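/- As X → ∞, the counting function N_3^+(X) of cubic fields of positive discriminant satisfies N_3^+(X) = (1/(12·ζ(3)))·X + (4·ζ(1/3)/(5·Γ(2/3)³·ζ(5/3)))·X^{5/6} + o(X^{5/6}); that is, (N_3^+(X) − X/(12·ζ(3)) − 4·ζ(1/3)·X^{5/6}/(5·Γ(2/3)³·ζ(5/3)))/X^{5/6} tends to 0 as X → ∞. -/

import Mathlib

open Filter Topology

/-- A cubic field: a number field of degree 3 over `ℚ`. -/
structure CubicField where
  carrier : Type
  [field : Field carrier]
  [nf : NumberField carrier]
  deg : Module.finrank ℚ carrier = 3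

attribute [instance] CubicField.field CubicField.nf

/-- Two cubic fields are identified if they are isomorphic. -/
instance CubicField.setoid : Setoid CubicField where
  r A B := Nonempty (A.carrier ≃+* B.carrier)
  iseqv := ⟨fun _ => ⟨RingEquiv.refl _⟩, fun ⟨e⟩ => ⟨e.symm⟩, fun ⟨e⟩ ⟨f⟩ => ⟨e.trans f⟩⟩

/-- The number of isomorphism classes of cubic fields whose discriminant satisfies `P`. -/
noncomputable def countCubic (P : ℤ → Prop) : ℕ :=
  Nat.card {C : Quotient CubicField.setoid //
    ∃ K : CubicField, ⟦K⟧ = C ∧ P (NumberField.discr K.carrier)}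

/-- An integral binary cubic form `a x³ + b x² y + c x y² + d y³`. -/
@[ext] structure BCF where
  a : ℤ
  b : ℤ
  c : ℤ
  d : ℤ

namespace BCF

/-- The value of a form at a pair of integers. -/
def eval (f : BCF) (x y : ℤ) : ℤ :=
  f.a * x ^ 3 + f.b * x ^ 2 * y + f.c * x * y ^ 2 + f.d * y ^ 3

/-- The discriminant of a binary cubic form. -/
def disc (f : BCF) : ℤ :=
  f.b ^ 2 * f.c ^ 2 - 4 * f.a * f.c ^ 3 - 4 * f.b ^ 3 * f.d - 27 * f.a ^ 2 * f.d ^ 2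
    + 18 * f.a * f.b * f.c * f.d

/-- The first coefficient of the Hessian. -/
def hP (f : BCF) : ℤ := f.b ^ 2 - 3 * f.a * f.c

/-- The middle coefficient of the Hessian. -/
def hQ (f : BCF) : ℤ := f.b * f.c - 9 * f.a * f.d

/-- The last coefficient of the Hessian. -/
def hR (f : BCF) : ℤ := f.c ^ 2 - 3 * f.b * f.d

/-- Multiplication of a form by an integer. -/
def scale (n : ℤ) (f : BCF) : BCF := ⟨n * f.a, n * f.b, n * f.c, n * f.d⟩

/-- Substitution of a linear map in a form. -/
def comp (f : BCF) (h : Matrix (Fin 2) (Fin 2) ℤ) : BCF where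
  a := f.a * h 0 0 ^ 3 + f.b * h 0 0 ^ 2 * h 1 0 + f.c * h 0 0 * h 1 0 ^ 2 + f.d * h 1 0 ^ 3
  b := 3 * f.a * h 0 0 ^ 2 * h 0 1 + f.b * (h 0 0 ^ 2 * h 1 1 + 2 * h 0 0 * h 0 1 * h 1 0)
    + f.c * (2 * h 0 0 * h 1 0 * h 1 1 + h 0 1 * h 1 0 ^ 2) + 3 * f.d * h 1 0 ^ 2 * h 1 1
  c := 3 * f.a * h 0 0 * h 0 1 ^ 2 + f.b * (2 * h 0 0 * h 0 1 * h 1 1 + h 0 1 ^ 2 * h 1 0)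
    + f.c * (h 0 0 * h 1 1 ^ 2 + 2 * h 0 1 * h 1 0 * h 1 1) + 3 * f.d * h 1 0 * h 1 1 ^ 2
  d := f.a * h 0 1 ^ 3 + f.b * h 0 1 ^ 2 * h 1 1 + f.c * h 0 1 * h 1 1 ^ 2 + f.d * h 1 1 ^ 3

theorem comp_mul (f : BCF) (h k : Matrix (Fin 2) (Fin 2) ℤ) :
    f.comp (h * k) = (f.comp h).comp k := by
  ext <;> simp only [comp, Matrix.mul_apply, Fin.sum_univ_two] <;> ring

@[simp] theorem comp_one (f : BCF) : f.comp 1 = f := by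
  ext <;> simp [comp]

theorem comp_scale (n : ℤ) (f : BCF) (h : Matrix (Fin 2) (Fin 2) ℤ) :
    (f.scale n).comp h = (f.comp h).scale n := by
  ext <;> simp only [comp, scale] <;> ring

theorem scale_scale (m n : ℤ) (f : BCF) : (f.scale n).scale m = f.scale (m * n) := by
  ext <;> simp only [scale] <;> ring

@[simp] theorem scale_one (f : BCF) : f.scale 1 = f := by
  ext <;> simp [scale]

theorem comp_scalar (f : BCF) (n : ℤ) : f.comp (n • (1 : Matrix (Fin 2) (Fin 2) ℤ))
    = f.scale (n ^ 3) := by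
  ext <;> simp [comp, scale] <;> ring_nf

theorem scale_injective {n : ℤ} (hn : n ≠ 0) : Function.Injective (scale n) := by
  intro f g h
  rw [BCF.ext_iff] at h
  simp only [scale, mul_eq_mul_left_iff, hn, or_false] at h
  exact BCF.ext h.1 h.2.1 h.2.2.1 h.2.2.2

theorem disc_comp (f : BCF) (h : Matrix (Fin 2) (Fin 2) ℤ) :
    (f.comp h).disc = h.det ^ 6 * f.disc := by
  simp only [comp, disc, Matrix.det_fin_two]; ring

theorem disc_scale (n : ℤ) (f : BCF) : (f.scale n).disc = n ^ 4 * f.disc := by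
  simp only [scale, disc]; ring

theorem eval_comp (f : BCF) (h : Matrix (Fin 2) (Fin 2) ℤ) (x y : ℤ) :
    (f.comp h).eval x y = f.eval (h 0 0 * x + h 0 1 * y) (h 1 0 * x + h 1 1 * y) := by
  simp only [comp, eval]; ring

theorem eval_scale (n : ℤ) (f : BCF) (x y : ℤ) : (f.scale n).eval x y = n * f.eval x y := by
  simp only [scale, eval]; ring

theorem hP_comp (f : BCF) (h : Matrix (Fin 2) (Fin 2) ℤ) : (f.comp h).hP =
    h.det ^ 2 * (f.hP * h 0 0 ^ 2 + f.hQ * h 0 0 * h 1 0 + f.hR * h 1 0 ^ 2) := by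
  simp only [comp, hP, hQ, hR, Matrix.det_fin_two]; ring

theorem hQ_comp (f : BCF) (h : Matrix (Fin 2) (Fin 2) ℤ) : (f.comp h).hQ =
    h.det ^ 2 * (2 * f.hP * h 0 0 * h 0 1 + f.hQ * (h 0 0 * h 1 1 + h 0 1 * h 1 0)
      + 2 * f.hR * h 1 0 * h 1 1) := by
  simp only [comp, hP, hQ, hR, Matrix.det_fin_two]; ring

theorem hR_comp (f : BCF) (h : Matrix (Fin 2) (Fin 2) ℤ) : (f.comp h).hR =
    h.det ^ 2 * (f.hP * h 0 1 ^ 2 + f.hQ * h 0 1 * h 1 1 + f.hR * h 1 1 ^ 2) := by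
  simp only [comp, hP, hQ, hR, Matrix.det_fin_two]; ring

theorem hP_scale (n : ℤ) (f : BCF) : (f.scale n).hP = n ^ 2 * f.hP := by
  simp only [scale, hP]; ring

theorem hQ_scale (n : ℤ) (f : BCF) : (f.scale n).hQ = n ^ 2 * f.hQ := by
  simp only [scale, hQ]; ring

theorem hR_scale (n : ℤ) (f : BCF) : (f.scale n).hR = n ^ 2 * f.hR := by
  simp only [scale, hR]; ring

theorem hessian_disc (f : BCF) : 4 * f.hP * f.hR - f.hQ ^ 2 = 3 * f.disc := by
  simp only [hP, hQ, hR, disc]; ring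

theorem syzygy (f : BCF) : (2 * f.b ^ 3 + 27 * f.a ^ 2 * f.d - 9 * f.a * f.b * f.c) ^ 2
    + 27 * f.a ^ 2 * f.disc = 4 * f.hP ^ 3 := by
  simp only [hP, disc]; ring

theorem syzygy' (f : BCF) : (2 * f.c ^ 3 + 27 * f.d ^ 2 * f.a - 9 * f.b * f.c * f.d) ^ 2
    + 27 * f.d ^ 2 * f.disc = 4 * f.hR ^ 3 := by
  simp only [hR, disc]; ring

theorem three_mul_disc_mul_b_sq (f : BCF) :
    (2 * f.hR * (3 * f.a) - f.hQ * f.b) ^ 2 + 3 * f.disc * f.b ^ 2 = 4 * f.hR * f.hP ^ 2 := by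
  simp only [hP, hQ, hR, disc]; ring

theorem three_mul_disc_mul_c_sq (f : BCF) :
    (2 * f.hP * (3 * f.d) - f.hQ * f.c) ^ 2 + 3 * f.disc * f.c ^ 2 = 4 * f.hP * f.hR ^ 2 := by
  simp only [hP, hQ, hR, disc]; ring

/-- A form is irreducible when it has no nontrivial integral zero. -/
def Irr (f : BCF) : Prop := ∀ x y : ℤ, f.eval x y = 0 → x = 0 ∧ y = 0

/-- The irreducible forms of positive discriminant. -/
def W : Set BCF := {f | f.Irr ∧ 0 < f.disc}

theorem Irr.a_ne {f : BCF} (hf : f.Irr) : f.a ≠ 0 := by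
  intro h
  have := hf 1 0 (by simp [eval, h])
  simp at this

theorem Irr.comp {f : BCF} (hf : f.Irr) {h : Matrix (Fin 2) (Fin 2) ℤ} (hh : h.det ≠ 0) :
    (f.comp h).Irr := by
  intro x y hxy
  rw [eval_comp] at hxy
  obtain ⟨h1, h2⟩ := hf _ _ hxy
  rw [Matrix.det_fin_two] at hh
  constructor
  · have : (h 0 0 * h 1 1 - h 0 1 * h 1 0) * x = 0 := by linear_combination h 1 1 * h1 - h 0 1 * h2
    exact (mul_eq_zero.mp this).resolve_left hh
  · have : (h 0 0 * h 1 1 - h 0 1 * h 1 0) * y = 0 := by linear_combination h 0 0 * h2 - h 1 0 * h1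
    exact (mul_eq_zero.mp this).resolve_left hh

theorem irr_scale_iff {f : BCF} {n : ℤ} (hn : n ≠ 0) : (f.scale n).Irr ↔ f.Irr := by
  simp [Irr, eval_scale, hn]

theorem comp_mem_W {f : BCF} (hf : f ∈ W) {h : Matrix (Fin 2) (Fin 2) ℤ} (hh : h.det ≠ 0) :
    f.comp h ∈ W :=
  ⟨hf.1.comp hh, by rw [disc_comp]; have := hf.2; positivity⟩

theorem scale_mem_W_iff {f : BCF} {n : ℤ} (hn : n ≠ 0) : f.scale n ∈ W ↔ f ∈ W := by
  simp only [W, Set.mem_ofPred_eq, irr_scale_iff hn, disc_scale]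
  rw [mul_pos_iff_of_pos_left (by positivity)]

theorem hP_pos {f : BCF} (ha : f.a ≠ 0) (hf : 0 < f.disc) : 0 < f.hP := by
  have h := syzygy f
  have : 0 < 27 * f.a ^ 2 * f.disc := by positivity
  have h3 : 0 < f.hP ^ 3 := by nlinarith [sq_nonneg (2 * f.b ^ 3 + 27 * f.a ^ 2 * f.d - 9 * f.a * f.b * f.c)]
  exact (Odd.pow_pos_iff (by decide)).mp h3

/-- The Hessian of the form is reduced. -/
def Red (f : BCF) : Prop := 0 < f.hP ∧ |f.hQ| ≤ f.hP ∧ f.hP ≤ f.hR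

theorem Red.mul_le {f : BCF} (h : f.Red) : f.hP * f.hR ≤ f.disc := by
  have h0 := hessian_disc f
  have : f.hQ ^ 2 ≤ f.hP ^ 2 :=
    sq_le_sq' (by linarith [neg_abs_le f.hQ, h.2.1]) ((le_abs_self _).trans h.2.1)
  nlinarith [h.1, h.2.2]

theorem Red.hR_pos {f : BCF} (h : f.Red) : 0 < f.hR := h.1.trans_le h.2.2

theorem Red.disc_pos {f : BCF} (h : f.Red) : 0 < f.disc :=
  (mul_pos h.1 h.hR_pos).trans_le h.mul_le

theorem Red.hP_sq_le {f : BCF} (h : f.Red) : f.hP ^ 2 ≤ f.disc := by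
  nlinarith [h.1, h.2.2, h.mul_le]

theorem Red.a_sq_le {f : BCF} (h : f.Red) : 27 * f.a ^ 2 ≤ 4 * f.hP := by
  have h1 := syzygy f
  have h2 := h.hP_sq_le
  have h3 : 27 * f.a ^ 2 * f.hP ^ 2 ≤ 4 * f.hP * f.hP ^ 2 := by
    nlinarith [sq_nonneg (2 * f.b ^ 3 + 27 * f.a ^ 2 * f.d - 9 * f.a * f.b * f.c), sq_nonneg f.a,
      mul_le_mul_of_nonneg_left h2 (sq_nonneg f.a)]
  exact le_of_mul_le_mul_right h3 (by have := h.1; positivity)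

theorem Red.b_sq_le {f : BCF} (h : f.Red) : 3 * f.b ^ 2 ≤ 4 * f.hP := by
  have h1 := three_mul_disc_mul_b_sq f
  have h2 := h.mul_le
  have hp := mul_pos h.1 h.hR_pos
  have h3 : 3 * f.b ^ 2 * (f.hP * f.hR) ≤ 4 * f.hP * (f.hP * f.hR) := by
    nlinarith [sq_nonneg (2 * f.hR * (3 * f.a) - f.hQ * f.b),
      mul_le_mul_of_nonneg_left h2 (sq_nonneg f.b)]
  exact le_of_mul_le_mul_right h3 hp

theorem Red.c_sq_le {f : BCF} (h : f.Red) : 3 * f.c ^ 2 ≤ 4 * f.hR := by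
  have h1 := three_mul_disc_mul_c_sq f
  have h2 := h.mul_le
  have hp := mul_pos h.1 h.hR_pos
  have h3 : 3 * f.c ^ 2 * (f.hP * f.hR) ≤ 4 * f.hR * (f.hP * f.hR) := by
    nlinarith [sq_nonneg (2 * f.hP * (3 * f.d) - f.hQ * f.c),
      mul_le_mul_of_nonneg_left h2 (sq_nonneg f.c)]
  exact le_of_mul_le_mul_right h3 hp

theorem Red.ad_sq_le {f : BCF} (h : f.Red) : 729 * (f.a * f.d) ^ 2 ≤ 16 * f.disc := by
  have hD := h.disc_pos
  have h1 : 27 * f.a ^ 2 * f.disc ≤ 4 * f.hP ^ 3 := by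
    nlinarith [syzygy f, sq_nonneg (2 * f.b ^ 3 + 27 * f.a ^ 2 * f.d - 9 * f.a * f.b * f.c)]
  have h2 : 27 * f.d ^ 2 * f.disc ≤ 4 * f.hR ^ 3 := by
    nlinarith [syzygy' f, sq_nonneg (2 * f.c ^ 3 + 27 * f.d ^ 2 * f.a - 9 * f.b * f.c * f.d)]
  have h3 : (f.hP * f.hR) ^ 3 ≤ f.disc ^ 3 :=
    pow_le_pow_left₀ (mul_pos h.1 h.hR_pos).le h.mul_le 3
  have h4 : (27 * f.a ^ 2 * f.disc) * (27 * f.d ^ 2 * f.disc) ≤ (4 * f.hP ^ 3) * (4 * f.hR ^ 3) :=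
    mul_le_mul h1 h2 (by positivity) (by have := h.1; positivity)
  have h5 : 729 * (f.a * f.d) ^ 2 * f.disc ^ 2 ≤ 16 * f.disc * f.disc ^ 2 := by nlinarith
  exact le_of_mul_le_mul_right h5 (by positivity)

theorem Red.bc_sq_le {f : BCF} (h : f.Red) : 9 * (f.b * f.c) ^ 2 ≤ 16 * f.disc := by
  have h1 := mul_le_mul h.b_sq_le h.c_sq_le (by positivity) (by have := h.1; positivity)
  nlinarith [h.mul_le]

theorem Red.scale_iff {f : BCF} {n : ℤ} (hn : n ≠ 0) : (f.scale n).Red ↔ f.Red := by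
  have h : 0 < n ^ 2 := by positivity
  simp only [Red, hP_scale, hQ_scale, hR_scale, abs_mul, abs_of_pos h]
  rw [mul_pos_iff_of_pos_left h, mul_le_mul_iff_right₀ h, mul_le_mul_iff_right₀ h]

theorem Red.d_sq_le {f : BCF} (h : f.Red) : f.d ^ 2 ≤ f.disc ^ 2 := by
  have hD := h.disc_pos
  have h2 : 27 * f.d ^ 2 * f.disc ≤ 4 * f.hR ^ 3 := by
    nlinarith [syzygy' f, sq_nonneg (2 * f.c ^ 3 + 27 * f.d ^ 2 * f.a - 9 * f.b * f.c * f.d)]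
  have h3 : f.hR ≤ f.disc := by nlinarith [h.mul_le, h.1, h.hR_pos]
  have h4 : f.hR ^ 3 ≤ f.disc ^ 3 := pow_le_pow_left₀ h.hR_pos.le h3 3
  have h5 : f.d ^ 2 * f.disc ≤ f.disc ^ 2 * f.disc := by nlinarith [sq_nonneg f.d]
  exact le_of_mul_le_mul_right h5 hD

theorem Red.hR_le {f : BCF} (h : f.Red) : f.hR ≤ f.disc := by
  nlinarith [h.mul_le, h.1, h.hR_pos]

theorem finite_box (M : ℤ) :
    {f : BCF | |f.a| ≤ M ∧ |f.b| ≤ M ∧ |f.c| ≤ M ∧ |f.d| ≤ M}.Finite := by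
  refine ((((Set.finite_Icc (-M) M).prod (Set.finite_Icc (-M) M)).prod
    ((Set.finite_Icc (-M) M).prod (Set.finite_Icc (-M) M))).image
    (fun t => (⟨t.1.1, t.1.2, t.2.1, t.2.2⟩ : BCF))).subset ?_
  rintro f ⟨h1, h2, h3, h4⟩
  exact ⟨((f.a, f.b), (f.c, f.d)), ⟨⟨abs_le.mp h1, abs_le.mp h2⟩, abs_le.mp h3, abs_le.mp h4⟩, rfl⟩

theorem finite_red (X : ℝ) : {f : BCF | f.Red ∧ (f.disc : ℝ) < X}.Finite := by
  refine (finite_box (2 * ⌈X⌉)).subset ?_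
  rintro f ⟨h, hX⟩
  have hD := h.disc_pos
  have h1 : f.disc < ⌈X⌉ := by
    have := hX.trans_le (Int.le_ceil X)
    exact_mod_cast this
  have hR := h.hR_le
  have hP := h.2.2
  have ha := h.a_sq_le
  have hb := h.b_sq_le
  have hc := h.c_sq_le
  have hd := h.d_sq_le
  refine ⟨?_, ?_, ?_, ?_⟩ <;> refine abs_le_of_sq_le_sq ?_ (by linarith) <;> nlinarith

/-- The group `GL₂(ℤ)`. -/
abbrev GLZ : Type := (Matrix (Fin 2) (Fin 2) ℤ)ˣ

theorem GLZ.det_eq (γ : GLZ) : (γ : Matrix (Fin 2) (Fin 2) ℤ).det = 1 ∨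
    (γ : Matrix (Fin 2) (Fin 2) ℤ).det = -1 :=
  Int.isUnit_iff.mp ((Matrix.isUnit_iff_isUnit_det _).1 γ.isUnit)

theorem GLZ.det_ne (γ : GLZ) : (γ : Matrix (Fin 2) (Fin 2) ℤ).det ≠ 0 := by
  rcases GLZ.det_eq γ with h | h <;> rw [h] <;> norm_num

theorem GLZ.det_sq (γ : GLZ) : (γ : Matrix (Fin 2) (Fin 2) ℤ).det ^ 2 = 1 := by
  rcases GLZ.det_eq γ with h | h <;> rw [h] <;> norm_num

/-- The element of `GL₂(ℤ)` given by a matrix of determinant `±1`. -/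
noncomputable def GLZ.mk (p q r s : ℤ) (h : p * s - q * r = 1 ∨ p * s - q * r = -1) : GLZ :=
  ((Matrix.isUnit_iff_isUnit_det !![p, q; r, s]).2
    (by rw [Matrix.det_fin_two_of]; exact Int.isUnit_iff.mpr h)).unit

@[simp] theorem GLZ.coe_mk (p q r s : ℤ) (h : p * s - q * r = 1 ∨ p * s - q * r = -1) :
    (GLZ.mk p q r s h : Matrix (Fin 2) (Fin 2) ℤ) = !![p, q; r, s] := rfl

theorem disc_comp_GLZ (f : BCF) (γ : GLZ) : (f.comp γ).disc = f.disc := by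
  rw [disc_comp, show (6 : ℕ) = 2 * 3 from rfl, pow_mul, GLZ.det_sq]; ring

theorem comp_mem_W_GLZ {f : BCF} (γ : GLZ) : f.comp γ ∈ W ↔ f ∈ W := by
  refine ⟨fun h => ?_, fun h => comp_mem_W h γ.det_ne⟩
  have := comp_mem_W h (γ⁻¹).det_ne
  rwa [← comp_mul, ← Units.val_mul, mul_inv_cancel, Units.val_one, comp_one] at this

/-- The Hessian of a form as a quadratic form. -/
def hv (f : BCF) (x y : ℤ) : ℤ := f.hP * x ^ 2 + f.hQ * x * y + f.hR * y ^ 2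

theorem hP_comp_GLZ (f : BCF) (γ : GLZ) : (f.comp γ).hP = f.hv (γ.1 0 0) (γ.1 1 0) := by
  rw [hP_comp, GLZ.det_sq, hv]; ring

theorem hR_comp_GLZ (f : BCF) (γ : GLZ) : (f.comp γ).hR = f.hv (γ.1 0 1) (γ.1 1 1) := by
  rw [hR_comp, GLZ.det_sq, hv]; ring

theorem hQ_comp_GLZ (f : BCF) (γ : GLZ) : (f.comp γ).hQ = 2 * f.hP * γ.1 0 0 * γ.1 0 1 +
    f.hQ * (γ.1 0 0 * γ.1 1 1 + γ.1 0 1 * γ.1 1 0) + 2 * f.hR * γ.1 1 0 * γ.1 1 1 := by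
  rw [hQ_comp, GLZ.det_sq]; ring

theorem four_hP_mul_hv (f : BCF) (x y : ℤ) :
    4 * f.hP * f.hv x y = (2 * f.hP * x + f.hQ * y) ^ 2 + 3 * f.disc * y ^ 2 := by
  rw [← hessian_disc, hv]; ring

theorem four_hR_mul_hv (f : BCF) (x y : ℤ) :
    4 * f.hR * f.hv x y = (2 * f.hR * y + f.hQ * x) ^ 2 + 3 * f.disc * x ^ 2 := by
  rw [← hessian_disc, hv]; ring

theorem hR_pos {f : BCF} (hf : f ∈ W) : 0 < f.hR := by
  have h1 := hP_pos hf.1.a_ne hf.2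
  have h2 := hessian_disc f
  have h3 := hf.2
  by_contra h
  nlinarith [sq_nonneg f.hQ]

theorem abs_mul_le_aux {f : BCF} (h2 : |f.hQ| ≤ f.hP) (x y : ℤ) :
    f.hP * (x ^ 2 - |x| * |y| + y ^ 2) + (f.hR - f.hP) * y ^ 2 ≤ f.hv x y := by
  have h3 : -(f.hP * (|x| * |y|)) ≤ f.hQ * (x * y) := by
    have : |f.hQ * (x * y)| ≤ f.hP * (|x| * |y|) := by
      rw [abs_mul, abs_mul]; gcongr
    linarith [neg_abs_le (f.hQ * (x * y))]
  rw [hv]; nlinarith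

theorem one_le_aux {x y : ℤ} (h : x ≠ 0 ∨ y ≠ 0) : 1 ≤ x ^ 2 - |x| * |y| + y ^ 2 := by
  have hx := sq_abs x
  have hy := sq_abs y
  have : 0 < |x| ∨ 0 < |y| := h.imp abs_pos.mpr abs_pos.mpr
  have h1 := abs_nonneg x
  have h2 := abs_nonneg y
  rw [← hx, ← hy]
  rcases this with h | h <;> nlinarith [sq_nonneg (|x| - |y|), sq_nonneg (2 * |x| - |y|), sq_nonneg (|x| - 2 * |y|)]

theorem Red.hP_le_hv {f : BCF} (hf : f.Red) {x y : ℤ} (h : x ≠ 0 ∨ y ≠ 0) : f.hP ≤ f.hv x y := by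
  have h1 := abs_mul_le_aux hf.2.1 x y
  have h2 := one_le_aux h
  nlinarith [hf.1, hf.2.2, sq_nonneg y]

theorem exists_red {f : BCF} (hf : f ∈ W) : ∃ γ : GLZ, (f.comp γ).Red := by
  have hpos : ∀ γ : GLZ, 0 < (f.comp γ).hP := fun γ =>
    hP_pos ((comp_mem_W_GLZ γ).2 hf).1.a_ne ((comp_mem_W_GLZ γ).2 hf).2
  obtain ⟨γ, hγ⟩ : ∃ γ : GLZ, ∀ δ : GLZ, (f.comp γ).hP ≤ (f.comp δ).hP := by
    have hne : (Set.range fun γ : GLZ => (f.comp γ).hP.toNat).Nonempty := Set.range_nonempty _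
    obtain ⟨γ, hγ⟩ := Nat.sInf_mem hne
    refine ⟨γ, fun δ => ?_⟩
    have := Nat.sInf_le (Set.mem_range_self (f := fun γ : GLZ => (f.comp γ).hP.toNat) δ)
    rw [← hγ] at this
    have h1 := hpos γ
    have h2 := hpos δ
    simp only at this
    omega
  set g := f.comp γ with hg
  have hP : 0 < g.hP := hpos γ
  -- translate
  obtain ⟨n, hn⟩ : ∃ n : ℤ, |g.hQ + 2 * g.hP * n| ≤ g.hP := by
    refine ⟨-((g.hQ + g.hP) / (2 * g.hP)), ?_⟩
    have h1 := Int.emod_add_mul_ediv (g.hQ + g.hP) (2 * g.hP)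
    have h2 := Int.emod_nonneg (g.hQ + g.hP) (show 2 * g.hP ≠ 0 by omega)
    have h3 := Int.emod_lt_of_pos (g.hQ + g.hP) (show 0 < 2 * g.hP by omega)
    rw [abs_le]
    constructor <;> nlinarith
  let τ : GLZ := GLZ.mk 1 n 0 1 (by simp)
  let σ : GLZ := GLZ.mk 0 1 1 0 (by simp)
  refine ⟨γ * τ, ?_⟩
  rw [Units.val_mul, comp_mul, ← hg]
  have e1 : (g.comp τ).hP = g.hP := by rw [hP_comp_GLZ]; simp [τ, hv]
  have e2 : (g.comp τ).hQ = g.hQ + 2 * g.hP * n := by rw [hQ_comp_GLZ]; simp [τ]; ring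
  refine ⟨by rwa [e1], by rwa [e1, e2], ?_⟩
  have h3 := hγ (γ * τ * σ)
  rw [Units.val_mul, Units.val_mul, comp_mul, comp_mul, ← hg, hP_comp_GLZ _ σ] at h3
  rw [e1]
  simpa [σ, hv] using h3

theorem finite_red_comp {f : BCF} (hf : f ∈ W) : {γ : GLZ | (f.comp γ).Red}.Finite := by
  have hP := hP_pos hf.1.a_ne hf.2
  have hR := hR_pos hf
  have hD := hf.2
  set M := 2 * (f.hP + f.hR) * f.disc with hM
  have key : ∀ x y : ℤ, f.hv x y ≤ f.disc → |x| ≤ M ∧ |y| ≤ M := by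
    intro x y h
    have h1 := four_hP_mul_hv f x y
    have h2 := four_hR_mul_hv f x y
    have h3 : f.hP * f.hv x y ≤ f.hP * f.disc := by gcongr
    have h4 : f.hR * f.hv x y ≤ f.hR * f.disc := by gcongr
    have hx : 3 * x ^ 2 ≤ 4 * f.hR := by
      refine le_of_mul_le_mul_right ?_ hD
      nlinarith [sq_nonneg (2 * f.hR * y + f.hQ * x)]
    have hy : 3 * y ^ 2 ≤ 4 * f.hP := by
      refine le_of_mul_le_mul_right ?_ hD
      nlinarith [sq_nonneg (2 * f.hP * x + f.hQ * y)]
    have hM1 : 2 * (f.hP + f.hR) ≤ M := by nlinarith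
    constructor <;> refine abs_le_of_sq_le_sq ?_ (by linarith) <;> nlinarith
  have hfin := (((Set.finite_Icc (-M) M).prod (Set.finite_Icc (-M) M)).prod
    ((Set.finite_Icc (-M) M).prod (Set.finite_Icc (-M) M)))
  refine Set.Finite.of_finite_image (f := fun γ : GLZ =>
    ((γ.1 0 0, γ.1 1 0), (γ.1 0 1, γ.1 1 1))) (hfin.subset ?_) ?_
  · rintro _ ⟨γ, hγ, rfl⟩
    have hγ : (f.comp γ).Red := hγ
    have h1 : f.hv (γ.1 0 0) (γ.1 1 0) ≤ f.disc := by
      rw [← hP_comp_GLZ, ← disc_comp_GLZ f γ]; exact hγ.2.2.trans hγ.hR_le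
    have h2 : f.hv (γ.1 0 1) (γ.1 1 1) ≤ f.disc := by
      rw [← hR_comp_GLZ, ← disc_comp_GLZ f γ]; exact hγ.hR_le
    exact ⟨⟨abs_le.mp (key _ _ h1).1, abs_le.mp (key _ _ h1).2⟩,
      ⟨abs_le.mp (key _ _ h2).1, abs_le.mp (key _ _ h2).2⟩⟩
  · intro γ _ δ _ h
    simp only [Prod.mk.injEq] at h
    ext i j
    fin_cases i <;> fin_cases j <;> simp [h]

/-- The Hessian of the form is in the interior of the reduced domain. -/
def Inn (f : BCF) : Prop := |f.hQ| < f.hP ∧ f.hP < f.hR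

theorem Inn.red {f : BCF} (h : f.Inn) : f.Red :=
  ⟨(abs_nonneg _).trans_lt h.1, h.1.le, h.2.le⟩

theorem GLZ.mul_apply_eq (γ : GLZ) : γ.1 0 0 * γ.1 1 1 - γ.1 0 1 * γ.1 1 0 = 1 ∨
    γ.1 0 0 * γ.1 1 1 - γ.1 0 1 * γ.1 1 0 = -1 := by
  have := γ.det_eq
  rwa [Matrix.det_fin_two] at this

theorem Inn.eq_of_red {f : BCF} (h : f.Inn) {γ : GLZ} (hγ : (f.comp γ).Red) :
    (γ.1 0 0 = 1 ∨ γ.1 0 0 = -1) ∧ (γ.1 1 1 = 1 ∨ γ.1 1 1 = -1) ∧ γ.1 0 1 = 0 ∧ γ.1 1 0 = 0 := by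
  have hdet := γ.mul_apply_eq
  set p := γ.1 0 0
  set q := γ.1 0 1
  set r := γ.1 1 0
  set s := γ.1 1 1
  have e1 : (f.comp γ).hP = f.hv p r := hP_comp_GLZ f γ
  have e2 := hQ_comp_GLZ f γ
  have e3 : (f.comp γ).hR = f.hv q s := hR_comp_GLZ f γ
  have hP : 0 < f.hP := h.red.1
  have h1 : (f.comp γ).hP ≤ f.hP := by
    have h2 : s ≠ 0 ∨ -r ≠ 0 := by
      by_contra hc
      push Not at hc
      rw [hc.1, neg_eq_zero.mp hc.2] at hdet
      simp at hdet
    have h3 := hγ.hP_le_hv h2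
    have h4 : (f.comp γ).hv s (-r) = (p * s - q * r) ^ 2 * f.hP := by
      rw [hv, e1, e2, e3, hv, hv]; ring
    rw [h4] at h3
    rcases hdet with hd | hd <;> rw [hd] at h3 <;> linarith
  have hr : r = 0 := by
    by_contra hr
    have h2 := abs_mul_le_aux h.1.le p r
    have h3 := one_le_aux (x := p) (Or.inr hr)
    have h4 : 1 ≤ r ^ 2 := by have : 0 < r ^ 2 := by positivity
                              linarith
    rw [e1] at h1
    nlinarith [h.2]
  have hps : p * s = 1 ∨ p * s = -1 := by simpa [hr] using hdet
  have hp : p = 1 ∨ p = -1 := Int.isUnit_iff.mp (isUnit_of_mul_isUnit_left (Int.isUnit_iff.mpr hps))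
  have hs : s = 1 ∨ s = -1 := Int.isUnit_iff.mp (isUnit_of_mul_isUnit_right (Int.isUnit_iff.mpr hps))
  refine ⟨hp, hs, ?_, hr⟩
  have h5 : (f.comp γ).hQ = p * (2 * f.hP * q + f.hQ * s) := by
    rw [e2]; change 2 * f.hP * p * q + f.hQ * (p * s + q * r) + 2 * f.hR * r * s = _
    rw [hr]; ring
  have h6 : (f.comp γ).hP = f.hP := by
    rw [e1, hv, hr]; rcases hp with hp | hp <;> rw [hp] <;> ring
  have h7 := hγ.2.1
  rw [h5, h6, abs_mul, show |p| = 1 by rcases hp with hp | hp <;> rw [hp] <;> rfl, one_mul] at h7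
  have h8 := abs_lt.mp h.1
  have h9 := abs_le.mp h7
  by_contra hq
  rcases lt_or_gt_of_ne hq with hq | hq
  · have : f.hP * q ≤ f.hP * (-1) := by gcongr; omega
    rcases hs with hs | hs <;> rw [hs] at h9 <;> linarith
  · have : f.hP * 1 ≤ f.hP * q := by gcongr; omega
    rcases hs with hs | hs <;> rw [hs] at h9 <;> linarith

section
open Finset Matrix ENNReal

open Classical in
/-- The weight of a form, which sums to `1` over the translates of a form by `GL₂(ℤ)`. -/
noncomputable def wt (f : BCF) : ℝ≥0∞ :=
  if f ∈ W ∧ f.Red then ((({γ : GLZ | (f.comp γ).Red}.ncard : ℕ) : ℝ≥0∞))⁻¹ else 0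

theorem comp_mul_GLZ (f : BCF) (γ δ : GLZ) : f.comp (γ * δ : GLZ) = (f.comp γ).comp δ := by
  rw [Units.val_mul, comp_mul]

theorem ncard_red_comp (f : BCF) (γ : GLZ) :
    {δ : GLZ | ((f.comp γ).comp δ).Red}.ncard = {δ : GLZ | (f.comp δ).Red}.ncard := by
  rw [← Set.ncard_image_of_injective {δ : GLZ | ((f.comp γ).comp δ).Red} (mul_right_injective γ)]
  congr 1
  ext δ
  simp only [Set.mem_image, Set.mem_ofPred_eq]
  constructor
  · rintro ⟨ε, h, rfl⟩
    rwa [comp_mul_GLZ]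
  · intro h
    refine ⟨γ⁻¹ * δ, ?_, by group⟩
    rw [← comp_mul_GLZ]
    simpa using h

theorem tsum_wt {f : BCF} (hf : f ∈ W) : ∑' γ : GLZ, (f.comp γ).wt = 1 := by
  classical
  set s := {δ : GLZ | (f.comp δ).Red} with hs
  have hfin : s.Finite := finite_red_comp hf
  have hne : s.Nonempty := exists_red hf
  have h1 : ∀ γ : GLZ, (f.comp γ).wt = s.indicator (fun _ => ((s.ncard : ℕ) : ℝ≥0∞)⁻¹) γ := by
    intro γ
    rw [wt, ncard_red_comp, Set.indicator_apply]
    have : f.comp γ ∈ W := (comp_mem_W_GLZ γ).2 hf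
    simp [this, hs]
  simp_rw [h1]
  rw [← _root_.tsum_subtype]
  have : Fintype s := hfin.fintype
  rw [tsum_fintype, sum_const, nsmul_eq_mul, card_univ, ← Nat.card_eq_fintype_card,
    Nat.card_coe_set_eq]
  refine ENNReal.mul_inv_cancel ?_ (by simp)
  rw [Nat.cast_ne_zero]
  exact (Set.ncard_pos hfin).2 hne |>.ne'

theorem wt_scale {n : ℤ} (hn : n ≠ 0) (f : BCF) : (f.scale n).wt = f.wt := by
  have h : (f.scale n ∈ W ∧ (f.scale n).Red) ↔ (f ∈ W ∧ f.Red) :=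
    and_congr (scale_mem_W_iff hn) (Red.scale_iff hn)
  unfold wt
  simp only [comp_scale, Red.scale_iff hn]
  by_cases h' : f ∈ W ∧ f.Red
  · rw [if_pos h', if_pos (h.2 h')]
  · rw [if_neg h', if_neg (fun e => h' (h.1 e))]

/-- The sublattices of index `p` of `ℤ²`. -/
def hm (p : ℕ) : Option (Fin p) → Matrix (Fin 2) (Fin 2) ℤ
  | none => !![1, 0; 0, (p : ℤ)]
  | some r => !![(p : ℤ), (r : ℤ); 0, 1]

@[simp] theorem det_hm (p : ℕ) (j : Option (Fin p)) : (hm p j).det = p := by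
  cases j <;> simp [hm, det_fin_two]

/-- All the coefficients of a form are divisible by `m`. -/
def Dv (m : ℤ) (f : BCF) : Prop := m ∣ f.a ∧ m ∣ f.b ∧ m ∣ f.c ∧ m ∣ f.d

theorem dv_iff {m : ℤ} {f : BCF} : f.Dv m ↔ ∃ g : BCF, g.scale m = f := by
  constructor
  · rintro ⟨⟨a, ha⟩, ⟨b, hb⟩, ⟨c, hc⟩, ⟨d, hd⟩⟩
    exact ⟨⟨a, b, c, d⟩, by ext <;> simp [scale, *]⟩
  · rintro ⟨g, rfl⟩
    simp [Dv, scale]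

theorem Dv.comp {m : ℤ} {f : BCF} (hf : f.Dv m) (h : Matrix (Fin 2) (Fin 2) ℤ) :
    (f.comp h).Dv m := by
  obtain ⟨g, rfl⟩ := dv_iff.mp hf
  exact dv_iff.mpr ⟨g.comp h, (comp_scale _ _ _).symm⟩

theorem dv_comp_GLZ {m : ℤ} {f : BCF} (γ : GLZ) : (f.comp γ).Dv m ↔ f.Dv m := by
  refine ⟨fun h => ?_, fun h => h.comp _⟩
  have := h.comp (γ⁻¹ : GLZ)
  rwa [← comp_mul_GLZ, mul_inv_cancel, Units.val_one, comp_one] at this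

theorem dv_scale_of_isCoprime {m n : ℤ} (h : IsCoprime m n) {f : BCF} :
    (f.scale n).Dv m ↔ f.Dv m := by
  have key : ∀ x : ℤ, m ∣ n * x ↔ m ∣ x := fun x => ⟨h.dvd_of_dvd_mul_left, fun h => h.mul_left _⟩
  simp only [Dv, scale, key]

theorem dv_comp_of_isCoprime {m : ℤ} {f : BCF} {N : Matrix (Fin 2) (Fin 2) ℤ}
    (hN : IsCoprime m N.det) : (f.comp N).Dv m ↔ f.Dv m := by
  refine ⟨fun h => ?_, fun h => h.comp _⟩
  have := h.comp N.adjugate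
  rw [← comp_mul, mul_adjugate, comp_scalar] at this
  exact (dv_scale_of_isCoprime hN.pow_right).mp this

open Classical in
/-- The number of sublattices of index `p` on which the form is divisible by `m`. -/
noncomputable def cnt (m : ℤ) (p : ℕ) (f : BCF) : ℕ :=
  (univ.filter fun j : Option (Fin p) => (f.comp (hm p j)).Dv m).card

theorem exists_hm {p : ℕ} (hp : p.Prime) (M : Matrix (Fin 2) (Fin 2) ℤ) (h : (p : ℤ) ∣ M.det) :
    ∃ j N, M = hm p j * N := by
  have hpp : Prime (p : ℤ) := Nat.prime_iff_prime_int.mp hp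
  have key : ∀ u v u' v' : ℤ, (p : ℤ) ∣ u * v' - u' * v → ¬ (p : ℤ) ∣ v →
      ∃ r : Fin p, (p : ℤ) ∣ u - r * v ∧ (p : ℤ) ∣ u' - r * v' := by
    intro u v u' v' h hv
    obtain ⟨x, y, hxy⟩ := (hpp.coprime_iff_not_dvd.mpr hv)
    have hp0 : (0 : ℤ) < p := by exact_mod_cast hp.pos
    refine ⟨⟨((u * y) % p).toNat, ?_⟩, ?_⟩
    · have h1 := Int.emod_lt_of_pos (u * y) hp0
      have h2 := Int.emod_nonneg (u * y) hp0.ne'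
      omega
    · simp only [Int.toNat_of_nonneg (Int.emod_nonneg (u * y) hp0.ne')]
      obtain ⟨k, hk⟩ := h
      have h3 := Int.emod_add_mul_ediv (u * y) p
      have h4 : u * y % p = u * y - p * (u * y / p) := by linarith
      have h5 : (p : ℤ) ∣ u - u * y % p * v := by
        rw [h4]; exact ⟨u * x + u * y / p * v, by linear_combination -u * hxy⟩
      refine ⟨h5, ?_⟩
      have h6 : (p : ℤ) ∣ v * (u' - u * y % p * v') := by
        obtain ⟨l, hl⟩ := h5
        exact ⟨v' * l - k, by linear_combination v' * hl - hk⟩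
      exact (hpp.dvd_or_dvd h6).resolve_left hv
  rw [det_fin_two] at h
  have fin : ∀ r : Fin p, (p : ℤ) ∣ M 0 0 - r * M 1 0 → (p : ℤ) ∣ M 0 1 - r * M 1 1 →
      ∃ j N, M = hm p j * N := by
    rintro r ⟨k, hk⟩ ⟨l, hl⟩
    refine ⟨some r, !![k, l; M 1 0, M 1 1], ?_⟩
    ext i j
    fin_cases i <;> fin_cases j <;> simp [hm, mul_apply] <;> linarith
  by_cases h1 : (p : ℤ) ∣ M 1 0
  · by_cases h2 : (p : ℤ) ∣ M 1 1
    · obtain ⟨k, hk⟩ := h1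
      obtain ⟨l, hl⟩ := h2
      refine ⟨none, !![M 0 0, M 0 1; k, l], ?_⟩
      ext i j
      fin_cases i <;> fin_cases j <;> simp [hm, mul_apply, hk, hl]
    · obtain ⟨r, h3, h4⟩ := key (M 0 1) (M 1 1) (M 0 0) (M 1 0)
        (by obtain ⟨k, hk⟩ := h; exact ⟨-k, by linear_combination -hk⟩) h2
      exact fin r h4 h3
  · obtain ⟨r, h3, h4⟩ := key (M 0 0) (M 1 0) (M 0 1) (M 1 1)
      (by convert h using 1) h1
    exact fin r h3 h4

theorem hm_unique {p : ℕ} (hp : p.Prime) {M N N' : Matrix (Fin 2) (Fin 2) ℤ}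
    (h : ¬ (p : ℤ) ^ 2 ∣ M.det) {i j : Option (Fin p)} (hi : M = hm p i * N) (hj : M = hm p j * N') :
    i = j := by
  have hpp : Prime (p : ℤ) := Nat.prime_iff_prime_int.mp hp
  have key : ¬ ((p : ℤ) ∣ M 0 0 ∧ (p : ℤ) ∣ M 0 1 ∧ (p : ℤ) ∣ M 1 0 ∧ (p : ℤ) ∣ M 1 1) := by
    rintro ⟨⟨a, ha⟩, ⟨b, hb⟩, ⟨c, hc⟩, ⟨d, hd⟩⟩
    exact h ⟨a * d - b * c, by rw [det_fin_two, ha, hb, hc, hd]; ring⟩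
  have hnone : ∀ N, M = hm p none * N → (p : ℤ) ∣ M 1 0 ∧ (p : ℤ) ∣ M 1 1 := by
    rintro N rfl
    simp [hm, mul_apply]
  have hsome : ∀ (r : Fin p) N, M = hm p (some r) * N →
      (p : ℤ) ∣ M 0 0 - r * M 1 0 ∧ (p : ℤ) ∣ M 0 1 - r * M 1 1 := by
    rintro r N rfl
    simp [hm, mul_apply]
  have hns : ∀ (r : Fin p) N N', M = hm p none * N → M = hm p (some r) * N' → False := by
    intro r N N' h1 h2
    obtain ⟨h3, h4⟩ := hnone _ h1
    obtain ⟨h5, h6⟩ := hsome _ _ h2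
    exact key ⟨(dvd_sub_left (h3.mul_left _)).mp h5, (dvd_sub_left (h4.mul_left _)).mp h6, h3, h4⟩
  match i, j with
  | none, none => rfl
  | none, some r => exact (hns r _ _ hi hj).elim
  | some r, none => exact (hns r _ _ hj hi).elim
  | some r, some s =>
    obtain ⟨h1, h2⟩ := hsome _ _ hi
    obtain ⟨h3, h4⟩ := hsome _ _ hj
    congr 1
    by_contra hrs
    have hrs' : ¬ (p : ℤ) ∣ (r : ℤ) - s := by
      intro hd
      have := Int.eq_zero_of_abs_lt_dvd hd (by rw [abs_lt]; omega)
      exact hrs (Fin.ext (by omega))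
    have h5 : (p : ℤ) ∣ ((r : ℤ) - s) * M 1 0 := by
      obtain ⟨k, hk⟩ := h1
      obtain ⟨l, hl⟩ := h3
      exact ⟨l - k, by linear_combination hl - hk⟩
    have h6 : (p : ℤ) ∣ ((r : ℤ) - s) * M 1 1 := by
      obtain ⟨k, hk⟩ := h2
      obtain ⟨l, hl⟩ := h4
      exact ⟨l - k, by linear_combination hl - hk⟩
    have h7 := (hpp.dvd_or_dvd h5).resolve_left hrs'
    have h8 := (hpp.dvd_or_dvd h6).resolve_left hrs'
    exact key ⟨(dvd_sub_left (h7.mul_left _)).mp h1, (dvd_sub_left (h8.mul_left _)).mp h2, h7, h8⟩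

theorem not_sq_dvd_mul {p : ℕ} (hp : p.Prime) {n : ℤ} (hn : ¬ (p : ℤ) ∣ n) :
    ¬ (p : ℤ) ^ 2 ∣ n * p := by
  have : (p : ℤ) ≠ 0 := by exact_mod_cast hp.ne_zero
  rw [sq, Int.mul_dvd_mul_iff_right this]
  exact hn

/-- The count is invariant under substitutions of determinant prime to `p`. -/
theorem cnt_comp {p : ℕ} (hp : p.Prime) (k : ℕ) (f : BCF) {g : Matrix (Fin 2) (Fin 2) ℤ}
    (hg : ¬ (p : ℤ) ∣ g.det) : cnt ((p : ℤ) ^ k) p (f.comp g) = cnt ((p : ℤ) ^ k) p f := by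
  classical
  have hpp : Prime (p : ℤ) := Nat.prime_iff_prime_int.mp hp
  have hp0 : (p : ℤ) ≠ 0 := hpp.ne_zero
  have h1 : ∀ j, ∃ i N, g * hm p j = hm p i * N := fun j => exists_hm hp _ (by simp)
  choose σ N hN using h1
  have hdet : ∀ j, (N j).det = g.det := by
    intro j
    have := congrArg det (hN j)
    rw [det_mul, det_mul, det_hm, det_hm, mul_comm] at this
    exact (mul_left_cancel₀ hp0 this).symm
  have hinj : Function.Injective σ := by
    have : ∀ j l L, g.adjugate * hm p (σ j) = hm p l * L → l = j := by
      intro j l L hl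
      have e1 : g.det • hm p j = hm p l * (L * N j) := by
        rw [← mul_assoc, ← hl, mul_assoc, ← hN j, ← mul_assoc,
          adjugate_mul, Matrix.smul_mul, one_mul]
      have e2 : g.det • hm p j = hm p j * (g.det • 1) := by rw [Matrix.mul_smul, mul_one]
      refine hm_unique hp ?_ e1 e2
      rw [det_smul, det_hm]
      exact not_sq_dvd_mul hp fun h => hg (hpp.dvd_of_dvd_pow h)
    intro i j hij
    obtain ⟨l, L, hl⟩ := exists_hm hp (g.adjugate * hm p (σ i)) (by simp)
    rw [← this i l L hl, ← this j l L (hij ▸ hl)]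
  have hbij := Finite.injective_iff_bijective.mp hinj
  have hiff : ∀ j, ((f.comp g).comp (hm p j)).Dv ((p : ℤ) ^ k) ↔
      (f.comp (hm p (σ j))).Dv ((p : ℤ) ^ k) := by
    intro j
    rw [← comp_mul, hN j, comp_mul, dv_comp_of_isCoprime]
    rw [hdet]
    exact IsCoprime.pow_left (hpp.coprime_iff_not_dvd.mpr hg)
  rw [cnt, cnt]
  refine card_bij (fun j _ => σ j) ?_ (fun i _ j _ h => hinj h) ?_
  · intro j hj
    simpa [hiff] using hj
  · intro i hi
    obtain ⟨j, rfl⟩ := hbij.2 i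
    exact ⟨j, by simpa [hiff] using hi, rfl⟩

theorem cnt_scale_of_isCoprime {m n : ℤ} (h : IsCoprime m n) (p : ℕ) (f : BCF) :
    cnt m p (f.scale n) = cnt m p f := by
  classical
  unfold cnt
  congr 1
  ext j
  rw [mem_filter, mem_filter, comp_scale, dv_scale_of_isCoprime h]

theorem cnt_GLZ {p : ℕ} (hp : p.Prime) (k : ℕ) (f : BCF) (γ : GLZ) :
    cnt ((p : ℤ) ^ k) p (f.comp γ) = cnt ((p : ℤ) ^ k) p f := by
  refine cnt_comp hp k f fun h => ?_
  have h1 := Nat.prime_iff_prime_int.mp hp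
  rcases γ.det_eq with h' | h' <;> rw [h'] at h
  · exact h1.not_dvd_one h
  · exact h1.not_dvd_one (by simpa using h)

/-- The integral matrices of determinant `±p`. -/
abbrev Mp (p : ℕ) : Type := {h : Matrix (Fin 2) (Fin 2) ℤ // h.det = p ∨ h.det = -p}

/-- Each matrix of determinant `±p` is uniquely a product of a standard one and an element
of `GL₂(ℤ)`. -/
noncomputable def mpEquiv {p : ℕ} (hp : p.Prime) : Option (Fin p) × GLZ ≃ Mp p :=
  Equiv.ofBijective (fun x => ⟨hm p x.1 * x.2, by
      rw [det_mul, det_hm]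
      rcases x.2.det_eq with h | h <;> rw [h] <;> simp⟩) <| by
    have hp0 : (p : ℤ) ≠ 0 := by exact_mod_cast hp.ne_zero
    have hpp : Prime (p : ℤ) := Nat.prime_iff_prime_int.mp hp
    constructor
    · rintro ⟨i, γ⟩ ⟨j, δ⟩ h
      simp only [Subtype.mk.injEq] at h
      have hij : i = j := by
        refine hm_unique hp ?_ rfl h
        rw [det_mul, det_hm, mul_comm]
        refine not_sq_dvd_mul hp fun hd => hpp.not_dvd_one ?_
        rcases γ.det_eq with h | h <;> rw [h] at hd <;> simpa using hd
      subst hij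
      congr 1
      ext1
      have h2 := congrArg (fun M => (hm p i).adjugate * M) h
      simp only [← mul_assoc, adjugate_mul, det_hm, Matrix.smul_mul,
        one_mul] at h2
      exact smul_right_injective _ hp0 h2
    · rintro ⟨M, hM⟩
      obtain ⟨j, N, hN⟩ := exists_hm hp M (by rcases hM with h | h <;> simp [h])
      have hdet : IsUnit N.det := by
        rw [hN, det_mul, det_hm] at hM
        rw [Int.isUnit_iff]
        refine hM.imp (fun h => ?_) (fun h => ?_)
        · exact mul_left_cancel₀ hp0 (by rw [h, mul_one])
        · exact mul_left_cancel₀ hp0 (by rw [h]; ring)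
      refine ⟨(j, ((isUnit_iff_isUnit_det N).2 hdet).unit), ?_⟩
      simp [hN]

@[simp] theorem mpEquiv_apply {p : ℕ} (hp : p.Prime) (x : Option (Fin p) × GLZ) :
    (mpEquiv hp x).1 = hm p x.1 * x.2 := rfl

theorem tsum_mp {p : ℕ} (hp : p.Prime) {m : ℤ} (hm0 : m ≠ 0) {f : BCF} (hf : f ∈ W) :
    open Classical in
    ∑' h : Mp p, ∑' g : BCF, (if g.scale m = f.comp h then g.wt else 0) = cnt m p f := by
  classical
  rw [← (mpEquiv hp).tsum_eq, ENNReal.tsum_prod', tsum_fintype, cnt, card_filter,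
    Nat.cast_sum]
  refine sum_congr rfl fun j _ => ?_
  simp only [mpEquiv_apply, comp_mul]
  split_ifs with hj
  · obtain ⟨g, hg⟩ := dv_iff.mp hj
    have hgW : g ∈ W := by
      rw [← scale_mem_W_iff hm0, hg]
      refine comp_mem_W hf ?_
      simp [hp.ne_zero]
    rw [Nat.cast_one, ← tsum_wt hgW]
    refine tsum_congr fun γ => ?_
    rw [← hg, comp_scale, tsum_eq_single (g.comp γ)]
    · simp
    · intro g' hg'
      rw [if_neg]
      exact fun h => hg' (scale_injective hm0 h)
  · rw [Nat.cast_zero, ENNReal.tsum_eq_zero]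
    intro γ
    rw [ENNReal.tsum_eq_zero]
    intro g
    rw [if_neg]
    intro h
    exact hj ((dv_comp_GLZ γ).mp (dv_iff.mpr ⟨g, h⟩))

/-- The complementary matrix. -/
def Mp.co {p : ℕ} (h : Mp p) : Mp p :=
  if h' : h.1.det = p then ⟨h.1.adjugate, by rw [det_adjugate]; simp [h']⟩
  else ⟨-h.1.adjugate, by
    have := h.2.resolve_left h'
    rw [det_neg, det_adjugate]; simp [this]⟩

theorem Mp.mul_co {p : ℕ} (h : Mp p) : h.1 * h.co.1 = (p : ℤ) • 1 := by
  unfold Mp.co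
  split_ifs with h'
  · simp [mul_adjugate, h']
  · simp [mul_adjugate, h.2.resolve_left h']

theorem Mp.co_mul {p : ℕ} (h : Mp p) : h.co.1 * h.1 = (p : ℤ) • 1 := by
  unfold Mp.co
  split_ifs with h'
  · simp [adjugate_mul, h']
  · simp [adjugate_mul, h.2.resolve_left h']

theorem Mp.co_co {p : ℕ} (hp : p ≠ 0) (h : Mp p) : h.co.co = h := by
  have hp0 : (p : ℤ) ≠ 0 := by exact_mod_cast hp
  ext1
  have h1 := congrArg (fun M => h.1 * M) h.co.mul_co
  simp only [← mul_assoc, h.mul_co, Matrix.smul_mul, one_mul, Matrix.mul_smul,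
    mul_one] at h1
  exact smul_right_injective _ hp0 h1

theorem scale_eq_comp_iff {p : ℕ} (hp : p ≠ 0) (h : Mp p) (f g : BCF) :
    g.scale p = f.comp h ↔ f.scale ((p : ℤ) ^ 2) = g.comp h.co := by
  have hp0 : (p : ℤ) ≠ 0 := by exact_mod_cast hp
  constructor
  · intro e
    have := congrArg (fun F => F.comp h.co.1) e
    simp only [comp_scale, ← comp_mul, h.mul_co, comp_scalar] at this
    apply scale_injective hp0
    rw [this, scale_scale]
    congr 1
    ring
  · intro e
    have := congrArg (fun F => F.comp h.1) e
    simp only [comp_scale, ← comp_mul, h.co_mul, comp_scalar] at this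
    apply scale_injective (pow_ne_zero 2 hp0)
    rw [this, scale_scale]
    congr 1

/-- The Hecke-type identity relating the two local counts. -/
theorem hecke {p : ℕ} (hp : p.Prime) (φ₁ φ₂ : BCF → ℝ≥0∞)
    (hφ : ∀ (f g : BCF) (h : Mp p), f ∈ W → g.scale p = f.comp h → φ₁ g = φ₂ f) :
    ∑' f, f.wt * cnt ((p : ℤ) ^ 2) p f * φ₁ f = ∑' f, f.wt * cnt (p : ℤ) p f * φ₂ f := by
  classical
  have hp0 : (p : ℤ) ≠ 0 := by exact_mod_cast hp.ne_zero
  have hw : ∀ f : BCF, f ∉ W → f.wt = 0 := fun f hf => by simp [wt, hf]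
  have e1 : ∀ f : BCF, f.wt * cnt (p : ℤ) p f * φ₂ f = ∑' g : BCF, ∑' h : Mp p,
      if g.scale p = f.comp h then f.wt * g.wt * φ₂ f else 0 := by
    intro f
    by_cases hf : f ∈ W
    · rw [← tsum_mp hp hp0 hf, ENNReal.tsum_comm, ← ENNReal.tsum_mul_left, ← ENNReal.tsum_mul_right]
      refine tsum_congr fun g => ?_
      rw [← ENNReal.tsum_mul_left, ← ENNReal.tsum_mul_right]
      refine tsum_congr fun h => ?_
      split_ifs <;> simp
    · simp [hw f hf]
  have e2 : ∀ g : BCF, g.wt * cnt ((p : ℤ) ^ 2) p g * φ₁ g = ∑' f : BCF, ∑' h : Mp p,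
      if f.scale ((p : ℤ) ^ 2) = g.comp h then f.wt * g.wt * φ₁ g else 0 := by
    intro g
    by_cases hg : g ∈ W
    · rw [← tsum_mp hp (pow_ne_zero 2 hp0) hg, ENNReal.tsum_comm, ← ENNReal.tsum_mul_left,
        ← ENNReal.tsum_mul_right]
      refine tsum_congr fun f => ?_
      rw [← ENNReal.tsum_mul_left, ← ENNReal.tsum_mul_right]
      refine tsum_congr fun h => ?_
      split_ifs <;> simp [mul_comm]
    · simp [hw g hg]
  simp_rw [e1, e2]
  rw [ENNReal.tsum_comm]
  refine tsum_congr fun f => tsum_congr fun g => ?_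
  rw [← (Equiv.mk (Mp.co (p := p)) Mp.co (Mp.co_co hp.ne_zero) (Mp.co_co hp.ne_zero)).tsum_eq]
  refine tsum_congr fun h => ?_
  simp only [Equiv.coe_fn_mk]
  by_cases hf : f ∈ W
  · by_cases e : g.scale p = f.comp h
    · rw [if_pos e, if_pos ((scale_eq_comp_iff hp.ne_zero h f g).1 e), hφ f g h hf e]
    · rw [if_neg e, if_neg (fun e' => e ((scale_eq_comp_iff hp.ne_zero h f g).2 e'))]
  · simp [hw f hf]

end

section
open Finset
open scoped ENNReal

/-- The number of zeros of a form on the projective line modulo `p`. -/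
noncomputable abbrev om (p : ℕ) (f : BCF) : ℕ := cnt (p : ℤ) p f

/-- The number of singular sublattices of index `p`. -/
noncomputable abbrev oo (p : ℕ) (f : BCF) : ℕ := cnt ((p : ℤ) ^ 2) p f

theorem dv_comp_hm_none {p : ℕ} (m : ℤ) (f : BCF) : (f.comp (hm p none)).Dv m ↔
    m ∣ f.a ∧ m ∣ f.b * p ∧ m ∣ f.c * p ^ 2 ∧ m ∣ f.d * p ^ 3 := by
  simp [Dv, comp, hm]

theorem dv_comp_hm_some {p : ℕ} (m : ℤ) (f : BCF) (r : Fin p) : (f.comp (hm p (some r))).Dv m ↔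
    m ∣ f.a * p ^ 3 ∧ m ∣ p ^ 2 * (3 * f.a * r + f.b) ∧
      m ∣ p * (3 * f.a * r ^ 2 + 2 * f.b * r + f.c) ∧
      m ∣ f.a * r ^ 3 + f.b * r ^ 2 + f.c * r + f.d := by
  simp only [Dv, comp, hm]
  simp only [Matrix.of_apply, Matrix.cons_val', Matrix.cons_val_zero, Matrix.cons_val_one,
    Matrix.cons_val_fin_one]
  ring_nf

open Classical in
theorem om_eq (p : ℕ) (f : BCF) : om p f = (if (p : ℤ) ∣ f.a then 1 else 0) +
    (univ.filter fun r : Fin p =>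
      (p : ℤ) ∣ f.a * r ^ 3 + f.b * r ^ 2 + f.c * r + f.d).card := by
  rw [om, cnt, card_filter, Fintype.sum_option, card_filter]
  congr 1
  · have h : (f.comp (hm p none)).Dv p ↔ (p : ℤ) ∣ f.a := by
      rw [dv_comp_hm_none]
      exact ⟨fun h => h.1, fun h => ⟨h, dvd_mul_left _ _, Dvd.dvd.mul_left (dvd_pow_self _
        two_ne_zero) _, Dvd.dvd.mul_left (dvd_pow_self _ three_ne_zero) _⟩⟩
    exact if_congr h rfl rfl
  · refine sum_congr rfl fun r _ => ?_
    simp only [dv_comp_hm_some]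
    congr 1
    simp [pow_succ, mul_assoc, dvd_mul_of_dvd_right]

theorem oo_scale_self {p : ℕ} (hp : p ≠ 0) (f : BCF) : oo p (f.scale p) = om p f := by
  classical
  have hp0 : (p : ℤ) ≠ 0 := by exact_mod_cast hp
  have key : ∀ g : BCF, (g.scale p).Dv ((p : ℤ) ^ 2) ↔ g.Dv p := fun g => by
    simp only [Dv, scale, sq, mul_dvd_mul_iff_left hp0]
  unfold oo om cnt
  congr 1
  ext j
  rw [mem_filter, mem_filter, comp_scale, key]

theorem om_le_of_dv {p : ℕ} (f : BCF) : om p f ≤ p + 1 := by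
  classical
  unfold om cnt
  refine (card_filter_le _ _).trans ?_
  simp

/-- A singular sublattice yields a double root modulo `p`. -/
theorem oo_le_one {p : ℕ} (hp : p.Prime) {f : BCF} (hf : ¬ f.Dv p) : oo p f ≤ 1 := by
  classical
  have hpp : Prime (p : ℤ) := Nat.prime_iff_prime_int.mp hp
  have hp0 : (p : ℤ) ≠ 0 := hpp.ne_zero
  have : Fact p.Prime := ⟨hp⟩
  have z : ∀ x : ℤ, (p : ℤ) ∣ x ↔ ((x : ℤ) : ZMod p) = 0 := fun x =>
    (ZMod.intCast_zmod_eq_zero_iff_dvd x p).symm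
  have hsome : ∀ r : Fin p, (f.comp (hm p (some r))).Dv ((p : ℤ) ^ 2) →
      (3 * f.a * (r : ℕ) ^ 2 + 2 * f.b * (r : ℕ) + f.c : ZMod p) = 0 ∧
      (f.a * (r : ℕ) ^ 3 + f.b * (r : ℕ) ^ 2 + f.c * (r : ℕ) + f.d : ZMod p) = 0 := by
    intro r h
    obtain ⟨-, -, h3, h4⟩ := (dv_comp_hm_some _ f r).1 h
    constructor
    · have h5 : (p : ℤ) ∣ 3 * f.a * r ^ 2 + 2 * f.b * r + f.c := by
        rwa [sq, mul_dvd_mul_iff_left hp0] at h3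
      simpa using (z _).1 h5
    · simpa using (z _).1 (dvd_trans (dvd_pow_self _ two_ne_zero) h4)
  have hnone : (f.comp (hm p none)).Dv ((p : ℤ) ^ 2) →
      (f.a : ZMod p) = 0 ∧ (f.b : ZMod p) = 0 := by
    intro h
    obtain ⟨h1, h2, -, -⟩ := (dv_comp_hm_none _ f).1 h
    refine ⟨(z _).1 (dvd_trans (dvd_pow_self _ two_ne_zero) h1), (z _).1 ?_⟩
    rwa [sq, mul_dvd_mul_iff_right hp0] at h2
  have hns : ∀ r : Fin p, (f.comp (hm p none)).Dv ((p : ℤ) ^ 2) →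
      (f.comp (hm p (some r))).Dv ((p : ℤ) ^ 2) → False := by
    intro r h1 h2
    obtain ⟨ha, hb⟩ := hnone h1
    obtain ⟨hc, hd⟩ := hsome r h2
    rw [ha, hb] at hc hd
    have hc' : (f.c : ZMod p) = 0 := by simpa using hc
    rw [hc'] at hd
    have hd' : (f.d : ZMod p) = 0 := by simpa using hd
    exact hf ⟨(z _).2 ha, (z _).2 hb, (z _).2 hc', (z _).2 hd'⟩
  unfold oo cnt
  rw [card_le_one]
  intro i hi j hj
  rw [mem_filter] at hi hj
  match i, j with
  | none, none => rfl
  | none, some r => exact (hns r hi.2 hj.2).elim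
  | some r, none => exact (hns r hj.2 hi.2).elim
  | some r, some s =>
    congr 1
    by_contra hrs
    obtain ⟨h1, h2⟩ := hsome r hi.2
    obtain ⟨h3, h4⟩ := hsome s hj.2
    have hne : ((r : ℕ) : ZMod p) - ((s : ℕ) : ZMod p) ≠ 0 := by
      rw [sub_ne_zero]
      intro h
      rw [ZMod.natCast_eq_natCast_iff'] at h
      rw [Nat.mod_eq_of_lt r.2, Nat.mod_eq_of_lt s.2] at h
      exact hrs (Fin.ext h)
    generalize ((r : ℕ) : ZMod p) = x at *
    generalize ((s : ℕ) : ZMod p) = y at *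
    have ha : (f.a : ZMod p) = 0 := by
      have : (f.a : ZMod p) * (x - y) ^ 3 = 0 := by
        linear_combination (x - y) * h1 + (x - y) * h3 - 2 * h2 + 2 * h4
      exact (mul_eq_zero.mp this).resolve_right (pow_ne_zero 3 hne)
    rw [ha] at h1 h2 h3 h4
    have hb : (f.b : ZMod p) = 0 := by
      have : (f.b : ZMod p) * (x - y) ^ 2 = 0 := by
        linear_combination (x - y) * h1 - h2 + h4
      exact (mul_eq_zero.mp this).resolve_right (pow_ne_zero 2 hne)
    rw [hb] at h1 h2
    have hc : (f.c : ZMod p) = 0 := by linear_combination h1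
    have hd : (f.d : ZMod p) = 0 := by rw [hc] at h2; linear_combination h2
    exact hf ⟨(z _).2 ha, (z _).2 hb, (z _).2 hc, (z _).2 hd⟩

theorem om_le_three {p : ℕ} (hp : p.Prime) {f : BCF} (hf : ¬ f.Dv p) : om p f ≤ 3 := by
  classical
  have : Fact p.Prime := ⟨hp⟩
  have z : ∀ x : ℤ, (p : ℤ) ∣ x ↔ ((x : ℤ) : ZMod p) = 0 := fun x =>
    (ZMod.intCast_zmod_eq_zero_iff_dvd x p).symm
  obtain ⟨A, hA⟩ : ∃ A, A = (f.a : ZMod p) := ⟨_, rfl⟩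
  obtain ⟨B, hB⟩ : ∃ B, B = (f.b : ZMod p) := ⟨_, rfl⟩
  obtain ⟨C, hC⟩ : ∃ C, C = (f.c : ZMod p) := ⟨_, rfl⟩
  obtain ⟨D, hD⟩ : ∃ D, D = (f.d : ZMod p) := ⟨_, rfl⟩
  let P : Polynomial (ZMod p) := Polynomial.C A * Polynomial.X ^ 3 +
    Polynomial.C B * Polynomial.X ^ 2 + Polynomial.C C * Polynomial.X + Polynomial.C D
  have hP : P ≠ 0 := by
    intro h
    apply hf
    have key : ∀ n, P.coeff n = 0 := fun n => by rw [h]; simp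
    have h0 := key 0
    have h1 := key 1
    have h2 := key 2
    have h3 := key 3
    simp [P, Polynomial.coeff_X, Polynomial.coeff_C, Polynomial.coeff_X_pow] at h0 h1 h2 h3
    exact ⟨(z _).2 (hA ▸ h3), (z _).2 (hB ▸ h2), (z _).2 (hC ▸ h1), (z _).2 (hD ▸ h0)⟩
  have hcard : (univ.filter fun r : Fin p =>
      (p : ℤ) ∣ f.a * r ^ 3 + f.b * r ^ 2 + f.c * r + f.d).card ≤ P.natDegree := by
    refine (card_le_card_of_injOn (t := P.roots.toFinset)
      (fun r : Fin p => ((r : ℕ) : ZMod p)) ?_ ?_).trans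
      ((Multiset.toFinset_card_le _).trans P.card_roots')
    · intro r hr
      have h := (mem_filter.1 hr).2
      rw [z] at h
      simp only [mem_coe, Multiset.mem_toFinset, Polynomial.mem_roots hP,
        Polynomial.IsRoot.def]
      simpa [P, hA, hB, hC, hD] using h
    · intro r _ s _ h
      simp only at h
      rw [ZMod.natCast_eq_natCast_iff', Nat.mod_eq_of_lt r.2, Nat.mod_eq_of_lt s.2] at h
      exact Fin.ext h
  rw [om_eq]
  split_ifs with ha
  · have : P.natDegree ≤ 2 := by
      have : P = Polynomial.C B * Polynomial.X ^ 2 +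
          Polynomial.C C * Polynomial.X + Polynomial.C D := by
        simp [P, hA, (z _).1 ha]
      rw [this]; exact Polynomial.natDegree_quadratic_le
    omega
  · have : P.natDegree ≤ 3 := Polynomial.natDegree_cubic_le
    omega

/-- The form is not maximal at `p`. -/
def Nmx (p : ℕ) (f : BCF) : Prop := f.Dv p ∨ 1 ≤ oo p f

open Classical in
/-- The indicator of non-maximality at `p`. -/
noncomputable def nx (p : ℕ) (f : BCF) : ℝ := if f.Nmx p then 1 else 0

theorem nx_congr {p : ℕ} {f g : BCF} (h : f.Nmx p ↔ g.Nmx p) : nx p f = nx p g := by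
  unfold nx
  by_cases h' : g.Nmx p
  · rw [if_pos h', if_pos (h.2 h')]
  · rw [if_neg h', if_neg (fun e => h' (h.1 e))]

theorem nx_of_not_dv {p : ℕ} (hp : p.Prime) {f : BCF} (hf : ¬ f.Dv p) : nx p f = oo p f := by
  have := oo_le_one hp hf
  unfold nx Nmx
  split_ifs with h
  · have := h.resolve_left hf
    norm_cast; omega
  · push Not at h
    norm_cast; omega

theorem nx_nonneg (p : ℕ) (f : BCF) : 0 ≤ nx p f := by
  unfold nx; split_ifs <;> norm_num

theorem Nmx.dvd_disc {p : ℕ} (hp : p.Prime) {f : BCF} (hf : f.Nmx p) : (p : ℤ) ∣ f.disc := by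
  classical
  have hp0 : (p : ℤ) ≠ 0 := by exact_mod_cast hp.ne_zero
  rcases hf with h | h
  · obtain ⟨g, rfl⟩ := dv_iff.mp h
    rw [disc_scale]
    exact Dvd.dvd.mul_right (dvd_pow_self _ (by norm_num)) _
  · obtain ⟨j, hj⟩ := card_pos.mp h
    obtain ⟨g, hg⟩ := dv_iff.mp (mem_filter.mp hj).2
    have := congrArg disc hg
    rw [disc_scale, disc_comp, det_hm] at this
    refine ⟨p * g.disc, mul_left_cancel₀ (pow_ne_zero 6 hp0) ?_⟩
    rw [← this]; ring

/-- Invariance of the local functions at `q` under the substitutions at `p`. -/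
theorem cnt_of_scale_eq {p q : ℕ} (hp : p.Prime) (hq : q.Prime) (hpq : p ≠ q) (k : ℕ)
    {f g : BCF} {h : Mp p} (e : g.scale p = f.comp h) :
    cnt ((q : ℤ) ^ k) q g = cnt ((q : ℤ) ^ k) q f := by
  have hc : IsCoprime (q : ℤ) p := Nat.isCoprime_iff_coprime.2 ((Nat.coprime_primes hq hp).2 hpq.symm)
  rw [← cnt_scale_of_isCoprime (hc.pow_left (m := k)) q g, e, cnt_comp hq]
  intro hd
  have h1 : (q : ℤ) ∣ p := by rcases h.2 with h' | h' <;> rw [h'] at hd <;> simpa using hd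
  have := hc.isUnit_of_dvd' dvd_rfl h1
  exact (Nat.prime_iff_prime_int.mp hq).not_isUnit this

theorem nx_of_scale_eq {p q : ℕ} (hp : p.Prime) (hq : q.Prime) (hpq : p ≠ q)
    {f g : BCF} {h : Mp p} (e : g.scale p = f.comp h) : nx q g = nx q f := by
  have hc : IsCoprime (q : ℤ) p := Nat.isCoprime_iff_coprime.2 ((Nat.coprime_primes hq hp).2 hpq.symm)
  have h1 : g.Nmx q ↔ f.Nmx q := by
    unfold Nmx oo
    rw [cnt_of_scale_eq hp hq hpq 2 e, ← dv_scale_of_isCoprime hc (f := g), e, dv_comp_of_isCoprime]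
    rcases h.2 with h' | h' <;> rw [h']
    · exact hc
    · exact hc.neg_right
  exact nx_congr h1

theorem cnt_scale_prime {p q : ℕ} (hp : p.Prime) (hq : q.Prime) (hpq : p ≠ q) (k : ℕ) (g : BCF) :
    cnt ((q : ℤ) ^ k) q (g.scale p) = cnt ((q : ℤ) ^ k) q g := by
  have hc : IsCoprime (q : ℤ) p := Nat.isCoprime_iff_coprime.2 ((Nat.coprime_primes hq hp).2 hpq.symm)
  exact cnt_scale_of_isCoprime (hc.pow_left (m := k)) q g

theorem nx_scale_prime {p q : ℕ} (hp : p.Prime) (hq : q.Prime) (hpq : p ≠ q) (g : BCF) :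
    nx q (g.scale p) = nx q g := by
  have hc : IsCoprime (q : ℤ) p := Nat.isCoprime_iff_coprime.2 ((Nat.coprime_primes hq hp).2 hpq.symm)
  refine nx_congr ?_
  unfold Nmx oo
  rw [cnt_scale_prime hp hq hpq, dv_scale_of_isCoprime hc]

theorem om_of_scale_eq {p q : ℕ} (hp : p.Prime) (hq : q.Prime) (hpq : p ≠ q)
    {f g : BCF} {h : Mp p} (e : g.scale p = f.comp h) : om q g = om q f := by
  simpa using cnt_of_scale_eq hp hq hpq 1 e

theorem om_scale_prime {p q : ℕ} (hp : p.Prime) (hq : q.Prime) (hpq : p ≠ q) (g : BCF) :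
    om q (g.scale p) = om q g := by
  simpa using cnt_scale_prime hp hq hpq 1 g

end

section
open Finset ENNReal

theorem wt_le_one (f : BCF) : f.wt ≤ 1 := by
  unfold wt
  split_ifs with h
  · rw [ENNReal.inv_le_one]
    have hpos : 0 < {γ : GLZ | (f.comp γ).Red}.ncard :=
      (Set.ncard_pos (finite_red_comp h.1)).2 ⟨1, by simpa using h.2⟩
    exact_mod_cast hpos
  · exact zero_le_one

theorem wt_ne_top (f : BCF) : f.wt ≠ ⊤ := ((wt_le_one f).trans_lt one_lt_top).ne

theorem wt_eq_zero {f : BCF} (h : ¬ (f ∈ W ∧ f.Red)) : f.wt = 0 := if_neg h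

/-- The weight of a form as a real number. -/
noncomputable def wr (f : BCF) : ℝ := f.wt.toReal

theorem wr_nonneg (f : BCF) : 0 ≤ f.wr := toReal_nonneg

theorem wr_le_one (f : BCF) : f.wr ≤ 1 := by
  have := toReal_mono one_ne_top (wt_le_one f)
  simpa [wr] using this

theorem wr_eq_zero {f : BCF} (h : ¬ (f ∈ W ∧ f.Red)) : f.wr = 0 := by
  rw [wr, wt_eq_zero h, toReal_zero]

theorem wr_scale {n : ℤ} (hn : n ≠ 0) (f : BCF) : (f.scale n).wr = f.wr := by
  rw [wr, wt_scale hn, wr]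

/-- The reduced forms of discriminant less than `X`. -/
noncomputable def redF (X : ℝ) : Finset BCF := (finite_red X).toFinset

theorem mem_redF {X : ℝ} {f : BCF} : f ∈ redF X ↔ f.Red ∧ (f.disc : ℝ) < X := by
  simp [redF]

theorem tsum_wt_mul (X : ℝ) {F : BCF → ℝ} (hF : ∀ f, 0 ≤ F f) :
    ∑' f : BCF, f.wt * ENNReal.ofReal (if (f.disc : ℝ) < X then F f else 0) =
      ENNReal.ofReal (∑ f ∈ redF X, f.wr * F f) := by
  rw [tsum_eq_sum (s := redF X), ofReal_sum_of_nonneg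
    fun f _ => mul_nonneg f.wr_nonneg (hF f)]
  · refine sum_congr rfl fun f hf => ?_
    rw [if_pos (mem_redF.1 hf).2, ofReal_mul f.wr_nonneg, wr, ofReal_toReal f.wt_ne_top]
  · intro f hf
    rw [mem_redF] at hf
    by_cases h : f.Red
    · rw [if_neg fun h' => hf ⟨h, h'⟩]; simp
    · rw [wt_eq_zero fun h' => h h'.2, zero_mul]

theorem sum_hecke {p : ℕ} (hp : p.Prime) {F : BCF → ℝ} (hF : ∀ f, 0 ≤ F f)
    (hinv : ∀ (f g : BCF) (h : Mp p), g.scale p = f.comp h → F g = F f) (X : ℝ) :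
    ∑ f ∈ redF X, f.wr * (oo p f * F f) = ∑ f ∈ redF (X / p ^ 2), f.wr * (om p f * F f) := by
  have hp0 : (0 : ℝ) < p := by exact_mod_cast hp.pos
  have h := hecke hp (fun f => ENNReal.ofReal (if (f.disc : ℝ) < X then F f else 0))
    (fun f => ENNReal.ofReal (if (f.disc : ℝ) < X / p ^ 2 then F f else 0)) (by
      intro f g h _ e
      have hd : g.disc = p ^ 2 * f.disc := by
        have := congrArg disc e
        rw [disc_scale, disc_comp] at this
        have h2 : h.1.det ^ 6 = (p : ℤ) ^ 6 := by
          rcases h.2 with h' | h' <;> rw [h'] ; ring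
        rw [h2] at this
        have hpz : (p : ℤ) ≠ 0 := by exact_mod_cast hp.ne_zero
        refine mul_left_cancel₀ (pow_ne_zero 4 hpz) ?_
        rw [this]; ring
      have hiff : ((g.disc : ℝ) < X) ↔ ((f.disc : ℝ) < X / p ^ 2) := by
        rw [hd, lt_div_iff₀ (by positivity)]
        push_cast
        rw [mul_comm]
      simp only [hiff, hinv f g h e])
  have conv : ∀ (c : BCF → ℕ) (Y : ℝ), ∑' f : BCF, f.wt * c f *
      ENNReal.ofReal (if (f.disc : ℝ) < Y then F f else 0) =
      ENNReal.ofReal (∑ f ∈ redF Y, f.wr * (c f * F f)) := by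
    intro c Y
    rw [← tsum_wt_mul Y fun f => mul_nonneg (Nat.cast_nonneg _) (hF f)]
    refine tsum_congr fun f => ?_
    rw [mul_assoc, ← ofReal_natCast, ← ofReal_mul (Nat.cast_nonneg _)]
    simp
  simp only [conv] at h
  refine (ofReal_eq_ofReal_iff ?_ ?_).1 h <;>
  exact sum_nonneg fun f _ => mul_nonneg f.wr_nonneg (mul_nonneg (Nat.cast_nonneg _) (hF f))

theorem sum_dv {p : ℕ} (hp : p.Prime) (F : BCF → ℝ) (X : ℝ) :
    open Classical in
    ∑ f ∈ (redF X).filter (fun f => f.Dv p), F f = ∑ f ∈ redF (X / p ^ 4), F (f.scale p) := by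
  classical
  have hp0 : (0 : ℝ) < p := by exact_mod_cast hp.pos
  have hpz : (p : ℤ) ≠ 0 := by exact_mod_cast hp.ne_zero
  have himg : (redF X).filter (fun f => f.Dv p) = (redF (X / p ^ 4)).image (scale p) := by
    ext f
    simp only [mem_filter, mem_image, mem_redF, dv_iff]
    constructor
    · rintro ⟨⟨h1, h2⟩, g, rfl⟩
      refine ⟨g, ⟨(Red.scale_iff hpz).1 h1, ?_⟩, rfl⟩
      rw [disc_scale] at h2
      rw [lt_div_iff₀ (by positivity)]
      push_cast at h2
      linarith
    · rintro ⟨g, ⟨h1, h2⟩, rfl⟩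
      refine ⟨⟨(Red.scale_iff hpz).2 h1, ?_⟩, g, rfl⟩
      rw [disc_scale]
      rw [lt_div_iff₀ (by positivity)] at h2
      push_cast
      linarith
  rw [himg, sum_image fun _ _ _ _ h => scale_injective hpz h]

theorem sum_scale {p : ℕ} (hp : p.Prime) (F : BCF → ℝ) (X : ℝ) :
    open Classical in
    ∑ f ∈ (redF X).filter (fun f => f.Dv p), f.wr * F f =
      ∑ f ∈ redF (X / p ^ 4), f.wr * F (f.scale p) := by
  rw [sum_dv hp fun f => f.wr * F f]
  exact sum_congr rfl fun f _ => by rw [wr_scale (by exact_mod_cast hp.ne_zero)]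

/-- The weighted number of reduced forms nonmaximal at the primes in `A`, counted with the
number of zeros modulo the primes in `E`. -/
noncomputable def tS (A E : Finset ℕ) (X : ℝ) : ℝ :=
  ∑ f ∈ redF X, f.wr * ((∏ p ∈ A, nx p f) * ∏ p ∈ E, (om p f : ℝ))

theorem tS_insert {p : ℕ} (hp : p.Prime) {A E : Finset ℕ} (hA : ∀ q ∈ A, q.Prime)
    (hE : ∀ q ∈ E, q.Prime) (hpA : p ∉ A) (hpE : p ∉ E) (X : ℝ) :
    tS (insert p A) E X = tS A (insert p E) (X / p ^ 2) + tS A E (X / p ^ 4)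
      - tS A (insert p E) (X / p ^ 4) := by
  classical
  set F : BCF → ℝ := fun f => (∏ q ∈ A, nx q f) * ∏ q ∈ E, (om q f : ℝ) with hFdef
  have hF : ∀ f, 0 ≤ F f := fun f => mul_nonneg (prod_nonneg fun _ _ => nx_nonneg _ _)
    (prod_nonneg fun _ _ => Nat.cast_nonneg _)
  have neA : ∀ q ∈ A, p ≠ q := fun q hq e => hpA (e ▸ hq)
  have neE : ∀ q ∈ E, p ≠ q := fun q hq e => hpE (e ▸ hq)
  have hinv : ∀ (f g : BCF) (h : Mp p), g.scale p = f.comp h → F g = F f := by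
    intro f g h e
    simp only [hFdef]
    congr 1
    · exact prod_congr rfl fun q hq => nx_of_scale_eq hp (hA q hq) (neA q hq) e
    · exact prod_congr rfl fun q hq => by
        rw [om_of_scale_eq hp (hE q hq) (neE q hq) e]
  have hsc : ∀ f : BCF, F (f.scale p) = F f := by
    intro f
    simp only [hFdef]
    congr 1
    · exact prod_congr rfl fun q hq => nx_scale_prime hp (hA q hq) (neA q hq) f
    · exact prod_congr rfl fun q hq => by rw [om_scale_prime hp (hE q hq) (neE q hq)]
  have e1 : tS (insert p A) E X = ∑ f ∈ redF X, f.wr * (nx p f * F f) := by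
    unfold tS
    refine sum_congr rfl fun f _ => ?_
    rw [prod_insert hpA, mul_assoc]
  have e2 : ∀ Y, tS A (insert p E) Y = ∑ f ∈ redF Y, f.wr * (om p f * F f) := by
    intro Y
    unfold tS
    refine sum_congr rfl fun f _ => ?_
    rw [prod_insert hpE]; ring
  have e3 : ∀ f : BCF, f.wr * (nx p f * F f) = f.wr * (oo p f * F f) +
      if f.Dv p then f.wr * ((1 - oo p f) * F f) else 0 := by
    intro f
    split_ifs with h
    · rw [nx, if_pos (show f.Nmx p from Or.inl h)]; ring
    · rw [nx_of_not_dv hp h, add_zero]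
  rw [e1, sum_congr rfl fun f _ => e3 f, sum_add_distrib, sum_hecke hp hF hinv,
    ← sum_filter]
  have e4 := sum_scale hp (fun f => (1 - oo p f) * F f) X
  simp only [oo_scale_self hp.ne_zero, hsc] at e4
  rw [e2, e2, add_sub_assoc]
  congr 1
  rw [tS, ← sum_sub_distrib]
  refine Eq.trans ?_ (e4.trans ?_)
  · congr!
  · exact sum_congr rfl fun f _ => by simp only [hFdef]; ring

theorem tS_nonneg (A E : Finset ℕ) (X : ℝ) : 0 ≤ tS A E X :=
  sum_nonneg fun f _ => mul_nonneg f.wr_nonneg (mul_nonneg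
    (prod_nonneg fun _ _ => nx_nonneg _ _) (prod_nonneg fun _ _ => Nat.cast_nonneg _))

/-- Maximality of a form at all primes. -/
def Mxl (f : BCF) : Prop := ∀ p : ℕ, p.Prime → ¬ f.Nmx p

open Classical in
/-- The weighted number of maximal forms. -/
noncomputable def nM (X : ℝ) : ℝ := ∑ f ∈ redF X, if f.Mxl then f.wr else 0

theorem nM_eq (X : ℝ) : nM X = ∑ q ∈ range (⌈X⌉₊ + 1),
    (ArithmeticFunction.moebius q : ℝ) * tS q.primeFactors ∅ X := by
  classical
  unfold nM tS
  simp only [prod_empty, mul_one, mul_sum]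
  rw [sum_comm]
  refine sum_congr rfl fun f hf => ?_
  obtain ⟨hr, hX⟩ := mem_redF.1 hf
  have hD := hr.disc_pos
  set N := f.disc.natAbs.primeFactors.filter fun p => f.Nmx p with hN
  set n := ∏ p ∈ N, p with hn
  have hNp : ∀ p ∈ N, p.Prime := fun p hp => (Nat.mem_primeFactors.1 (mem_filter.1 hp).1).1
  have hmem : ∀ p : ℕ, p.Prime → (p ∈ N ↔ f.Nmx p) := by
    intro p hp
    simp only [hN, mem_filter, Nat.mem_primeFactors]
    refine ⟨fun h => h.2, fun h => ⟨⟨hp, ?_, ?_⟩, h⟩⟩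
    · rw [← Int.natCast_dvd]; exact h.dvd_disc hp
    · simpa using hD.ne'
  have hn0 : n ≠ 0 := prod_ne_zero_iff.2 fun p hp => (hNp p hp).ne_zero
  have hpf : n.primeFactors = N := Nat.primeFactors_prod hNp
  have hnX : n < ⌈X⌉₊ + 1 := by
    have h1 : n ∣ f.disc.natAbs := (prod_dvd_prod_of_subset _ _ _
      (filter_subset _ _)).trans (Nat.prod_primeFactors_dvd _)
    have h2 : n ≤ f.disc.natAbs := Nat.le_of_dvd (by simpa using hD.ne') h1
    have h3 : ((f.disc.natAbs : ℕ) : ℝ) < X := by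
      rw [Nat.cast_natAbs, abs_of_pos hD]; exact hX
    have h4 : (n : ℝ) ≤ ⌈X⌉₊ := (Nat.cast_le.2 h2).trans (h3.le.trans (Nat.le_ceil X))
    have : n ≤ ⌈X⌉₊ := by exact_mod_cast h4
    omega
  have hterm : ∀ q ∈ range (⌈X⌉₊ + 1), (ArithmeticFunction.moebius q : ℝ) *
      (f.wr * ∏ p ∈ q.primeFactors, nx p f) =
      if q ∈ n.divisors then f.wr * (ArithmeticFunction.moebius q : ℝ) else 0 := by
    intro q _
    by_cases hq : Squarefree q
    · have hpr : ∏ p ∈ q.primeFactors, nx p f = if q.primeFactors ⊆ N then 1 else 0 := by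
        split_ifs with h
        · exact prod_eq_one fun p hp => if_pos ((hmem p (Nat.prime_of_mem_primeFactors hp)).1 (h hp))
        · rw [not_subset] at h
          obtain ⟨p, hp, hp'⟩ := h
          exact prod_eq_zero hp (if_neg fun h =>
            hp' ((hmem p (Nat.prime_of_mem_primeFactors hp)).2 h))
      have hiff : q ∈ n.divisors ↔ q.primeFactors ⊆ N := by
        rw [Nat.mem_divisors, ← hpf]
        refine ⟨fun h => Nat.primeFactors_mono h.1 h.2, fun h => ⟨?_, hn0⟩⟩
        rw [← Nat.prod_primeFactors_of_squarefree hq]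
        exact (prod_dvd_prod_of_subset _ _ _ h).trans (Nat.prod_primeFactors_dvd _)
      rw [hpr]
      by_cases h : q.primeFactors ⊆ N
      · rw [if_pos h, if_pos (hiff.2 h)]; ring
      · rw [if_neg h, if_neg (fun h' => h (hiff.1 h'))]; ring
    · rw [ArithmeticFunction.moebius_eq_zero_of_not_squarefree hq]; simp
  rw [sum_congr rfl hterm, ← sum_filter]
  have hfil : (range (⌈X⌉₊ + 1)).filter (fun q => q ∈ n.divisors) = n.divisors := by
    ext q
    rw [mem_filter, and_iff_right_iff_imp]
    intro h
    have := Nat.divisor_le h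
    rw [mem_range]; omega
  rw [hfil, ← mul_sum]
  have hmu : ∑ q ∈ n.divisors, (ArithmeticFunction.moebius q : ℝ) = if n = 1 then 1 else 0 := by
    have := congrArg (fun g : ArithmeticFunction ℤ => g n) ArithmeticFunction.moebius_mul_coe_zeta
    simp only [ArithmeticFunction.coe_mul_zeta_apply, ArithmeticFunction.one_apply] at this
    exact_mod_cast this
  rw [hmu]
  have hmx : f.Mxl ↔ n = 1 := by
    constructor
    · intro h
      have : N = ∅ := eq_empty_of_forall_notMem fun p hp =>
        h p (hNp p hp) ((hmem p (hNp p hp)).1 hp)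
      rw [hn, this, prod_empty]
    · intro h p hp hm
      rw [h, Nat.primeFactors_one] at hpf
      have := (hmem p hp).2 hm
      rw [← hpf] at this
      simp at this
  by_cases h : f.Mxl
  · rw [if_pos h, if_pos (hmx.1 h), mul_one]
  · rw [if_neg h, if_neg (fun h' => h (hmx.2 h')), mul_zero]

end

end BCF

section
open Finset
open scoped ENNReal

theorem exists_pow_card_primeFactors_le (k : ℕ) {ε : ℝ} (hε : 0 < ε) :
    ∃ C : ℝ, 0 < C ∧ ∀ q : ℕ, q ≠ 0 → (k : ℝ) ^ q.primeFactors.card ≤ C * (q : ℝ) ^ ε := by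
  classical
  obtain ⟨P, hP⟩ : ∃ P : ℕ, ∀ p : ℕ, P ≤ p → (k : ℝ) ≤ (p : ℝ) ^ ε := by
    have := (tendsto_rpow_atTop hε).comp tendsto_natCast_atTop_atTop
    exact eventually_atTop.1 (this.eventually_ge_atTop (k : ℝ))
  refine ⟨((k : ℝ) + 1) ^ P, by positivity, fun q hq => ?_⟩
  have h1 : (k : ℝ) ^ q.primeFactors.card = ∏ p ∈ q.primeFactors, (k : ℝ) := by simp
  rw [h1, ← prod_filter_mul_prod_filter_not q.primeFactors (fun p => p < P)]
  refine mul_le_mul ?_ ?_ (prod_nonneg fun _ _ => Nat.cast_nonneg _) (by positivity)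
  · rw [prod_const]
    have hc : (q.primeFactors.filter fun p => p < P).card ≤ P := by
      refine (card_le_card (t := range P) fun p hp => ?_).trans (by simp)
      exact mem_range.2 (mem_filter.1 hp).2
    calc (k : ℝ) ^ _ ≤ ((k : ℝ) + 1) ^ (q.primeFactors.filter fun p => p < P).card := by
          exact pow_le_pow_left₀ (Nat.cast_nonneg k) (by linarith) _
      _ ≤ _ := pow_le_pow_right₀ (by linarith [(Nat.cast_nonneg k : (0 : ℝ) ≤ k)]) hc
  · calc ∏ p ∈ q.primeFactors.filter (fun p => ¬ p < P), (k : ℝ)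
        ≤ ∏ p ∈ q.primeFactors.filter (fun p => ¬ p < P), (p : ℝ) ^ ε :=
          prod_le_prod (fun _ _ => Nat.cast_nonneg _) fun p hp =>
            hP p (not_lt.1 (mem_filter.1 hp).2)
      _ = ((∏ p ∈ q.primeFactors.filter (fun p => ¬ p < P), p : ℕ) : ℝ) ^ ε := by
          rw [Nat.cast_prod, Real.finsetProd_rpow _ _ fun _ _ => Nat.cast_nonneg _]
      _ ≤ (q : ℝ) ^ ε := by
          gcongr
          refine Nat.le_of_dvd (Nat.pos_of_ne_zero hq) ?_
          exact (prod_dvd_prod_of_subset _ _ _ (filter_subset _ _)).trans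
            (Nat.prod_primeFactors_dvd q)

theorem riemannZeta_ofReal_im {s : ℝ} (hs : 1 < s) : (riemannZeta s).im = 0 := by
  rw [zeta_eq_tsum_one_div_nat_cpow (by simpa using hs)]
  have : ∀ n : ℕ, 1 / (n : ℂ) ^ (s : ℂ) = ((1 / (n : ℝ) ^ s : ℝ) : ℂ) := fun n => by
    push_cast
    rw [Complex.ofReal_cpow (Nat.cast_nonneg n)]; simp
  simp only [this]
  rw [← Complex.ofReal_tsum, Complex.ofReal_im]

theorem tsum_moebius_mul_prod {α : ℕ → ℝ} {s t : ℝ} (hs : 1 < s) (ht : 1 < t)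
    (hsum : Summable fun q : ℕ => ‖(ArithmeticFunction.moebius q : ℝ) * ∏ p ∈ q.primeFactors, α p‖)
    (hα : ∀ p : ℕ, p.Prime → 1 - α p = (1 - (p : ℝ) ^ (-s)) * (1 - (p : ℝ) ^ (-t))) :
    (∑' q : ℕ, (ArithmeticFunction.moebius q : ℝ) * ∏ p ∈ q.primeFactors, α p) *
      ((riemannZeta s).re * (riemannZeta t).re) = 1 := by
  set f : ℕ → ℝ := fun q => (ArithmeticFunction.moebius q : ℝ) * ∏ p ∈ q.primeFactors, α p with hf
  have h1 := EulerProduct.eulerProduct_hasProd (f := f) (by simp [hf]) (fun {m n} hmn => by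
    simp only [hf]
    rw [ArithmeticFunction.isMultiplicative_moebius.map_mul_of_coprime hmn,
      hmn.primeFactors_mul, prod_union hmn.disjoint_primeFactors]
    push_cast; ring) hsum (by simp [hf])
  have h2 : ∀ p : Nat.Primes, ∑' e, f ((p : ℕ) ^ e) = 1 - α p := by
    intro p
    rw [tsum_eq_sum (s := range 2)]
    · simp [hf, sum_range_succ, ArithmeticFunction.moebius_apply_prime p.2,
        p.2.primeFactors, sub_eq_add_neg]
    · intro e he
      have he : 2 ≤ e := by simp at he; omega
      have : ArithmeticFunction.moebius ((p : ℕ) ^ e) = 0 :=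
        ArithmeticFunction.moebius_apply_prime_pow p.2 (by omega) |>.trans (if_neg (by omega))
      simp [hf, this]
  simp only [h2] at h1
  have zr : ∀ u : ℝ, 1 < u → HasProd (fun p : Nat.Primes => (1 - ((p : ℕ) : ℝ) ^ (-u))⁻¹)
      (riemannZeta u).re := by
    intro u hu
    have hz : riemannZeta u = ((riemannZeta u).re : ℂ) :=
      Complex.ext (by simp) (by simpa using riemannZeta_ofReal_im hu)
    have h := riemannZeta_eulerProduct_hasProd (s := (u : ℂ)) (by simpa using hu)
    rw [hz] at h
    have e : (fun p : Nat.Primes => (1 - ((p : ℕ) : ℂ) ^ (-(u : ℂ)))⁻¹) =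
        fun p : Nat.Primes => (((1 - ((p : ℕ) : ℝ) ^ (-u))⁻¹ : ℝ) : ℂ) := by
      funext p
      push_cast
      rw [Complex.ofReal_cpow (Nat.cast_nonneg _)]
      simp
    rw [e] at h
    rw [HasProd] at h ⊢
    have h' := (Complex.continuous_re.tendsto _).comp h
    simpa only [Function.comp_def, ← Complex.ofReal_prod, Complex.ofReal_re] using h'
  have h3 := h1.mul ((zr s hs).mul (zr t ht))
  have h4 : (fun p : Nat.Primes => (1 - α p) * ((1 - ((p : ℕ) : ℝ) ^ (-s))⁻¹ *
      (1 - ((p : ℕ) : ℝ) ^ (-t))⁻¹)) = fun _ => 1 := by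
    funext p
    have lt1 : ∀ u : ℝ, 1 < u → 1 - ((p : ℕ) : ℝ) ^ (-u) ≠ 0 := fun u hu => by
      have := Real.rpow_lt_one_of_one_lt_of_neg (x := ((p : ℕ) : ℝ)) (z := -u)
        (by exact_mod_cast p.2.one_lt) (by linarith)
      linarith
    rw [hα p p.2]
    have := lt1 s hs
    have := lt1 t ht
    field_simp
  rw [h4] at h3
  exact h3.unique hasProd_one

theorem abs_le_of_hecke_recursion {D : Finset ℕ → Finset ℕ → ℝ → ℝ} {G : ℝ → ℝ → ℝ} {Y₀ : ℝ}
    (hY₀ : 0 ≤ Y₀)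
    (hD : ∀ {p : ℕ} {A E : Finset ℕ}, p.Prime → (∀ q ∈ A, q.Prime) → (∀ q ∈ E, q.Prime) → p ∉ A →
      p ∉ E → ∀ X, 0 ≤ X → D (insert p A) E X = D A (insert p E) (X / p ^ 2) + D A E (X / p ^ 4)
        - D A (insert p E) (X / p ^ 4))
    (hG : ∀ {y y' n n' : ℝ}, 0 ≤ y → y ≤ y' → 0 ≤ n → n ≤ n' → G y n ≤ G y' n')
    (hbase : ∀ E : Finset ℕ, (∀ q ∈ E, q.Prime) → ∀ Y, Y₀ ≤ Y → |D ∅ E Y| ≤ G Y (∏ p ∈ E, (p : ℝ)))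
    (A : Finset ℕ) (hA : ∀ q ∈ A, q.Prime) : ∀ (E : Finset ℕ), (∀ q ∈ E, q.Prime) →
      Disjoint A E → ∀ X, Y₀ * (∏ p ∈ A, (p : ℝ)) ^ 4 ≤ X →
      |D A E X| ≤ 3 ^ A.card * G (X / (∏ p ∈ A, (p : ℝ)) ^ 2)
        ((∏ p ∈ A, (p : ℝ)) * ∏ p ∈ E, (p : ℝ)) := by
  classical
  induction A using Finset.induction_on with
  | empty =>
    intro E hE _ X hX
    simpa using hbase E hE X (by simpa using hX)
  | insert p A hpA ih =>
    intro E hE hdis X hX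
    rw [disjoint_insert_left] at hdis
    have hp : p.Prime := hA p (mem_insert_self _ _)
    have hA' : ∀ q ∈ A, q.Prime := fun q hq => hA q (mem_insert_of_mem hq)
    have hpE' : ∀ q ∈ insert p E, q.Prime := fun q hq => by
      rcases mem_insert.1 hq with rfl | h
      exacts [hp, hE q h]
    have hdis' : Disjoint A (insert p E) := disjoint_insert_right.2 ⟨hpA, hdis.2⟩
    
    rw [prod_insert hpA] at hX ⊢
    set a := ∏ p ∈ A, (p : ℝ) with ha
    set e := ∏ p ∈ E, (p : ℝ) with he
    have hp1 : (1 : ℝ) ≤ p := by exact_mod_cast hp.one_le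
    have ha0 : 0 < a := prod_pos fun q hq => by exact_mod_cast (hA' q hq).pos
    have he0 : 0 < e := prod_pos fun q hq => by exact_mod_cast (hE q hq).pos
    have hX0 : 0 ≤ X := le_trans (by positivity) hX
    rw [hD hp hA' hE hpA hdis.1 X hX0]
    have h4 : Y₀ * a ^ 4 ≤ X / p ^ 4 := by
      rw [le_div_iff₀ (by positivity)]; linarith [show Y₀ * (p * a) ^ 4 = Y₀ * a ^ 4 * p ^ 4 by ring]
    have h24 : X / (p : ℝ) ^ 4 ≤ X / p ^ 2 := by
      gcongr
      · norm_num
    have b1 := ih hA' (insert p E) hpE' hdis' (X / p ^ 2) (h4.trans h24)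
    have b2 := ih hA' E hE hdis.2 (X / p ^ 4) h4
    have b3 := ih hA' (insert p E) hpE' hdis' (X / p ^ 4) h4
    rw [prod_insert hdis.1] at b1 b3
    rw [card_insert_of_notMem hpA]
    have e1 : X / (p : ℝ) ^ 2 / a ^ 2 = X / (p * a) ^ 2 := by rw [div_div, mul_pow]
    have e2 : X / (p : ℝ) ^ 4 / a ^ 2 ≤ X / (p * a) ^ 2 := by
      rw [← e1]; gcongr
    have e3 : a * (p * e) = p * a * e := by ring
    rw [← he, e1, e3] at b1
    rw [← he, e3] at b3
    rw [← he] at b2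
    have c2 : G (X / p ^ 4 / a ^ 2) (a * e) ≤ G (X / (p * a) ^ 2) (p * a * e) :=
      hG (by positivity) e2 (by positivity) (by
        rw [mul_assoc]; exact le_mul_of_one_le_left (by positivity) hp1)
    have c3 : G (X / p ^ 4 / a ^ 2) (p * a * e) ≤ G (X / (p * a) ^ 2) (p * a * e) :=
      hG (by positivity) e2 (by positivity) le_rfl
    have h3 : (0 : ℝ) ≤ 3 ^ A.card := by positivity
    have c2' := mul_le_mul_of_nonneg_left c2 h3
    have c3' := mul_le_mul_of_nonneg_left c3 h3
    have e5 : (3 : ℝ) ^ (A.card + 1) = 3 * 3 ^ A.card := by ring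
    rw [e5, mul_assoc]
    have := abs_le.1 b1
    have := abs_le.1 b2
    have := abs_le.1 b3
    rw [abs_le]
    constructor <;> linarith

end

namespace BCF

section
open Real Finset

/-- The expected main term of `tS A E X`. -/
noncomputable def mainS (c₁ c₂ : ℝ) (A E : Finset ℕ) (X : ℝ) : ℝ :=
  c₁ * X * ((∏ p ∈ A, (1 - (1 - (p : ℝ) ^ (-2 : ℝ)) * (1 - (p : ℝ) ^ (-3 : ℝ)))) *
    ∏ p ∈ E, (1 + (p : ℝ) ^ (-1 : ℝ))) +
  c₂ * X ^ (5 / 6 : ℝ) *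
    ((∏ p ∈ A, (1 - (1 - (p : ℝ) ^ (-(5 / 3) : ℝ)) * (1 - (p : ℝ) ^ (-2 : ℝ)))) *
      ∏ p ∈ E, (1 + (p : ℝ) ^ (-(1 / 3) : ℝ)))

theorem mainS_insert (c₁ c₂ : ℝ) {p : ℕ} (hp : p.Prime) {A E : Finset ℕ} (hpA : p ∉ A)
    (hpE : p ∉ E) {X : ℝ} (hX : 0 ≤ X) :
    mainS c₁ c₂ (insert p A) E X = mainS c₁ c₂ A (insert p E) (X / p ^ 2) +
      mainS c₁ c₂ A E (X / p ^ 4) - mainS c₁ c₂ A (insert p E) (X / p ^ 4) := by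
  have hp0 : (0 : ℝ) < p := by exact_mod_cast hp.pos
  simp only [mainS, prod_insert hpA, prod_insert hpE]
  have d2 : (X / p ^ 2) ^ (5 / 6 : ℝ) = X ^ (5 / 6 : ℝ) * (p : ℝ) ^ (-(5 / 3) : ℝ) := by
    rw [div_eq_mul_inv, mul_rpow hX (by positivity), ← rpow_natCast,
      ← rpow_neg hp0.le, ← rpow_mul hp0.le]
    norm_num
  have d4 : (X / p ^ 4) ^ (5 / 6 : ℝ) = X ^ (5 / 6 : ℝ) * (p : ℝ) ^ (-(10 / 3) : ℝ) := by
    rw [div_eq_mul_inv, mul_rpow hX (by positivity), ← rpow_natCast,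
      ← rpow_neg hp0.le, ← rpow_mul hp0.le]
    norm_num
  set t : ℝ := (p : ℝ) ^ (-(1 / 3) : ℝ) with ht
  have pw : ∀ k : ℕ, (p : ℝ) ^ (-(k / 3) : ℝ) = t ^ k := fun k => by
    rw [ht, ← rpow_natCast, ← rpow_mul hp0.le]; congr 1; ring
  have e1 : (p : ℝ) ^ (-1 : ℝ) = t ^ 3 := by rw [← pw]; norm_num
  have e2 : (p : ℝ) ^ (-2 : ℝ) = t ^ 6 := by rw [← pw]; norm_num
  have e3 : (p : ℝ) ^ (-3 : ℝ) = t ^ 9 := by rw [← pw]; norm_num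
  have e5 : (p : ℝ) ^ (-(5 / 3) : ℝ) = t ^ 5 := by rw [← pw]; norm_num
  have e10 : (p : ℝ) ^ (-(10 / 3) : ℝ) = t ^ 10 := by rw [← pw]; norm_num
  have f2 : X / (p : ℝ) ^ 2 = X * t ^ 6 := by
    rw [← e2, rpow_neg hp0.le]; norm_num; rfl
  have f4 : X / (p : ℝ) ^ 4 = X * t ^ 12 := by
    have : (p : ℝ) ^ (-4 : ℝ) = t ^ 12 := by rw [← pw]; norm_num
    rw [← this, rpow_neg hp0.le]; norm_num; rfl
  rw [d2, d4, e1, e2, e3, e5, e10, f2, f4]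
  ring

/-- Comparison of `X ^ u * q ^ v` with `X ^ (83 / 100) * q ^ (-21 / 20)`, split at `q ^ 5 = X`. -/
theorem rpow_mul_rpow_le {X q u v : ℝ} (hX : 1 ≤ X) (hq : 1 ≤ q)
    (hv : 0 ≤ v + 21 / 20 ∧ q ^ 5 ≤ X ∨ v + 21 / 20 ≤ 0 ∧ X ≤ q ^ 5)
    (hu : u + (v + 21 / 20) / 5 ≤ 83 / 100) :
    X ^ u * q ^ v ≤ X ^ (83 / 100 : ℝ) * q ^ (-(21 / 20) : ℝ) := by
  have hX0 : 0 < X := by linarith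
  have hq0 : 0 < q := by linarith
  have key : q ^ (v + 21 / 20) ≤ X ^ ((v + 21 / 20) / 5) := by
    have e : q ^ (v + 21 / 20) = (q ^ 5) ^ ((v + 21 / 20) / 5) := by
      rw [← rpow_natCast, ← rpow_mul hq0.le]; congr 1; push_cast; ring
    rw [e]
    rcases hv with ⟨h1, h2⟩ | ⟨h1, h2⟩
    · exact rpow_le_rpow (by positivity) h2 (by linarith)
    · exact rpow_le_rpow_of_nonpos hX0 h2 (by linarith)
  have e : q ^ v = q ^ (v + 21 / 20) * q ^ (-(21 / 20) : ℝ) := by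
    rw [← rpow_add hq0]; congr 1; ring
  rw [e, ← mul_assoc]
  gcongr
  calc X ^ u * q ^ (v + 21 / 20) ≤ X ^ u * X ^ ((v + 21 / 20) / 5) := by gcongr
    _ = X ^ (u + (v + 21 / 20) / 5) := (rpow_add hX0 _ _).symm
    _ ≤ _ := rpow_le_rpow_of_exponent_le hX hu

theorem abs_prod_sieve_le {s t : ℝ} (hs : 0 ≤ s) (hst : s ≤ t) {q : ℕ} (hq : Squarefree q) :
    |∏ p ∈ q.primeFactors, (1 - (1 - (p : ℝ) ^ (-s)) * (1 - (p : ℝ) ^ (-t)))| ≤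
      3 ^ q.primeFactors.card * (q : ℝ) ^ (-s) := by
  have e : (q : ℝ) ^ (-s) = ∏ p ∈ q.primeFactors, (p : ℝ) ^ (-s) := by
    conv_lhs => rw [← Nat.prod_primeFactors_of_squarefree hq, Nat.cast_prod]
    rw [finsetProd_rpow _ _ fun _ _ => Nat.cast_nonneg _]
  rw [e, abs_prod, ← prod_const, ← prod_mul_distrib]
  refine prod_le_prod (fun _ _ => abs_nonneg _) fun p hp => ?_
  have hp1 : (1 : ℝ) ≤ p := by exact_mod_cast (Nat.prime_of_mem_primeFactors hp).one_le
  have h0 : 0 ≤ (p : ℝ) ^ (-t) := by positivity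
  have h1 : (p : ℝ) ^ (-t) ≤ (p : ℝ) ^ (-s) := rpow_le_rpow_of_exponent_le hp1 (by linarith)
  have h2 : (p : ℝ) ^ (-s) ≤ 1 := rpow_le_one_of_one_le_of_nonpos hp1 (by linarith)
  rw [abs_le]; constructor <;> nlinarith

theorem abs_moebius_le_one (q : ℕ) : |(ArithmeticFunction.moebius q : ℝ)| ≤ 1 := by
  exact_mod_cast ArithmeticFunction.abs_moebius_le_one (n := q)

theorem abs_moebius_mul_prod_le {s t : ℝ} (hs : 0 ≤ s) (hst : s ≤ t) :
    ∃ C : ℝ, 0 < C ∧ ∀ q : ℕ, q ≠ 0 → |(ArithmeticFunction.moebius q : ℝ) *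
      ∏ p ∈ q.primeFactors, (1 - (1 - (p : ℝ) ^ (-s)) * (1 - (p : ℝ) ^ (-t)))| ≤
      C * (q : ℝ) ^ (-s + 1 / 100) := by
  obtain ⟨C, hC, h⟩ := exists_pow_card_primeFactors_le 3 (ε := 1 / 100) (by norm_num)
  refine ⟨C, hC, fun q hq => ?_⟩
  have hq0 : (0 : ℝ) < q := by exact_mod_cast Nat.pos_of_ne_zero hq
  by_cases hs' : Squarefree q
  · rw [abs_mul]
    calc _ ≤ 1 * (3 ^ q.primeFactors.card * (q : ℝ) ^ (-s)) := by
          gcongr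
          · exact abs_moebius_le_one q
          · exact abs_prod_sieve_le hs hst hs'
      _ ≤ 1 * (C * (q : ℝ) ^ (1 / 100 : ℝ) * (q : ℝ) ^ (-s)) := by
          gcongr; exact_mod_cast h q hq
      _ = _ := by rw [rpow_add hq0]; ring
  · rw [ArithmeticFunction.moebius_eq_zero_of_not_squarefree hs']
    simp; positivity

theorem summable_moebius_mul_prod {s t : ℝ} (hs : 11 / 10 ≤ s) (hst : s ≤ t) :
    Summable fun q : ℕ => ‖(ArithmeticFunction.moebius q : ℝ) *
      ∏ p ∈ q.primeFactors, (1 - (1 - (p : ℝ) ^ (-s)) * (1 - (p : ℝ) ^ (-t)))‖ := by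
  obtain ⟨C, hC, h⟩ := abs_moebius_mul_prod_le (s := s) (t := t) (by linarith) hst
  have : Summable fun q : ℕ => C * (q : ℝ) ^ (-s + 1 / 100) :=
    (summable_nat_rpow.2 (by linarith)).mul_left C
  refine this.of_nonneg_of_le (fun _ => norm_nonneg _) fun q => ?_
  rcases eq_or_ne q 0 with rfl | hq
  · simp; positivity
  · exact h q hq

theorem tail_moebius_mul_prod {s t : ℝ} (hs : 3 / 2 ≤ s) (hst : s ≤ t) {f : ℕ → ℝ}
    (hf : f = fun q : ℕ => (ArithmeticFunction.moebius q : ℝ) *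
      ∏ p ∈ q.primeFactors, (1 - (1 - (p : ℝ) ^ (-s)) * (1 - (p : ℝ) ^ (-t)))) :
    ∃ C : ℝ, 0 < C ∧ ∀ X : ℝ, 1 ≤ X → |∑ q ∈ range (⌈X⌉₊ + 1), f q - ∑' q, f q| ≤
      C * X ^ (-s + 3 / 2) := by
  obtain ⟨C, hC, h⟩ := abs_moebius_mul_prod_le (s := s) (t := t) (by linarith) hst
  have hsum : Summable fun q => ‖f q‖ := hf ▸ summable_moebius_mul_prod (by linarith) hst
  have hS : Summable fun q : ℕ => (q : ℝ) ^ (-(3 / 2) + 1 / 100 : ℝ) :=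
    summable_nat_rpow.2 (by norm_num)
  refine ⟨C * (1 + ∑' q : ℕ, (q : ℝ) ^ (-(3 / 2) + 1 / 100 : ℝ)), ?_, fun X hX => ?_⟩
  · have : 0 ≤ ∑' q : ℕ, (q : ℝ) ^ (-(3 / 2) + 1 / 100 : ℝ) := tsum_nonneg fun _ => by positivity
    positivity
  rw [← hsum.of_norm.sum_add_tsum_nat_add (⌈X⌉₊ + 1), sub_add_cancel_left, abs_neg]
  have hb : ∀ q : ℕ, ‖f (q + (⌈X⌉₊ + 1))‖ ≤
      C * X ^ (-s + 3 / 2) * ((q + (⌈X⌉₊ + 1) : ℕ) : ℝ) ^ (-(3 / 2) + 1 / 100 : ℝ) := by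
    intro q
    set n := q + (⌈X⌉₊ + 1)
    have hn : X ≤ n := (Nat.le_ceil X).trans (by exact_mod_cast (by omega))
    have hn0 : (0 : ℝ) < n := by linarith
    have := h n (by omega)
    rw [hf]
    refine this.trans ?_
    rw [mul_assoc]
    gcongr
    calc (n : ℝ) ^ (-s + 1 / 100) = (n : ℝ) ^ (-s + 3 / 2) * (n : ℝ) ^ (-(3 / 2) + 1 / 100 : ℝ) := by
          rw [← rpow_add hn0]; congr 1; ring
      _ ≤ _ := by
          gcongr ?_ * _
          exact rpow_le_rpow_of_nonpos (by linarith) hn (by linarith)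
  have hS' := ((summable_nat_add_iff (⌈X⌉₊ + 1)).2 hS).mul_left (C * X ^ (-s + 3 / 2))
  calc |∑' q, f (q + (⌈X⌉₊ + 1))| ≤ ∑' q, C * X ^ (-s + 3 / 2) *
        ((q + (⌈X⌉₊ + 1) : ℕ) : ℝ) ^ (-(3 / 2) + 1 / 100 : ℝ) := by
        have := tsum_of_norm_bounded hS'.hasSum hb
        exact this
    _ = C * X ^ (-s + 3 / 2) * ∑' q : ℕ, ((q + (⌈X⌉₊ + 1) : ℕ) : ℝ) ^ (-(3 / 2) + 1 / 100 : ℝ) :=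
        tsum_mul_left
    _ ≤ C * X ^ (-s + 3 / 2) * (1 + ∑' q : ℕ, (q : ℝ) ^ (-(3 / 2) + 1 / 100 : ℝ)) := by
        gcongr
        have := hS.sum_add_tsum_nat_add (⌈X⌉₊ + 1)
        have h0 : 0 ≤ ∑ q ∈ range (⌈X⌉₊ + 1), (q : ℝ) ^ (-(3 / 2) + 1 / 100 : ℝ) :=
          sum_nonneg fun _ _ => by positivity
        linarith
    _ = _ := by ring

theorem tS_moebius_bound {c₁ c₂ K : ℝ} (hK : 0 ≤ K)
    (H1 : ∀ E : Finset ℕ, (∀ q ∈ E, q.Prime) → ∀ Y : ℝ, 1 ≤ Y →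
      |tS ∅ E Y - mainS c₁ c₂ ∅ E Y| ≤ K * (Y ^ (19 / 24 : ℝ) * (∏ p ∈ E, (p : ℝ)) ^ (3 / 5 : ℝ) +
        Y ^ (1 / 2 : ℝ) * (∏ p ∈ E, (p : ℝ)) ^ (31 / 20 : ℝ)))
    (H2 : ∀ E : Finset ℕ, (∀ q ∈ E, q.Prime) → ∀ Y : ℝ, 0 ≤ Y →
      tS ∅ E Y ≤ K * (Y * (∏ p ∈ E, (p : ℝ)) ^ (1 / 100 : ℝ))) :
    ∃ C : ℝ, 0 < C ∧ ∀ X : ℝ, 1 ≤ X → ∀ q : ℕ, q ≠ 0 →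
      |(ArithmeticFunction.moebius q : ℝ) *
        (tS q.primeFactors ∅ X - mainS c₁ c₂ q.primeFactors ∅ X)| ≤
      C * (X ^ (83 / 100 : ℝ) * (q : ℝ) ^ (-(21 / 20) : ℝ)) := by
  obtain ⟨B, hB, hBq⟩ := exists_pow_card_primeFactors_le 3 (ε := 1 / 100) (by norm_num)
  refine ⟨B * (2 * K + |c₁| + |c₂| + 1), by positivity, fun X hX q hq => ?_⟩
  have hX0 : 0 < X := by linarith
  by_cases hs : Squarefree q
  swap
  · rw [ArithmeticFunction.moebius_eq_zero_of_not_squarefree hs]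
    simp; positivity
  have hq1 : (1 : ℝ) ≤ q := by exact_mod_cast Nat.pos_of_ne_zero hq
  have hq0 : (0 : ℝ) < q := by linarith
  have hA : ∀ p ∈ q.primeFactors, p.Prime := fun p hp => Nat.prime_of_mem_primeFactors hp
  have hprod : ∏ p ∈ q.primeFactors, (p : ℝ) = q := by
    rw [← Nat.cast_prod, Nat.prod_primeFactors_of_squarefree hs]
  have hdiv : ∀ u : ℝ, (X / (q : ℝ) ^ 2) ^ u = X ^ u * (q : ℝ) ^ (-(2 * u)) := fun u => by
    rw [div_eq_mul_inv, mul_rpow hX0.le (by positivity), ← rpow_natCast,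
      ← rpow_neg hq0.le, ← rpow_mul hq0.le]
    congr 2; push_cast; ring
  have h3 : (3 : ℝ) ^ q.primeFactors.card ≤ B * (q : ℝ) ^ (1 / 100 : ℝ) := by
    exact_mod_cast hBq q hq
  set R := X ^ (83 / 100 : ℝ) * (q : ℝ) ^ (-(21 / 20) : ℝ) with hR
  have hR0 : 0 < R := by positivity
  rw [abs_mul]
  have hmu := abs_moebius_le_one q
  suffices h : |tS q.primeFactors ∅ X - mainS c₁ c₂ q.primeFactors ∅ X| ≤
      B * (2 * K + |c₁| + |c₂| + 1) * R by
    calc _ ≤ 1 * |tS q.primeFactors ∅ X - mainS c₁ c₂ q.primeFactors ∅ X| := by gcongr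
      _ ≤ _ := by linarith
  rcases le_total ((q : ℝ) ^ 5) X with hqX | hqX
  · have h4 : (q : ℝ) ^ 4 ≤ X := (pow_le_pow_right₀ hq1 (by norm_num)).trans hqX
    have := abs_le_of_hecke_recursion (Y₀ := 1) (D := fun A E Y => tS A E Y - mainS c₁ c₂ A E Y)
      (G := fun y n => K * (y ^ (19 / 24 : ℝ) * n ^ (3 / 5 : ℝ) + y ^ (1 / 2 : ℝ) * n ^ (31 / 20 : ℝ)))
      zero_le_one
      (fun hp hA hE hpA hpE Y hY => by
        simp only [tS_insert hp hA hE hpA hpE, mainS_insert c₁ c₂ hp hpA hpE hY]; ring)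
      (fun {y y' n n'} h1 h2 h3 h4 => by
        have : 0 ≤ y' := h1.trans h2
        have : 0 ≤ n' := h3.trans h4
        gcongr)
      H1 q.primeFactors hA ∅ (by simp) (by simp) X (by rw [hprod]; linarith)
    simp only [hprod, prod_empty, mul_one, hdiv] at this
    have g1 : (q : ℝ) ^ (1 / 100 : ℝ) * (X ^ (19 / 24 : ℝ) * (q : ℝ) ^ (-(2 * (19 / 24)) : ℝ) *
        (q : ℝ) ^ (3 / 5 : ℝ)) ≤ R := by
      have e : (q : ℝ) ^ (1 / 100 : ℝ) * (X ^ (19 / 24 : ℝ) * (q : ℝ) ^ (-(2 * (19 / 24)) : ℝ) *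
        (q : ℝ) ^ (3 / 5 : ℝ)) = X ^ (19 / 24 : ℝ) *
          (q : ℝ) ^ (1 / 100 + (-(2 * (19 / 24)) + 3 / 5) : ℝ) := by
        rw [rpow_add hq0, rpow_add hq0]; ring
      rw [e]
      exact rpow_mul_rpow_le hX hq1 (Or.inl ⟨by norm_num, hqX⟩) (by norm_num)
    have g2 : (q : ℝ) ^ (1 / 100 : ℝ) * (X ^ (1 / 2 : ℝ) * (q : ℝ) ^ (-(2 * (1 / 2)) : ℝ) *
        (q : ℝ) ^ (31 / 20 : ℝ)) ≤ R := by
      have e : (q : ℝ) ^ (1 / 100 : ℝ) * (X ^ (1 / 2 : ℝ) * (q : ℝ) ^ (-(2 * (1 / 2)) : ℝ) *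
        (q : ℝ) ^ (31 / 20 : ℝ)) = X ^ (1 / 2 : ℝ) *
          (q : ℝ) ^ (1 / 100 + (-(2 * (1 / 2)) + 31 / 20) : ℝ) := by
        rw [rpow_add hq0, rpow_add hq0]; ring
      rw [e]
      exact rpow_mul_rpow_le hX hq1 (Or.inl ⟨by norm_num, hqX⟩) (by norm_num)
    refine this.trans ?_
    calc _ ≤ B * (q : ℝ) ^ (1 / 100 : ℝ) * (K * (X ^ (19 / 24 : ℝ) * (q : ℝ) ^ (-(2 * (19 / 24)) : ℝ) *
          (q : ℝ) ^ (3 / 5 : ℝ) + X ^ (1 / 2 : ℝ) * (q : ℝ) ^ (-(2 * (1 / 2)) : ℝ) *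
          (q : ℝ) ^ (31 / 20 : ℝ))) := by gcongr
      _ = B * K * ((q : ℝ) ^ (1 / 100 : ℝ) * (X ^ (19 / 24 : ℝ) * (q : ℝ) ^ (-(2 * (19 / 24)) : ℝ) *
          (q : ℝ) ^ (3 / 5 : ℝ)) + (q : ℝ) ^ (1 / 100 : ℝ) * (X ^ (1 / 2 : ℝ) *
          (q : ℝ) ^ (-(2 * (1 / 2)) : ℝ) * (q : ℝ) ^ (31 / 20 : ℝ))) := by ring
      _ ≤ B * K * (R + R) := by gcongr
      _ = B * (2 * K) * R := by ring
      _ ≤ _ := by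
          gcongr
          linarith [abs_nonneg c₁, abs_nonneg c₂]
  · have := abs_le_of_hecke_recursion (Y₀ := 0) (D := fun A E Y => tS A E Y)
      (G := fun y n => K * (y * n ^ (1 / 100 : ℝ)))
      le_rfl
      (fun hp hA hE hpA hpE Y hY => by
        simp only [tS_insert hp hA hE hpA hpE])
      (fun {y y' n n'} h1 h2 h3 h4 => by
        have : 0 ≤ y' := h1.trans h2
        have : 0 ≤ n' := h3.trans h4
        gcongr)
      (fun E hE Y hY => by rw [abs_of_nonneg (tS_nonneg _ _ _)]; exact H2 E hE Y hY)
      q.primeFactors hA ∅ (by simp) (by simp) X (by simpa using hX0.le)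
    simp only [hprod, prod_empty, mul_one] at this
    have d1 : X / (q : ℝ) ^ 2 = X ^ (1 : ℝ) * (q : ℝ) ^ (-2 : ℝ) := by
      have := hdiv 1
      rw [rpow_one] at this; rw [this]; norm_num
    rw [d1] at this
    have g : ∀ u v : ℝ, v + 1 / 100 + 21 / 20 ≤ 0 → u + (v + 1 / 100 + 21 / 20) / 5 ≤ 83 / 100 →
        (q : ℝ) ^ (1 / 100 : ℝ) * (X ^ u * (q : ℝ) ^ v) ≤ R := fun u v h1 h2 => by
      have e : (q : ℝ) ^ (1 / 100 : ℝ) * (X ^ u * (q : ℝ) ^ v) =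
          X ^ u * (q : ℝ) ^ (v + 1 / 100) := by
        rw [rpow_add hq0]; ring
      rw [e]
      exact rpow_mul_rpow_le hX hq1 (Or.inr ⟨h1, hqX⟩) h2
    have t1 : |tS q.primeFactors ∅ X| ≤ B * K * R := by
      refine this.trans ?_
      calc _ ≤ B * (q : ℝ) ^ (1 / 100 : ℝ) * (K * (X ^ (1 : ℝ) * (q : ℝ) ^ (-2 : ℝ) *
            (q : ℝ) ^ (1 / 100 : ℝ))) := by gcongr
        _ = B * K * ((q : ℝ) ^ (1 / 100 : ℝ) * (X ^ (1 : ℝ) * (q : ℝ) ^ (-2 + 1 / 100 : ℝ))) := by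
            rw [rpow_add hq0]; ring
        _ ≤ _ := by
            gcongr
            exact g _ _ (by norm_num) (by norm_num)
    have t2 : |mainS c₁ c₂ q.primeFactors ∅ X| ≤ B * (|c₁| + |c₂|) * R := by
      unfold mainS
      simp only [prod_empty, mul_one]
      refine (abs_add_le _ _).trans ?_
      rw [abs_mul, abs_mul, abs_mul, abs_mul, abs_of_pos hX0,
        abs_of_pos (rpow_pos_of_pos hX0 _)]
      have s1 := abs_prod_sieve_le (s := 2) (t := 3) (by norm_num) (by norm_num) hs
      have s2 := abs_prod_sieve_le (s := 5 / 3) (t := 2) (by norm_num) (by norm_num) hs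
      have g1 := g 1 (-2) (by norm_num) (by norm_num)
      have g2 := g (5 / 6) (-(5 / 3)) (by norm_num) (by norm_num)
      rw [rpow_one] at g1
      calc _ ≤ |c₁| * X * (B * (q : ℝ) ^ (1 / 100 : ℝ) * (q : ℝ) ^ (-2 : ℝ)) +
            |c₂| * X ^ (5 / 6 : ℝ) * (B * (q : ℝ) ^ (1 / 100 : ℝ) * (q : ℝ) ^ (-(5 / 3) : ℝ)) := by
            gcongr
            · exact s1.trans (by gcongr)
            · exact s2.trans (by gcongr)
        _ = |c₁| * B * ((q : ℝ) ^ (1 / 100 : ℝ) * (X * (q : ℝ) ^ (-2 : ℝ))) +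
            |c₂| * B * ((q : ℝ) ^ (1 / 100 : ℝ) * (X ^ (5 / 6 : ℝ) * (q : ℝ) ^ (-(5 / 3) : ℝ))) := by
            ring
        _ ≤ |c₁| * B * R + |c₂| * B * R := by gcongr
        _ = _ := by ring
    calc _ ≤ B * K * R + B * (|c₁| + |c₂|) * R := (abs_sub _ _).trans (add_le_add t1 t2)
      _ = B * (K + |c₁| + |c₂|) * R := by ring
      _ ≤ _ := by
          refine mul_le_mul_of_nonneg_right (mul_le_mul_of_nonneg_left ?_ hB.le) hR0.le
          linarith

theorem tendsto_nM {c₁ c₂ K : ℝ} (hK : 0 ≤ K)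
    (H1 : ∀ E : Finset ℕ, (∀ q ∈ E, q.Prime) → ∀ Y : ℝ, 1 ≤ Y →
      |tS ∅ E Y - mainS c₁ c₂ ∅ E Y| ≤ K * (Y ^ (19 / 24 : ℝ) * (∏ p ∈ E, (p : ℝ)) ^ (3 / 5 : ℝ) +
        Y ^ (1 / 2 : ℝ) * (∏ p ∈ E, (p : ℝ)) ^ (31 / 20 : ℝ)))
    (H2 : ∀ E : Finset ℕ, (∀ q ∈ E, q.Prime) → ∀ Y : ℝ, 0 ≤ Y →
      tS ∅ E Y ≤ K * (Y * (∏ p ∈ E, (p : ℝ)) ^ (1 / 100 : ℝ))) :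
    Tendsto (fun X : ℝ => (nM X - c₁ * X / ((riemannZeta 2).re * (riemannZeta 3).re)
      - c₂ * X ^ (5 / 6 : ℝ) / ((riemannZeta (5 / 3)).re * (riemannZeta 2).re)) / X ^ (5 / 6 : ℝ))
      atTop (𝓝 0) := by
  obtain ⟨C, hC, hb⟩ := tS_moebius_bound hK H1 H2
  obtain ⟨T₁, hT₁, ht1⟩ := tail_moebius_mul_prod (s := 2) (t := 3) (by norm_num) (by norm_num) rfl
  obtain ⟨T₂, hT₂, ht2⟩ := tail_moebius_mul_prod (s := 5 / 3) (t := 2) (by norm_num) (by norm_num) rfl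
  have z1 := tsum_moebius_mul_prod (s := 2) (t := 3) (by norm_num) (by norm_num)
    (summable_moebius_mul_prod (by norm_num) (by norm_num)) (α := fun p =>
      (1 - (1 - (p : ℝ) ^ (-2 : ℝ)) * (1 - (p : ℝ) ^ (-3 : ℝ)))) (fun p _ => by ring)
  have z2 := tsum_moebius_mul_prod (s := 5 / 3) (t := 2) (by norm_num) (by norm_num)
    (summable_moebius_mul_prod (by norm_num) (by norm_num)) (α := fun p =>
      (1 - (1 - (p : ℝ) ^ (-(5 / 3) : ℝ)) * (1 - (p : ℝ) ^ (-2 : ℝ)))) (fun p _ => by ring)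
  push_cast at z1 z2
  set S₁ := ∑' q : ℕ, (ArithmeticFunction.moebius q : ℝ) * ∏ p ∈ q.primeFactors,
    (1 - (1 - (p : ℝ) ^ (-2 : ℝ)) * (1 - (p : ℝ) ^ (-3 : ℝ))) with hS1
  set S₂ := ∑' q : ℕ, (ArithmeticFunction.moebius q : ℝ) * ∏ p ∈ q.primeFactors,
    (1 - (1 - (p : ℝ) ^ (-(5 / 3) : ℝ)) * (1 - (p : ℝ) ^ (-2 : ℝ))) with hS2
  have hS : Summable fun q : ℕ => (q : ℝ) ^ (-(21 / 20) : ℝ) :=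
    summable_nat_rpow.2 (by norm_num)
  set Z := ∑' q : ℕ, (q : ℝ) ^ (-(21 / 20) : ℝ) with hZ
  have bound : ∀ X : ℝ, 1 ≤ X → |(nM X - c₁ * X / ((riemannZeta 2).re * (riemannZeta 3).re)
      - c₂ * X ^ (5 / 6 : ℝ) / ((riemannZeta (5 / 3)).re * (riemannZeta 2).re)) / X ^ (5 / 6 : ℝ)| ≤
      (C * Z + |c₁| * T₁ + |c₂| * T₂) * X ^ (-(1 / 300) : ℝ) := by
    intro X hX
    have hX0 : 0 < X := by linarith
    set s := range (⌈X⌉₊ + 1) with hs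
    have i1 : c₁ * X / ((riemannZeta 2).re * (riemannZeta 3).re) = c₁ * X * S₁ := by
      rw [eq_div_of_mul_eq (right_ne_zero_of_mul_eq_one z1) z1]; ring
    have i2 : c₂ * X ^ (5 / 6 : ℝ) / ((riemannZeta (5 / 3)).re * (riemannZeta 2).re) =
        c₂ * X ^ (5 / 6 : ℝ) * S₂ := by
      rw [eq_div_of_mul_eq (right_ne_zero_of_mul_eq_one z2) z2]; ring
    have m : ∑ q ∈ s, (ArithmeticFunction.moebius q : ℝ) * mainS c₁ c₂ q.primeFactors ∅ X =
        c₁ * X * ∑ q ∈ s, (ArithmeticFunction.moebius q : ℝ) * ∏ p ∈ q.primeFactors,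
          (1 - (1 - (p : ℝ) ^ (-2 : ℝ)) * (1 - (p : ℝ) ^ (-3 : ℝ))) +
        c₂ * X ^ (5 / 6 : ℝ) * ∑ q ∈ s, (ArithmeticFunction.moebius q : ℝ) *
          ∏ p ∈ q.primeFactors, (1 - (1 - (p : ℝ) ^ (-(5 / 3) : ℝ)) * (1 - (p : ℝ) ^ (-2 : ℝ))) := by
      rw [mul_sum, mul_sum, ← sum_add_distrib]
      refine sum_congr rfl fun q _ => ?_
      simp only [mainS, prod_empty]; ring
    have d : |nM X - ∑ q ∈ s, (ArithmeticFunction.moebius q : ℝ) *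
        mainS c₁ c₂ q.primeFactors ∅ X| ≤ C * Z * X ^ (83 / 100 : ℝ) := by
      rw [nM_eq, ← sum_sub_distrib]
      simp only [← mul_sub]
      refine (abs_sum_le_sum_abs _ _).trans ?_
      calc _ ≤ ∑ q ∈ s, C * X ^ (83 / 100 : ℝ) * (q : ℝ) ^ (-(21 / 20) : ℝ) := by
            refine sum_le_sum fun q _ => ?_
            rcases eq_or_ne q 0 with rfl | hq
            · simp
            · rw [mul_assoc]; exact hb X hX q hq
        _ = C * X ^ (83 / 100 : ℝ) * ∑ q ∈ s, (q : ℝ) ^ (-(21 / 20) : ℝ) := by rw [mul_sum]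
        _ ≤ C * X ^ (83 / 100 : ℝ) * Z := by
            gcongr
            exact hS.sum_le_tsum _ fun _ _ => by positivity
        _ = _ := by ring
    rw [abs_div, abs_of_pos (rpow_pos_of_pos hX0 _), div_le_iff₀ (by positivity), mul_assoc,
      ← rpow_add hX0, i1, i2]
    have t1 := ht1 X hX
    have t2 := ht2 X hX
    rw [← hs] at t1 t2
    set P₁ := ∑ q ∈ s, (ArithmeticFunction.moebius q : ℝ) * ∏ p ∈ q.primeFactors,
          (1 - (1 - (p : ℝ) ^ (-2 : ℝ)) * (1 - (p : ℝ) ^ (-3 : ℝ)))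
    set P₂ := ∑ q ∈ s, (ArithmeticFunction.moebius q : ℝ) *
          ∏ p ∈ q.primeFactors, (1 - (1 - (p : ℝ) ^ (-(5 / 3) : ℝ)) * (1 - (p : ℝ) ^ (-2 : ℝ)))
    rw [m] at d
    have x1 : X * X ^ (-2 + 3 / 2 : ℝ) ≤ X ^ (-(1 / 300) + 5 / 6 : ℝ) := by
      rw [← rpow_one_add' hX0.le (by norm_num)]
      exact rpow_le_rpow_of_exponent_le hX (by norm_num)
    have x2 : X ^ (5 / 6 : ℝ) * X ^ (-(5 / 3) + 3 / 2 : ℝ) ≤ X ^ (-(1 / 300) + 5 / 6 : ℝ) := by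
      rw [← rpow_add hX0]
      exact rpow_le_rpow_of_exponent_le hX (by norm_num)
    have x3 : X ^ (83 / 100 : ℝ) ≤ X ^ (-(1 / 300) + 5 / 6 : ℝ) :=
      rpow_le_rpow_of_exponent_le hX (by norm_num)
    have hZ0 : 0 ≤ Z := tsum_nonneg fun _ => by positivity
    have e : nM X - c₁ * X * S₁ - c₂ * X ^ (5 / 6 : ℝ) * S₂ =
      (nM X - (c₁ * X * P₁ + c₂ * X ^ (5 / 6 : ℝ) * P₂)) + c₁ * X * (P₁ - S₁) +
        c₂ * X ^ (5 / 6 : ℝ) * (P₂ - S₂) := by ring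
    rw [e]
    refine (abs_add_le _ _).trans ?_
    rw [abs_mul, abs_mul, abs_of_pos (rpow_pos_of_pos hX0 _)]
    refine (add_le_add_left (abs_add_le _ _) _).trans ?_
    rw [abs_mul, abs_mul, abs_of_pos hX0]
    calc _ ≤ C * Z * X ^ (83 / 100 : ℝ) + |c₁| * X * (T₁ * X ^ (-2 + 3 / 2 : ℝ)) +
          |c₂| * X ^ (5 / 6 : ℝ) * (T₂ * X ^ (-(5 / 3) + 3 / 2 : ℝ)) := by gcongr
      _ = C * Z * X ^ (83 / 100 : ℝ) + |c₁| * T₁ * (X * X ^ (-2 + 3 / 2 : ℝ)) +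
          |c₂| * T₂ * (X ^ (5 / 6 : ℝ) * X ^ (-(5 / 3) + 3 / 2 : ℝ)) := by ring
      _ ≤ C * Z * X ^ (-(1 / 300) + 5 / 6 : ℝ) + |c₁| * T₁ * X ^ (-(1 / 300) + 5 / 6 : ℝ) +
          |c₂| * T₂ * X ^ (-(1 / 300) + 5 / 6 : ℝ) := by gcongr
      _ = _ := by ring
  refine squeeze_zero_norm' (a := fun X : ℝ => (C * Z + |c₁| * T₁ + |c₂| * T₂) *
    X ^ (-(1 / 300) : ℝ)) ?_ ?_
  · filter_upwards [eventually_ge_atTop 1] with X hX using bound X hX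
  · simpa using (tendsto_rpow_neg_atTop (y := 1 / 300) (by norm_num)).const_mul
      (C * Z + |c₁| * T₁ + |c₂| * T₂)

end

section
open Matrix Finset

theorem nmx_of_dvd {p : ℕ} (hp : p.Prime) {f : BCF} (γ : GLZ) (h1 : (p : ℤ) ^ 2 ∣ (f.comp γ).a)
    (h2 : (p : ℤ) ∣ (f.comp γ).b) : f.Nmx p := by
  refine Or.inr ?_
  have e : oo p (f.comp γ) = oo p f := cnt_GLZ hp 2 f γ
  rw [← e, oo, cnt, Nat.one_le_iff_ne_zero, ← Nat.pos_iff_ne_zero, card_pos]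
  refine ⟨none, ?_⟩
  classical
  rw [mem_filter]
  refine ⟨mem_univ _, (dv_comp_hm_none _ _).2 ⟨h1, ?_, dvd_mul_left _ _, ?_⟩⟩
  · rw [pow_two]; exact mul_dvd_mul_right h2 _
  · exact Dvd.dvd.mul_left (pow_dvd_pow _ (by norm_num)) _

theorem Nmx.exists_scale {p : ℕ} {f : BCF} (h : f.Nmx p) :
    (∃ g : BCF, f = g.scale p) ∨
      ∃ (g : BCF) (j : Option (Fin p)), f.comp (hm p j) = g.scale ((p : ℤ) ^ 2) := by
  rcases h with h | h
  · obtain ⟨g, hg⟩ := dv_iff.1 h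
    exact Or.inl ⟨g, hg.symm⟩
  · rw [oo, cnt, Nat.one_le_iff_ne_zero, ← Nat.pos_iff_ne_zero, card_pos] at h
    obtain ⟨j, hj⟩ := h
    classical
    rw [mem_filter] at hj
    obtain ⟨g, hg⟩ := dv_iff.1 hj.2
    exact Or.inr ⟨g, j, hg.symm⟩

theorem comp_adjugate (f : BCF) (g : Matrix (Fin 2) (Fin 2) ℤ) :
    (f.comp g).comp g.adjugate = f.scale (g.det ^ 3) := by
  rw [← comp_mul, mul_adjugate, det_fin_two]
  ext <;> simp [comp, scale] <;> ring

theorem nmx_of_column {p : ℕ} (hp : p.Prime) {f k : BCF} {g : Matrix (Fin 2) (Fin 2) ℤ} {j : ℕ}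
    (h : f.comp g = k.scale ((p : ℤ) ^ j * g.det ^ 2)) (h0 : g.det ≠ 0) (hd : (p : ℤ) ∣ g.det)
    (hc : ¬ ((p : ℤ) ∣ g 0 0 ∧ (p : ℤ) ∣ g 1 0)) : f.Nmx p := by
  have hpp : Prime (p : ℤ) := Nat.prime_iff_prime_int.mp hp
  set e : ℤ := (Int.gcd (g 0 0) (g 1 0) : ℤ) with he
  have hpe : ¬ (p : ℤ) ∣ e := fun h' => hc ⟨h'.trans (Int.gcd_dvd_left ..), h'.trans (Int.gcd_dvd_right ..)⟩
  obtain ⟨x, hx⟩ : e ∣ g 0 0 := Int.gcd_dvd_left ..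
  obtain ⟨z, hz⟩ : e ∣ g 1 0 := Int.gcd_dvd_right ..
  have he0 : e ≠ 0 := fun h' => hpe (h' ▸ dvd_zero _)
  obtain ⟨s, t, hst⟩ : ∃ s t : ℤ, x * s - t * z = 1 := by
    refine ⟨Int.gcdA (g 0 0) (g 1 0), -Int.gcdB (g 0 0) (g 1 0), ?_⟩
    have := Int.gcd_eq_gcd_ab (g 0 0) (g 1 0)
    rw [← he] at this
    apply mul_left_cancel₀ he0
    linear_combination -this - Int.gcdA (g 0 0) (g 1 0) * hx - Int.gcdB (g 0 0) (g 1 0) * hz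
  set γ := GLZ.mk x t z s (Or.inl hst) with hγ
  set B := s * g 0 1 - t * g 1 1
  set C := x * g 1 1 - z * g 0 1
  have hg : g = γ.1 * !![e, B; 0, C] := by
    rw [hγ, GLZ.coe_mk]
    ext i j
    fin_cases i <;> fin_cases j
    · simp [hx]; ring
    · simp only [mul_apply, Fin.sum_univ_two]; simp [B, C]; linear_combination (-g 0 1) * hst
    · simp [hz]; ring
    · simp only [mul_apply, Fin.sum_univ_two]; simp [B, C]; linear_combination (-g 1 1) * hst
  have hdet : g.det = e * C := by
    rw [hg, det_mul, hγ, GLZ.coe_mk, det_fin_two_of, det_fin_two_of]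
    linear_combination (e * C) * hst
  have hC0 : C ≠ 0 := fun h' => h0 (by rw [hdet, h', mul_zero])
  have hpC : (p : ℤ) ∣ C := (hpp.dvd_or_dvd (hdet ▸ hd)).resolve_left hpe
  obtain ⟨n, C', hC', hCC⟩ := (Int.finiteMultiplicity_iff.2 ⟨by simpa using hp.ne_one, hC0⟩
    : FiniteMultiplicity (p : ℤ) C).exists_eq_pow_mul_and_not_dvd |> fun ⟨c, h1, h2⟩ =>
      (⟨_, c, h1, h2⟩ : ∃ (n : ℕ) (C' : ℤ), C = (p : ℤ) ^ n * C' ∧ ¬ (p : ℤ) ∣ C')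
  have hn : n ≠ 0 := fun h' => hCC (by rw [hC', h', pow_zero, one_mul] at hpC; exact hpC)
  rw [hdet, hg, comp_mul] at h
  set F := f.comp γ.1 with hF
  have ha := congrArg BCF.a h
  have hb := congrArg BCF.b h
  simp [comp, scale] at ha hb
  have hce : ∀ k : ℕ, IsCoprime ((p : ℤ) ^ k) e := fun k =>
    IsCoprime.pow_left ((Prime.coprime_iff_not_dvd hpp).2 hpe)
  have d1 : (p : ℤ) ^ (2 * n) ∣ F.a := by
    refine ((hce (2 * n)).pow_right (n := 3)).dvd_of_dvd_mul_right (ha ▸ ?_)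
    rw [hC']
    exact ⟨(p : ℤ) ^ j * (e * C') ^ 2 * k.a, by ring⟩
  have d2 : (p : ℤ) ^ n ∣ F.b := by
    have h3 : (p : ℤ) ^ (2 * n) ∣ F.b * (e ^ 2 * C) := by
      have : F.b * (e ^ 2 * C) = (p : ℤ) ^ j * (e * C) ^ 2 * k.b - F.a * (3 * e ^ 2 * B) := by
        rw [← hb]; ring
      rw [this]
      refine dvd_sub ?_ (d1.mul_right _)
      rw [hC']
      exact ⟨(p : ℤ) ^ j * (e * C') ^ 2 * k.b, by ring⟩
    have h4 : (p : ℤ) ^ n ∣ F.b * C' * e ^ 2 := by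
      rw [hC', two_mul, pow_add] at h3
      refine (mul_dvd_mul_iff_left (pow_ne_zero n hpp.ne_zero)).1 (h3.trans (dvd_of_eq ?_))
      ring
    have h5 := ((hce n).pow_right (n := 2)).dvd_of_dvd_mul_right h4
    exact IsCoprime.dvd_of_dvd_mul_right
      (IsCoprime.pow_left ((Prime.coprime_iff_not_dvd hpp).2 hCC)) h5
  exact nmx_of_dvd hp γ ((pow_dvd_pow _ (by omega)).trans d1) ((dvd_pow_self _ hn).trans d2)

theorem nmx_of_comp_aux {p : ℕ} (hp : p.Prime) {f : BCF} (N : ℕ) : ∀ (k : BCF)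
    (g : Matrix (Fin 2) (Fin 2) ℤ) (j : ℕ), g.det.natAbs ≤ N →
    f.comp g = k.scale ((p : ℤ) ^ j * g.det ^ 2) → g.det ≠ 0 → ((p : ℤ) ∣ g.det ∨ 1 ≤ j) →
    f.Nmx p := by
  have hpp : Prime (p : ℤ) := Nat.prime_iff_prime_int.mp hp
  induction N with
  | zero => intro k g j h1 _ h2; exact absurd (Int.natAbs_eq_zero.1 (by omega)) h2
  | succ N ih =>
    intro k g j hN h h0 hj
    by_cases hd : (p : ℤ) ∣ g.det
    swap
    · have hj1 := hj.resolve_left hd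
      have h1 := comp_adjugate f g
      rw [h, comp_scale, eq_comm] at h1
      have h2 : (f.scale (g.det ^ 3)).Dv p := by
        rw [h1]
        refine dv_iff.2 ⟨(k.comp g.adjugate).scale ((p : ℤ) ^ (j - 1) * g.det ^ 2), ?_⟩
        rw [scale_scale]
        congr 1
        rw [← mul_assoc, ← pow_succ', Nat.sub_add_cancel hj1]
      have hcop : IsCoprime (p : ℤ) (g.det ^ 3) :=
        ((Prime.coprime_iff_not_dvd hpp).2 hd).pow_right
      exact Or.inl ((dv_scale_of_isCoprime hcop).1 h2)
    by_cases hc : (p : ℤ) ∣ g 0 0 ∧ (p : ℤ) ∣ g 1 0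
    swap
    · exact nmx_of_column hp h h0 hd hc
    by_cases hc' : (p : ℤ) ∣ g 0 1 ∧ (p : ℤ) ∣ g 1 1
    swap
    · have hsw : (!![0, 1; 1, 0] : Matrix (Fin 2) (Fin 2) ℤ).det = -1 := by
        simp [det_fin_two_of]
      have hdet : (g * !![0, 1; 1, 0]).det = - g.det := by
        rw [det_mul, hsw]; ring
      refine nmx_of_column hp (f := f) (k := k.comp !![0, 1; 1, 0]) (g := g * !![0, 1; 1, 0]) (j := j)
        ?_ ?_ ?_ ?_
      · rw [comp_mul, h, comp_scale, hdet]; congr 1; ring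
      · rw [hdet]; exact neg_ne_zero.2 h0
      · rw [hdet]; exact (dvd_neg).2 hd
      · simpa [mul_apply, Fin.sum_univ_two] using hc'
    obtain ⟨⟨x, hx⟩, z, hz⟩ := hc
    obtain ⟨⟨y, hy⟩, w, hw⟩ := hc'
    have hg : g = ((p : ℤ) • !![x, y; z, w] : Matrix (Fin 2) (Fin 2) ℤ) := by
      ext i j
      fin_cases i <;> fin_cases j <;> simp [hx, hy, hz, hw]
    have hdet : g.det = (p : ℤ) ^ 2 * (!![x, y; z, w] : Matrix (Fin 2) (Fin 2) ℤ).det := by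
      rw [hg, det_smul]; simp
    have hp2 : 2 ≤ (p : ℤ) := by exact_mod_cast hp.two_le
    set m := (!![x, y; z, w] : Matrix (Fin 2) (Fin 2) ℤ).det with hm
    have hm0 : m ≠ 0 := fun h' => h0 (by rw [hdet, h', mul_zero])
    refine ih k !![x, y; z, w] (j + 1) ?_ ?_ hm0 (Or.inr (by omega))
    · have h1 : g.det.natAbs = p ^ 2 * m.natAbs := by
        rw [hdet, Int.natAbs_mul]; simp [Int.natAbs_pow]
      have h2 : 0 < m.natAbs := Int.natAbs_pos.2 hm0
      have h3 : 2 ≤ p := hp.two_le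
      have : 4 * m.natAbs ≤ p ^ 2 * m.natAbs := Nat.mul_le_mul_right _ (by nlinarith)
      omega
    · have h1 : f.comp g = (f.comp !![x, y; z, w]).scale ((p : ℤ) ^ 3) := by
        rw [hg]; ext <;> simp [comp, scale] <;> ring_nf
      rw [h1, hdet] at h
      apply scale_injective (n := (p : ℤ) ^ 3) (pow_ne_zero _ hpp.ne_zero)
      rw [h, scale_scale]
      congr 1; ring

/-- If `f` is obtained from `k` by a sublattice of index divisible by `p`, then `f` is not maximal
at `p`. -/
theorem nmx_of_comp {p : ℕ} (hp : p.Prime) {f k : BCF} {g : Matrix (Fin 2) (Fin 2) ℤ}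
    (h : k.comp g = f.scale g.det) (h0 : g.det ≠ 0) (hd : (p : ℤ) ∣ g.det) : f.Nmx p := by
  have h1 : f.comp g.adjugate = k.scale (g.det ^ 2) := by
    apply scale_injective h0
    rw [scale_scale, ← comp_scale, ← h, comp_adjugate]
    congr 1; ring
  have h2 : g.adjugate.det = g.det := by rw [det_adjugate]; simp
  refine nmx_of_comp_aux hp _ k g.adjugate 0 le_rfl ?_ (by rwa [h2]) (Or.inl (by rwa [h2]))
  rw [h1, h2]; simp

end

section
open Polynomial IntermediateField NumberField

variable {K : Type} [Field K]

theorem exists_int_mul_eq_of_quadratic [NumberField K] (hK : Module.finrank ℚ K = 3) {ξ : K} {A B C : ℤ}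
    (hAB : A ≠ 0 ∨ B ≠ 0) (h : (A : K) * ξ ^ 2 + B * ξ + C = 0) :
    ∃ s t : ℤ, t ≠ 0 ∧ (t : K) * ξ = s := by
  have hint : IsIntegral ℚ ξ := Algebra.IsIntegral.isIntegral ξ
  set P : ℚ[X] := Polynomial.C (A : ℚ) * X ^ 2 + Polynomial.C (B : ℚ) * X + Polynomial.C (C : ℚ) with hP
  have hP0 : P ≠ 0 := by
    intro h0
    rcases hAB with h1 | h1
    · have := congrArg (fun p => coeff p 2) h0
      simp only [hP, coeff_add, coeff_C_mul, coeff_X_pow, coeff_X, coeff_C, coeff_zero] at this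
      norm_num at this
      exact h1 this
    · have := congrArg (fun p => coeff p 1) h0
      simp only [hP, coeff_add, coeff_C_mul, coeff_X_pow, coeff_X, coeff_C, coeff_zero] at this
      norm_num at this
      exact h1 this
  have hPr : aeval ξ P = 0 := by
    simp [hP]; exact_mod_cast h
  have hdeg : (minpoly ℚ ξ).natDegree ≤ 2 :=
    (natDegree_le_of_dvd (minpoly.dvd ℚ ξ hPr) hP0).trans natDegree_quadratic_le
  have hdvd : (minpoly ℚ ξ).natDegree ∣ 3 := hK ▸ minpoly.degree_dvd hint
  have h1 : (minpoly ℚ ξ).natDegree = 1 := by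
    rcases (Nat.dvd_prime Nat.prime_three).1 hdvd with h | h
    · exact h
    · omega
  obtain ⟨r, hr⟩ := minpoly.natDegree_eq_one_iff.1 h1
  refine ⟨r.num, r.den, by exact_mod_cast r.den_nz, ?_⟩
  rw [← hr]
  have : ((r.den : ℚ)) * r = r.num := by rw [mul_comm]; exact Rat.mul_den_eq_num r
  have := congrArg (algebraMap ℚ K) this
  rw [map_mul, map_natCast, map_intCast] at this
  exact_mod_cast this

/-- `K` contains a root of the form `f`. -/
def Root (f : BCF) (K : Type) [Field K] : Prop :=
  ∃ θ : K, (f.a : K) * θ ^ 3 + f.b * θ ^ 2 + f.c * θ + f.d = 0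

theorem Irr.not_rational [CharZero K] {f : BCF} (hf : f.Irr) {θ : K}
    (h : (f.a : K) * θ ^ 3 + f.b * θ ^ 2 + f.c * θ + f.d = 0) {s t : ℤ}
    (hst : (t : K) * θ = s) : s = 0 ∧ t = 0 := by
  refine hf s t ?_
  have : ((f.eval s t : ℤ) : K) = 0 := by
    simp only [eval]
    push_cast
    rw [← hst]
    linear_combination (t : K) ^ 3 * h
  exact_mod_cast this

theorem Root.comp [CharZero K] {f : BCF} (hf : f.Irr) (h : f.Root K)
    {g : Matrix (Fin 2) (Fin 2) ℤ} (hg : g.det ≠ 0) : (f.comp g).Root K := by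
  obtain ⟨θ, hθ⟩ := h
  have hden : -(g 1 0 : K) * θ + g 0 0 ≠ 0 := by
    intro h0
    obtain ⟨h1, h2⟩ := hf.not_rational hθ (s := g 0 0) (t := g 1 0) (by linear_combination -h0)
    exact hg (by rw [Matrix.det_fin_two, h1, h2]; ring)
  set D := -(g 1 0 : K) * θ + g 0 0 with hD
  set η := (g 1 1 * θ - g 0 1) / D with hη
  have hηD : η * D = g 1 1 * θ - g 0 1 := div_mul_cancel₀ _ hden
  refine ⟨η, mul_left_cancel₀ (pow_ne_zero 3 hden) ?_⟩
  have h1 : (g 0 0 : K) * (η * D) + g 0 1 * D = (g 0 0 * g 1 1 - g 0 1 * g 1 0) * θ := by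
    rw [hηD, hD]; ring
  have h2 : (g 1 0 : K) * (η * D) + g 1 1 * D = (g 0 0 * g 1 1 - g 0 1 * g 1 0) := by
    rw [hηD, hD]; ring
  trans (f.a : K) * (g 0 0 * (η * D) + g 0 1 * D) ^ 3 +
    f.b * (g 0 0 * (η * D) + g 0 1 * D) ^ 2 * (g 1 0 * (η * D) + g 1 1 * D) +
    f.c * (g 0 0 * (η * D) + g 0 1 * D) * (g 1 0 * (η * D) + g 1 1 * D) ^ 2 +
    f.d * (g 1 0 * (η * D) + g 1 1 * D) ^ 3
  · simp only [BCF.comp]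
    push_cast
    ring
  · rw [h1, h2]
    linear_combination ((g 0 0 : K) * g 1 1 - g 0 1 * g 1 0) ^ 3 * hθ

theorem root_scale_iff [CharZero K] {f : BCF} {n : ℤ} (hn : n ≠ 0) :
    (f.scale n).Root K ↔ f.Root K := by
  have hn' : (n : K) ≠ 0 := by exact_mod_cast hn
  refine exists_congr fun θ => ?_
  simp only [scale]
  push_cast
  rw [show (n : K) * f.a * θ ^ 3 + n * f.b * θ ^ 2 + n * f.c * θ + n * f.d =
    n * (f.a * θ ^ 3 + f.b * θ ^ 2 + f.c * θ + f.d) by ring, mul_eq_zero]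
  exact or_iff_right hn'

theorem finrank_adjoin_eq [NumberField K] (hK : Module.finrank ℚ K = 3) {f : BCF} (hf : f.Irr) {θ : K}
    (h : (f.a : K) * θ ^ 3 + f.b * θ ^ 2 + f.c * θ + f.d = 0) : ℚ⟮θ⟯ = ⊤ ∧
    minpoly ℚ θ = Polynomial.C (f.a : ℚ)⁻¹ * (Polynomial.C (f.a : ℚ) * X ^ 3 +
      Polynomial.C (f.b : ℚ) * X ^ 2 + Polynomial.C (f.c : ℚ) * X + Polynomial.C (f.d : ℚ)) := by
  have hint : IsIntegral ℚ θ := Algebra.IsIntegral.isIntegral θ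
  have ha : (f.a : ℚ) ≠ 0 := by exact_mod_cast hf.a_ne
  have hdvd : (minpoly ℚ θ).natDegree ∣ 3 := hK ▸ minpoly.degree_dvd hint
  have h3 : (minpoly ℚ θ).natDegree = 3 := by
    rcases (Nat.dvd_prime Nat.prime_three).1 hdvd with h1 | h1
    · obtain ⟨r, hr⟩ := minpoly.natDegree_eq_one_iff.1 h1
      have : ((r.den : ℤ) : K) * θ = (r.num : ℤ) := by
        rw [← hr]
        have : ((r.den : ℚ)) * r = r.num := by rw [mul_comm]; exact Rat.mul_den_eq_num r
        have := congrArg (algebraMap ℚ K) this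
        rw [map_mul, map_natCast, map_intCast] at this
        exact_mod_cast this
      have := (hf.not_rational h this).2
      simp at this
    · exact h1
  constructor
  · apply IntermediateField.eq_of_le_of_finrank_eq le_top
    rw [adjoin.finrank hint, h3, IntermediateField.finrank_top', hK]
  · set P := Polynomial.C (f.a : ℚ) * X ^ 3 +
      Polynomial.C (f.b : ℚ) * X ^ 2 + Polynomial.C (f.c : ℚ) * X + Polynomial.C (f.d : ℚ) with hP
    have hPd : P.natDegree = 3 := natDegree_cubic ha
    have hPl : P.leadingCoeff = f.a := leadingCoeff_cubic ha
    have hmon : (Polynomial.C (f.a : ℚ)⁻¹ * P).Monic := by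
      rw [Monic, leadingCoeff_mul, leadingCoeff_C, hPl, inv_mul_cancel₀ ha]
    refine (eq_of_monic_of_dvd_of_natDegree_le (minpoly.monic hint) hmon ?_ ?_).symm
    · apply minpoly.dvd
      have : aeval θ P = 0 := by simp [hP]; exact_mod_cast h
      rw [map_mul, this, mul_zero]
    · rw [natDegree_C_mul (inv_ne_zero ha), hPd, h3]

theorem Root.equiv [NumberField K] (hK : Module.finrank ℚ K = 3) {L : Type} [Field L] [NumberField L]
    (hL : Module.finrank ℚ L = 3) {f : BCF} (hf : f.Irr) (h1 : f.Root K) (h2 : f.Root L) :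
    Nonempty (K ≃+* L) := by
  obtain ⟨θ, hθ⟩ := h1
  obtain ⟨η, hη⟩ := h2
  obtain ⟨t1, m1⟩ := finrank_adjoin_eq hK hf hθ
  obtain ⟨t2, m2⟩ := finrank_adjoin_eq hL hf hη
  have hi1 : IsIntegral ℚ θ := Algebra.IsIntegral.isIntegral θ
  have hi2 : IsIntegral ℚ η := Algebra.IsIntegral.isIntegral η
  have e3 := adjoinRootEquivAdjoin ℚ hi1
  have e4 := adjoinRootEquivAdjoin ℚ hi2
  rw [m1] at e3
  rw [m2] at e4
  have e1 : K ≃ₐ[ℚ] ℚ⟮θ⟯ := (IntermediateField.topEquiv (F := ℚ) (E := K)).symm.trans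
    (IntermediateField.equivOfEq t1.symm)
  have e2 : ℚ⟮η⟯ ≃ₐ[ℚ] L := (IntermediateField.equivOfEq t2).trans IntermediateField.topEquiv
  exact ⟨((e1.trans (e3.symm.trans e4)).trans e2).toRingEquiv⟩

theorem Root.map {L : Type} [Field L] {f : BCF} (h : f.Root K) (e : K ≃+* L) : f.Root L := by
  obtain ⟨θ, hθ⟩ := h
  refine ⟨e θ, ?_⟩
  have := congrArg e hθ
  simpa using this

theorem exists_root {f : BCF} (hf : f.Irr) : ∃ C : CubicField, f.Root C.carrier := by
  have ha : (f.a : ℚ) ≠ 0 := by exact_mod_cast hf.a_ne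
  set P := Polynomial.C (f.a : ℚ) * X ^ 3 +
      Polynomial.C (f.b : ℚ) * X ^ 2 + Polynomial.C (f.c : ℚ) * X + Polynomial.C (f.d : ℚ) with hP
  have hPd : P.natDegree = 3 := natDegree_cubic ha
  have hirr : Irreducible P := by
    refine (irreducible_iff_roots_eq_zero_of_degree_le_three (by omega) (by omega)).2 ?_
    rw [Multiset.eq_zero_iff_forall_notMem]
    intro r hr
    have h0 : Polynomial.eval r P = 0 := (mem_roots'.1 hr).2
    have h1 : (f.a : ℚ) * r ^ 3 + f.b * r ^ 2 + f.c * r + f.d = 0 := by simpa [hP] using h0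
    have h2 : ((r.den : ℤ) : ℚ) * r = (r.num : ℤ) := by
      rw [mul_comm]; exact_mod_cast Rat.mul_den_eq_num r
    have := (hf.not_rational h1 h2).2
    simp at this
  have : Fact (Irreducible P) := ⟨hirr⟩
  have hfd : FiniteDimensional ℚ (AdjoinRoot P) := (AdjoinRoot.powerBasis hirr.ne_zero).finite
  have hnf : NumberField (AdjoinRoot P) := { to_charZero := charZero_of_injective_algebraMap (algebraMap ℚ _).injective, to_finiteDimensional := hfd }
  refine ⟨⟨AdjoinRoot P, by rw [(AdjoinRoot.powerBasis hirr.ne_zero).finrank]; simp [hPd]⟩,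
    AdjoinRoot.root P, ?_⟩
  have key : ∀ {L : Type} [Field L] (φ : ℚ →+* L) (x : L), eval₂ φ x P = 0 →
      (f.a : L) * x ^ 3 + f.b * x ^ 2 + f.c * x + f.d = 0 := by
    intro L _ φ x hx
    rw [hP] at hx
    simp only [eval₂_add, eval₂_mul, eval₂_pow, eval₂_C, eval₂_X] at hx
    simp only [map_intCast] at hx
    exact hx
  exact key _ _ (AdjoinRoot.eval₂_root P)

end

section
open NumberField

variable {K : Type} [Field K] [NumberField K]

theorem exists_int_of_mul_eq {x : 𝓞 K} {n m : ℤ} (hn : n ≠ 0) (h : (n : 𝓞 K) * x = m) :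
    ∃ k : ℤ, x = k := by
  have hn' : (n : K) ≠ 0 := by exact_mod_cast hn
  have h1 : (n : K) * (x : K) = m := by
    have := congrArg (algebraMap (𝓞 K) K) h
    rw [map_mul, map_intCast, map_intCast] at this
    exact this
  have h2 : (x : K) = algebraMap ℚ K ((m : ℚ) / n) := by
    rw [map_div₀, map_intCast, map_intCast, eq_div_iff hn', mul_comm]
    exact h1
  have h3 : IsIntegral ℤ (x : K) := x.2
  rw [h2, isIntegral_algebraMap_iff (algebraMap ℚ K).injective,
    IsIntegrallyClosed.isIntegral_iff] at h3
  obtain ⟨k, hk⟩ := h3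
  refine ⟨k, ?_⟩
  apply FaithfulSMul.algebraMap_injective (𝓞 K) K
  rw [map_intCast]
  change (x : K) = _
  rw [h2, ← hk]
  simp

theorem exists_basis (hK : Module.finrank ℚ K = 3) :
    ∃ b : Module.Basis (Fin 3) ℤ (𝓞 K), b 0 = 1 := by
  set S : Submodule ℤ (𝓞 K) := Submodule.span ℤ {1} with hS
  have htf : ∀ (n : ℤ) (x : 𝓞 K ⧸ S), n • x = 0 → n = 0 ∨ x = 0 := by
    intro n x h
    obtain ⟨y, rfl⟩ := S.mkQ_surjective x
    by_cases hn : n = 0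
    · exact Or.inl hn
    right
    rw [← map_smul, Submodule.mkQ_apply, Submodule.Quotient.mk_eq_zero,
      Submodule.mem_span_singleton] at h
    obtain ⟨m, hm⟩ := h
    obtain ⟨k, rfl⟩ := exists_int_of_mul_eq (x := y) (m := m) hn (by
      simpa using hm.symm)
    rw [Submodule.mkQ_apply, Submodule.Quotient.mk_eq_zero, Submodule.mem_span_singleton]
    exact ⟨k, by simp⟩
  have : Module.IsTorsionFree ℤ (𝓞 K ⧸ S) := by
    refine Module.IsTorsionFree.of_smul_eq_zero ?_
    intro n x h
    exact htf n x h
  have hfree : Module.Free ℤ (𝓞 K ⧸ S) := inferInstance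
  have hrS : Module.finrank ℤ S = 1 := by
    rw [← (LinearEquiv.toSpanNonzeroSingleton ℤ (𝓞 K) 1 one_ne_zero).finrank_eq,
      Module.finrank_self]
  have hr : Module.finrank ℤ (𝓞 K ⧸ S) = 2 := by
    have := Submodule.finrank_quotient_add_finrank S
    rw [RingOfIntegers.rank, hK, hrS] at this
    omega
  obtain ⟨s, hs⟩ := Module.projective_lifting_property S.mkQ LinearMap.id S.mkQ_surjective
  let bq : Module.Basis (Fin 2) ℤ (𝓞 K ⧸ S) := Module.finBasisOfFinrankEq ℤ _ hr
  have hss : ∀ x, S.mkQ (s x) = x := fun x => LinearMap.congr_fun hs x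
  have hli : LinearIndependent ℤ ![1, s (bq 0), s (bq 1)] := by
    rw [Fintype.linearIndependent_iff]
    intro g hg
    simp only [Fin.sum_univ_three, Matrix.cons_val_zero, Matrix.cons_val_one,
      Matrix.cons_val] at hg
    have h1 := congrArg S.mkQ hg
    have h0 : S.mkQ 1 = 0 := by
      rw [Submodule.mkQ_apply, Submodule.Quotient.mk_eq_zero]
      exact Submodule.mem_span_singleton_self 1
    rw [map_add, map_add, map_smul, map_smul, map_smul, hss, hss, h0, smul_zero, zero_add,
      S.mkQ.map_zero] at h1
    have h2 := Fintype.linearIndependent_iff.1 bq.linearIndependent ![g 1, g 2]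
      (by simpa [Fin.sum_univ_two] using h1)
    have h3 : g 1 = 0 := h2 0
    have h4 : g 2 = 0 := h2 1
    rw [h3, h4, zero_smul, zero_smul, add_zero, add_zero] at hg
    have h5 : g 0 = 0 := by simpa using hg
    intro i
    fin_cases i <;> assumption
  have hsp : ⊤ ≤ Submodule.span ℤ (Set.range ![1, s (bq 0), s (bq 1)]) := by
    intro x _
    have hx : S.mkQ (x - s (S.mkQ x)) = 0 := by rw [map_sub, hss, sub_self]
    rw [Submodule.mkQ_apply, Submodule.Quotient.mk_eq_zero, Submodule.mem_span_singleton] at hx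
    obtain ⟨m, hm⟩ := hx
    have h1 := bq.sum_repr (S.mkQ x)
    rw [Fin.sum_univ_two] at h1
    have h2 := congrArg s h1
    rw [map_add, map_smul, map_smul] at h2
    have : x = m • 1 + (bq.repr (S.mkQ x) 0 • s (bq 0) + bq.repr (S.mkQ x) 1 • s (bq 1)) := by
      rw [h2, hm]; abel
    rw [this]
    have hm : ∀ i, ![1, s (bq 0), s (bq 1)] i ∈
      Submodule.span ℤ (Set.range ![1, s (bq 0), s (bq 1)]) :=
      fun i => Submodule.subset_span ⟨i, rfl⟩
    exact add_mem (Submodule.smul_mem _ _ (hm 0)) (add_mem (Submodule.smul_mem _ _ (hm 1))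
      (Submodule.smul_mem _ _ (hm 2)))
  exact ⟨Module.Basis.mk hli hsp, by simp⟩

end

section
open Matrix NumberField

theorem basis_fin_three_unique {R : Type} [CommRing R] (b : Module.Basis (Fin 3) ℤ R)
    (hb : b 0 = 1) {p q r p' q' r' : ℤ}
    (h : (p : R) + q * b 1 + r * b 2 = p' + q' * b 1 + r' * b 2) : p = p' ∧ q = q' ∧ r = r' := by
  have := Fintype.linearIndependent_iff.1 b.linearIndependent ![p - p', q - q', r - r'] (by
    simp only [Fin.sum_univ_three, cons_val_zero, cons_val_one,
      cons_val, zsmul_eq_mul, hb]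
    push_cast
    linear_combination h)
  have h0 := this 0
  have h1 := this 1
  have h2 := this 2
  simp only [cons_val_zero, cons_val_one, cons_val] at h0 h1 h2
  omega

theorem basis_fin_three_exists {R : Type} [CommRing R] (b : Module.Basis (Fin 3) ℤ R)
    (hb : b 0 = 1) (x : R) : ∃ p q r : ℤ, x = p + q * b 1 + r * b 2 := by
  have := b.sum_repr x
  simp only [Fin.sum_univ_three, zsmul_eq_mul, hb, mul_one] at this
  exact ⟨_, _, _, this.symm⟩

theorem basis_fin_three_repr {R : Type} [CommRing R] (b : Module.Basis (Fin 3) ℤ R)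
    (hb : b 0 = 1) {x : R} {p q r : ℤ} (h : x = p + q * b 1 + r * b 2) :
    b.repr x 0 = p ∧ b.repr x 1 = q ∧ b.repr x 2 = r := by
  refine basis_fin_three_unique b hb ?_
  rw [← h]
  have := b.sum_repr x
  simp only [Fin.sum_univ_three, zsmul_eq_mul, hb, mul_one] at this
  exact this

theorem basis_fin_three_trace {R : Type} [CommRing R] (b : Module.Basis (Fin 3) ℤ R)
    (hb : b 0 = 1) {x : R} {p q r p' q' r' p'' q'' r'' : ℤ} (h : x = p + q * b 1 + r * b 2)
    (h' : x * b 1 = p' + q' * b 1 + r' * b 2) (h'' : x * b 2 = p'' + q'' * b 1 + r'' * b 2) :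
    Algebra.trace ℤ R x = p + q' + r'' := by
  rw [Algebra.trace_eq_matrix_trace b, trace, Fin.sum_univ_three]
  simp only [diag_apply, Algebra.leftMulMatrix_eq_repr_mul]
  rw [(basis_fin_three_repr b hb h').2.1, (basis_fin_three_repr b hb h'').2.2, hb, mul_one,
    (basis_fin_three_repr b hb h).1]

theorem exists_normal_basis {R : Type} [CommRing R] (b : Module.Basis (Fin 3) ℤ R)
    (hb : b 0 = 1) : ∃ (b' : Module.Basis (Fin 3) ℤ R) (k : ℤ), b' 0 = 1 ∧ b' 1 * b' 2 = k := by
  obtain ⟨k, m, n, h⟩ := basis_fin_three_exists b hb (b 1 * b 2)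
  have hli : LinearIndependent ℤ ![1, b 1 - (n : R), b 2 - (m : R)] := by
    rw [Fintype.linearIndependent_iff]
    intro g hg
    simp only [Fin.sum_univ_three, cons_val_zero, cons_val_one,
      cons_val, zsmul_eq_mul] at hg
    obtain ⟨h0, h1, h2⟩ := basis_fin_three_unique b hb (p := g 0 - g 1 * n - g 2 * m) (q := g 1)
      (r := g 2) (p' := 0) (q' := 0) (r' := 0) (by push_cast; linear_combination hg)
    rw [h1, h2] at h0
    have h5 : g 0 = 0 := by simpa using h0
    intro i
    fin_cases i <;> assumption
  have hsp : ⊤ ≤ Submodule.span ℤ (Set.range ![1, b 1 - (n : R), b 2 - (m : R)]) := by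
    intro x _
    obtain ⟨p, q, r, rfl⟩ := basis_fin_three_exists b hb x
    have hm : ∀ i, ![1, b 1 - (n : R), b 2 - (m : R)] i ∈
      Submodule.span ℤ (Set.range ![1, b 1 - (n : R), b 2 - (m : R)]) :=
      fun i => Submodule.subset_span ⟨i, rfl⟩
    have : (p : R) + q * b 1 + r * b 2 = (p + q * n + r * m) • 1 +
        (q • (b 1 - (n : R)) + r • (b 2 - (m : R))) := by
      simp only [zsmul_eq_mul]; push_cast; ring
    rw [this]
    exact add_mem (Submodule.smul_mem _ _ (hm 0)) (add_mem (Submodule.smul_mem _ _ (hm 1))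
      (Submodule.smul_mem _ _ (hm 2)))
  refine ⟨Module.Basis.mk hli hsp, k + n * m, by simp, ?_⟩
  simp only [Module.Basis.mk_apply, cons_val_one, cons_val]
  push_cast
  linear_combination h

/-- Every cubic ring has a basis whose multiplication table is given by a binary cubic form. -/
theorem exists_form_of_basis {R : Type} [CommRing R] (b₀ : Module.Basis (Fin 3) ℤ R)
    (hb₀ : b₀ 0 = 1) : ∃ (b : Module.Basis (Fin 3) ℤ R) (f : BCF), b 0 = 1 ∧
      b 1 * b 2 = -f.a * f.d ∧ b 1 ^ 2 = -f.a * f.c + f.b * b 1 - f.a * b 2 ∧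
      b 2 ^ 2 = -f.b * f.d + f.d * b 1 - f.c * b 2 := by
  obtain ⟨b, m, hb, hm⟩ := exists_normal_basis b₀ hb₀
  obtain ⟨A0, A1, A2, hA⟩ := basis_fin_three_exists b hb (b 1 ^ 2)
  obtain ⟨B0, B1, B2, hB⟩ := basis_fin_three_exists b hb (b 2 ^ 2)
  obtain ⟨h1, h2, h3⟩ := basis_fin_three_unique b hb (p := A1 * m + A2 * B0) (q := A2 * B1)
    (r := A0 + A2 * B2) (p' := 0) (q' := m) (r' := 0) (by
      push_cast
      linear_combination (-b 2) * hA + (b 1 - A1) * hm - A2 * hB)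
  obtain ⟨h4, h5, h6⟩ := basis_fin_three_unique b hb (p := B1 * A0 + B2 * m) (q := B0 + B1 * A1)
    (r := B1 * A2) (p' := 0) (q' := 0) (r' := m) (by
      push_cast
      linear_combination (-b 1) * hB + (b 2 - B2) * hm - B1 * hA)
  refine ⟨b, ⟨-A2, A1, -B2, B1⟩, hb, ?_, ?_, ?_⟩
  · rw [hm, ← h2]; push_cast; ring
  · rw [hA, show A0 = -(A2 * B2) by omega]; push_cast; ring
  · rw [hB, show B0 = -(B1 * A1) by omega]; push_cast; ring

theorem discr_basis_eq {R : Type} [CommRing R] (b : Module.Basis (Fin 3) ℤ R) (f : BCF)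
    (hb : b 0 = 1) (h12 : b 1 * b 2 = -f.a * f.d)
    (h11 : b 1 ^ 2 = -f.a * f.c + f.b * b 1 - f.a * b 2)
    (h22 : b 2 ^ 2 = -f.b * f.d + f.d * b 1 - f.c * b 2) : Algebra.discr ℤ b = f.disc := by
  have t0 : Algebra.trace ℤ R 1 = 3 := by
    rw [basis_fin_three_trace b hb (p := 1) (q := 0) (r := 0) (p' := 0) (q' := 1) (r' := 0)
      (p'' := 0) (q'' := 0) (r'' := 1)] <;> simp
  have t1 : Algebra.trace ℤ R (b 1) = f.b := by
    rw [basis_fin_three_trace b hb (p := 0) (q := 1) (r := 0) (p' := -f.a * f.c) (q' := f.b)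
      (r' := -f.a) (p'' := -f.a * f.d) (q'' := 0) (r'' := 0)]
    · ring
    · push_cast; ring
    · push_cast; linear_combination h11
    · push_cast; linear_combination h12
  have t2 : Algebra.trace ℤ R (b 2) = -f.c := by
    rw [basis_fin_three_trace b hb (p := 0) (q := 0) (r := 1) (p' := -f.a * f.d) (q' := 0)
      (r' := 0) (p'' := -f.b * f.d) (q'' := f.d) (r'' := -f.c)]
    · ring
    · push_cast; ring
    · push_cast; linear_combination h12
    · push_cast; linear_combination h22
  have tz : ∀ n : ℤ, Algebra.trace ℤ R (n : R) = 3 * n := by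
    intro n
    have : (n : R) = n • 1 := by simp
    rw [this, map_smul, t0, smul_eq_mul]; ring
  have tm : ∀ (n : ℤ) (x : R), Algebra.trace ℤ R ((n : R) * x) = n * Algebra.trace ℤ R x := by
    intro n x
    rw [← zsmul_eq_mul, map_smul, smul_eq_mul]
  have t11 : Algebra.trace ℤ R (b 1 * b 1) = f.b ^ 2 - 2 * f.a * f.c := by
    rw [show b 1 * b 1 = ((-f.a * f.c : ℤ) : R) + (f.b : R) * b 1 + ((-f.a : ℤ) : R) * b 2 by
      push_cast; linear_combination h11, map_add, map_add, tz, tm, tm, t1, t2]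
    ring
  have t22 : Algebra.trace ℤ R (b 2 * b 2) = f.c ^ 2 - 2 * f.b * f.d := by
    rw [show b 2 * b 2 = ((-f.b * f.d : ℤ) : R) + (f.d : R) * b 1 + ((-f.c : ℤ) : R) * b 2 by
      push_cast; linear_combination h22, map_add, map_add, tz, tm, tm, t1, t2]
    ring
  have t12 : Algebra.trace ℤ R (b 1 * b 2) = -3 * f.a * f.d := by
    rw [show b 1 * b 2 = ((-f.a * f.d : ℤ) : R) by push_cast; exact h12, tz]
    ring
  have t21 : Algebra.trace ℤ R (b 2 * b 1) = -3 * f.a * f.d := by rw [mul_comm, t12]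
  rw [Algebra.discr_def, det_fin_three]
  simp only [Algebra.traceMatrix_apply, Algebra.traceForm_apply, hb, one_mul, mul_one, t0, t1, t2,
    t11, t12, t21, t22, disc]
  ring

end

section
open Polynomial Matrix NumberField

variable {K : Type} [Field K] [NumberField K]

theorem isIntegral_of_cubic {L : Type} [Field L] {x : L} {u v w : ℤ}
    (h : x ^ 3 + u * x ^ 2 + v * x + w = 0) : IsIntegral ℤ x := by
  refine ⟨X ^ 3 + C u * X ^ 2 + C v * X +
    C w, by monicity!, ?_⟩
  simp only [eval₂_add, eval₂_mul, eval₂_pow,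
    eval₂_C, eval₂_X]
  simpa using h

theorem comp_eq_scale_of_eval {f f' : BCF} {g : Matrix (Fin 2) (Fin 2) ℤ} {n : ℤ}
    (h : ∀ x y : ℤ, f.eval (g 0 0 * x + g 0 1 * y) (g 1 0 * x + g 1 1 * y) = n * f'.eval x y) :
    f.comp g = f'.scale n := by
  have h1 := h 1 0
  have h2 := h 0 1
  have h3 := h 1 1
  have h4 := h 1 (-1)
  simp only [eval] at h1 h2 h3 h4
  rw [BCF.ext_iff]
  simp only [BCF.comp, scale]
  refine ⟨?_, ?_, ?_, ?_⟩
  · linear_combination h1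
  · have : (2 : ℤ) ≠ 0 := by norm_num
    refine mul_left_cancel₀ this ?_
    linear_combination h3 - h4 - 2 * h2
  · have : (2 : ℤ) ≠ 0 := by norm_num
    refine mul_left_cancel₀ this ?_
    linear_combination h3 + h4 - 2 * h1
  · linear_combination h2

theorem exists_ring_form (hK : Module.finrank ℚ K = 3) :
    ∃ f : BCF, f.Irr ∧ f.Root K ∧ f.disc = discr K ∧ ∀ f' : BCF, f'.Irr → f'.Root K →
      ∃ g : Matrix (Fin 2) (Fin 2) ℤ, g.det ≠ 0 ∧ f.comp g = f'.scale g.det := by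
  obtain ⟨b₀, hb₀⟩ := exists_basis hK
  obtain ⟨B, f, hB, h12, h11, h22⟩ := exists_form_of_basis b₀ hb₀
  have hdisc := discr_basis_eq B f hB h12 h11 h22
  rw [NumberField.discr_eq_discr] at hdisc
  have hinj := FaithfulSMul.algebraMap_injective (𝓞 K) K
  set w1 : K := algebraMap (𝓞 K) K (B 1) with hw1
  set w2 : K := algebraMap (𝓞 K) K (B 2) with hw2
  have k12 : w1 * w2 = -f.a * f.d := by
    have := congrArg (algebraMap (𝓞 K) K) h12
    simpa only [map_mul, map_neg, map_intCast] using this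
  have k11 : w1 ^ 2 = -f.a * f.c + f.b * w1 - f.a * w2 := by
    have := congrArg (algebraMap (𝓞 K) K) h11
    simpa only [map_mul, map_neg, map_intCast, map_pow, map_add, map_sub] using this
  have k22 : w2 ^ 2 = -f.b * f.d + f.d * w1 - f.c * w2 := by
    have := congrArg (algebraMap (𝓞 K) K) h22
    simpa only [map_mul, map_neg, map_intCast, map_pow, map_add, map_sub] using this
  have huniq : ∀ {p q r p' q' r' : ℤ}, (p : K) + q * w1 + r * w2 = p' + q' * w1 + r' * w2 →
      p = p' ∧ q = q' ∧ r = r' := by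
    intro p q r p' q' r' h
    refine basis_fin_three_unique B hB (hinj ?_)
    simpa only [map_mul, map_intCast, map_add] using h
  have hex : ∀ x : K, IsIntegral ℤ x → ∃ p q r : ℤ, x = p + q * w1 + r * w2 := by
    intro x hx
    obtain ⟨p, q, r, h⟩ := basis_fin_three_exists B hB (⟨x, hx⟩ : 𝓞 K)
    refine ⟨p, q, r, ?_⟩
    have := congrArg (algebraMap (𝓞 K) K) h
    simp only [map_mul, map_intCast, map_add] at this
    exact this
  have hsq : ∀ x y : ℤ, (x * w1 + y * w2) ^ 2 = (-f.a * f.c * x ^ 2 - f.b * f.d * y ^ 2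
      - 2 * x * y * f.a * f.d) + (f.b * x ^ 2 + f.d * y ^ 2) * w1
      - (f.a * x ^ 2 + f.c * y ^ 2) * w2 := by
    intro x y
    linear_combination (x : K) ^ 2 * k11 + (y : K) ^ 2 * k22 + 2 * x * y * k12
  have hirr : f.Irr := by
    intro x y h0
    simp only [eval] at h0
    have h0' : (f.a : K) * x ^ 3 + f.b * x ^ 2 * y + f.c * x * y ^ 2 + f.d * y ^ 3 = 0 := by
      exact_mod_cast h0
    have key : ∀ s t : ℤ, t ≠ 0 → (t : K) * (x * w1 + y * w2) = s → x = 0 ∧ y = 0 := by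
      intro s t ht h
      obtain ⟨h1, h2, h3⟩ := huniq (p := 0) (q := t * x) (r := t * y) (p' := s) (q' := 0)
        (r' := 0) (by push_cast; linear_combination h)
      exact ⟨(mul_eq_zero.1 h2).resolve_left ht, (mul_eq_zero.1 h3).resolve_left ht⟩
    by_contra hxy
    by_cases hx : x = 0
    · have hy : y ≠ 0 := fun hy => hxy ⟨hx, hy⟩
      obtain ⟨s, t, ht, h⟩ := exists_int_mul_eq_of_quadratic hK (ξ := x * w1 + y * w2)
        (A := y) (B := f.a * x ^ 2 + f.c * y ^ 2)
        (C := y * (f.a * f.c * x ^ 2 + f.b * f.d * y ^ 2 + 2 * x * y * f.a * f.d))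
        (Or.inl hy) (by
          push_cast
          linear_combination (y : K) * hsq x y + w1 * h0')
      exact hxy (key s t ht h)
    · obtain ⟨s, t, ht, h⟩ := exists_int_mul_eq_of_quadratic hK (ξ := x * w1 + y * w2)
        (A := x) (B := -(f.b * x ^ 2 + f.d * y ^ 2))
        (C := x * (f.a * f.c * x ^ 2 + f.b * f.d * y ^ 2 + 2 * x * y * f.a * f.d))
        (Or.inl hx) (by
          push_cast
          linear_combination (x : K) * hsq x y - w2 * h0')
      exact hxy (key s t ht h)
  have ha : (f.a : K) ≠ 0 := by exact_mod_cast hirr.a_ne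
  refine ⟨f, hirr, ⟨-w1 / f.a, ?_⟩, hdisc.symm, ?_⟩
  · set θ := -w1 / f.a with hθ
    have hθa : f.a * θ = -w1 := by rw [hθ]; field_simp
    refine mul_left_cancel₀ (pow_ne_zero 2 ha) ?_
    trans (f.a * θ) ^ 3 + f.b * (f.a * θ) ^ 2 + f.a * f.c * (f.a * θ) + f.a ^ 2 * f.d
    · ring
    · rw [hθa]
      linear_combination (-w1) * k11 + f.a * k12
  · rintro f' hf' ⟨θ, hθ⟩
    set α : K := -f'.a * θ with hα
    set β : K := -(f'.a * θ ^ 2 + f'.b * θ + f'.c) with hβ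
    have hαi : IsIntegral ℤ α := by
      refine isIntegral_of_cubic (u := -f'.b) (v := f'.a * f'.c) (w := -f'.a ^ 2 * f'.d) ?_
      push_cast
      rw [hα]
      linear_combination (-f'.a ^ 2 : K) * hθ
    have hβi : IsIntegral ℤ β := by
      refine isIntegral_of_cubic (u := f'.c) (v := f'.b * f'.d) (w := f'.a * f'.d ^ 2) ?_
      push_cast
      have h1 : θ * β = f'.d := by rw [hβ]; linear_combination -hθ
      have h2 : α * β = -f'.a * f'.d := by rw [hα]; linear_combination -f'.a * h1
      have h3 : β ^ 2 = -f'.b * f'.d + f'.d * α - f'.c * β := by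
        rw [hα]
        have : β ^ 2 = -(f'.a * θ * (θ * β) + f'.b * (θ * β) + f'.c * β) := by
          rw [hβ]; ring
        rw [this, h1]; ring
      linear_combination β * h3 + f'.d * h2
    obtain ⟨k1, p, q, e1⟩ := hex α hαi
    obtain ⟨k2, r, s, e2⟩ := hex β hβi
    have m1 : θ * β = f'.d := by rw [hβ]; linear_combination -hθ
    have m12 : α * β = -f'.a * f'.d := by rw [hα]; linear_combination -f'.a * m1
    have m22 : β ^ 2 = -f'.b * f'.d + f'.d * α - f'.c * β := by
      rw [hα]
      have : β ^ 2 = -(f'.a * θ * (θ * β) + f'.b * (θ * β) + f'.c * β) := by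
        rw [hβ]; ring
      rw [this, m1]; ring
    have m11 : α ^ 2 = -f'.a * f'.c + f'.b * α - f'.a * β := by rw [hα, hβ]; ring
    refine ⟨!![p, r; q, s], ?_, comp_eq_scale_of_eval ?_⟩
    · rw [det_fin_two_of]
      intro h0
      have h0' : (p : K) * s - r * q = 0 := by exact_mod_cast h0
      have hnr : ∀ A B C : ℤ, (A ≠ 0 ∨ B ≠ 0) → ¬ ((A : K) * θ ^ 2 + B * θ + C = 0) := by
        intro A B C hAB h
        obtain ⟨s, t, ht, h⟩ := exists_int_mul_eq_of_quadratic hK hAB h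
        exact ht (hf'.not_rational hθ h).2
      have ha' := hf'.a_ne
      have hq : q = 0 := by
        by_contra hq
        refine hnr (q * f'.a) (q * f'.b - s * f'.a) (q * f'.c - (s * k1 - q * k2))
          (Or.inl (mul_ne_zero hq ha')) ?_
        push_cast
        have : (s : K) * α - q * β = s * k1 - q * k2 := by
          rw [e1, e2]; linear_combination w1 * h0'
        rw [hα, hβ] at this
        linear_combination this
      have hs : s = 0 := by
        by_contra hs
        refine hnr (q * f'.a) (q * f'.b - s * f'.a) (q * f'.c - (s * k1 - q * k2))
          (Or.inr (by rw [hq, zero_mul, zero_sub, neg_ne_zero]; exact mul_ne_zero hs ha')) ?_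
        push_cast
        have : (s : K) * α - q * β = s * k1 - q * k2 := by
          rw [e1, e2]; linear_combination w1 * h0'
        rw [hα, hβ] at this
        linear_combination this
      have hp : p = 0 := by
        by_contra hp
        refine hnr (p * f'.a) (p * f'.b - r * f'.a) (p * f'.c - (r * k1 - p * k2))
          (Or.inl (mul_ne_zero hp ha')) ?_
        push_cast
        have : (r : K) * α - p * β = r * k1 - p * k2 := by
          rw [e1, e2]; linear_combination (-w2) * h0'
        rw [hα, hβ] at this
        linear_combination this
      refine hnr 0 f'.a k1 (Or.inr ha') ?_
      rw [hp, hq, hα] at e1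
      push_cast at e1 ⊢
      linear_combination -e1
    · intro x y
      rw [det_fin_two_of]
      simp only [of_apply, cons_val_zero, cons_val_one, cons_val',
        cons_val_fin_one]
      set X := p * x + r * y with hX
      set Y := q * x + s * y with hY
      set k := k1 * x + k2 * y with hk
      have hη : (x : K) * α + y * β = k + X * w1 + Y * w2 := by
        rw [e1, e2, hX, hY, hk]; push_cast; ring
      have hη2 : ((x : K) * α + y * β) ^ 2 = (-f'.a * f'.c * x ^ 2 - f'.b * f'.d * y ^ 2
          - 2 * x * y * f'.a * f'.d) + (f'.b * x ^ 2 + f'.d * y ^ 2) * α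
          - (f'.a * x ^ 2 + f'.c * y ^ 2) * β := by
        linear_combination (x : K) ^ 2 * m11 + (y : K) ^ 2 * m22 + 2 * x * y * m12
      have h3 := hsq X Y
      obtain ⟨u0, u1, u2⟩ := huniq
        (p := -f.a * f.c * X ^ 2 - f.b * f.d * Y ^ 2 - 2 * X * Y * f.a * f.d + k ^ 2)
        (q := f.b * X ^ 2 + f.d * Y ^ 2 + 2 * k * X)
        (r := -(f.a * X ^ 2 + f.c * Y ^ 2) + 2 * k * Y)
        (p' := (-f'.a * f'.c * x ^ 2 - f'.b * f'.d * y ^ 2 - 2 * x * y * f'.a * f'.d) +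
          (f'.b * x ^ 2 + f'.d * y ^ 2) * k1 - (f'.a * x ^ 2 + f'.c * y ^ 2) * k2)
        (q' := (f'.b * x ^ 2 + f'.d * y ^ 2) * p - (f'.a * x ^ 2 + f'.c * y ^ 2) * r)
        (r' := (f'.b * x ^ 2 + f'.d * y ^ 2) * q - (f'.a * x ^ 2 + f'.c * y ^ 2) * s) (by
          rw [hη, e1, e2] at hη2
          push_cast
          linear_combination hη2 - h3)
      simp only [eval]
      rw [hX, hY] at u1 u2 ⊢
      linear_combination (q * x + s * y) * u1 - (p * x + r * y) * u2

end

section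
open Finset Matrix NumberField ENNReal

theorem nmx_comp_GLZ {p : ℕ} (hp : p.Prime) (f : BCF) (γ : GLZ) :
    (f.comp γ).Nmx p ↔ f.Nmx p := by
  rw [Nmx, Nmx, dv_comp_GLZ, oo, oo, cnt_GLZ hp]

theorem mxl_comp_GLZ (f : BCF) (γ : GLZ) : (f.comp γ).Mxl ↔ f.Mxl :=
  forall₂_congr fun _ hp => not_congr (nmx_comp_GLZ hp f γ)

theorem comp_GLZ_cancel (f : BCF) (γ : GLZ) : (f.comp γ).comp (γ⁻¹ : GLZ) = f := by
  rw [← comp_mul_GLZ, mul_inv_cancel]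
  simp

/-- The maximal form attached to a cubic field. -/
theorem exists_mxl_form {K : Type} [Field K] [NumberField K] (hK : Module.finrank ℚ K = 3) :
    ∃ f : BCF, f.Irr ∧ f.Root K ∧ f.disc = discr K ∧ f.Mxl ∧
      ∀ f' : BCF, f'.Irr → f'.Root K → f'.Mxl → ∃ γ : GLZ, f' = f.comp γ := by
  obtain ⟨f, hf, hroot, hdisc, huniv⟩ := exists_ring_form hK
  have hd0 : f.disc ≠ 0 := hdisc ▸ discr_ne_zero K
  have key : ∀ g : BCF, g.Irr → g.Root K → ∀ m : ℤ, f.disc = m ^ 2 * g.disc → m ^ 2 ≤ 1 := by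
    intro g hg hgr m hm
    obtain ⟨h, h0, he⟩ := huniv g hg hgr
    have h1 := congrArg disc he
    rw [disc_comp, disc_scale] at h1
    have h2 : h.det ^ 2 * f.disc = g.disc := by
      refine mul_left_cancel₀ (pow_ne_zero 4 h0) ?_
      linear_combination h1
    have h3 : (m * h.det) ^ 2 * f.disc = 1 * f.disc := by
      rw [← h2] at hm
      linear_combination -hm
    have h4 := mul_right_cancel₀ hd0 h3
    have h5 : 1 ≤ h.det ^ 2 := by
      have : 0 < h.det ^ 2 := by positivity
      omega
    nlinarith [sq_nonneg m]
  refine ⟨f, hf, hroot, hdisc, ?_, ?_⟩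
  · intro p hp hn
    have hp0 : (p : ℤ) ≠ 0 := by exact_mod_cast hp.ne_zero
    have hp2 : (2 : ℤ) ≤ p := by exact_mod_cast hp.two_le
    rcases hn.exists_scale with ⟨g, hg⟩ | ⟨g, j, hg⟩
    · have h1 : g.Irr := (irr_scale_iff hp0).1 (hg ▸ hf)
      have h2 : g.Root K := (root_scale_iff hp0).1 (hg ▸ hroot)
      have h3 := key g h1 h2 ((p : ℤ) ^ 2) (by rw [hg, disc_scale]; ring)
      have h5 : (4 : ℤ) ≤ (p : ℤ) ^ 2 := by nlinarith
      nlinarith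
    · have hp02 : (p : ℤ) ^ 2 ≠ 0 := pow_ne_zero 2 hp0
      have hdet : (hm p j).det ≠ 0 := by rw [det_hm]; exact hp0
      have h1 : g.Irr := (irr_scale_iff hp02).1 (hg ▸ hf.comp hdet)
      have h2 : g.Root K := (root_scale_iff hp02).1 (hg ▸ hroot.comp hf hdet)
      have h4 := congrArg disc hg
      rw [disc_comp, disc_scale, det_hm] at h4
      have h3 := key g h1 h2 (p : ℤ) (by
        refine mul_left_cancel₀ (pow_ne_zero 6 hp0) ?_
        linear_combination h4)
      nlinarith
  · intro f' hf' hr' hm'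
    obtain ⟨g, h0, he⟩ := huniv f' hf' hr'
    have hunit : g.det.natAbs = 1 := by
      by_contra hne
      obtain ⟨p, hp, hpd⟩ := Nat.exists_prime_and_dvd hne
      exact hm' p hp (nmx_of_comp hp he h0 (Int.natCast_dvd.2 hpd))
    rcases Int.natAbs_eq_iff.1 hunit with h | h
    · refine ⟨GLZ.mk (g 0 0) (g 0 1) (g 1 0) (g 1 1) (by
        rw [← det_fin_two]; exact Or.inl h), ?_⟩
      rw [GLZ.coe_mk]
      rw [h] at he
      simp only [Nat.cast_one, scale_one] at he
      rw [← he]; congr 1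
      ext i j; fin_cases i <;> fin_cases j <;> rfl
    · refine ⟨GLZ.mk (-g 0 0) (-g 0 1) (-g 1 0) (-g 1 1) (by
        right
        have := det_fin_two g
        rw [h] at this
        push_cast at this
        linear_combination -this), ?_⟩
      rw [GLZ.coe_mk]
      rw [h, BCF.ext_iff] at he
      simp only [comp, scale] at he
      push_cast at he
      obtain ⟨h1, h2, h3, h4⟩ := he
      rw [BCF.ext_iff]
      simp only [comp, of_apply, cons_val_zero, cons_val_one,
        cons_val', cons_val_fin_one]
      refine ⟨?_, ?_, ?_, ?_⟩
      · linear_combination h1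
      · linear_combination h2
      · linear_combination h3
      · linear_combination h4

theorem Irr.d_ne {f : BCF} (hf : f.Irr) : f.d ≠ 0 := by
  intro h
  have := hf 0 1 (by simp [eval, h])
  simp at this

theorem Inn.comp_injOn {f : BCF} (hf : f.Irr) (h : f.Inn) :
    Set.InjOn (fun γ : GLZ => f.comp γ) {γ : GLZ | (f.comp γ).Red} := by
  intro γ hγ δ hδ he
  obtain ⟨g1, g2, g3, g4⟩ := h.eq_of_red hγ
  obtain ⟨d1, d2, d3, d4⟩ := h.eq_of_red hδ
  have ha := hf.a_ne
  have hd := hf.d_ne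
  simp only [comp, BCF.mk.injEq] at he
  obtain ⟨ea, -, -, ed⟩ := he
  rw [g3, d3] at ed
  rw [g4, d4] at ea
  have e1 : γ.1 0 0 = δ.1 0 0 := by
    have : f.a * γ.1 0 0 ^ 3 = f.a * δ.1 0 0 ^ 3 := by linear_combination ea
    have := mul_left_cancel₀ ha this
    rcases g1 with g | g <;> rcases d1 with d | d <;> rw [g, d] at this ⊢ <;> norm_num at this
  have e2 : γ.1 1 1 = δ.1 1 1 := by
    have : f.d * γ.1 1 1 ^ 3 = f.d * δ.1 1 1 ^ 3 := by linear_combination ed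
    have := mul_left_cancel₀ hd this
    rcases g2 with g | g <;> rcases d2 with d | d <;> rw [g, d] at this ⊢ <;> norm_num at this
  apply Units.ext
  ext i j
  fin_cases i <;> fin_cases j
  · exact e1
  · exact g3.trans d3.symm
  · exact g4.trans d4.symm
  · exact e2

/-- The sum of the weights of the translates of `f` is at most one. -/
theorem sum_wr_le_one {f : BCF} (hf : f ∈ W) (s : Finset BCF)
    (hs : ∀ g ∈ s, ∃ γ : GLZ, g = f.comp γ) : ∑ g ∈ s, g.wr ≤ 1 := by
  classical
  choose! φ hφ using hs
  have hinj : Set.InjOn φ s := by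
    intro g hg h hh e
    rw [hφ g hg, hφ h hh, e]
  have h1 : ∑ g ∈ s, g.wt ≤ 1 := by
    rw [← tsum_wt hf]
    calc ∑ g ∈ s, g.wt = ∑ γ ∈ s.image φ, (f.comp γ).wt := by
          rw [sum_image hinj]
          exact sum_congr rfl fun g hg => by rw [← hφ g hg]
      _ ≤ _ := ENNReal.sum_le_tsum _
  have h2 : ∑ g ∈ s, g.wr = (∑ g ∈ s, g.wt).toReal :=
    (toReal_sum fun g _ => g.wt_ne_top).symm
  rw [h2]
  simpa using toReal_mono one_ne_top h1

theorem one_le_sum_wr {f : BCF} (hf : f ∈ W) (h : f.Inn) (s : Finset BCF)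
    (hs : ∀ γ : GLZ, (f.comp γ).Red → f.comp γ ∈ s) : 1 ≤ ∑ g ∈ s, g.wr := by
  classical
  have h1 : 1 ≤ ∑ g ∈ s, g.wt := by
    rw [← tsum_wt hf, tsum_eq_sum (s := (finite_red_comp hf).toFinset)]
    · rw [← sum_image (f := fun g : BCF => g.wt) (g := fun γ : GLZ => f.comp γ)]
      · refine sum_le_sum_of_subset ?_
        intro g hg
        obtain ⟨γ, hγ, rfl⟩ := mem_image.1 hg
        exact hs γ (by simpa using hγ)
      · have := h.comp_injOn hf.1
        simpa using this
    · intro γ hγ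
      refine wt_eq_zero fun hc => hγ ?_
      simpa using hc.2
  have h2 : ∑ g ∈ s, g.wr = (∑ g ∈ s, g.wt).toReal :=
    (toReal_sum fun g _ => g.wt_ne_top).symm
  rw [h2]
  have hne : ∑ g ∈ s, g.wt ≠ ⊤ := sum_ne_top.2 fun g _ => g.wt_ne_top
  simpa using toReal_mono hne h1

open Classical in
/-- The irreducible reduced forms on the boundary of the fundamental domain. -/
noncomputable def bndF (X : ℝ) : Finset BCF := (redF X).filter fun f => f ∈ W ∧ ¬ f.Inn

theorem abs_countCubic_sub_nM_le (X : ℝ) :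
    |(countCubic (fun d => 0 < (d : ℝ) ∧ (d : ℝ) < X) : ℝ) - nM X| ≤ (bndF X).card := by
  classical
  set T : Set (Quotient CubicField.setoid) := {C | ∃ K : CubicField, ⟦K⟧ = C ∧
    (0 < ((discr K.carrier : ℤ) : ℝ) ∧ ((discr K.carrier : ℤ) : ℝ) < X)} with hT
  have hcount : countCubic (fun d => 0 < (d : ℝ) ∧ (d : ℝ) < X) = T.ncard := rfl
  set G : Finset BCF := (redF X).filter fun f => f ∈ W ∧ f.Mxl with hG
  have hmemG : ∀ f, f ∈ G ↔ (f.Red ∧ (f.disc : ℝ) < X) ∧ f ∈ W ∧ f.Mxl := by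
    intro f
    rw [hG, mem_filter, mem_redF]
  have hnM : nM X = ∑ f ∈ G, f.wr := by
    rw [nM, hG, sum_filter]
    refine sum_congr rfl fun f _ => ?_
    by_cases h1 : f ∈ W
    · simp [h1]
    · rw [wr_eq_zero fun h => h1 h.1]; simp
  have hiso : ∀ {K L : CubicField}, (⟦K⟧ : Quotient CubicField.setoid) = ⟦L⟧ ↔
      Nonempty (K.carrier ≃+* L.carrier) := fun {K L} => Quotient.eq
  -- every class is represented
  have hex : ∀ C ∈ T, ∃ f ∈ G, f.Root C.out.carrier := by
    rintro C ⟨K, rfl, h0, hX⟩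
    obtain ⟨f, hf, hr, hd, hm, -⟩ := exists_mxl_form K.deg
    have hW : f ∈ W := ⟨hf, by rw [hd]; exact_mod_cast h0⟩
    obtain ⟨γ, hγ⟩ := exists_red hW
    refine ⟨f.comp γ, (hmemG _).2 ⟨⟨hγ, ?_⟩, (comp_mem_W_GLZ γ).2 hW, (mxl_comp_GLZ f γ).2 hm⟩, ?_⟩
    · rw [disc_comp_GLZ, hd]; exact hX
    · obtain ⟨e⟩ := hiso.1 (Quotient.out_eq (⟦K⟧ : Quotient CubicField.setoid)).symm
      exact (hr.comp hf γ.det_ne).map e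
  have huniq : ∀ f : BCF, f.Irr → ∀ C D : Quotient CubicField.setoid, f.Root C.out.carrier →
      f.Root D.out.carrier → C = D := by
    intro f hf C D h1 h2
    rw [← Quotient.out_eq C, ← Quotient.out_eq D]
    exact hiso.2 (Root.equiv C.out.deg D.out.deg hf h1 h2)
  have hsame : ∀ f ∈ G, ∀ g ∈ G, ∀ C : Quotient CubicField.setoid, f.Root C.out.carrier →
      g.Root C.out.carrier → ∃ γ : GLZ, g = f.comp γ := by
    intro f hf g hg C h1 h2
    rw [hmemG] at hf hg
    obtain ⟨k, -, -, -, -, hk⟩ := exists_mxl_form C.out.deg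
    obtain ⟨γ, rfl⟩ := hk f hf.2.1.1 h1 hf.2.2
    obtain ⟨δ, rfl⟩ := hk g hg.2.1.1 h2 hg.2.2
    refine ⟨γ⁻¹ * δ, ?_⟩
    rw [comp_mul_GLZ, comp_GLZ_cancel]
  have hcls : ∀ f ∈ G, ∃ C ∈ T, f.Root C.out.carrier := by
    intro f hf
    rw [hmemG] at hf
    obtain ⟨K, hK⟩ := exists_root hf.2.1.1
    obtain ⟨e⟩ := hiso.1 (Quotient.out_eq (⟦K⟧ : Quotient CubicField.setoid)).symm
    refine ⟨⟦K⟧, ⟨K, rfl, ?_⟩, hK.map e⟩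
    obtain ⟨k, -, -, hd, -, hk⟩ := exists_mxl_form K.deg
    obtain ⟨γ, rfl⟩ := hk f hf.2.1.1 hK hf.2.2
    rw [← hd, ← disc_comp_GLZ k γ]
    exact ⟨by exact_mod_cast hf.2.1.2, hf.1.2⟩
  have hne : Nonempty BCF := ⟨⟨0, 0, 0, 0⟩⟩
  choose! φ hφG hφr using hex
  have hφinj : Set.InjOn φ T := by
    intro C hC D hD e
    exact huniq (φ C) ((hmemG _).1 (hφG C hC)).2.1.1 C D (hφr C hC) (e ▸ hφr D hD)
  have hTfin : T.Finite := by
    refine Set.Finite.of_finite_image (G.finite_toSet.subset ?_) hφinj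
    rintro _ ⟨C, hC, rfl⟩
    exact hφG C hC
  set TF := hTfin.toFinset with hTF
  have hmT : ∀ C, C ∈ TF ↔ C ∈ T := fun C => hTfin.mem_toFinset
  have hsum : ∑ f ∈ G, f.wr =
      ∑ C ∈ TF, ∑ f ∈ G.filter (fun f => f.Root C.out.carrier), f.wr := by
    simp_rw [sum_filter]
    rw [sum_comm]
    refine sum_congr rfl fun f hf => ?_
    obtain ⟨C, hC, hr⟩ := hcls f hf
    rw [sum_eq_single C]
    · rw [if_pos hr]
    · intro D _ hne
      exact if_neg fun h => hne (huniq f ((hmemG _).1 hf).2.1.1 D C h hr)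
    · intro h
      exact absurd ((hmT C).2 hC) h
  have hcard : (T.ncard : ℝ) = ∑ C ∈ TF, 1 := by
    rw [Set.ncard_eq_toFinset_card T hTfin]; simp [hTF]
  rw [hcount, hnM, hsum, hcard, ← sum_sub_distrib]
  have hle : ∀ C ∈ TF, |1 - ∑ f ∈ G.filter (fun f => f.Root C.out.carrier), f.wr| ≤
      if φ C ∈ bndF X then 1 else 0 := by
    intro C hC
    rw [hmT] at hC
    have hg := hφG C hC
    have hgm := (hmemG _).1 hg
    set s := G.filter (fun f => f.Root C.out.carrier) with hs
    have hup : ∑ f ∈ s, f.wr ≤ 1 := by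
      refine sum_wr_le_one hgm.2.1 s fun f hf => ?_
      rw [hs, mem_filter] at hf
      exact hsame _ hg f hf.1 C (hφr C hC) hf.2
    have hlow : 0 ≤ ∑ f ∈ s, f.wr := sum_nonneg fun f _ => f.wr_nonneg
    split_ifs with hb
    · rw [abs_le]; constructor <;> linarith
    · have hinn : (φ C).Inn := by
        by_contra hni
        refine hb ?_
        rw [bndF, mem_filter, mem_redF]
        exact ⟨hgm.1, hgm.2.1, hni⟩
      have : 1 ≤ ∑ f ∈ s, f.wr := by
        refine one_le_sum_wr hgm.2.1 hinn s fun γ hγ => ?_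
        rw [hs, mem_filter, hmemG]
        refine ⟨⟨⟨hγ, by rw [disc_comp_GLZ]; exact hgm.1.2⟩, (comp_mem_W_GLZ γ).2 hgm.2.1,
          (mxl_comp_GLZ _ γ).2 hgm.2.2⟩, (hφr C hC).comp hgm.2.1.1 γ.det_ne⟩
      rw [abs_le]; constructor <;> linarith
  refine (abs_sum_le_sum_abs _ _).trans ((sum_le_sum hle).trans ?_)
  rw [← sum_filter, sum_const, nsmul_eq_mul, mul_one]
  have : (TF.filter fun C => φ C ∈ bndF X).card ≤ (bndF X).card := by
    refine card_le_card_of_injOn φ (fun C hC => ?_) (fun C hC D hD e => ?_)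
    · exact (mem_filter.1 hC).2
    · exact hφinj ((hmT C).1 (mem_filter.1 hC).1) ((hmT D).1 (mem_filter.1 hD).1) e
  exact_mod_cast this

end

section
open Real

/-- The divisor bound. -/
theorem exists_card_divisors_le {ε : ℝ} (hε : 0 < ε) :
    ∃ C : ℝ, 0 < C ∧ ∀ n : ℕ, n ≠ 0 → (n.divisors.card : ℝ) ≤ C * (n : ℝ) ^ ε := by
  obtain ⟨x, hx⟩ : ∃ x, x = ε / 2 * Real.log 2 := ⟨_, rfl⟩
  have hx0 : 0 < x := by rw [hx]; have := log_pos one_lt_two; positivity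
  obtain ⟨k, hk⟩ := exists_nat_ge (1 + 1 / x)
  obtain ⟨C, hC, hC'⟩ := exists_pow_card_primeFactors_le k (half_pos hε)
  refine ⟨C, hC, fun n hn => ?_⟩
  have key : ∀ p ∈ n.primeFactors, ((n.factorization p + 1 : ℕ) : ℝ) ≤
      k * ((p : ℝ) ^ n.factorization p) ^ (ε / 2) := by
    intro p hp
    have hp2 : (2 : ℝ) ≤ p := by exact_mod_cast (Nat.prime_of_mem_primeFactors hp).two_le
    set e := n.factorization p with he
    have h1 : (1 + e * x : ℝ) ≤ ((p : ℝ) ^ e) ^ (ε / 2) := by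
      calc (1 + e * x : ℝ) ≤ Real.exp (e * x) := by linarith [add_one_le_exp (e * x : ℝ)]
        _ = ((2 : ℝ) ^ e) ^ (ε / 2) := by
          rw [← rpow_natCast, ← rpow_mul (by norm_num),
            rpow_def_of_pos (by norm_num), hx]
          ring_nf
        _ ≤ _ := by gcongr
    have h2 : ((e + 1 : ℕ) : ℝ) ≤ (1 + 1 / x) * (1 + e * x) := by
      have : (1 + 1 / x) * (1 + e * x) = 1 + e + e * x + 1 / x := by field_simp; ring
      rw [this]
      push_cast
      have : 0 ≤ e * x := by positivity
      have : 0 < 1 / x := by positivity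
      linarith
    calc _ ≤ _ := h2
      _ ≤ k * ((p : ℝ) ^ e) ^ (ε / 2) := by gcongr
  rw [Nat.card_divisors hn, Nat.cast_prod]
  calc ∏ p ∈ n.primeFactors, ((n.factorization p + 1 : ℕ) : ℝ)
      ≤ ∏ p ∈ n.primeFactors, (k * ((p : ℝ) ^ n.factorization p) ^ (ε / 2)) :=
        Finset.prod_le_prod (fun _ _ => Nat.cast_nonneg _) key
    _ = (k : ℝ) ^ n.primeFactors.card * (n : ℝ) ^ (ε / 2) := by
      rw [Finset.prod_mul_distrib, Finset.prod_const,
        finsetProd_rpow _ _ fun _ _ => by positivity]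
      congr 2
      have := Nat.prod_factorization_pow_eq_self hn
      rw [Finsupp.prod, Nat.support_factorization] at this
      exact_mod_cast this
    _ ≤ C * (n : ℝ) ^ (ε / 2) * (n : ℝ) ^ (ε / 2) := by
      gcongr
      exact hC' n hn
    _ = C * (n : ℝ) ^ ε := by
      rw [mul_assoc, ← rpow_add (by positivity)]
      ring_nf

end

section
open Real Finset

section Fourier
variable {q : ℕ} [NeZero q]

/-- The number of roots of `a r³ + b r² + c r + d` modulo `q`. -/
def NR (q : ℕ) [NeZero q] (a b c d : ZMod q) : ℕ :=
  (univ.filter fun r : ZMod q => a * r ^ 3 + b * r ^ 2 + c * r + d = 0).card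

/-- The exponential sum attached to the cubic polynomial `a r³ + b r² + c r`. -/
noncomputable def expS (a b c h : ZMod q) : ℂ :=
  ∑ r : ZMod q, ZMod.stdAddChar (h * (a * r ^ 3 + b * r ^ 2 + c * r))

/-- A bound for the discrepancy of the values of a cubic polynomial modulo `q`. -/
noncomputable def Edis (q : ℕ) [NeZero q] (a b c : ZMod q) : ℝ :=
  (∑ h ∈ univ.filter (fun h : ZMod q => h ≠ 0),
    ‖expS a b c h‖ * (2 / ‖(ZMod.stdAddChar h : ℂ) - 1‖)) / q

theorem Edis_nonneg (a b c : ZMod q) : 0 ≤ Edis q a b c := by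
  unfold Edis; positivity

theorem NR_eq_sum (a b c d : ZMod q) :
    (q : ℂ) * NR q a b c d = ∑ h : ZMod q, ZMod.stdAddChar (h * d) * expS a b c h := by
  have h1 : ∀ h : ZMod q, ZMod.stdAddChar (h * d) * expS a b c h =
      ∑ r : ZMod q, (ZMod.stdAddChar (h * (a * r ^ 3 + b * r ^ 2 + c * r + d)) : ℂ) := by
    intro h
    rw [expS, mul_sum]
    refine sum_congr rfl fun r _ => ?_
    rw [← AddChar.map_add_eq_mul]
    congr 1
    ring
  simp only [h1]
  rw [sum_comm]
  simp only [AddChar.sum_mulShift _ (ZMod.isPrimitive_stdAddChar q), ZMod.card]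
  rw [NR, card_filter, Nat.cast_sum, mul_sum]
  refine sum_congr rfl fun r _ => ?_
  split_ifs <;> simp

theorem norm_sum_stdAddChar_le {h : ZMod q} (hh : h ≠ 0) (u v : ℤ) :
    ‖∑ d ∈ Ico u v, (ZMod.stdAddChar (h * (d : ZMod q)) : ℂ)‖ ≤
      2 / ‖(ZMod.stdAddChar h : ℂ) - 1‖ := by
  have h1 : (ZMod.stdAddChar h : ℂ) - 1 ≠ 0 := by
    rw [sub_ne_zero]
    intro h2
    apply hh
    apply ZMod.injective_stdAddChar
    rw [h2, AddChar.map_zero_eq_one]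
  rcases le_or_gt v u with huv | huv
  · rw [Ico_eq_empty (by simpa using huv), sum_empty, norm_zero]
    positivity
  rw [le_div_iff₀ (norm_pos_iff.2 h1), ← norm_mul]
  have h2 : (∑ d ∈ Ico u v, (ZMod.stdAddChar (h * (d : ZMod q)) : ℂ)) *
      ((ZMod.stdAddChar h : ℂ) - 1) =
      (ZMod.stdAddChar (h * (v : ZMod q)) : ℂ) - ZMod.stdAddChar (h * (u : ZMod q)) := by
    obtain ⟨n, rfl⟩ : ∃ n : ℕ, v = u + n := ⟨(v - u).toNat, by lia⟩
    clear huv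
    induction n with
    | zero => simp
    | succ n ih =>
      have : Ico u (u + (n + 1 : ℕ)) = insert (u + n : ℤ) (Ico u (u + n)) := by
        ext x; simp only [mem_insert, mem_Ico]; push_cast; lia
      rw [this, sum_insert (by simp), add_mul, ih]
      have e : (ZMod.stdAddChar (h * ((u + (n + 1 : ℕ) : ℤ) : ZMod q)) : ℂ) =
          ZMod.stdAddChar (h * ((u + n : ℤ) : ZMod q)) * ZMod.stdAddChar h := by
        rw [← AddChar.map_add_eq_mul]
        congr 1
        push_cast
        ring
      rw [e]
      ring
  rw [h2]
  refine (norm_sub_le _ _).trans ?_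
  rw [AddChar.norm_apply, AddChar.norm_apply]
  norm_num

/-- The number of roots has mean value one over intervals, up to the discrepancy. -/
theorem abs_sum_NR_sub_one_le (a b c : ZMod q) (u v : ℤ) :
    |∑ d ∈ Ico u v, ((NR q a b c (d : ZMod q) : ℝ) - 1)| ≤ Edis q a b c := by
  have hq : (0 : ℝ) < q := by exact_mod_cast Nat.pos_of_ne_zero (NeZero.ne q)
  have h0 : expS a b c 0 = q := by simp [expS, ZMod.card]
  have h1 : ∀ d : ZMod q, (q : ℂ) * ((NR q a b c d : ℂ) - 1) =
      ∑ h ∈ univ.filter (fun h : ZMod q => h ≠ 0), ZMod.stdAddChar (h * d) * expS a b c h := by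
    intro d
    rw [mul_sub, NR_eq_sum, ← sum_filter_add_sum_filter_not univ (fun h : ZMod q => h ≠ 0)]
    simp only [not_not]
    rw [filter_eq' univ (0 : ZMod q)]
    simp [h0]
  have h2 : (q : ℂ) * ∑ d ∈ Ico u v, ((NR q a b c (d : ZMod q) : ℂ) - 1) =
      ∑ h ∈ univ.filter (fun h : ZMod q => h ≠ 0),
        (∑ d ∈ Ico u v, (ZMod.stdAddChar (h * (d : ZMod q)) : ℂ)) * expS a b c h := by
    rw [mul_sum]
    simp only [h1, sum_mul]
    rw [sum_comm]
  rw [Edis, le_div_iff₀ hq, ← norm_eq_abs, ← Complex.norm_real, mul_comm]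
  have h3 : (q : ℝ) = ‖(q : ℂ)‖ := by simp
  rw [h3, ← norm_mul]
  push_cast
  rw [h2]
  refine (norm_sum_le _ _).trans (sum_le_sum fun h hh => ?_)
  rw [norm_mul, mul_comm]
  gcongr
  exact norm_sum_stdAddChar_le (mem_filter.1 hh).2 u v

theorem card_filter_mul_eq_zero_le {j : ℕ} (hj : j ≠ 0) :
    (univ.filter fun x : ZMod q => (j : ZMod q) * x = 0).card ≤ j.gcd q := by
  have hg : 0 < j.gcd q := Nat.gcd_pos_of_pos_left _ (Nat.pos_of_ne_zero hj)
  refine (card_le_card ?_).trans (IsAddCyclic.card_nsmul_eq_zero_le (α := ZMod q) hg)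
  intro x hx
  have hx := (mem_filter.1 hx).2
  rw [mem_filter]
  refine ⟨mem_univ _, ?_⟩
  rw [nsmul_eq_mul]
  have := Nat.gcd_eq_gcd_ab j q
  have h2 := congrArg (fun t : ℤ => (t : ZMod q)) this
  simp only [Int.cast_natCast, Int.cast_add, Int.cast_mul, CharP.cast_eq_zero, zero_mul,
    add_zero] at h2
  rw [h2, mul_right_comm, hx, zero_mul]

theorem sum_norm_expS_sq_le (a b : ZMod q) {j : ℕ} (hj : j ≠ 0) :
    ∑ c : ZMod q, ‖expS a b c j‖ ^ 2 ≤ (q : ℝ) ^ 2 * j.gcd q := by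
  have h1 : ∀ c : ZMod q, ((‖expS a b c j‖ ^ 2 : ℝ) : ℂ) = ∑ r : ZMod q, ∑ s : ZMod q,
      (ZMod.stdAddChar ((j : ZMod q) * (a * r ^ 3 + b * r ^ 2 - a * s ^ 3 - b * s ^ 2)) : ℂ) *
        ZMod.stdAddChar (c * ((j : ZMod q) * (r - s))) := by
    intro c
    rw [Complex.ofReal_pow, ← Complex.mul_conj', expS, map_sum, sum_mul_sum]
    refine sum_congr rfl fun r _ => sum_congr rfl fun s _ => ?_
    rw [← AddChar.map_neg_eq_conj, ← AddChar.map_add_eq_mul, ← AddChar.map_add_eq_mul]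
    congr 1
    ring
  have h2 : ((∑ c : ZMod q, ‖expS a b c j‖ ^ 2 : ℝ) : ℂ) = ∑ r : ZMod q, ∑ s : ZMod q,
      (ZMod.stdAddChar ((j : ZMod q) * (a * r ^ 3 + b * r ^ 2 - a * s ^ 3 - b * s ^ 2)) : ℂ) *
        (if (j : ZMod q) * (r - s) = 0 then q else 0 : ℕ) := by
    rw [Complex.ofReal_sum]
    simp only [h1]
    rw [sum_comm]
    refine sum_congr rfl fun r _ => ?_
    rw [sum_comm]
    refine sum_congr rfl fun s _ => ?_
    rw [← mul_sum, AddChar.sum_mulShift _ (ZMod.isPrimitive_stdAddChar q), ZMod.card]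
  have h0 : 0 ≤ ∑ c : ZMod q, ‖expS a b c j‖ ^ 2 := sum_nonneg fun _ _ => by positivity
  have h3 : ∑ c : ZMod q, ‖expS a b c j‖ ^ 2 = ‖((∑ c : ZMod q, ‖expS a b c j‖ ^ 2 : ℝ) : ℂ)‖ := by
    rw [Complex.norm_real, norm_eq_abs, abs_of_nonneg h0]
  rw [h3, h2]
  calc _ ≤ ∑ r : ZMod q, ∑ s : ZMod q, ((if (j : ZMod q) * (r - s) = 0 then q else 0 : ℕ) : ℝ) := by
        refine (norm_sum_le _ _).trans (sum_le_sum fun r _ => (norm_sum_le _ _).trans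
          (sum_le_sum fun s _ => ?_))
        rw [norm_mul, AddChar.norm_apply, one_mul, Complex.norm_natCast]
    _ = ∑ r : ZMod q, (q : ℝ) * (univ.filter fun x : ZMod q => (j : ZMod q) * x = 0).card := by
        refine sum_congr rfl fun r _ => ?_
        rw [card_filter, Nat.cast_sum, mul_sum]
        refine Fintype.sum_equiv (Equiv.subLeft r) _ _ fun s => ?_
        simp only [Equiv.subLeft_apply]
        split_ifs <;> simp
    _ ≤ ∑ r : ZMod q, (q : ℝ) * (j.gcd q : ℕ) := by
        gcongr
        exact card_filter_mul_eq_zero_le hj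
    _ = _ := by
        rw [sum_const, card_univ, ZMod.card, nsmul_eq_mul]
        ring

theorem two_div_norm_stdAddChar_le {j : ℕ} (h0 : 0 < j) (hj : j < q) :
    2 / ‖(ZMod.stdAddChar (j : ZMod q) : ℂ) - 1‖ ≤ (q : ℝ) / 2 * (1 / j + 1 / (q - j : ℝ)) := by
  have hq : (0 : ℝ) < q := by exact_mod_cast Nat.pos_of_ne_zero (NeZero.ne q)
  have hj0 : (0 : ℝ) < j := by exact_mod_cast h0
  have hjq : (0 : ℝ) < q - j := sub_pos.2 (by exact_mod_cast hj)
  have hπ := pi_pos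
  have e : (ZMod.stdAddChar (j : ZMod q) : ℂ) =
      Complex.exp (Complex.I * ((2 * π * j / q : ℝ) : ℂ)) := by
    have := ZMod.stdAddChar_coe (N := q) (j : ℤ)
    rw [Int.cast_natCast] at this
    rw [this]
    congr 1
    push_cast
    ring
  rw [e, Complex.norm_exp_I_mul_ofReal_sub_one, norm_mul, norm_eq_abs, norm_eq_abs,
    abs_of_pos (zero_lt_two' ℝ)]
  have e2 : 2 * π * j / q / 2 = π * j / q := by ring
  rw [e2]
  have key : ∀ x : ℝ, 0 < x → x ≤ q / 2 → 2 / (2 * |Real.sin (π * x / q)|) ≤ q / 2 * (1 / x) := by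
    intro x hx hxq
    have h1 := mul_le_sin (x := π * x / q) (by positivity) (by
      rw [div_le_div_iff₀ hq two_pos]; nlinarith)
    have h2 : 2 / π * (π * x / q) = 2 * x / q := by field_simp
    rw [h2] at h1
    have h3 : 0 < 2 * x / q := by positivity
    rw [abs_of_pos (h3.trans_le h1)]
    calc _ ≤ 2 / (2 * (2 * x / q)) := by gcongr
      _ = _ := by field_simp; 
  rcases le_total (j : ℝ) (q / 2) with h | h
  · refine (key j hj0 h).trans ?_
    gcongr
    have : 0 < 1 / (q - j : ℝ) := by positivity
    linarith
  · have h1 := key (q - j) hjq (by linarith)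
    have h2 : Real.sin (π * (q - j) / q) = Real.sin (π * j / q) := by
      rw [← Real.sin_pi_sub]
      congr 1
      field_simp
      ring
    rw [h2] at h1
    refine h1.trans ?_
    gcongr
    have : 0 < 1 / (j : ℝ) := by positivity
    linarith

theorem sum_norm_expS_le (a b : ZMod q) {j : ℕ} (hj : j ≠ 0) :
    ∑ c : ZMod q, ‖expS a b c j‖ ≤ (q : ℝ) ^ (3 / 2 : ℝ) * j.gcd q := by
  have hq : (0 : ℝ) < q := by exact_mod_cast Nat.pos_of_ne_zero (NeZero.ne q)
  have h1 : (∑ c : ZMod q, ‖expS a b c j‖) ^ 2 ≤ ((q : ℝ) ^ (3 / 2 : ℝ) * j.gcd q) ^ 2 := by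
    refine sq_sum_le_card_mul_sum_sq.trans ?_
    rw [card_univ, ZMod.card]
    have h2 := sum_norm_expS_sq_le a b hj
    have h3 : ((q : ℝ) ^ (3 / 2 : ℝ)) ^ 2 = q ^ 3 := by
      rw [← rpow_natCast, ← rpow_mul hq.le, ← rpow_natCast]
      norm_num
    have h4 : (1 : ℝ) ≤ j.gcd q := by
      exact_mod_cast Nat.gcd_pos_of_pos_left _ (Nat.pos_of_ne_zero hj)
    rw [mul_pow, h3]
    calc (q : ℝ) * _ ≤ q * (q ^ 2 * j.gcd q) := by gcongr
      _ = q ^ 3 * j.gcd q := by ring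
      _ ≤ _ := by
        gcongr
        exact le_self_pow₀ h4 (by norm_num)
  exact le_of_sq_le_sq h1 (by positivity)

end Fourier

theorem sum_gcd_div_le (q : ℕ) (hq : q ≠ 0) :
    ∑ j ∈ Ico 1 q, (j.gcd q : ℝ) / j ≤ q.divisors.card * (1 + Real.log q) := by
  have h1 : ∀ j ∈ Ico 1 q, (j.gcd q : ℝ) / j ≤
      ∑ g ∈ q.divisors, if g ∣ j then (g : ℝ) / j else 0 := by
    intro j hj
    have := single_le_sum (s := q.divisors) (f := fun g => if g ∣ j then (g : ℝ) / j else 0)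
      (fun g _ => by split_ifs <;> positivity)
      (Nat.mem_divisors.2 ⟨Nat.gcd_dvd_right j q, hq⟩)
    rwa [if_pos (Nat.gcd_dvd_left j q)] at this
  refine (sum_le_sum h1).trans ?_
  rw [sum_comm, ← nsmul_eq_mul, ← sum_const]
  refine sum_le_sum fun g hg => ?_
  have hg0 : 0 < g := Nat.pos_of_mem_divisors hg
  rw [← sum_filter]
  have h2 : ∑ j ∈ (Ico 1 q).filter (fun j => g ∣ j), (g : ℝ) / j =
      ∑ m ∈ ((Ico 1 q).filter (fun j => g ∣ j)).image (fun j => j / g), (m : ℝ)⁻¹ := by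
    rw [sum_image]
    · refine sum_congr rfl fun j hj => ?_
      obtain ⟨k, rfl⟩ := (mem_filter.1 hj).2
      rw [Nat.mul_div_cancel_left _ hg0]
      push_cast
      have : (g : ℝ) ≠ 0 := by positivity
      rw [div_mul_eq_div_div, div_self this, one_div]
    · intro x hx y hy hxy
      obtain ⟨k, rfl⟩ := (mem_filter.1 hx).2
      obtain ⟨l, rfl⟩ := (mem_filter.1 hy).2
      simp only [Nat.mul_div_cancel_left _ hg0] at hxy
      rw [hxy]
  rw [h2]
  have h3 := harmonic_le_one_add_log q
  rw [harmonic_eq_sum_Icc] at h3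
  push_cast at h3
  refine le_trans (sum_le_sum_of_subset_of_nonneg ?_ fun _ _ _ => by positivity) h3
  intro m hm
  obtain ⟨j, hj, rfl⟩ := mem_image.1 hm
  obtain ⟨hj, k, rfl⟩ := mem_filter.1 hj
  rw [mem_Ico] at hj
  rw [Nat.mul_div_cancel_left _ hg0, mem_Icc]
  constructor
  · rcases Nat.eq_zero_or_pos k with rfl | h
    · simp at hj
    · exact h
  · nlinarith

/-- The average discrepancy. -/
theorem sum_Edis_le (q : ℕ) [NeZero q] (a b : ZMod q) :
    ∑ c : ZMod q, Edis q a b c ≤ (q : ℝ) ^ (3 / 2 : ℝ) * (q.divisors.card * (1 + Real.log q)) := by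
  have hq : (0 : ℝ) < q := by exact_mod_cast Nat.pos_of_ne_zero (NeZero.ne q)
  have h1 : ∑ c : ZMod q, Edis q a b c = (∑ j ∈ Ico 1 q, (∑ c : ZMod q, ‖expS a b c j‖) *
      (2 / ‖(ZMod.stdAddChar (j : ZMod q) : ℂ) - 1‖)) / q := by
    unfold Edis
    rw [← sum_div, sum_comm]
    congr 1
    simp only [sum_mul]
    refine sum_nbij' (fun h => h.val) (fun j => (j : ZMod q)) ?_ ?_ ?_ ?_ ?_
    · intro h hh
      rw [mem_Ico]
      refine ⟨Nat.one_le_iff_ne_zero.2 fun h0 => (mem_filter.1 hh).2 ?_, ZMod.val_lt h⟩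
      exact (ZMod.val_eq_zero h).1 h0
    · intro j hj
      rw [mem_Ico] at hj
      rw [mem_filter]
      refine ⟨mem_univ _, fun h0 => ?_⟩
      have := congrArg ZMod.val h0
      rw [ZMod.val_natCast_of_lt hj.2, ZMod.val_zero] at this
      lia
    · intro h _
      exact ZMod.natCast_zmod_val h
    · intro j hj
      exact ZMod.val_natCast_of_lt (mem_Ico.1 hj).2
    · intro h _
      simp only [ZMod.natCast_zmod_val]
  rw [h1, div_le_iff₀ hq]
  calc _ ≤ ∑ j ∈ Ico 1 q, ((q : ℝ) ^ (3 / 2 : ℝ) * j.gcd q) *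
        ((q : ℝ) / 2 * (1 / j + 1 / (q - j : ℝ))) := by
        refine sum_le_sum fun j hj => ?_
        rw [mem_Ico] at hj
        gcongr
        · exact sum_norm_expS_le a b (by lia)
        · exact two_div_norm_stdAddChar_le (by lia) hj.2
    _ = (q : ℝ) ^ (3 / 2 : ℝ) * (q / 2) * (∑ j ∈ Ico 1 q, (j.gcd q : ℝ) / j +
        ∑ j ∈ Ico 1 q, (j.gcd q : ℝ) / (q - j)) := by
        rw [← sum_add_distrib, mul_sum]
        refine sum_congr rfl fun j _ => ?_
        ring
    _ = (q : ℝ) ^ (3 / 2 : ℝ) * q * ∑ j ∈ Ico 1 q, (j.gcd q : ℝ) / j := by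
        have : ∑ j ∈ Ico 1 q, (j.gcd q : ℝ) / (q - j) = ∑ j ∈ Ico 1 q, (j.gcd q : ℝ) / j := by
          refine sum_nbij' (fun j => q - j) (fun j => q - j) ?_ ?_ ?_ ?_ ?_
          · intro j hj; rw [mem_Ico] at *; lia
          · intro j hj; rw [mem_Ico] at *; lia
          · intro j hj; rw [mem_Ico] at *; lia
          · intro j hj; rw [mem_Ico] at *; lia
          · intro j hj
            rw [mem_Ico] at hj
            rw [Nat.gcd_self_sub_left hj.2.le, Nat.cast_sub hj.2.le, Nat.gcd_comm]
        rw [this]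
        ring
    _ ≤ (q : ℝ) ^ (3 / 2 : ℝ) * q * (q.divisors.card * (1 + Real.log q)) := by
        gcongr
        exact sum_gcd_div_le q (NeZero.ne q)
    _ = _ := by ring

theorem exists_sum_Edis_le : ∃ C : ℝ, 0 < C ∧ ∀ (q : ℕ) [NeZero q] (a b : ZMod q),
    ∑ c : ZMod q, Edis q a b c ≤ C * (q : ℝ) ^ (61 / 40 : ℝ) := by
  obtain ⟨C, hC, h⟩ := exists_card_divisors_le (ε := 1 / 80) (by norm_num)
  refine ⟨C * 81, by positivity, fun q _ a b => (sum_Edis_le q a b).trans ?_⟩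
  have hq0 : q ≠ 0 := NeZero.ne q
  have hq1 : (1 : ℝ) ≤ q := by exact_mod_cast Nat.pos_of_ne_zero hq0
  have hl := log_le_rpow_div (x := q) (ε := 1 / 80) (by positivity) (by norm_num)
  have h1 : (1 : ℝ) ≤ (q : ℝ) ^ (1 / 80 : ℝ) := one_le_rpow hq1 (by norm_num)
  have h2 := h q hq0
  have hl0 := log_nonneg hq1
  calc (q : ℝ) ^ (3 / 2 : ℝ) * (q.divisors.card * (1 + Real.log q))
      ≤ (q : ℝ) ^ (3 / 2 : ℝ) * ((C * (q : ℝ) ^ (1 / 80 : ℝ)) * (81 * (q : ℝ) ^ (1 / 80 : ℝ))) := by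
        gcongr
        rw [div_eq_mul_inv] at hl
        norm_num at hl
        linarith
    _ = C * 81 * ((q : ℝ) ^ (3 / 2 : ℝ) * (q : ℝ) ^ (1 / 80 : ℝ) * (q : ℝ) ^ (1 / 80 : ℝ)) := by
        ring
    _ = _ := by
        rw [← rpow_add (by positivity), ← rpow_add (by positivity)]
        norm_num

end

section
open Finset

/-- The number of roots modulo `q` of a cubic polynomial with integer coefficients. -/
def NRZ (q : ℕ) (a b c d : ℤ) : ℕ :=
  (univ.filter fun r : Fin q => (q : ℤ) ∣ a * r ^ 3 + b * r ^ 2 + c * r + d).card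

theorem NRZ_eq_NR (q : ℕ) [NeZero q] (a b c d : ℤ) : NRZ q a b c d = NR q a b c d := by
  refine card_bij' (fun r _ => ((r : ℕ) : ZMod q)) (fun r _ => ⟨r.val, ZMod.val_lt r⟩) ?_ ?_ ?_ ?_
  · intro r hr
    have := (mem_filter.1 hr).2
    rw [← ZMod.intCast_zmod_eq_zero_iff_dvd] at this
    push_cast at this
    exact mem_filter.2 ⟨mem_univ _, this⟩
  · intro r hr
    have := (mem_filter.1 hr).2
    refine mem_filter.2 ⟨mem_univ _, ?_⟩
    rw [← ZMod.intCast_zmod_eq_zero_iff_dvd]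
    push_cast
    rw [ZMod.natCast_zmod_val]
    exact this
  · intro r _
    ext
    exact ZMod.val_natCast_of_lt r.2
  · intro r _
    exact ZMod.natCast_zmod_val r

theorem NRZ_one (a b c d : ℤ) : NRZ 1 a b c d = 1 := by
  simp [NRZ]

theorem NRZ_mul {m n : ℕ} (hm : m ≠ 0) (hn : n ≠ 0) (h : m.Coprime n) (a b c d : ℤ) :
    NRZ (m * n) a b c d = NRZ m a b c d * NRZ n a b c d := by
  have : NeZero m := ⟨hm⟩
  have : NeZero n := ⟨hn⟩
  rw [NRZ_eq_NR, NRZ_eq_NR, NRZ_eq_NR, NR, NR, NR, ← card_product]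
  refine card_equiv (ZMod.chineseRemainder h).toEquiv fun r => ?_
  rw [mem_product, mem_filter, mem_filter, mem_filter]
  simp only [mem_univ, true_and]
  rw [← map_eq_zero_iff _ (ZMod.chineseRemainder h).injective, Prod.ext_iff]
  simp only [map_add, map_mul, map_pow, map_intCast]
  simp

theorem NRZ_prod (E : Finset ℕ) (hE : ∀ p ∈ E, p.Prime) (a b c d : ℤ) :
    ∏ p ∈ E, NRZ p a b c d = NRZ (∏ p ∈ E, p) a b c d := by
  induction E using Finset.induction_on with
  | empty => simp [NRZ_one]
  | insert p E hp ih =>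
    rw [prod_insert hp, prod_insert hp, ih fun q hq => hE q (mem_insert_of_mem hq), NRZ_mul]
    · exact (hE p (mem_insert_self _ _)).ne_zero
    · exact prod_ne_zero_iff.2 fun q hq => (hE q (mem_insert_of_mem hq)).ne_zero
    · refine Nat.Coprime.prod_right fun q hq => ?_
      refine (Nat.coprime_primes (hE p (mem_insert_self _ _)) (hE q (mem_insert_of_mem hq))).2 ?_
      rintro rfl
      exact hp hq

theorem prod_om_eq (E : Finset ℕ) (hE : ∀ p ∈ E, p.Prime) (f : BCF) :
    ∏ p ∈ E, om p f = ∑ T ∈ E.powerset, if ((∏ p ∈ T, p : ℕ) : ℤ) ∣ f.a then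
      NRZ (∏ p ∈ E \ T, p) f.a f.b f.c f.d else 0 := by
  have h1 : ∏ p ∈ E, om p f = ∏ p ∈ E, ((if (p : ℤ) ∣ f.a then 1 else 0) +
      NRZ p f.a f.b f.c f.d) := prod_congr rfl fun p _ => om_eq p f
  rw [h1, prod_add]
  refine sum_congr rfl fun T hT => ?_
  rw [mem_powerset] at hT
  have h2 : (∀ p ∈ T, (p : ℤ) ∣ f.a) ↔ ((∏ p ∈ T, p : ℕ) : ℤ) ∣ f.a := by
    constructor
    · intro h
      push_cast
      refine Finset.prod_dvd_of_coprime (fun p hp r hr hpr => ?_) h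
      simp only [Function.onFun]
      exact Nat.isCoprime_iff_coprime.2 ((Nat.coprime_primes (hE p (hT hp)) (hE r (hT hr))).2 hpr)
    · intro h p hp
      refine dvd_trans ?_ h
      push_cast
      exact dvd_prod_of_mem _ hp
  rw [NRZ_prod _ fun p hp => hE p (mem_sdiff.1 hp).1]
  split_ifs with h
  · rw [prod_congr rfl fun p hp => if_pos (h2.2 h p hp)]
    simp
  · obtain ⟨p, hp, hpa⟩ : ∃ p ∈ T, ¬ (p : ℤ) ∣ f.a := by
      by_contra hc
      push Not at hc
      exact h (h2.1 hc)
    rw [prod_eq_zero hp (if_neg hpa), zero_mul]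

theorem sum_periodic_le {q : ℕ} [NeZero q] (g : ZMod q → ℝ) (hg : ∀ x, 0 ≤ g x) (u : ℤ) (n : ℕ)
    (s : Finset ℤ) (hs : ∀ c ∈ s, u ≤ c ∧ c < u + n) :
    ∑ c ∈ s, g c ≤ ((n : ℝ) / q + 1) * ∑ x, g x := by
  have hq : 0 < q := Nat.pos_of_ne_zero (NeZero.ne q)
  have hq' : (0 : ℝ) < q := by exact_mod_cast hq
  have h0 : 0 ≤ ∑ x, g x := sum_nonneg fun x _ => hg x
  have h1 : ∑ c ∈ s, g c ≤ ∑ k ∈ range (n / q + 1), ∑ x, g x := by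
    have h2 : ∀ k ∈ range (n / q + 1), ∑ x, g x = ∑ j : Fin q, g ((u + q * k + j : ℤ) : ZMod q) := by
      intro k _
      symm
      have hb : Function.Bijective (fun j : Fin q => ((u + q * k + j : ℤ) : ZMod q)) := by
        rw [Fintype.bijective_iff_injective_and_card]
        refine ⟨fun i j hij => ?_, by simp [ZMod.card]⟩
        simp only [Int.cast_add, Int.cast_mul, Int.cast_natCast, CharP.cast_eq_zero, zero_mul,
          add_zero, add_right_inj] at hij
        have := congrArg ZMod.val hij
        rw [ZMod.val_natCast_of_lt i.2, ZMod.val_natCast_of_lt j.2] at this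
        exact Fin.ext this
      exact Fintype.sum_bijective _ hb _ _ fun _ => rfl
    rw [sum_congr rfl h2, sum_sigma']
    have h3 : s ⊆ ((range (n / q + 1)).sigma fun _ => (univ : Finset (Fin q))).image
        (fun x => (u + q * (x.1 : ℕ) + (x.2 : ℕ) : ℤ)) := by
      intro c hc
      obtain ⟨hc1, hc2⟩ := hs c hc
      obtain ⟨m, hm⟩ : ∃ m : ℕ, c = u + m := ⟨(c - u).toNat, by lia⟩
      refine mem_image.2 ⟨⟨m / q, ⟨m % q, Nat.mod_lt _ hq⟩⟩, ?_, ?_⟩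
      · refine mem_sigma.2 ⟨mem_range.2 (Nat.lt_succ_of_le (Nat.div_le_div_right ?_)), mem_univ _⟩
        lia
      · rw [hm]
        have := Nat.div_add_mod m q
        have : (m : ℤ) = q * (m / q : ℕ) + (m % q : ℕ) := by exact_mod_cast this.symm
        linarith
    refine (sum_le_sum_of_subset_of_nonneg h3 fun c _ _ => hg _).trans ?_
    exact sum_image_le_of_nonneg fun x _ => hg _
  refine h1.trans ?_
  rw [sum_const, card_range, nsmul_eq_mul]
  refine mul_le_mul_of_nonneg_right ?_ h0
  push_cast
  have : ((n / q : ℕ) : ℝ) ≤ n / q := Nat.cast_div_le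
  linarith

/-- The discrepancy of the number of roots modulo `q` over intervals of constant terms. -/
theorem exists_discrepancy : ∃ C : ℝ, 0 < C ∧ ∀ q : ℕ, q ≠ 0 → ∃ Ed : ℤ → ℤ → ℤ → ℝ,
    (∀ a b c, 0 ≤ Ed a b c) ∧
    (∀ a b c u v, |∑ d ∈ Ico u v, ((NRZ q a b c d : ℝ) - 1)| ≤ Ed a b c) ∧
    ∀ a b u (n : ℕ) (s : Finset ℤ), (∀ c ∈ s, u ≤ c ∧ c < u + n) →
      ∑ c ∈ s, Ed a b c ≤ C * ((n / q + 1) * (q : ℝ) ^ (61 / 40 : ℝ)) := by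
  obtain ⟨C, hC, h⟩ := exists_sum_Edis_le
  refine ⟨C, hC, fun q hq => ?_⟩
  have : NeZero q := ⟨hq⟩
  refine ⟨fun a b c => Edis q a b c, fun _ _ _ => Edis_nonneg _ _ _, fun a b c u v => ?_,
    fun a b u n s hs => ?_⟩
  · simp only [NRZ_eq_NR]
    exact abs_sum_NR_sub_one_le _ _ _ u v
  · refine (sum_periodic_le (fun c => Edis q a b c) (fun _ => Edis_nonneg _ _ _) u n s hs).trans ?_
    calc _ ≤ ((n : ℝ) / q + 1) * (C * (q : ℝ) ^ (61 / 40 : ℝ)) := by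
          gcongr
          exact h q a b
      _ = _ := by ring

end

section
open ENNReal MeasureTheory Set

/-- A set whose frontier is contained in a finite set of `m` points is a union of at most
`2 * m + 1` disjoint order connected sets. -/
theorem exists_ordConnected_pieces {S : Set ℝ} {Z : Finset ℝ} (h : frontier S ⊆ Z) :
    ∃ T : Fin (Z.card + 1) ⊕ Z → Set ℝ, (∀ i, (T i).OrdConnected) ∧
      Pairwise (fun i j => Disjoint (T i) (T j)) ∧ S = ⋃ i, T i := by
  classical
  let N : ℝ → ℕ := fun t => (Z.filter fun z => z < t).card
  have hmono : Monotone N := fun s t hst => Finset.card_le_card fun z hz => by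
    rw [Finset.mem_filter] at hz ⊢
    exact ⟨hz.1, hz.2.trans_le hst⟩
  have hN : ∀ t, N t < Z.card + 1 := fun t => Nat.lt_succ_of_le (Finset.card_filter_le _ _)
  let J : ℕ → Set ℝ := fun k => {t | t ∉ Z ∧ N t = k}
  have hJ : ∀ k, (J k).OrdConnected := by
    intro k
    refine ⟨fun s hs t ht u hu => ?_⟩
    have h1 := hmono hu.1
    have h2 := hmono hu.2
    refine ⟨fun hz => ?_, by have := hs.2; have := ht.2; omega⟩
    have hut : u < t := lt_of_le_of_ne hu.2 fun h => ht.1 (h ▸ hz)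
    have : N u < N t := by
      refine Finset.card_lt_card ⟨fun z hz => ?_, fun hsub => ?_⟩
      · rw [Finset.mem_filter] at hz ⊢
        exact ⟨hz.1, hz.2.trans_le hu.2⟩
      · have := hsub (Finset.mem_filter.2 ⟨hz, hut⟩)
        exact lt_irrefl _ (Finset.mem_filter.1 this).2
    have := hs.2
    have := ht.2
    omega
  have hJS : ∀ k, J k ⊆ S ∨ Disjoint (J k) S := by
    intro k
    by_contra hcon
    push Not at hcon
    obtain ⟨h1, h2⟩ := hcon
    obtain ⟨x, hx, hxS⟩ := Set.not_subset.1 h1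
    obtain ⟨y, hy, hyS⟩ := Set.not_disjoint_iff.1 h2
    have hc : IsPreconnected (J k) := isPreconnected_iff_ordConnected.2 (hJ k)
    have hfr : ∀ t ∈ J k, t ∉ frontier S := fun t ht hf => ht.1 (h hf)
    have hin : ∀ (A : Set ℝ), frontier A = frontier S → ∀ t ∈ J k, t ∈ A → t ∈ interior A := by
      intro A hA t ht htA
      by_contra hcon
      exact hfr t ht (hA ▸ ⟨subset_closure htA, hcon⟩)
    obtain ⟨z, -, hz1, hz2⟩ := hc (interior S) (interior Sᶜ) isOpen_interior isOpen_interior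
      (fun t ht => (em (t ∈ S)).imp (hin S rfl t ht) (hin Sᶜ (frontier_compl S) t ht))
      ⟨y, hy, hin S rfl y hy hyS⟩ ⟨x, hx, hin Sᶜ (frontier_compl S) x hx hxS⟩
    exact interior_subset hz2 (interior_subset hz1)
  refine ⟨Sum.elim (fun k => if J k ⊆ S then J k else ∅)
    (fun z => if (z : ℝ) ∈ S then {(z : ℝ)} else ∅), ?_, ?_, ?_⟩
  · rintro (k | z)
    · simp only [Sum.elim_inl]
      split_ifs
      · exact hJ k
      · exact ordConnected_empty
    · simp only [Sum.elim_inr]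
      split_ifs
      · exact ordConnected_singleton
      · exact ordConnected_empty
  · have h0 : ∀ (k : ℕ) (z : Z), Disjoint (J k) {(z : ℝ)} := fun k z => by
      rw [Set.disjoint_singleton_right]
      exact fun hh => hh.1 z.2
    rintro (k | z) (k' | z') hne
    · simp only [Sum.elim_inl]
      have : Disjoint (J k) (J k') := by
        rw [Set.disjoint_left]
        intro t ht ht'
        apply hne
        congr 1
        exact Fin.ext (ht.2.symm.trans ht'.2)
      split_ifs <;> simp [this]
    · simp only [Sum.elim_inl, Sum.elim_inr]
      split_ifs <;> try simp only [Set.disjoint_empty, Set.empty_disjoint]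
      exact h0 _ _
    · simp only [Sum.elim_inl, Sum.elim_inr]
      split_ifs <;> try simp only [Set.disjoint_empty, Set.empty_disjoint]
      exact (h0 _ _).symm
    · simp only [Sum.elim_inr]
      split_ifs <;> try simp only [Set.disjoint_empty, Set.empty_disjoint]
      rw [Set.disjoint_singleton]
      exact fun h => hne (congrArg Sum.inr (Subtype.ext h))
  · ext t
    simp only [Set.mem_iUnion, Sum.exists]
    constructor
    · intro ht
      by_cases hz : t ∈ Z
      · right
        exact ⟨⟨t, hz⟩, by simp [ht]⟩
      · left
        refine ⟨⟨N t, hN t⟩, ?_⟩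
        have htJ : t ∈ J (N t) := ⟨hz, rfl⟩
        have : J (N t) ⊆ S := (hJS _).resolve_right fun hd => Set.disjoint_left.1 hd htJ ht
        simp only [Sum.elim_inl]
        rw [if_pos this]
        exact htJ
    · rintro (⟨k, hk⟩ | ⟨z, hz⟩)
      · simp only [Sum.elim_inl] at hk
        split_ifs at hk with hh
        · exact hh hk
        · exact hk.elim
      · simp only [Sum.elim_inr] at hz
        split_ifs at hz with hh
        · rw [hz]; exact hh
        · exact hz.elim

open Classical in
theorem abs_sum_filter_le_of_frontier {S : Set ℝ} {Z : Finset ℝ} (h : frontier S ⊆ Z)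
    {I : Finset ℤ} (hI : ∀ n : ℤ, (n : ℝ) ∈ S → n ∈ I) {g : ℤ → ℝ} {E : ℝ}
    (hg : ∀ u v : ℤ, |∑ n ∈ Finset.Ico u v, g n| ≤ E) :
    |∑ n ∈ I.filter (fun n : ℤ => (n : ℝ) ∈ S), g n| ≤ (2 * Z.card + 1) * E := by
  obtain ⟨T, hT, hTd, hTS⟩ := exists_ordConnected_pieces h
  have h1 : I.filter (fun n : ℤ => (n : ℝ) ∈ S) =
      Finset.univ.biUnion fun i => I.filter (fun n : ℤ => (n : ℝ) ∈ T i) := by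
    ext n
    simp [hTS]
  rw [h1, Finset.sum_biUnion]
  · refine (Finset.abs_sum_le_sum_abs _ _).trans ?_
    have h2 : ∀ i ∈ Finset.univ, |∑ n ∈ I.filter (fun n : ℤ => (n : ℝ) ∈ T i), g n| ≤ E := by
      intro i _
      by_cases hne : (I.filter (fun n : ℤ => (n : ℝ) ∈ T i)).Nonempty
      · set F := I.filter (fun n : ℤ => (n : ℝ) ∈ T i) with hF
        have : F = Finset.Ico (F.min' hne) (F.max' hne + 1) := by
          ext n
          rw [Finset.mem_Ico, Int.lt_add_one_iff]
          refine ⟨fun hn => ⟨F.min'_le n hn, F.le_max' n hn⟩, fun hn => ?_⟩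
          have hmin := (Finset.mem_filter.1 (F.min'_mem hne)).2
          have hmax := (Finset.mem_filter.1 (F.max'_mem hne)).2
          have hnT : (n : ℝ) ∈ T i := (hT i).out hmin hmax
            ⟨by exact_mod_cast hn.1, by exact_mod_cast hn.2⟩
          rw [hF, Finset.mem_filter]
          exact ⟨hI n (hTS ▸ Set.mem_iUnion.2 ⟨i, hnT⟩), hnT⟩
        rw [this]
        exact hg _ _
      · rw [Finset.not_nonempty_iff_eq_empty.1 hne, Finset.sum_empty, abs_zero]
        exact (abs_nonneg _).trans (hg 0 0)
    refine (Finset.sum_le_sum h2).trans (le_of_eq ?_)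
    simp only [Finset.sum_const, Finset.card_univ, Fintype.card_sum, Fintype.card_fin,
      Fintype.card_coe, nsmul_eq_mul]
    push_cast
    ring
  · intro i _ j _ hij
    rw [Function.onFun, Finset.disjoint_left]
    intro n hn hn'
    exact Set.disjoint_left.1 (hTd hij) (Finset.mem_filter.1 hn).2 (Finset.mem_filter.1 hn').2

open Classical in
theorem abs_card_sub_volume_ordConnected {T : Set ℝ} (hT : T.OrdConnected)
    {I : Finset ℤ} (hI : ∀ n : ℤ, (n : ℝ) ∈ T → n ∈ I) (hb : volume T ≠ ⊤) :
    |((I.filter (fun n : ℤ => (n : ℝ) ∈ T)).card : ℝ) - (volume T).toReal| ≤ 1 := by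
  set F := I.filter (fun n : ℤ => (n : ℝ) ∈ T) with hF
  have hmem : ∀ n : ℤ, n ∈ F ↔ (n : ℝ) ∈ T := fun n => by
    rw [hF, Finset.mem_filter]
    exact ⟨fun h => h.2, fun h => ⟨hI n h, h⟩⟩
  by_cases hne : F.Nonempty
  · set m := F.min' hne with hm
    set M := F.max' hne with hM
    have hmT := (hmem m).1 (F.min'_mem hne)
    have hMT := (hmem M).1 (F.max'_mem hne)
    have hmM : m ≤ M := F.min'_le _ (F.max'_mem hne)
    have hFI : F = Finset.Icc m M := by
      ext n
      rw [Finset.mem_Icc]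
      refine ⟨fun hn => ⟨F.min'_le n hn, F.le_max' n hn⟩, fun hn => ?_⟩
      exact (hmem n).2 (hT.out hmT hMT ⟨by exact_mod_cast hn.1, by exact_mod_cast hn.2⟩)
    have hlow : Set.Icc (m : ℝ) M ⊆ T := hT.out hmT hMT
    have hup : T ⊆ Set.Icc ((m : ℝ) - 1) (M + 1) := by
      intro t ht
      constructor
      · by_contra hlt
        push Not at hlt
        have : ((m - 1 : ℤ) : ℝ) ∈ T := hT.out ht hmT ⟨by push_cast; linarith, by push_cast; linarith⟩
        have := F.min'_le _ ((hmem _).2 this)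
        omega
      · by_contra hlt
        push Not at hlt
        have : ((M + 1 : ℤ) : ℝ) ∈ T := hT.out hMT ht ⟨by push_cast; linarith, by push_cast; linarith⟩
        have := F.le_max' _ ((hmem _).2 this)
        omega
    have hmM' : (m : ℝ) ≤ M := by exact_mod_cast hmM
    have h1 : (M : ℝ) - m ≤ (volume T).toReal := by
      have := toReal_mono hb (measure_mono (μ := volume) hlow)
      rwa [Real.volume_Icc, toReal_ofReal (by linarith)] at this
    have h2 : (volume T).toReal ≤ M - m + 2 := by
      have := toReal_mono (by simp) (measure_mono (μ := volume) hup)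
      rw [Real.volume_Icc, toReal_ofReal (by linarith)] at this
      linarith
    have h3 : (F.card : ℝ) = M - m + 1 := by
      rw [hFI, Int.card_Icc]
      have : (((M + 1 - m).toNat : ℤ) : ℝ) = M - m + 1 := by
        rw [Int.toNat_of_nonneg (by omega)]
        push_cast
        ring
      exact_mod_cast this
    rw [h3, abs_le]
    constructor <;> linarith
  · rw [Finset.not_nonempty_iff_eq_empty.1 hne, Finset.card_empty, Nat.cast_zero, zero_sub, abs_neg,
      abs_of_nonneg toReal_nonneg]
    by_cases hTe : T.Nonempty
    · obtain ⟨t, ht⟩ := hTe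
      have hno : ∀ n : ℤ, (n : ℝ) ∉ T := fun n hn => hne ⟨n, (hmem n).2 hn⟩
      have hup : T ⊆ Set.Icc (⌊t⌋ : ℝ) (⌊t⌋ + 1) := by
        intro s hs
        constructor
        · by_contra hlt
          push Not at hlt
          exact hno ⌊t⌋ (hT.out hs ht ⟨hlt.le, Int.floor_le t⟩)
        · by_contra hlt
          push Not at hlt
          refine hno (⌊t⌋ + 1) (hT.out ht hs ⟨?_, ?_⟩)
          · push_cast; exact (Int.lt_floor_add_one t).le
          · push_cast; exact hlt.le
      have := toReal_mono (by simp) (measure_mono (μ := volume) hup)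
      rw [Real.volume_Icc, toReal_ofReal (by linarith)] at this
      linarith
    · rw [Set.not_nonempty_iff_eq_empty.1 hTe]
      simp

open Classical in
theorem abs_card_sub_volume_le_of_frontier {S : Set ℝ} {Z : Finset ℝ} (h : frontier S ⊆ Z)
    {I : Finset ℤ} (hI : ∀ n : ℤ, (n : ℝ) ∈ S → n ∈ I) (hb : volume S ≠ ⊤) :
    |((I.filter (fun n : ℤ => (n : ℝ) ∈ S)).card : ℝ) - (volume S).toReal| ≤ 2 * Z.card + 1 := by
  obtain ⟨T, hT, hTd, hTS⟩ := exists_ordConnected_pieces h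
  have hsub : ∀ i, T i ⊆ S := fun i => hTS ▸ Set.subset_iUnion T i
  have hfin : ∀ i, volume (T i) ≠ ⊤ := fun i => ne_top_of_le_ne_top hb (measure_mono (hsub i))
  have h1 : I.filter (fun n : ℤ => (n : ℝ) ∈ S) =
      Finset.univ.biUnion fun i => I.filter (fun n : ℤ => (n : ℝ) ∈ T i) := by
    ext n
    simp [hTS]
  have h2 : (volume S).toReal = ∑ i, (volume (T i)).toReal := by
    rw [hTS, measure_iUnion hTd fun i => (hT i).measurableSet, tsum_fintype,
      toReal_sum fun i _ => hfin i]
  rw [h1, Finset.card_biUnion, h2, Nat.cast_sum, ← Finset.sum_sub_distrib]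
  · refine (Finset.abs_sum_le_sum_abs _ _).trans ?_
    refine (Finset.sum_le_sum fun i _ => abs_card_sub_volume_ordConnected (hT i)
      (fun n hn => hI n (hsub i hn)) (hfin i)).trans (le_of_eq ?_)
    simp only [Finset.sum_const, Finset.card_univ, Fintype.card_sum, Fintype.card_fin,
      Fintype.card_coe, nsmul_eq_mul]
    push_cast
    ring
  · intro i _ j _ hij
    rw [Function.onFun, Finset.disjoint_left]
    intro n hn hn'
    exact Set.disjoint_left.1 (hTd hij) (Finset.mem_filter.1 hn).2 (Finset.mem_filter.1 hn').2

end

section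
open MeasureTheory Set

/-- The frontier of `S` has at most `m` points. -/
def Fr (m : ℕ) (S : Set ℝ) : Prop := ∃ Z : Finset ℝ, Z.card ≤ m ∧ frontier S ⊆ Z

theorem Fr.inter {m n : ℕ} {S T : Set ℝ} (hS : Fr m S) (hT : Fr n T) : Fr (m + n) (S ∩ T) := by
  classical
  obtain ⟨Z, hZ, hZS⟩ := hS
  obtain ⟨Z', hZ', hZT⟩ := hT
  refine ⟨Z ∪ Z', (Finset.card_union_le _ _).trans (add_le_add hZ hZ'), ?_⟩
  refine (frontier_inter_subset S T).trans ?_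
  rw [Finset.coe_union]
  exact union_subset_union (inter_subset_left.trans hZS) (inter_subset_right.trans hZT)

theorem Fr.compl {m : ℕ} {S : Set ℝ} (hS : Fr m S) : Fr m Sᶜ := by
  obtain ⟨Z, hZ, hZS⟩ := hS
  exact ⟨Z, hZ, by rwa [frontier_compl]⟩

theorem Fr.mono {m n : ℕ} {S : Set ℝ} (hS : Fr m S) (h : m ≤ n) : Fr n S := by
  obtain ⟨Z, hZ, hZS⟩ := hS
  exact ⟨Z, hZ.trans h, hZS⟩

theorem fr_poly (p : Polynomial ℝ) : Fr p.natDegree {t | 0 < p.eval t} := by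
  classical
  by_cases hp : p = 0
  · refine ⟨∅, by simp, ?_⟩
    simp [hp]
  · refine ⟨p.roots.toFinset, (Multiset.toFinset_card_le _).trans p.card_roots', ?_⟩
    refine (frontier_lt_subset_eq continuous_const p.continuous).trans fun t ht => ?_
    rw [Finset.mem_coe, Multiset.mem_toFinset, Polynomial.mem_roots hp]
    exact (show (0 : ℝ) = p.eval t from ht).symm

theorem fr_pos {g : ℝ → ℝ} (c₀ c₁ c₂ c₃ c₄ : ℝ)
    (hg : ∀ t, g t = c₄ * t ^ 4 + c₃ * t ^ 3 + c₂ * t ^ 2 + c₁ * t + c₀) : Fr 4 {t | 0 < g t} := by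
  open Polynomial in
  have h := fr_poly (C c₄ * X ^ 4 + C c₃ * X ^ 3 + C c₂ * X ^ 2 + C c₁ * X + C c₀)
  simp only [Polynomial.eval_add, Polynomial.eval_mul, Polynomial.eval_C, Polynomial.eval_pow,
    Polynomial.eval_X, ← hg] at h
  exact h.mono (by compute_degree)

open Classical in
theorem Fr.abs_sum_le {m : ℕ} {S : Set ℝ} (h : Fr m S)
    {I : Finset ℤ} (hI : ∀ n : ℤ, (n : ℝ) ∈ S → n ∈ I) {g : ℤ → ℝ} {E : ℝ}
    (hg : ∀ u v : ℤ, |∑ n ∈ Finset.Ico u v, g n| ≤ E) :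
    |∑ n ∈ I.filter (fun n : ℤ => (n : ℝ) ∈ S), g n| ≤ (2 * m + 1) * E := by
  obtain ⟨Z, hZ, hZS⟩ := h
  have hE : 0 ≤ E := (abs_nonneg _).trans (hg 0 0)
  refine (abs_sum_filter_le_of_frontier hZS hI hg).trans ?_
  gcongr

open Classical in
theorem Fr.abs_card_sub_le {m : ℕ} {S : Set ℝ} (h : Fr m S)
    {I : Finset ℤ} (hI : ∀ n : ℤ, (n : ℝ) ∈ S → n ∈ I) (hb : volume S ≠ ⊤) :
    |((I.filter (fun n : ℤ => (n : ℝ) ∈ S)).card : ℝ) - (volume S).toReal| ≤ 2 * m + 1 := by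
  obtain ⟨Z, hZ, hZS⟩ := h
  refine (abs_card_sub_volume_le_of_frontier hZS hI hb).trans ?_
  gcongr

open Classical in
/-- Summing the measures of the integral slices of a set. -/
theorem abs_sum_measure_slice_sub_le {X : Type*} [MeasurableSpace X] {μ : Measure X} [SFinite μ]
    {S : Set (ℝ × X)} (hS : MeasurableSet S) {L : ℝ} {B : Set X} (hB : MeasurableSet B)
    (hμB : μ B ≠ ⊤) (hSB : S ⊆ Icc (-L) L ×ˢ B) {I : Finset ℤ}
    (hI : ∀ (n : ℤ) (x : X), ((n : ℝ), x) ∈ S → n ∈ I) {m : ℕ}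
    (hm : ∀ x, Fr m {t | (t, x) ∈ S}) :
    |∑ n ∈ I, (μ {x | ((n : ℝ), x) ∈ S}).toReal - ((volume.prod μ) S).toReal| ≤
      (2 * m + 1) * (μ B).toReal := by
  have hfinB : IsFiniteMeasure (μ.restrict B) := ⟨by rw [Measure.restrict_apply_univ]; exact hμB.lt_top⟩
  have hsec : ∀ t : ℝ, MeasurableSet {x | (t, x) ∈ S} := fun t => measurable_prodMk_left hS
  have hvol : ∀ x, volume {t | (t, x) ∈ S} ≤ ENNReal.ofReal (L - -L) := fun x => by
    rw [← Real.volume_Icc]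
    exact measure_mono fun t ht => (hSB ht).1
  have hvt : ∀ x, volume {t | (t, x) ∈ S} ≠ ⊤ := fun x =>
    ne_top_of_le_ne_top ENNReal.ofReal_ne_top (hvol x)
  let c : X → ℝ := fun x => ((I.filter (fun n : ℤ => (n : ℝ) ∈ {t | (t, x) ∈ S})).card : ℝ)
  let v : X → ℝ := fun x => (volume {t | (t, x) ∈ S}).toReal
  have hc : ∀ x, c x = ∑ n ∈ I, ({x | ((n : ℝ), x) ∈ S}.indicator (fun _ => (1 : ℝ)) x) := by
    intro x
    simp only [c, Finset.card_filter, Set.indicator, Nat.cast_sum]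
    refine Finset.sum_congr rfl fun n _ => ?_
    simp only [Set.mem_ofPred_eq]
    split_ifs <;> simp
  have hci : Integrable c (μ.restrict B) := by
    have : c = fun x => ∑ n ∈ I, ({x | ((n : ℝ), x) ∈ S}.indicator (fun _ => (1 : ℝ)) x) :=
      funext hc
    rw [this]
    exact integrable_finsetSum _ fun n _ => (integrable_const 1).indicator (hsec n)
  have hvm : Measurable v := (measurable_measure_prodMk_right hS).ennreal_toReal
  have hvi : Integrable v (μ.restrict B) := by
    refine Integrable.of_bound hvm.aestronglyMeasurable (ENNReal.ofReal (L - -L)).toReal ?_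
    refine Filter.Eventually.of_forall fun x => ?_
    rw [Real.norm_eq_abs, abs_of_nonneg ENNReal.toReal_nonneg]
    exact ENNReal.toReal_mono ENNReal.ofReal_ne_top (hvol x)
  have h1 : ∑ n ∈ I, (μ {x | ((n : ℝ), x) ∈ S}).toReal = ∫ x in B, c x ∂μ := by
    simp only [hc]
    rw [integral_finsetSum I fun (n : ℤ) _ => (integrable_const (1 : ℝ)).indicator (hsec (n : ℝ))]
    refine Finset.sum_congr rfl fun n _ => ?_
    rw [integral_indicator_const _ (hsec n), smul_eq_mul, mul_one, measureReal_def, Measure.restrict_apply (hsec n)]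
    congr 2
    ext x
    exact ⟨fun hx => ⟨hx, (hSB hx).2⟩, fun hx => hx.1⟩
  have h2 : ((volume.prod μ) S).toReal = ∫ x in B, v x ∂μ := by
    have h3 : ∫ x in B, v x ∂μ = (∫⁻ x in B, volume {t | (t, x) ∈ S} ∂μ).toReal :=
      integral_toReal (measurable_measure_prodMk_right hS).aemeasurable
        (Filter.Eventually.of_forall fun x => (hvt x).lt_top)
    rw [Measure.prod_apply_symm hS, h3, ← lintegral_indicator hB]
    congr 1
    refine lintegral_congr fun x => ?_
    by_cases hx : x ∈ B
    · rw [Set.indicator_of_mem hx]; rfl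
    · rw [Set.indicator_of_notMem hx]
      have : (fun t : ℝ => (t, x)) ⁻¹' S = ∅ := by
        ext t
        simp only [Set.mem_preimage, Set.mem_empty_iff_false, iff_false]
        exact fun ht => hx (hSB ht).2
      rw [this, measure_empty]
  rw [h1, h2, ← integral_sub hci hvi, ← Real.norm_eq_abs]
  refine (norm_setIntegral_le_of_norm_le_const hμB.lt_top (C := 2 * m + 1) fun x _ => ?_).trans ?_
  · rw [Real.norm_eq_abs]
    exact (hm x).abs_card_sub_le (fun n hn => hI n x hn) (hvt x)
  · rw [measureReal_def]

end

/-- The terms of a series continuing the zeta function to the right half plane. -/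
noncomputable def zt (n : ℕ) (s : ℂ) : ℂ :=
  (n + 1 : ℂ) ^ (-s) - ((n + 2 : ℂ) ^ (1 - s) - (n + 1 : ℂ) ^ (1 - s)) / (1 - s)

theorem norm_zt_le (n : ℕ) {s : ℂ} (hs : 0 < s.re) (hs1 : s ≠ 1) :
    ‖zt n s‖ ≤ ‖s‖ * (n + 1 : ℝ) ^ (-s.re - 1) := by
  have hs0 : s ≠ 0 := fun h => by simp [h] at hs
  have hn : (0 : ℝ) < n + 1 := by positivity
  set C := ‖s‖ * (n + 1 : ℝ) ^ (-s.re - 1) with hC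
  have hC0 : 0 ≤ C := by positivity
  have hmem : ∀ x ∈ Set.Icc (n + 1 : ℝ) (n + 2), 0 < x := fun x hx => hn.trans_le hx.1
  have hd1 : ∀ x ∈ Set.Icc (n + 1 : ℝ) (n + 2),
      HasDerivWithinAt (fun y : ℝ => (y : ℂ) ^ (-s)) (-s * (x : ℂ) ^ (-s - 1))
        (Set.Icc (n + 1 : ℝ) (n + 2)) x := by
    intro x hx
    have h := hasDerivAt_ofReal_cpow_const' (x := x) (hmem x hx).ne' (r := -s - 1)
      (by intro h; apply hs0; linear_combination -h)
    have h2 := (h.const_mul (-s)).hasDerivWithinAt (s := Set.Icc (n + 1 : ℝ) (n + 2))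
    refine h2.congr_of_mem (fun y _ => ?_) hx
    rw [show -s - 1 + 1 = -s by ring]
    field_simp
  have hb1 : ∀ x ∈ Set.Icc (n + 1 : ℝ) (n + 2), ‖-s * (x : ℂ) ^ (-s - 1)‖ ≤ C := by
    intro x hx
    rw [norm_mul, norm_neg, Complex.norm_cpow_eq_rpow_re_of_pos (hmem x hx)]
    have : (-s - 1).re = -s.re - 1 := by simp
    rw [this, hC]
    gcongr ‖s‖ * ?_
    exact Real.rpow_le_rpow_of_nonpos hn hx.1 (by linarith)
  have hmv : ∀ x ∈ Set.Icc (n + 1 : ℝ) (n + 2),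
      ‖((n + 1 : ℝ) : ℂ) ^ (-s) - (x : ℂ) ^ (-s)‖ ≤ C := by
    intro x hx
    have h := (convex_Icc (n + 1 : ℝ) (n + 2 : ℝ)).norm_image_sub_le_of_norm_hasDerivWithin_le
      hd1 hb1 hx ⟨le_rfl, by linarith⟩
    refine h.trans ?_
    have : ‖(n + 1 : ℝ) - x‖ ≤ 1 := by
      rw [Real.norm_eq_abs, abs_le]
      exact ⟨by linarith [hx.2], by linarith [hx.1]⟩
    nlinarith
  have hd2 : ∀ x ∈ Set.Icc (n + 1 : ℝ) (n + 2),
      HasDerivWithinAt (fun y : ℝ => (y : ℂ) * ((n + 1 : ℝ) : ℂ) ^ (-s) -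
        (y : ℂ) ^ (-s + 1) / (-s + 1)) (((n + 1 : ℝ) : ℂ) ^ (-s) - (x : ℂ) ^ (-s))
        (Set.Icc (n + 1 : ℝ) (n + 2)) x := by
    intro x hx
    have h := hasDerivAt_ofReal_cpow_const' (x := x) (hmem x hx).ne' (r := -s)
      (by intro h; apply hs1; linear_combination -h)
    have h3 : HasDerivAt (fun y : ℝ => (y : ℂ) * ((n + 1 : ℝ) : ℂ) ^ (-s))
        (((n + 1 : ℝ) : ℂ) ^ (-s)) x := by
      have := (Complex.ofRealCLM.hasDerivAt (x := x)).mul_const (((n + 1 : ℝ) : ℂ) ^ (-s))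
      simpa using this
    exact (h3.sub h).hasDerivWithinAt
  have h := (convex_Icc (n + 1 : ℝ) (n + 2 : ℝ)).norm_image_sub_le_of_norm_hasDerivWithin_le
      hd2 hmv (x := (n + 1 : ℝ)) (y := (n + 2 : ℝ)) ⟨le_rfl, by linarith⟩ ⟨by linarith, le_rfl⟩
  have h4 : ‖(n + 2 : ℝ) - (n + 1)‖ = 1 := by
    rw [show (n + 2 : ℝ) - (n + 1) = 1 by ring, norm_one]
  rw [h4, mul_one] at h
  convert h using 1
  refine congrArg norm ?_
  rw [zt]
  push_cast
  rw [show -s + 1 = 1 - s by ring]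
  ring

theorem summable_zt_bound {δ : ℝ} (hδ : 0 < δ) (C : ℝ) :
    Summable fun n : ℕ => C * (n + 1 : ℝ) ^ (-δ - 1) := by
  have h := (Real.summable_nat_rpow (p := -δ - 1)).2 (by linarith)
  have := (summable_nat_add_iff 1).2 h
  refine (this.mul_left C).congr fun n => ?_
  push_cast
  rfl

theorem sum_range_zt (N : ℕ) (s : ℂ) : ∑ n ∈ Finset.range N, zt n s =
    ∑ n ∈ Finset.range N, (n + 1 : ℂ) ^ (-s) - ((N + 1 : ℂ) ^ (1 - s) - 1) / (1 - s) := by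
  induction N with
  | zero => simp
  | succ N ih =>
    rw [Finset.sum_range_succ, Finset.sum_range_succ, ih, zt]
    push_cast
    rw [show (N + 1 + 1 : ℂ) = N + 2 by ring]
    ring

theorem summable_zt {s : ℂ} (hs : 0 < s.re) (hs1 : s ≠ 1) : Summable fun n => zt n s :=
  Summable.of_norm_bounded (summable_zt_bound hs ‖s‖) fun n => norm_zt_le n hs hs1

theorem tsum_zt_of_one_lt {s : ℂ} (hs : 1 < s.re) :
    ∑' n, zt n s = riemannZeta s + 1 / (1 - s) := by
  have hs1 : s ≠ 1 := fun h => by simp [h] at hs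
  have h1 := (summable_zt (by linarith) hs1).hasSum.tendsto_sum_nat
  have h2 : Tendsto (fun N : ℕ => ∑ n ∈ Finset.range N, (n + 1 : ℂ) ^ (-s)) atTop
      (𝓝 (riemannZeta s)) := by
    have hsum : Summable fun n : ℕ => (n + 1 : ℂ) ^ (-s) := by
      have := (summable_nat_add_iff 1).2 (Complex.summable_one_div_nat_cpow.2 hs)
      refine this.congr fun n => ?_
      push_cast
      rw [Complex.cpow_neg, one_div]
    have := hsum.hasSum.tendsto_sum_nat
    convert this using 2
    rw [zeta_eq_tsum_one_div_nat_add_one_cpow hs]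
    refine tsum_congr fun n => ?_
    rw [Complex.cpow_neg, one_div]
  have h3 : Tendsto (fun N : ℕ => (N + 1 : ℂ) ^ (1 - s)) atTop (𝓝 0) := by
    rw [tendsto_zero_iff_norm_tendsto_zero]
    have h4 : Tendsto (fun N : ℕ => ((N : ℝ) + 1) ^ (-(s.re - 1))) atTop (𝓝 0) :=
      (tendsto_rpow_neg_atTop (by linarith)).comp
        (tendsto_atTop_add_const_right _ _ tendsto_natCast_atTop_atTop)
    refine h4.congr fun N => ?_
    have := Complex.norm_cpow_eq_rpow_re_of_pos (x := (N + 1 : ℝ)) (by positivity) (1 - s)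
    push_cast at this
    rw [this]
    congr 1
    simp
  have h5 := h2.sub ((h3.sub_const 1).div_const (1 - s))
  refine tendsto_nhds_unique h1 ?_
  simp only [sum_range_zt]
  convert h5 using 2
  ring

theorem tsum_zt_third : ∑' n, zt n (1 / 3) = riemannZeta (1 / 3) + 3 / 2 := by
  let U : Set ℂ := {s | 1 / 4 < s.re} ∩ {s | s.re - 1 / 2 < s.im} ∩ Metric.ball 0 10
  have hUo : IsOpen U := by
    refine (IsOpen.inter ?_ ?_).inter Metric.isOpen_ball
    · exact isOpen_lt continuous_const Complex.continuous_re
    · exact isOpen_lt (Complex.continuous_re.sub continuous_const) Complex.continuous_im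
  have hUc : IsPreconnected U := by
    refine Convex.isPreconnected ((Convex.inter ?_ ?_).inter (convex_ball _ _))
    · exact convex_halfSpace_re_gt _
    · have : {s : ℂ | s.re - 1 / 2 < s.im} =
          {s : ℂ | (Complex.reLm - Complex.imLm) s < 1 / 2} := by
        ext s
        simp only [Set.mem_ofPred_eq, LinearMap.sub_apply, Complex.reLm_coe, Complex.imLm_coe]
        constructor <;> intro h <;> linarith
      rw [this]
      exact convex_halfSpace_lt (LinearMap.isLinear _) _
  have hU1 : ∀ s ∈ U, s ≠ 1 := by
    rintro s ⟨⟨-, h⟩, -⟩ rfl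
    norm_num at h
  have hU0 : ∀ s ∈ U, 0 < s.re := fun s hs => by
    have : 1 / 4 < s.re := hs.1.1
    linarith
  have hf : DifferentiableOn ℂ (fun s => ∑' n, zt n s) U := by
    refine Complex.differentiableOn_tsum_of_summable_norm
      (summable_zt_bound (δ := 1 / 4) (by norm_num) 10) (fun n => ?_) hUo fun n s hs => ?_
    · intro s hs
      have h1 : (n + 1 : ℂ) ≠ 0 := by exact_mod_cast n.succ_ne_zero
      have h2 : (n + 2 : ℂ) ≠ 0 := by exact_mod_cast (n + 1).succ_ne_zero
      have h3 : 1 - s ≠ 0 := sub_ne_zero.2 (hU1 s hs).symm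
      refine DifferentiableAt.differentiableWithinAt ?_
      unfold zt
      refine DifferentiableAt.sub ?_ (DifferentiableAt.div (DifferentiableAt.sub ?_ ?_) ?_ h3)
      · exact (differentiableAt_id.neg).const_cpow (Or.inl h1)
      · exact (differentiableAt_id.const_sub 1).const_cpow (Or.inl h2)
      · exact (differentiableAt_id.const_sub 1).const_cpow (Or.inl h1)
      · exact differentiableAt_id.const_sub 1
    · refine (norm_zt_le n (hU0 s hs) (hU1 s hs)).trans ?_
      have h4 : 1 / 4 < s.re := hs.1.1
      have h5 : ‖s‖ < 10 := by simpa using hs.2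
      have h6 : (1 : ℝ) ≤ n + 1 := by linarith [(Nat.cast_nonneg n : (0 : ℝ) ≤ n)]
      gcongr
  have hg : DifferentiableOn ℂ (fun s => riemannZeta s + 1 / (1 - s)) U := by
    intro s hs
    have h3 : 1 - s ≠ 0 := sub_ne_zero.2 (hU1 s hs).symm
    exact ((differentiableAt_riemannZeta (hU1 s hs)).add
      ((differentiableAt_const 1).div (differentiableAt_id.const_sub 1) h3)).differentiableWithinAt
  have hz : (2 + 2 * Complex.I) ∈ U := by
    refine ⟨⟨by simp; norm_num, by simp⟩, ?_⟩
    rw [mem_ball_zero_iff]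
    refine (norm_add_le _ _).trans_lt ?_
    simp
    norm_num
  have key := (hf.analyticOnNhd hUo).eqOn_of_preconnected_of_eventuallyEq (hg.analyticOnNhd hUo)
    hUc hz (by
      have : {s : ℂ | 1 < s.re} ∈ 𝓝 (2 + 2 * Complex.I) :=
        (isOpen_lt continuous_const Complex.continuous_re).mem_nhds (by simp)
      filter_upwards [this] with s hs
      exact tsum_zt_of_one_lt hs)
  have h13 : (1 / 3 : ℂ) ∈ U := by
    have h1 : (1 / 3 : ℂ) = ((1 / 3 : ℝ) : ℂ) := by push_cast; rfl
    rw [h1]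
    refine ⟨⟨?_, ?_⟩, ?_⟩
    · show (1 / 4 : ℝ) < ((1 / 3 : ℝ) : ℂ).re
      rw [Complex.ofReal_re]; norm_num
    · show ((1 / 3 : ℝ) : ℂ).re - 1 / 2 < ((1 / 3 : ℝ) : ℂ).im
      rw [Complex.ofReal_re, Complex.ofReal_im]; norm_num
    · rw [mem_ball_zero_iff, Complex.norm_real]; norm_num
  have := key h13
  simp only at this
  rw [this]
  norm_num

section
open Real Finset

theorem rpow_two_thirds_sub_le {x y : ℝ} (hx : 0 < x) (hxy : x ≤ y) :
    y ^ (-(1 / 3) : ℝ) * (y - x) ≤ 3 / 2 * (y ^ (2 / 3 : ℝ) - x ^ (2 / 3 : ℝ)) ∧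
      3 / 2 * (y ^ (2 / 3 : ℝ) - x ^ (2 / 3 : ℝ)) ≤ x ^ (-(1 / 3) : ℝ) * (y - x) := by
  rcases hxy.eq_or_lt with rfl | h
  · simp
  obtain ⟨c, hc, hc'⟩ := exists_hasDerivAt_eq_slope (fun t : ℝ => 3 / 2 * t ^ (2 / 3 : ℝ))
    (fun t => t ^ (-(1 / 3) : ℝ)) h
    (ContinuousOn.mul continuousOn_const (ContinuousOn.rpow_const continuousOn_id
      fun t _ => Or.inr (by norm_num))) (fun t ht => by
      have := (hasDerivAt_rpow_const (x := t) (p := 2 / 3)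
        (Or.inl (hx.trans ht.1).ne')).const_mul (3 / 2)
      refine this.congr_deriv ?_
      rw [show (2 / 3 - 1 : ℝ) = -(1 / 3) by norm_num]
      ring)
  have hd : 0 < y - x := sub_pos.2 h
  have h1 : 3 / 2 * (y ^ (2 / 3 : ℝ) - x ^ (2 / 3 : ℝ)) = c ^ (-(1 / 3) : ℝ) * (y - x) := by
    rw [hc']
    field_simp
  rw [h1]
  constructor
  · gcongr ?_ * _
    exact rpow_le_rpow_of_nonpos (hx.trans hc.1) hc.2.le (by norm_num)
  · gcongr ?_ * _
    exact rpow_le_rpow_of_nonpos hx hc.1.le (by norm_num)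

theorem abs_sum_rpow_sub_zeta_le (N : ℕ) :
    |∑ n ∈ range N, (n + 1 : ℝ) ^ (-(1 / 3) : ℝ) - 3 / 2 * (N + 1 : ℝ) ^ (2 / 3 : ℝ) -
      (riemannZeta (1 / 3)).re| ≤ (N + 1 : ℝ) ^ (-(1 / 3) : ℝ) := by
  let r : ℕ → ℝ := fun n => (n + 1 : ℝ) ^ (-(1 / 3) : ℝ) -
    3 / 2 * ((n + 2 : ℝ) ^ (2 / 3 : ℝ) - (n + 1 : ℝ) ^ (2 / 3 : ℝ))
  have hzr : ∀ n, zt n (1 / 3) = (r n : ℂ) := by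
    intro n
    have e1 : ((n : ℂ) + 1) = ((n + 1 : ℝ) : ℂ) := by push_cast; rfl
    have e2 : ((n : ℂ) + 2) = ((n + 2 : ℝ) : ℂ) := by push_cast; rfl
    have e3 : (-(1 / 3) : ℂ) = ((-(1 / 3) : ℝ) : ℂ) := by push_cast; rfl
    have e4 : (1 - 1 / 3 : ℂ) = ((2 / 3 : ℝ) : ℂ) := by push_cast; norm_num
    rw [zt, e1, e2, e3, e4, ← Complex.ofReal_cpow (by positivity), ← Complex.ofReal_cpow
      (by positivity), ← Complex.ofReal_cpow (by positivity)]
    simp only [r]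
    push_cast
    ring
  have hr0 : ∀ n, 0 ≤ r n := fun n => by
    have := (rpow_two_thirds_sub_le (x := n + 1) (y := n + 2) (by positivity) (by linarith)).2
    rw [show (n + 2 : ℝ) - (n + 1) = 1 by ring, mul_one] at this
    simp only [r]
    linarith
  have hr1 : ∀ n, r n ≤ (n + 1 : ℝ) ^ (-(1 / 3) : ℝ) - (n + 2 : ℝ) ^ (-(1 / 3) : ℝ) := fun n => by
    have := (rpow_two_thirds_sub_le (x := n + 1) (y := n + 2) (by positivity) (by linarith)).1
    rw [show (n + 2 : ℝ) - (n + 1) = 1 by ring, mul_one] at this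
    simp only [r]
    linarith
  have hs : Summable r := by
    have := summable_zt (s := 1 / 3) (by norm_num) (by norm_num)
    simp only [hzr] at this
    exact Complex.summable_ofReal.1 this
  have ht : ∑' n, r n = (riemannZeta (1 / 3)).re + 3 / 2 := by
    have h := congrArg Complex.re tsum_zt_third
    simp only [hzr] at h
    rw [← Complex.ofReal_tsum, Complex.ofReal_re] at h
    rw [h, Complex.add_re]
    congr 1
    norm_num
  have hsplit := hs.sum_add_tsum_nat_add N
  have htail0 : 0 ≤ ∑' n, r (n + N) := tsum_nonneg fun n => hr0 _
  have htail1 : ∑' n, r (n + N) ≤ (N + 1 : ℝ) ^ (-(1 / 3) : ℝ) := by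
    refine tsum_le_of_sum_range_le (fun n => hr0 _) fun M => ?_
    have : ∑ n ∈ range M, r (n + N) ≤
        (N + 1 : ℝ) ^ (-(1 / 3) : ℝ) - (M + N + 1 : ℝ) ^ (-(1 / 3) : ℝ) := by
      induction M with
      | zero => simp
      | succ M ih =>
        rw [sum_range_succ]
        have := hr1 (M + N)
        push_cast at this ⊢
        rw [show (M + 1 + N + 1 : ℝ) = M + N + 2 by ring]
        linarith
    have h0 : 0 ≤ (M + N + 1 : ℝ) ^ (-(1 / 3) : ℝ) := by positivity
    linarith
  have hfin : ∑ n ∈ range N, r n = ∑ n ∈ range N, (n + 1 : ℝ) ^ (-(1 / 3) : ℝ) -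
      3 / 2 * ((N + 1 : ℝ) ^ (2 / 3 : ℝ) - 1) := by
    clear hsplit htail0 htail1
    induction N with
    | zero => simp
    | succ N ih =>
      rw [sum_range_succ, sum_range_succ, ih]
      simp only [r]
      push_cast
      rw [show (N + 1 + 1 : ℝ) = N + 2 by ring]
      ring
  rw [hfin, ht] at hsplit
  rw [abs_le]
  constructor <;> linarith

/-- The sum over the leading coefficient. -/
theorem abs_sum_cube_sub_le {A : ℝ} (hA : 0 < A) {M : ℕ} (hM : A ≤ M) :
    |∑ n ∈ range M, max 0 (A ^ (10 / 3 : ℝ) * (n + 1 : ℝ) ^ (-(1 / 3) : ℝ) - (n + 1) ^ 3) -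
      5 / 4 * A ^ 4 - (riemannZeta (1 / 3)).re * A ^ (10 / 3 : ℝ)| ≤
      (5 + |(riemannZeta (1 / 3)).re|) * A ^ (19 / 6 : ℝ) := by
  set z := (riemannZeta (1 / 3)).re with hz
  have hcube : ∀ t : ℝ, 0 < t → t ^ 3 = t ^ (10 / 3 : ℝ) * t ^ (-(1 / 3) : ℝ) := fun t ht => by
    rw [← rpow_add ht, ← rpow_natCast]
    norm_num
  set N := ⌊A⌋₊ with hN
  have hN1 : (N : ℝ) ≤ A := Nat.floor_le hA.le
  have hN2 : A < N + 1 := Nat.lt_floor_add_one A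
  have hNM : N ≤ M := by
    have : (N : ℝ) ≤ M := hN1.trans hM
    exact_mod_cast this
  have hF : ∑ n ∈ range M,
      max 0 (A ^ (10 / 3 : ℝ) * (n + 1 : ℝ) ^ (-(1 / 3) : ℝ) - (n + 1) ^ 3) =
      A ^ (10 / 3 : ℝ) * ∑ n ∈ range N, (n + 1 : ℝ) ^ (-(1 / 3) : ℝ) -
        ∑ n ∈ range N, (n + 1 : ℝ) ^ 3 := by
    rw [← sum_range_add_sum_Ico _ hNM, mul_sum, ← sum_sub_distrib]
    rw [sum_eq_zero (s := Ico N M), add_zero]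
    · refine sum_congr rfl fun n hn => max_eq_right ?_
      have h1 : (n + 1 : ℝ) ≤ A := by
        have : (n + 1 : ℝ) ≤ N := by exact_mod_cast mem_range.1 hn
        linarith
      rw [hcube (n + 1) (by positivity), ← sub_mul]
      refine mul_nonneg (sub_nonneg.2 ?_) (by positivity)
      gcongr
    · intro n hn
      refine max_eq_left ?_
      have h1 : A ≤ (n + 1 : ℝ) := by
        have : (N : ℝ) ≤ n := by exact_mod_cast (mem_Ico.1 hn).1
        linarith
      rw [hcube (n + 1) (by positivity), ← sub_mul]
      refine mul_nonpos_of_nonpos_of_nonneg (sub_nonpos.2 ?_) (by positivity)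
      gcongr
  rw [hF]
  rcases lt_or_ge A 1 with h1 | h1
  · have hN0 : N = 0 := Nat.floor_eq_zero.2 h1
    rw [hN0]
    simp only [range_zero, sum_empty, mul_zero, sub_zero, zero_sub]
    have h4 : A ^ 4 ≤ A ^ (19 / 6 : ℝ) := by
      rw [← rpow_natCast]
      exact rpow_le_rpow_of_exponent_ge hA h1.le (by norm_num)
    have h10 : A ^ (10 / 3 : ℝ) ≤ A ^ (19 / 6 : ℝ) :=
      rpow_le_rpow_of_exponent_ge hA h1.le (by norm_num)
    have h0 : 0 ≤ A ^ (19 / 6 : ℝ) := by positivity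
    calc |-(5 / 4 * A ^ 4) - z * A ^ (10 / 3 : ℝ)|
        ≤ |-(5 / 4 * A ^ 4)| + |z * A ^ (10 / 3 : ℝ)| := abs_sub _ _
      _ = 5 / 4 * A ^ 4 + |z| * A ^ (10 / 3 : ℝ) := by
        rw [abs_neg, abs_of_nonneg (by positivity), abs_mul, abs_of_nonneg (a := A ^ (10 / 3 : ℝ))
          (by positivity)]
      _ ≤ 5 / 4 * A ^ (19 / 6 : ℝ) + |z| * A ^ (19 / 6 : ℝ) := by gcongr
      _ ≤ _ := by nlinarith
  · have h2 := abs_sum_rpow_sub_zeta_le N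
    rw [← hz] at h2
    have h3 : (N + 1 : ℝ) ^ (-(1 / 3) : ℝ) ≤ A ^ (-(1 / 3) : ℝ) :=
      rpow_le_rpow_of_nonpos hA hN2.le (by norm_num)
    have h4 : 3 / 2 * ((N + 1 : ℝ) ^ (2 / 3 : ℝ) - A ^ (2 / 3 : ℝ)) ≤ A ^ (-(1 / 3) : ℝ) := by
      refine (rpow_two_thirds_sub_le hA hN2.le).2.trans ?_
      have : 0 < A ^ (-(1 / 3) : ℝ) := by positivity
      nlinarith
    have h5 : 0 ≤ 3 / 2 * ((N + 1 : ℝ) ^ (2 / 3 : ℝ) - A ^ (2 / 3 : ℝ)) := by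
      have : A ^ (2 / 3 : ℝ) ≤ (N + 1 : ℝ) ^ (2 / 3 : ℝ) := by gcongr
      linarith
    have h6 : |∑ n ∈ range N, (n + 1 : ℝ) ^ (-(1 / 3) : ℝ) - 3 / 2 * A ^ (2 / 3 : ℝ) - z| ≤
        2 * A ^ (-(1 / 3) : ℝ) := by
      rw [abs_le] at h2 ⊢
      constructor <;> linarith
    have h7 : ∑ n ∈ range N, (n + 1 : ℝ) ^ 3 = ((N : ℝ) * (N + 1) / 2) ^ 2 := by
      clear * -
      induction N with
      | zero => simp
      | succ N ih => rw [sum_range_succ, ih]; push_cast; ring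
    have h8 : |((N : ℝ) * (N + 1) / 2) ^ 2 - A ^ 4 / 4| ≤ A ^ 3 := by
      have hn0 : (0 : ℝ) ≤ N := Nat.cast_nonneg N
      have hup : (N : ℝ) * (N + 1) ≤ A * (A + 1) := by nlinarith
      have hlo : (A - 1) * A ≤ (N : ℝ) * (N + 1) := by nlinarith
      have h01 : 0 ≤ (A - 1) * A := mul_nonneg (by linarith) hA.le
      have hup2 : ((N : ℝ) * (N + 1)) ^ 2 ≤ (A * (A + 1)) ^ 2 := by gcongr
      have hlo2 : ((A - 1) * A) ^ 2 ≤ ((N : ℝ) * (N + 1)) ^ 2 := by gcongr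
      have : A ^ 2 ≤ A ^ 3 := by nlinarith [sq_nonneg A]
      have hA2 : 0 ≤ A ^ 2 := sq_nonneg A
      rw [abs_le]
      constructor <;> nlinarith
    have h9 : A ^ 3 ≤ A ^ (19 / 6 : ℝ) := by
      rw [← rpow_natCast]
      exact rpow_le_rpow_of_exponent_le h1 (by norm_num)
    have h10 : A ^ 4 = A ^ (10 / 3 : ℝ) * A ^ (2 / 3 : ℝ) := by
      rw [← rpow_add hA, ← rpow_natCast]
      norm_num
    rw [h7]
    have e : A ^ (10 / 3 : ℝ) * ∑ n ∈ range N, (n + 1 : ℝ) ^ (-(1 / 3) : ℝ) -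
        ((N : ℝ) * (N + 1) / 2) ^ 2 - 5 / 4 * A ^ 4 - z * A ^ (10 / 3 : ℝ) =
        A ^ (10 / 3 : ℝ) * (∑ n ∈ range N, (n + 1 : ℝ) ^ (-(1 / 3) : ℝ) -
          3 / 2 * A ^ (2 / 3 : ℝ) - z) - (((N : ℝ) * (N + 1) / 2) ^ 2 - A ^ 4 / 4) := by
      linear_combination (-3 / 2) * h10
    rw [e]
    calc _ ≤ A ^ (10 / 3 : ℝ) * (2 * A ^ (-(1 / 3) : ℝ)) + A ^ 3 := by
          refine (abs_sub _ _).trans (add_le_add ?_ h8)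
          rw [abs_mul, abs_of_nonneg (a := A ^ (10 / 3 : ℝ)) (by positivity)]
          gcongr
      _ = 3 * A ^ 3 := by linear_combination (-2) * hcube A hA
      _ ≤ 3 * A ^ (19 / 6 : ℝ) := by linarith
      _ ≤ _ := by
        have : 0 ≤ A ^ (19 / 6 : ℝ) := by positivity
        have := abs_nonneg z
        nlinarith

end

section
open Real MeasureTheory Set

theorem measurableSet_and {α : Type*} [MeasurableSpace α] {p q : α → Prop}
    (hp : MeasurableSet {x | p x}) (hq : MeasurableSet {x | q x}) :
    MeasurableSet {x | p x ∧ q x} := hp.inter hq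

theorem lintegral_rpow_Ioo {r p₁ p₂ : ℝ} (hr : 0 < r) (h1 : 0 ≤ p₁) (h2 : 0 ≤ p₂) :
    ∫⁻ P in Ioo p₁ p₂, ENNReal.ofReal (r * P ^ (r - 1)) = ENNReal.ofReal (p₂ ^ r - p₁ ^ r) := by
  rcases le_total p₂ p₁ with h | h
  · rw [Ioo_eq_empty (not_lt.2 h), Measure.restrict_empty, lintegral_zero_measure,
      ENNReal.ofReal_of_nonpos]
    exact sub_nonpos.2 (rpow_le_rpow h2 h hr.le)
  · have hi : IntervalIntegrable (fun P : ℝ => r * P ^ (r - 1)) volume p₁ p₂ :=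
      (intervalIntegral.intervalIntegrable_rpow' (by linarith)).const_mul r
    rw [← ofReal_integral_eq_lintegral_ofReal]
    · rw [← integral_Ioc_eq_integral_Ioo, ← intervalIntegral.integral_of_le h,
        intervalIntegral.integral_const_mul, integral_rpow (Or.inl (by linarith))]
      congr 1
      rw [sub_add_cancel]
      field_simp
    · exact ((intervalIntegrable_iff_integrableOn_Ioo_of_le h).1 hi)
    · refine (ae_restrict_iff' measurableSet_Ioo).2 (Filter.Eventually.of_forall fun P hP => ?_)
      have : 0 < P := h1.trans_lt hP.1
      simp only [Pi.zero_apply]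
      positivity

/-- The density in the leading coefficient `a` of the volume of the forms of bounded discriminant
with `3 D > 4 σ² P²`. -/
noncomputable def Vd (σ Y a u : ℝ) : ℝ :=
  36 / 5 * ((Y / 108) ^ (5 / 6 : ℝ) * a ^ (-(1 / 3) : ℝ) * √(1 - u ^ 2) ^ (-(5 / 3) : ℝ) -
    σ ^ 5 * a ^ 3 * √(1 - u ^ 2) ^ (-5 : ℝ))

theorem measurable_Vd (σ Y : ℝ) : Measurable fun z : ℝ × ℝ => Vd σ Y z.1 z.2 := by
  unfold Vd; fun_prop

/-- The region of the covariants `(P, U)` with `a` fixed. -/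
def PU (σ Y a : ℝ) : Set (ℝ × ℝ) :=
  {z | 0 < z.1 ∧ 36 * a ^ 2 * σ ^ 2 * z.1 ^ 2 < 4 * z.1 ^ 3 - z.2 ^ 2 ∧
    4 * z.1 ^ 3 - z.2 ^ 2 < 27 * a ^ 2 * Y}

theorem measurableSet_PU (σ Y a : ℝ) : MeasurableSet (PU σ Y a) := by
  unfold PU
  exact measurableSet_and (measurableSet_lt measurable_const measurable_fst) (measurableSet_and
    (measurableSet_lt (by fun_prop) (by fun_prop)) (measurableSet_lt (by fun_prop) (by fun_prop)))

theorem volume_PU {σ Y a : ℝ} (hσ : 0 ≤ σ) (hY : 0 < Y) (ha : 0 < a) :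
    (volume.prod volume) (PU σ Y a) = ENNReal.ofReal (27 * a ^ 2) *
      ∫⁻ u in Ioo (-1) 1, ENNReal.ofReal (Vd σ Y a u) := by
  let S : Set (ℝ × ℝ) := {z | 0 < z.1 ∧ 36 * a ^ 2 * σ ^ 2 * z.1 ^ 2 < 4 * z.1 ^ 3 * (1 - z.2 ^ 2) ∧
    4 * z.1 ^ 3 * (1 - z.2 ^ 2) < 27 * a ^ 2 * Y}
  have hS : MeasurableSet S := by
    exact measurableSet_and (measurableSet_lt measurable_const measurable_fst) (measurableSet_and
      (measurableSet_lt (by fun_prop) (by fun_prop)) (measurableSet_lt (by fun_prop) (by fun_prop)))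
  rw [Measure.prod_apply (measurableSet_PU σ Y a)]
  have h1 : ∀ P : ℝ, volume (Prod.mk P ⁻¹' PU σ Y a) =
      ∫⁻ u, S.indicator (fun z => ENNReal.ofReal (2 * z.1 ^ (3 / 2 : ℝ))) (P, u) := by
    intro P
    rcases le_or_gt P 0 with hP | hP
    · have e1 : Prod.mk P ⁻¹' PU σ Y a = ∅ := by
        ext u; simp only [PU, mem_preimage, Set.mem_ofPred_eq, mem_empty_iff_false, iff_false]
        exact fun h => absurd h.1 (not_lt.2 hP)
      have e2 : ∀ u, S.indicator (fun z => ENNReal.ofReal (2 * z.1 ^ (3 / 2 : ℝ))) (P, u) = 0 :=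
        fun u => indicator_of_notMem (fun h => absurd h.1 (not_lt.2 hP)) _
      simp only [e1, e2, measure_empty, lintegral_zero]
    · set k := 2 * P ^ (3 / 2 : ℝ) with hk
      have hk0 : 0 < k := by positivity
      have hk2 : k ^ 2 = 4 * P ^ 3 := by
        rw [hk, mul_pow, ← rpow_natCast (P ^ (3 / 2 : ℝ)), ← rpow_mul hP.le,
          ← rpow_natCast P]
        norm_num
      have h2 := Real.volume_preimage_mul_left hk0.ne' (Prod.mk P ⁻¹' PU σ Y a)
      have h3 : (fun x => k * x) ⁻¹' (Prod.mk P ⁻¹' PU σ Y a) = Prod.mk P ⁻¹' S := by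
        ext u
        simp only [PU, S, mem_preimage, Set.mem_ofPred_eq]
        rw [mul_pow, hk2, ← mul_one_sub]
      rw [h3] at h2
      have h4 : volume (Prod.mk P ⁻¹' PU σ Y a) = ENNReal.ofReal k * volume (Prod.mk P ⁻¹' S) := by
        rw [h2, ← mul_assoc, ← ENNReal.ofReal_mul hk0.le, abs_of_pos (by positivity),
          mul_inv_cancel₀ hk0.ne', ENNReal.ofReal_one, one_mul]
      have hSP : MeasurableSet (Prod.mk P ⁻¹' S) := measurable_prodMk_left hS
      rw [h4, ← lintegral_indicator_one hSP, ← lintegral_const_mul' _ _ ENNReal.ofReal_ne_top]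
      refine lintegral_congr fun u => ?_
      by_cases hu : (P, u) ∈ S
      · rw [indicator_of_mem hu, indicator_of_mem (show u ∈ Prod.mk P ⁻¹' S from hu)]
        simp [hk]
      · rw [indicator_of_notMem hu, indicator_of_notMem (show u ∉ Prod.mk P ⁻¹' S from hu),
          mul_zero]
  simp only [h1]
  rw [lintegral_lintegral_swap (by
    refine Measurable.aemeasurable (Measurable.indicator ?_ hS)
    fun_prop)]
  rw [← lintegral_const_mul' _ _ ENNReal.ofReal_ne_top, ← lintegral_indicator measurableSet_Ioo]
  refine lintegral_congr fun u => ?_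
  by_cases hu : u ∈ Ioo (-1 : ℝ) 1
  · rw [indicator_of_mem hu]
    have hs2 : 0 < 1 - u ^ 2 := by nlinarith [hu.1, hu.2]
    set s := √(1 - u ^ 2) with hs
    have hs0 : 0 < s := sqrt_pos.2 hs2
    have hss : 1 - u ^ 2 = s ^ 2 := (sq_sqrt hs2.le).symm
    set p₁ := 9 * a ^ 2 * σ ^ 2 / s ^ 2 with hp₁
    set p₂ := (27 * a ^ 2 * Y / (4 * s ^ 2)) ^ (1 / 3 : ℝ) with hp₂
    have hp₁0 : 0 ≤ p₁ := by positivity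
    have hp₂0 : 0 ≤ p₂ := by positivity
    have hp₂3 : p₂ ^ 3 = 27 * a ^ 2 * Y / (4 * s ^ 2) := by
      rw [hp₂, ← rpow_natCast, ← rpow_mul (by positivity)]
      norm_num
    have hmem : ∀ P, (P, u) ∈ S ↔ P ∈ Ioo p₁ p₂ := by
      intro P
      simp only [S, Set.mem_ofPred_eq, mem_Ioo]
      rw [hss]
      have e2 : 0 < P → (4 * P ^ 3 * s ^ 2 < 27 * a ^ 2 * Y ↔ P < p₂) := by
        intro hP
        rw [← pow_lt_pow_iff_left₀ hP.le hp₂0 (n := 3) (by norm_num), hp₂3,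
          lt_div_iff₀ (by positivity)]
        constructor <;> intro h <;> nlinarith
      have e1 : 0 < P → (36 * a ^ 2 * σ ^ 2 * P ^ 2 < 4 * P ^ 3 * s ^ 2 ↔ p₁ < P) := by
        intro hP
        rw [hp₁, div_lt_iff₀ (by positivity)]
        have : 0 < 4 * P ^ 2 := by positivity
        rw [show 36 * a ^ 2 * σ ^ 2 * P ^ 2 = 4 * P ^ 2 * (9 * a ^ 2 * σ ^ 2) by ring,
          show 4 * P ^ 3 * s ^ 2 = 4 * P ^ 2 * (P * s ^ 2) by ring, mul_lt_mul_iff_right₀ this]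
      constructor
      · rintro ⟨h0, h1, h2⟩
        exact ⟨(e1 h0).1 h1, (e2 h0).1 h2⟩
      · rintro ⟨h1, h2⟩
        have h0 := hp₁0.trans_lt h1
        exact ⟨h0, (e1 h0).2 h1, (e2 h0).2 h2⟩
    have h5 : ∀ P, S.indicator (fun z => ENNReal.ofReal (2 * z.1 ^ (3 / 2 : ℝ))) (P, u) =
        (Ioo p₁ p₂).indicator (fun P => ENNReal.ofReal (4 / 5) *
          ENNReal.ofReal (5 / 2 * P ^ (5 / 2 - 1 : ℝ))) P := by
      intro P
      by_cases hP : P ∈ Ioo p₁ p₂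
      · rw [indicator_of_mem ((hmem P).2 hP), indicator_of_mem hP,
          ← ENNReal.ofReal_mul (by norm_num)]
        congr 1
        norm_num
        ring
      · rw [indicator_of_notMem (fun h => hP ((hmem P).1 h)), indicator_of_notMem hP]
    simp only [h5]
    rw [lintegral_indicator measurableSet_Ioo, lintegral_const_mul' _ _ ENNReal.ofReal_ne_top,
      lintegral_rpow_Ioo (by norm_num) hp₁0 hp₂0, ← ENNReal.ofReal_mul (by norm_num),
      ← ENNReal.ofReal_mul (by positivity)]
    congr 1
    have e1 : p₁ ^ (5 / 2 : ℝ) = 243 * (a ^ 2 * a ^ 3) * σ ^ 5 * s ^ (-5 : ℝ) := by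
      have : p₁ = (3 * a * σ / s) ^ (2 : ℝ) := by
        rw [hp₁, rpow_two]; ring
      rw [this, ← rpow_mul (by positivity), rpow_neg hs0.le]
      have : (2 * (5 / 2) : ℝ) = (5 : ℕ) := by norm_num
      have h5 : s ^ (5 : ℝ) = s ^ 5 := by exact_mod_cast rpow_natCast s 5
      rw [this, rpow_natCast, h5]
      field_simp
      norm_num
      ring
    have e2 : p₂ ^ (5 / 2 : ℝ) = 243 * ((Y / 108) ^ (5 / 6 : ℝ) * (a ^ 2 * a ^ (-(1 / 3) : ℝ)) *
        s ^ (-(5 / 3) : ℝ)) := by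
      rw [hp₂, ← rpow_mul (by positivity)]
      have e3 : 27 * a ^ 2 * Y / (4 * s ^ 2) = 3 ^ (6 : ℝ) * (Y / 108) * a ^ (2 : ℝ) * s ^ (-2 : ℝ) := by
        rw [rpow_neg hs0.le, rpow_two, rpow_two]
        have : (3 : ℝ) ^ (6 : ℝ) = 729 := by
          have : (6 : ℝ) = (6 : ℕ) := by norm_num
          rw [this, rpow_natCast]; norm_num
        rw [this]
        field_simp
        norm_num
      have e4 : (243 : ℝ) = 3 ^ (5 : ℝ) := by
        have : (5 : ℝ) = (5 : ℕ) := by norm_num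
        rw [this, rpow_natCast]; norm_num
      have e5 : a ^ 2 * a ^ (-(1 / 3) : ℝ) = a ^ (5 / 3 : ℝ) := by
        rw [← rpow_two, ← rpow_add ha]; norm_num
      rw [e3, mul_rpow (by positivity) (by positivity), mul_rpow (by positivity)
        (by positivity), mul_rpow (by positivity) (by positivity), ← rpow_mul (by norm_num),
        ← rpow_mul ha.le, ← rpow_mul hs0.le, e4, e5]
      norm_num
      ring
    rw [e1, e2, Vd]
    ring
  · rw [indicator_of_notMem hu]
    have : ∀ P, S.indicator (fun z => ENNReal.ofReal (2 * z.1 ^ (3 / 2 : ℝ))) (P, u) = 0 := by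
      intro P
      refine indicator_of_notMem (fun h => hu ?_) _
      obtain ⟨h0, h1, -⟩ := h
      simp only at h0 h1
      have h2 : 0 < 4 * P ^ 3 * (1 - u ^ 2) := lt_of_le_of_lt (by positivity) h1
      have h3 : 0 < 1 - u ^ 2 := pos_of_mul_pos_right h2 (by positivity)
      exact ⟨by nlinarith, by nlinarith⟩
    simp only [this, lintegral_zero]

theorem lintegral_sub_cube {k m : ℝ} (hk : 0 < k) (hm : 0 < m) :
    ∫⁻ a in Ioi 0, ENNReal.ofReal (k * a ^ (-(1 / 3) : ℝ) - m * a ^ 3) =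
      ENNReal.ofReal (5 / 4 * (m * (k / m) ^ (6 / 5 : ℝ))) := by
  set a₀ := (k / m) ^ (3 / 10 : ℝ) with ha₀
  have ha0 : 0 < a₀ := by positivity
  have h10 : a₀ ^ (10 / 3 : ℝ) = k / m := by
    rw [ha₀, ← rpow_mul (by positivity)]; norm_num
  have h4 : a₀ ^ 4 = (k / m) ^ (6 / 5 : ℝ) := by
    rw [ha₀, ← rpow_natCast, ← rpow_mul (by positivity)]; norm_num
  have hcube : ∀ t : ℝ, 0 < t → t ^ 3 = t ^ (10 / 3 : ℝ) * t ^ (-(1 / 3) : ℝ) := fun t ht => by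
    rw [← rpow_add ht, ← rpow_natCast]
    norm_num
  have hk' : k = m * a₀ ^ (10 / 3 : ℝ) := by rw [h10]; field_simp
  have hpos : ∀ a ∈ Ioc 0 a₀, 0 ≤ k * a ^ (-(1 / 3) : ℝ) - m * a ^ 3 := by
    intro a ha
    rw [hcube a ha.1, hk', mul_assoc, ← mul_sub, ← sub_mul]
    have : a ^ (10 / 3 : ℝ) ≤ a₀ ^ (10 / 3 : ℝ) := rpow_le_rpow ha.1.le ha.2 (by norm_num)
    have h0 : 0 ≤ a ^ (-(1 / 3) : ℝ) := rpow_nonneg ha.1.le _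
    exact mul_nonneg hm.le (mul_nonneg (sub_nonneg.2 this) h0)
  have hneg : ∀ a, a₀ < a → k * a ^ (-(1 / 3) : ℝ) - m * a ^ 3 ≤ 0 := by
    intro a ha
    have ha' := ha0.trans ha
    rw [hcube a ha', hk', mul_assoc, ← mul_sub, ← sub_mul]
    have : a₀ ^ (10 / 3 : ℝ) ≤ a ^ (10 / 3 : ℝ) := rpow_le_rpow ha0.le ha.le (by norm_num)
    have h0 : 0 ≤ a ^ (-(1 / 3) : ℝ) := rpow_nonneg ha'.le _
    exact mul_nonpos_of_nonneg_of_nonpos hm.le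
      (mul_nonpos_of_nonpos_of_nonneg (sub_nonpos.2 this) h0)
  have h1 : ∫⁻ a in Ioi 0, ENNReal.ofReal (k * a ^ (-(1 / 3) : ℝ) - m * a ^ 3) =
      ∫⁻ a in Ioc 0 a₀, ENNReal.ofReal (k * a ^ (-(1 / 3) : ℝ) - m * a ^ 3) := by
    rw [← lintegral_indicator measurableSet_Ioi, ← lintegral_indicator measurableSet_Ioc]
    refine lintegral_congr fun a => ?_
    by_cases h0 : 0 < a
    · rw [indicator_of_mem (mem_Ioi.2 h0)]
      by_cases h1 : a ≤ a₀
      · rw [indicator_of_mem (show a ∈ Ioc 0 a₀ from ⟨h0, h1⟩)]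
      · rw [indicator_of_notMem (show a ∉ Ioc 0 a₀ from fun h => h1 h.2), ENNReal.ofReal_of_nonpos
          (hneg a (not_le.1 h1))]
    · rw [indicator_of_notMem (show a ∉ Ioi (0:ℝ) from h0),
        indicator_of_notMem (show a ∉ Ioc 0 a₀ from fun h => h0 h.1)]
  have hi1 : IntervalIntegrable (fun a : ℝ => k * a ^ (-(1 / 3) : ℝ)) volume 0 a₀ :=
    (intervalIntegral.intervalIntegrable_rpow' (by norm_num)).const_mul k
  have hi2 : IntervalIntegrable (fun a : ℝ => m * a ^ 3) volume 0 a₀ :=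
    (intervalIntegral.intervalIntegrable_pow 3).const_mul m
  rw [h1, ← ofReal_integral_eq_lintegral_ofReal]
  · rw [← intervalIntegral.integral_of_le ha0.le, intervalIntegral.integral_sub hi1 hi2,
      intervalIntegral.integral_const_mul, intervalIntegral.integral_const_mul,
      integral_rpow (Or.inl (by norm_num)), integral_pow]
    congr 1
    rw [← h4, zero_rpow (by norm_num)]
    have h5 : a₀ ^ 4 = a₀ ^ (10 / 3 : ℝ) * a₀ ^ (-(1 / 3) + 1 : ℝ) := by
      rw [← rpow_add ha0, ← rpow_natCast]; norm_num
    rw [hk', h5]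
    norm_num
    ring
  · exact (intervalIntegrable_iff_integrableOn_Ioc_of_le ha0.le).1 (hi1.sub hi2)
  · exact (ae_restrict_iff' measurableSet_Ioc).2 (Filter.Eventually.of_forall hpos)

theorem lintegral_Vd {σ Y u : ℝ} (hσ : 0 < σ) (hY : 0 < Y) (hu : u ∈ Ioo (-1 : ℝ) 1) :
    ∫⁻ a in Ioi 0, ENNReal.ofReal (Vd σ Y a u) =
      ENNReal.ofReal (Y / (12 * σ)) * ENNReal.ofReal ((1 - u ^ 2) ^ (-(1 / 2) : ℝ)) := by
  have hs2 : 0 < 1 - u ^ 2 := by nlinarith [hu.1, hu.2]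
  set s := √(1 - u ^ 2) with hs
  have hs0 : 0 < s := sqrt_pos.2 hs2
  have hk : 0 < 36 / 5 * ((Y / 108) ^ (5 / 6 : ℝ) * s ^ (-(5 / 3) : ℝ)) := by positivity
  have hm : 0 < 36 / 5 * (σ ^ 5 * s ^ (-5 : ℝ)) := by positivity
  have h := lintegral_sub_cube hk hm
  have e : ∀ a, Vd σ Y a u = 36 / 5 * ((Y / 108) ^ (5 / 6 : ℝ) * s ^ (-(5 / 3) : ℝ)) *
      a ^ (-(1 / 3) : ℝ) - 36 / 5 * (σ ^ 5 * s ^ (-5 : ℝ)) * a ^ 3 := by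
    intro a; rw [Vd]; ring
  simp only [e]
  rw [h, ← ENNReal.ofReal_mul (by positivity)]
  congr 1
  have h1 : 36 / 5 * ((Y / 108) ^ (5 / 6 : ℝ) * s ^ (-(5 / 3) : ℝ)) /
      (36 / 5 * (σ ^ 5 * s ^ (-5 : ℝ))) = (Y / 108) ^ (5 / 6 : ℝ) * σ ^ (-5 : ℝ) *
        s ^ (10 / 3 : ℝ) := by
    have e1 : s ^ (-(5 / 3) : ℝ) = s ^ (10 / 3 : ℝ) * s ^ (-5 : ℝ) := by
      rw [← rpow_add hs0]; norm_num
    have e2 : σ ^ (-5 : ℝ) = (σ ^ 5)⁻¹ := by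
      rw [rpow_neg hσ.le]; congr 1; exact_mod_cast rpow_natCast σ 5
    rw [e1, e2]
    field_simp
  rw [h1, mul_rpow (by positivity) (by positivity), mul_rpow (by positivity)
    (by positivity), ← rpow_mul (by positivity), ← rpow_mul hσ.le, ← rpow_mul hs0.le]
  have e3 : (1 - u ^ 2) ^ (-(1 / 2) : ℝ) = s ^ (-5 : ℝ) * s ^ (4 : ℝ) := by
    rw [← rpow_add hs0, hs, sqrt_eq_rpow, ← rpow_mul hs2.le]; norm_num
  have e4 : σ ^ (-5 * (6 / 5) : ℝ) = (σ ^ 6)⁻¹ := by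
    rw [show (-5 * (6 / 5) : ℝ) = -(6 : ℕ) by norm_num, rpow_neg hσ.le, rpow_natCast]
  rw [e3, e4]
  norm_num
  field_simp
  norm_num

theorem le_rpow_one_sub_sq {α : ℝ} (hα : 0 < α) {u : ℝ} (hu : u ∈ Ioo (-1 : ℝ) 1) :
    (1 - u ^ 2) ^ (-α) ≤ (1 - u) ^ (-α) + (1 + u) ^ (-α) := by
  have h1 : 0 < 1 - u := by linarith [hu.2]
  have h2 : 0 < 1 + u := by linarith [hu.1]
  have p1 : 0 < (1 - u) ^ (-α) := by positivity
  have p2 : 0 < (1 + u) ^ (-α) := by positivity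
  rcases le_total 0 u with h | h
  · have : (1 - u ^ 2) ^ (-α) ≤ (1 - u) ^ (-α) :=
      rpow_le_rpow_of_nonpos h1 (by nlinarith) (by linarith)
    linarith
  · have : (1 - u ^ 2) ^ (-α) ≤ (1 + u) ^ (-α) :=
      rpow_le_rpow_of_nonpos h2 (by nlinarith) (by linarith)
    linarith

theorem integrableOn_one_sub_sq_rpow {α : ℝ} (h0 : 0 < α) (h1 : α < 1) :
    IntegrableOn (fun u : ℝ => (1 - u ^ 2) ^ (-α)) (Ioo (-1) 1) := by
  have hi : IntervalIntegrable (fun x : ℝ => x ^ (-α)) volume 0 2 :=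
    intervalIntegral.intervalIntegrable_rpow' (by linarith)
  have i1 : IntervalIntegrable (fun x : ℝ => (1 - x) ^ (-α)) volume (-1) 1 := by
    have := (hi.comp_sub_left 1).symm
    norm_num at this
    exact this
  have i2 : IntervalIntegrable (fun x : ℝ => (1 + x) ^ (-α)) volume (-1) 1 := by
    have := hi.comp_add_left 1
    norm_num at this
    exact this
  have i3 := (intervalIntegrable_iff_integrableOn_Ioo_of_le (by norm_num)).1 (i1.add i2)
  refine Integrable.mono' i3 (by
    refine Measurable.aestronglyMeasurable ?_
    fun_prop) ((ae_restrict_iff' measurableSet_Ioo).2 (Filter.Eventually.of_forall fun u hu => ?_))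
  rw [norm_eq_abs, abs_of_nonneg (rpow_nonneg (by nlinarith [hu.1, hu.2]) _)]
  exact le_rpow_one_sub_sq h0 hu

theorem integral_one_sub_sq_rpow_neg_half {x y : ℝ} (hx : -1 ≤ x) (hy : y ≤ 1) (hxy : x ≤ y) :
    ∫ u in Ioo x y, (1 - u ^ 2) ^ (-(1 / 2) : ℝ) = Real.arcsin y - Real.arcsin x := by
  have hi : IntegrableOn (fun u : ℝ => (1 - u ^ 2) ^ (-(1 / 2) : ℝ)) (Ioo x y) :=
    (integrableOn_one_sub_sq_rpow (by norm_num) (by norm_num)).mono_set (Ioo_subset_Ioo hx hy)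
  rw [← integral_Ioc_eq_integral_Ioo, ← intervalIntegral.integral_of_le hxy]
  refine intervalIntegral.integral_eq_sub_of_hasDerivAt_of_le hxy
    continuous_arcsin.continuousOn (fun u hu => ?_)
    ((intervalIntegrable_iff_integrableOn_Ioo_of_le hxy).2 hi)
  have h1 : u ≠ -1 := by have := hu.1; intro h; linarith
  have h2 : u ≠ 1 := by have := hu.2; intro h; linarith
  have := hasDerivAt_arcsin h1 h2
  have h3 : (0 : ℝ) ≤ 1 - u ^ 2 := by nlinarith [hu.1, hu.2]
  rw [sqrt_eq_rpow, one_div, ← rpow_neg h3] at this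
  exact this

theorem lintegral_lintegral_Vd {σ Y : ℝ} (hσ : 0 < σ) (hY : 0 < Y) :
    ∫⁻ a in Ioi 0, ∫⁻ u in Ioo (-1) 1, ENNReal.ofReal (Vd σ Y a u) =
      ENNReal.ofReal (π / 12 * (Y / σ)) := by
  rw [lintegral_lintegral_swap (by
    exact ((measurable_Vd σ Y).ennreal_ofReal).aemeasurable)]
  rw [setLIntegral_congr_fun measurableSet_Ioo fun u hu => lintegral_Vd hσ hY hu,
    lintegral_const_mul' _ _ ENNReal.ofReal_ne_top, ← ofReal_integral_eq_lintegral_ofReal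
    (integrableOn_one_sub_sq_rpow (by norm_num) (by norm_num)),
    integral_one_sub_sq_rpow_neg_half le_rfl le_rfl (by norm_num),
    ← ENNReal.ofReal_mul (by positivity)]
  · rw [Real.arcsin_one, Real.arcsin_neg_one]
    congr 1
    field_simp
    ring
  · refine (ae_restrict_iff' measurableSet_Ioo).2 (Filter.Eventually.of_forall fun u hu => ?_)
    exact rpow_nonneg (by nlinarith [hu.1, hu.2]) _

theorem integral_one_sub_sq_rpow_eq {α : ℝ} (hα : 0 < α) :
    ∫ u in Ioo (-1 : ℝ) 1, (1 - u ^ 2) ^ (α - 1) =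
      2 * 4 ^ (α - 1) * (Gamma α * Gamma α / Gamma (α + α)) := by
  have hb : (∫ t in (0 : ℝ)..1, t ^ (α - 1) * (1 - t) ^ (α - 1)) = ProbabilityTheory.beta α α := by
    have h := ProbabilityTheory.beta_eq_betaIntegralReal α α hα hα
    rw [h, Complex.betaIntegral, intervalIntegral.integral_of_le zero_le_one,
      intervalIntegral.integral_of_le zero_le_one]
    have hi : Integrable (fun x : ℝ => (x : ℂ) ^ ((α : ℂ) - 1) * (1 - (x : ℂ)) ^ ((α : ℂ) - 1))
        (volume.restrict (Ioc 0 1)) :=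
      (intervalIntegrable_iff_integrableOn_Ioc_of_le zero_le_one).1
        (Complex.betaIntegral_convergent (by simpa) (by simpa))
    have := integral_re hi
    simp only [RCLike.re_to_complex] at this
    rw [← this]
    refine setIntegral_congr_fun measurableSet_Ioc fun x hx => ?_
    have e1 : (x : ℂ) ^ ((α : ℂ) - 1) = ((x ^ (α - 1) : ℝ) : ℂ) := by
      rw [Complex.ofReal_cpow hx.1.le]; push_cast; rfl
    have e2 : (1 - (x : ℂ)) ^ ((α : ℂ) - 1) = (((1 - x) ^ (α - 1) : ℝ) : ℂ) := by
      rw [Complex.ofReal_cpow (sub_nonneg.2 hx.2)]; push_cast; rfl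
    simp only [e1, e2]
    rw [← Complex.ofReal_mul, Complex.ofReal_re]
  rw [ProbabilityTheory.beta] at hb
  rw [← hb, ← integral_Ioc_eq_integral_Ioo, ← intervalIntegral.integral_of_le (by norm_num)]
  have h := intervalIntegral.integral_comp_mul_sub (a := 0) (b := 1)
    (fun u : ℝ => (1 - u ^ 2) ^ (α - 1)) (two_ne_zero) 1
  norm_num at h
  have e : ∫ t in (0 : ℝ)..1, (1 - (2 * t - 1) ^ 2) ^ (α - 1) =
      4 ^ (α - 1) * ∫ t in (0 : ℝ)..1, t ^ (α - 1) * (1 - t) ^ (α - 1) := by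
    rw [← intervalIntegral.integral_const_mul]
    refine intervalIntegral.integral_congr fun t ht => ?_
    rw [uIcc_of_le zero_le_one] at ht
    have : 1 - (2 * t - 1) ^ 2 = 4 * (t * (1 - t)) := by ring
    simp only [this]
    rw [mul_rpow (by norm_num) (mul_nonneg ht.1 (sub_nonneg.2 ht.2)),
      mul_rpow ht.1 (sub_nonneg.2 ht.2)]
  rw [e] at h
  linarith

theorem beta_const : 27 * (108 : ℝ) ^ (-(5 / 6) : ℝ) *
    ∫ u in Ioo (-1 : ℝ) 1, (1 - u ^ 2) ^ (-(5 / 6) : ℝ) =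
      π ^ 2 / Gamma (2 / 3) ^ 3 := by
  have h := integral_one_sub_sq_rpow_eq (α := 1 / 6) (by norm_num)
  norm_num at h
  rw [h]
  have d := Gamma_mul_Gamma_add_half (1 / 6)
  norm_num at d
  have r := Gamma_mul_Gamma_one_sub (1 / 3)
  rw [show π * (1 / 3) = π / 3 by ring, Real.sin_pi_div_three] at r
  norm_num at r
  have g1 : 0 < Gamma (1 / 3) := Gamma_pos_of_pos (by norm_num)
  have g2 : 0 < Gamma (2 / 3) := Gamma_pos_of_pos (by norm_num)
  have g6 : 0 < Gamma (1 / 6) := Gamma_pos_of_pos (by norm_num)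
  have hpi := sq_sqrt pi_pos.le
  have h3 : √(3 : ℝ) ^ 2 = 3 := sq_sqrt (by norm_num)
  have e1 : (108 : ℝ) ^ (-(5 / 6) : ℝ) = (2 : ℝ) ^ (-(5 / 3) : ℝ) * (√3 * (1 / 27)) := by
    rw [show (108 : ℝ) = 2 ^ (2 : ℝ) * 3 ^ (3 : ℝ) by norm_num,
      mul_rpow (by positivity) (by positivity), ← rpow_mul (by norm_num),
      ← rpow_mul (by norm_num), sqrt_eq_rpow,
      show (1 / 27 : ℝ) = 3 ^ (-3 : ℝ) by
        rw [show (-3 : ℝ) = ((-3 : ℤ) : ℝ) by norm_num, rpow_intCast]; norm_num,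
      ← rpow_add (by norm_num)]
    norm_num
  have e2 : (4 : ℝ) ^ (-(5 / 6) : ℝ) = (2 : ℝ) ^ (-(5 / 3) : ℝ) := by
    rw [show (4 : ℝ) = 2 ^ (2 : ℝ) by norm_num, ← rpow_mul (by norm_num)]; norm_num
  have e3 : ((2 : ℝ) ^ (2 / 3 : ℝ)) ^ 2 * ((2 : ℝ) ^ (-(5 / 3) : ℝ)) ^ 2 = 1 / 4 := by
    rw [← rpow_natCast, ← rpow_natCast, ← rpow_mul (by norm_num),
      ← rpow_mul (by norm_num), ← rpow_add (by norm_num),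
      show (1 / 4 : ℝ) = 2 ^ (-2 : ℝ) by
        rw [show (-2 : ℝ) = ((-2 : ℤ) : ℝ) by norm_num, rpow_intCast]; norm_num]
    norm_num
  rw [e1, e2]
  set x := (2 : ℝ) ^ (2 / 3 : ℝ)
  set y := (2 : ℝ) ^ (-(5 / 3) : ℝ)
  set a := Gamma (1 / 3)
  set b := Gamma (2 / 3)
  set c := Gamma (1 / 6)
  have h3p : (0 : ℝ) < √3 := by positivity
  have r' : a * b * √3 = 2 * π := by rw [r]; field_simp
  field_simp
  have q1 : c ^ 2 * b ^ 2 = a ^ 2 * x ^ 2 * π := by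
    rw [← mul_pow, d, mul_pow, mul_pow, hpi]
  have : y ^ 2 * √3 * 2 * c ^ 2 * b ^ 3 = (2 * π ^ 2) * (2 * (x ^ 2 * y ^ 2)) * a := by
    calc y ^ 2 * √3 * 2 * c ^ 2 * b ^ 3 = y ^ 2 * 2 * √3 * b * (c ^ 2 * b ^ 2) := by ring
      _ = 2 * x ^ 2 * y ^ 2 * π * a * (a * b * √3) := by rw [q1]; ring
      _ = _ := by rw [r']; ring
  rw [e3] at this
  nlinarith [this]

theorem sqrt_rpow {x : ℝ} (hx : 0 ≤ x) (r : ℝ) : √x ^ r = x ^ (r / 2) := by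
  rw [sqrt_eq_rpow, ← rpow_mul hx]; congr 1; ring

theorem max_Vd_le {Y a : ℝ} (hY : 0 < Y) (ha : 0 < a) {u : ℝ} (hu : u ∈ Ioo (-1 : ℝ) 1) :
    max 0 (Vd 1 Y a u) ≤
      36 / 5 * (Y / 108) ^ (5 / 6 : ℝ) * a ^ (-(1 / 3) : ℝ) * (1 - u ^ 2) ^ (-(5 / 6) : ℝ) := by
  have hs : 0 < 1 - u ^ 2 := by nlinarith [hu.1, hu.2]
  refine max_le (by positivity) ?_
  rw [Vd, sqrt_rpow hs.le, sqrt_rpow hs.le]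
  norm_num
  have : 0 < a ^ 3 * (1 - u ^ 2) ^ (-(5 / 2) : ℝ) := by positivity
  linarith

theorem integrableOn_max_Vd {Y a : ℝ} (hY : 0 < Y) (ha : 0 < a) :
    IntegrableOn (fun u => max 0 (Vd 1 Y a u)) (Ioo (-1) 1) := by
  refine Integrable.mono' ((integrableOn_one_sub_sq_rpow (α := 5 / 6) (by norm_num)
    (by norm_num)).const_mul (36 / 5 * (Y / 108) ^ (5 / 6 : ℝ) * a ^ (-(1 / 3) : ℝ))) ?_
    ((ae_restrict_iff' measurableSet_Ioo).2 (Filter.Eventually.of_forall fun u hu => ?_))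
  · refine Measurable.aestronglyMeasurable ?_
    exact measurable_const.max ((measurable_Vd 1 Y).comp (measurable_const.prodMk measurable_id))
  · rw [norm_eq_abs, abs_of_nonneg (le_max_left _ _)]
    exact max_Vd_le hY ha hu

theorem toReal_lintegral_Vd (Y a : ℝ) :
    (∫⁻ u in Ioo (-1) 1, ENNReal.ofReal (Vd 1 Y a u)).toReal =
      ∫ u in Ioo (-1) 1, max 0 (Vd 1 Y a u) := by
  rw [integral_eq_lintegral_of_nonneg_ae (f := fun u => max 0 (Vd 1 Y a u))
    (Filter.Eventually.of_forall fun u => le_max_left _ _)]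
  · congr 2
    funext u
    rcases le_total 0 (Vd 1 Y a u) with h | h
    · rw [max_eq_right h]
    · rw [max_eq_left h, ENNReal.ofReal_of_nonpos h, ENNReal.ofReal_zero]
  · refine Measurable.aestronglyMeasurable ?_
    exact measurable_const.max ((measurable_Vd 1 Y).comp (measurable_const.prodMk measurable_id))

theorem Vd_one_eq {Y q n u : ℝ} (hY : 0 < Y) (hq : 0 < q) (hn : 0 < n) (hu : u ∈ Ioo (-1 : ℝ) 1) :
    Vd 1 Y (q * n) u = 36 / 5 * q ^ 3 * √(1 - u ^ 2) ^ (-5 : ℝ) *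
      (((Y / 108) ^ (1 / 4 : ℝ) * √(1 - u ^ 2) / q) ^ (10 / 3 : ℝ) * n ^ (-(1 / 3) : ℝ) - n ^ 3) := by
  have hs : 0 < √(1 - u ^ 2) := sqrt_pos.2 (by nlinarith [hu.1, hu.2])
  set s := √(1 - u ^ 2)
  rw [Vd, div_rpow (by positivity) hq.le, mul_rpow (by positivity) hs.le,
    ← rpow_mul (by positivity), mul_rpow hq.le hn.le,
    show (1 / 4 * (10 / 3) : ℝ) = 5 / 6 by norm_num]
  have e1 : s ^ (-(5 / 3) : ℝ) = s ^ (-5 : ℝ) * s ^ (10 / 3 : ℝ) := by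
    rw [← rpow_add hs]; norm_num
  have e2 : q ^ (-(1 / 3) : ℝ) = q ^ 3 / q ^ (10 / 3 : ℝ) := by
    rw [← rpow_natCast, ← rpow_sub hq]; norm_num
  rw [e1, e2]
  ring

theorem abs_sum_max_Vd_sub_le {Y q u : ℝ} (hY : 0 < Y) (hq : 0 < q) (hu : u ∈ Ioo (-1 : ℝ) 1)
    {M : ℕ} (hM : (Y / 108) ^ (1 / 4 : ℝ) / q ≤ M) :
    |∑ n ∈ Finset.range M, max 0 (Vd 1 Y (q * (n + 1)) u) -
      (Y / (12 * q)) * (1 - u ^ 2) ^ (-(1 / 2) : ℝ) -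
      (36 / 5 * (Y / 108) ^ (5 / 6 : ℝ) * (riemannZeta (1 / 3)).re * q ^ (-(1 / 3) : ℝ)) *
        (1 - u ^ 2) ^ (-(5 / 6) : ℝ)| ≤
      (36 / 5 * (5 + |(riemannZeta (1 / 3)).re|) * (Y / 108) ^ (19 / 24 : ℝ) *
        q ^ (-(1 / 6) : ℝ)) * (1 - u ^ 2) ^ (-(11 / 12) : ℝ) := by
  have hs2 : 0 < 1 - u ^ 2 := by nlinarith [hu.1, hu.2]
  have hs : 0 < √(1 - u ^ 2) := sqrt_pos.2 hs2
  have hs1 : √(1 - u ^ 2) ≤ 1 := sqrt_le_one.2 (by nlinarith [sq_nonneg u])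
  set s := √(1 - u ^ 2) with hsdef
  have hA0 : 0 < (Y / 108) ^ (1 / 4 : ℝ) := by positivity
  set A := (Y / 108) ^ (1 / 4 : ℝ) * s / q with hA
  have hApos : 0 < A := by positivity
  have hAM : A ≤ M := by
    refine le_trans ?_ hM
    rw [hA]
    gcongr
    nlinarith
  have key := abs_sum_cube_sub_le hApos hAM
  set z := (riemannZeta (1 / 3)).re
  set c := 36 / 5 * q ^ 3 * s ^ (-5 : ℝ) with hc
  have hc0 : 0 < c := by positivity
  have e0 : ∑ n ∈ Finset.range M, max 0 (Vd 1 Y (q * (n + 1)) u) = c * ∑ n ∈ Finset.range M,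
      max 0 (A ^ (10 / 3 : ℝ) * (n + 1 : ℝ) ^ (-(1 / 3) : ℝ) - (n + 1) ^ 3) := by
    rw [Finset.mul_sum]
    refine Finset.sum_congr rfl fun n _ => ?_
    rw [Vd_one_eq hY hq (by positivity) hu, mul_max_of_nonneg _ _ hc0.le, mul_zero]
  have p1 : A ^ 4 = (Y / 108) * s ^ (4 : ℝ) / q ^ 4 := by
    rw [hA, div_pow, mul_pow, ← rpow_natCast (_ ^ _), ← rpow_mul (by positivity)]
    norm_num
  have p2 : A ^ (10 / 3 : ℝ) = (Y / 108) ^ (5 / 6 : ℝ) * s ^ (10 / 3 : ℝ) / q ^ (10 / 3 : ℝ) := by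
    rw [hA, div_rpow (by positivity) hq.le, mul_rpow (by positivity) hs.le,
    ← rpow_mul (by positivity)]
    norm_num
  have p3 : A ^ (19 / 6 : ℝ) = (Y / 108) ^ (19 / 24 : ℝ) * s ^ (19 / 6 : ℝ) / q ^ (19 / 6 : ℝ) := by
    rw [hA, div_rpow (by positivity) hq.le, mul_rpow (by positivity) hs.le,
    ← rpow_mul (by positivity)]
    norm_num
  have s1 : (1 - u ^ 2) ^ (-(1 / 2) : ℝ) = s ^ (-5 : ℝ) * s ^ (4 : ℝ) := by
    rw [← rpow_add hs, hsdef, sqrt_rpow hs2.le]; norm_num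
  have s2 : (1 - u ^ 2) ^ (-(5 / 6) : ℝ) = s ^ (-5 : ℝ) * s ^ (10 / 3 : ℝ) := by
    rw [← rpow_add hs, hsdef, sqrt_rpow hs2.le]; norm_num
  have s3 : (1 - u ^ 2) ^ (-(11 / 12) : ℝ) = s ^ (-5 : ℝ) * s ^ (19 / 6 : ℝ) := by
    rw [← rpow_add hs, hsdef, sqrt_rpow hs2.le]; norm_num
  have q2 : q ^ (-(1 / 3) : ℝ) = q ^ 3 / q ^ (10 / 3 : ℝ) := by
    rw [← rpow_natCast, ← rpow_sub hq]; norm_num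
  have q3 : q ^ (-(1 / 6) : ℝ) = q ^ 3 / q ^ (19 / 6 : ℝ) := by
    rw [← rpow_natCast, ← rpow_sub hq]; norm_num
  rw [e0, s1, s2, s3, q2, q3]
  set T := ∑ n ∈ Finset.range M, max 0 (A ^ (10 / 3 : ℝ) * (n + 1 : ℝ) ^ (-(1 / 3) : ℝ) - (n + 1) ^ 3)
  rw [p1, p2, p3] at key
  have h := mul_le_mul_of_nonneg_left key hc0.le
  rw [← abs_of_pos hc0, ← abs_mul, abs_of_pos hc0] at h
  refine (le_of_eq ?_).trans (h.trans (le_of_eq ?_))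
  · congr 1
    rw [hc]
    field_simp
    ring
  · rw [hc]; ring

theorem exists_abs_sum_lintegral_Vd_sub_le : ∃ C : ℝ, 0 < C ∧ ∀ Y q : ℝ, 0 < Y → 0 < q →
    ∀ M : ℕ, (Y / 108) ^ (1 / 4 : ℝ) / q ≤ M →
    |∑ n ∈ Finset.range M, (∫⁻ u in Ioo (-1) 1, ENNReal.ofReal (Vd 1 Y (q * (n + 1)) u)).toReal -
      π / 12 * (Y / q) - (36 / 5 * (Y / 108) ^ (5 / 6 : ℝ) * (riemannZeta (1 / 3)).re *
        q ^ (-(1 / 3) : ℝ)) * ∫ u in Ioo (-1 : ℝ) 1, (1 - u ^ 2) ^ (-(5 / 6) : ℝ)| ≤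
      C * (Y ^ (19 / 24 : ℝ) * q ^ (-(1 / 6) : ℝ)) := by
  have i1 := integrableOn_one_sub_sq_rpow (α := 1 / 2) (by norm_num) (by norm_num)
  have i2 := integrableOn_one_sub_sq_rpow (α := 5 / 6) (by norm_num) (by norm_num)
  have i3 := integrableOn_one_sub_sq_rpow (α := 11 / 12) (by norm_num) (by norm_num)
  set I := ∫ u in Ioo (-1 : ℝ) 1, (1 - u ^ 2) ^ (-(11 / 12) : ℝ) with hI
  have hI0 : 0 ≤ I := setIntegral_nonneg measurableSet_Ioo fun u hu =>
    rpow_nonneg (by nlinarith [hu.1, hu.2]) _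
  set z := (riemannZeta (1 / 3)).re with hz
  refine ⟨36 / 5 * (5 + |z|) * (1 / 108) ^ (19 / 24 : ℝ) * I + 1, by positivity, ?_⟩
  intro Y q hY hq M hM
  simp only [toReal_lintegral_Vd]
  have hint : ∀ n ∈ Finset.range M, Integrable (fun u => max 0 (Vd 1 Y (q * ((n : ℝ) + 1)) u))
      (volume.restrict (Ioo (-1) 1)) := fun n _ => integrableOn_max_Vd hY (by positivity)
  have e1 : π / 12 * (Y / q) =
      ∫ u in Ioo (-1 : ℝ) 1, (Y / (12 * q)) * (1 - u ^ 2) ^ (-(1 / 2) : ℝ) := by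
    rw [integral_const_mul, integral_one_sub_sq_rpow_neg_half le_rfl le_rfl (by norm_num),
      Real.arcsin_one, Real.arcsin_neg_one]
    field_simp
    ring
  have hs : Integrable (fun u => ∑ n ∈ Finset.range M, max 0 (Vd 1 Y (q * (n + 1)) u) -
      (Y / (12 * q)) * (1 - u ^ 2) ^ (-(1 / 2) : ℝ)) (volume.restrict (Ioo (-1) 1)) :=
    (integrable_finsetSum _ hint).sub (i1.const_mul _)
  rw [e1, ← integral_finsetSum _ hint, ← integral_const_mul,
    ← integral_sub (integrable_finsetSum _ hint) (i1.const_mul _),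
    ← integral_sub hs (i2.const_mul _)]
  have hb : |∫ u in Ioo (-1 : ℝ) 1, (∑ n ∈ Finset.range M, max 0 (Vd 1 Y (q * (n + 1)) u) -
      (Y / (12 * q)) * (1 - u ^ 2) ^ (-(1 / 2) : ℝ) -
      (36 / 5 * (Y / 108) ^ (5 / 6 : ℝ) * z * q ^ (-(1 / 3) : ℝ)) *
        (1 - u ^ 2) ^ (-(5 / 6) : ℝ))| ≤ ∫ u in Ioo (-1 : ℝ) 1,
      (36 / 5 * (5 + |z|) * (Y / 108) ^ (19 / 24 : ℝ) *
        q ^ (-(1 / 6) : ℝ)) * (1 - u ^ 2) ^ (-(11 / 12) : ℝ) := by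
    rw [← norm_eq_abs]
    refine norm_integral_le_of_norm_le (i3.const_mul _)
      ((ae_restrict_iff' measurableSet_Ioo).2 (Filter.Eventually.of_forall fun u hu => ?_))
    rw [norm_eq_abs]
    exact abs_sum_max_Vd_sub_le hY hq hu hM
  refine hb.trans ?_
  rw [integral_const_mul, ← hI, show Y / 108 = (1 / 108) * Y by ring,
    mul_rpow (by norm_num) hY.le]
  have : 0 ≤ Y ^ (19 / 24 : ℝ) * q ^ (-(1 / 6) : ℝ) := by positivity
  linarith

end

section
open ENNReal Real MeasureTheory Set

theorem lintegral_comp_affine {f : ℝ → ENNReal} (hf : Measurable f) {α : ℝ} (hα : α ≠ 0) (β : ℝ) :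
    ∫⁻ x, f (α * x + β) = ENNReal.ofReal |α⁻¹| * ∫⁻ x, f x := by
  have h1 : ∫⁻ x, f (α * x + β) = ∫⁻ x, f (x + β) ∂(Measure.map (α * ·) volume) := by
    rw [lintegral_map (by fun_prop) (by fun_prop)]
  rw [h1, Real.map_volume_mul_left hα, lintegral_smul_measure, lintegral_add_right_eq_self f β]
  rfl

theorem volume_affine_preimage {S : Set ℝ} (hS : MeasurableSet S) {α : ℝ} (hα : α ≠ 0) (β : ℝ) :
    volume {x | α * x + β ∈ S} = ENNReal.ofReal |α⁻¹| * volume S := by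
  have h := lintegral_indicator_one (μ := volume)
    (hS.preimage (by fun_prop : Measurable fun x : ℝ => α * x + β))
  rw [← lintegral_indicator_one hS, ← lintegral_comp_affine (measurable_one.indicator hS) hα β]
  exact h.symm

/-- Discriminant of a real binary cubic form. -/
def rD (a b c d : ℝ) : ℝ :=
  b ^ 2 * c ^ 2 - 4 * a * c ^ 3 - 4 * b ^ 3 * d - 27 * a ^ 2 * d ^ 2 + 18 * a * b * c * d

/-- The part of the fundamental domain (`θ = 1`) or of its cusp (`θ = 0`) with fixed `a`. -/
def Vb (θ Y a : ℝ) : Set (ℝ × ℝ × ℝ) :=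
  {z | |z.1 * z.2.1 - 9 * a * z.2.2| < z.1 ^ 2 - 3 * a * z.2.1 ∧
    4 * (z.1 ^ 2 - 3 * a * z.2.1) ^ 2 - θ * (z.1 * z.2.1 - 9 * a * z.2.2) ^ 2 <
      3 * rD a z.1 z.2.1 z.2.2 ∧ rD a z.1 z.2.1 z.2.2 < Y}

/-- The region `Vb` in terms of `b` and the covariants `P`, `U`. -/
def Gb (θ Y a : ℝ) : Set (ℝ × ℝ × ℝ) :=
  {z | |2 * z.1 * z.2.1 - z.2.2| < 3 * a * z.2.1 ∧
    36 * a ^ 2 * z.2.1 ^ 2 - θ * (2 * z.1 * z.2.1 - z.2.2) ^ 2 < 4 * z.2.1 ^ 3 - z.2.2 ^ 2 ∧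
    4 * z.2.1 ^ 3 - z.2.2 ^ 2 < 27 * a ^ 2 * Y}

theorem measurableSet_Vb (θ Y a : ℝ) : MeasurableSet (Vb θ Y a) := by
  unfold Vb rD
  exact measurableSet_and (measurableSet_lt (by fun_prop) (by fun_prop)) (measurableSet_and
    (measurableSet_lt (by fun_prop) (by fun_prop)) (measurableSet_lt (by fun_prop) (by fun_prop)))

theorem measurableSet_Gb (θ Y a : ℝ) : MeasurableSet (Gb θ Y a) := by
  unfold Gb
  exact measurableSet_and (measurableSet_lt (by fun_prop) (by fun_prop)) (measurableSet_and
    (measurableSet_lt (by fun_prop) (by fun_prop)) (measurableSet_lt (by fun_prop) (by fun_prop)))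

theorem mem_Vb_iff {θ Y a : ℝ} (ha : 0 < a) (b c d : ℝ) : (b, c, d) ∈ Vb θ Y a ↔
    (b, (-(3 * a)) * c + b ^ 2, 27 * a ^ 2 * d + (2 * b ^ 3 - 9 * a * b * c)) ∈ Gb θ Y a := by
  have e1 : 2 * b * (-(3 * a) * c + b ^ 2) - (27 * a ^ 2 * d + (2 * b ^ 3 - 9 * a * b * c)) =
      3 * a * (b * c - 9 * a * d) := by ring
  have e2 : 4 * (-(3 * a) * c + b ^ 2) ^ 3 - (27 * a ^ 2 * d + (2 * b ^ 3 - 9 * a * b * c)) ^ 2 =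
      27 * a ^ 2 * rD a b c d := by rw [rD]; ring
  have e3 : 36 * a ^ 2 * (-(3 * a) * c + b ^ 2) ^ 2 - θ * (3 * a * (b * c - 9 * a * d)) ^ 2 =
      9 * a ^ 2 * (4 * (b ^ 2 - 3 * a * c) ^ 2 - θ * (b * c - 9 * a * d) ^ 2) := by ring
  have ha2 : 0 < a ^ 2 := by positivity
  simp only [Vb, Gb, mem_ofPred_eq, e1, e2, e3]
  rw [abs_mul, abs_of_pos (by positivity : 0 < 3 * a), mul_lt_mul_iff_right₀ (by positivity),
    show 27 * a ^ 2 * rD a b c d = 9 * a ^ 2 * (3 * rD a b c d) by ring,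
    mul_lt_mul_iff_right₀ (by positivity),
    show 9 * a ^ 2 * (3 * rD a b c d) = 27 * a ^ 2 * rD a b c d by ring,
    mul_lt_mul_iff_right₀ (by positivity),
    show -(3 * a) * c + b ^ 2 = b ^ 2 - 3 * a * c by ring]

theorem volume_Vb_eq_Gb {θ Y a : ℝ} (ha : 0 < a) :
    volume (Vb θ Y a) = ENNReal.ofReal (1 / (81 * a ^ 3)) * volume (Gb θ Y a) := by
  have hG := measurableSet_Gb θ Y a
  rw [Measure.volume_eq_prod, Measure.prod_apply (measurableSet_Vb θ Y a),
    Measure.prod_apply hG, ← lintegral_const_mul' _ _ ofReal_ne_top]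
  refine lintegral_congr fun b => ?_
  rw [Measure.volume_eq_prod, Measure.prod_apply (measurable_prodMk_left (measurableSet_Vb θ Y a)),
    Measure.prod_apply (measurable_prodMk_left hG)]
  have hm : Measurable fun P : ℝ => volume (Prod.mk P ⁻¹' (Prod.mk b ⁻¹' Gb θ Y a)) :=
    measurable_measure_prodMk_left (measurable_prodMk_left hG)
  have h1 := lintegral_comp_affine hm (α := -(3 * a)) (by nlinarith) (b ^ 2)
  have h2 : ∀ c : ℝ, volume (Prod.mk c ⁻¹' (Prod.mk b ⁻¹' Vb θ Y a)) =
      ENNReal.ofReal |(27 * a ^ 2)⁻¹| *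
        volume (Prod.mk ((-(3 * a)) * c + b ^ 2) ⁻¹' (Prod.mk b ⁻¹' Gb θ Y a)) := by
    intro c
    rw [← volume_affine_preimage (measurable_prodMk_left (measurable_prodMk_left hG))
      (by positivity) (2 * b ^ 3 - 9 * a * b * c)]
    congr 1
    ext d
    exact mem_Vb_iff ha b c d
  rw [lintegral_congr h2, lintegral_const_mul' _ _ ofReal_ne_top, h1, ← mul_assoc,
    ← ofReal_mul (abs_nonneg _), ← abs_mul]
  congr 2
  rw [inv_neg, mul_neg, abs_neg, abs_of_pos (by positivity)]
  field_simp
  norm_num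

theorem mem_Gb_iff {θ Y a : ℝ} (hθ : θ ≤ 1) (ha : 0 < a) {b P U : ℝ} (hP : 0 < P) :
    (b, P, U) ∈ Gb θ Y a ↔ (3 * a)⁻¹ * b + -(U / (6 * a * P)) ∈
      {x : ℝ | x ∈ Ioo (-(1 / 2) : ℝ) (1 / 2) ∧ (P, U) ∈ PU (√(1 - θ * x ^ 2)) Y a} := by
  set x := (3 * a)⁻¹ * b + -(U / (6 * a * P)) with hx
  have e1 : 2 * b * P - U = 6 * a * P * x := by rw [hx]; field_simp; ring
  have h1 : |2 * b * P - U| < 3 * a * P ↔ x ∈ Ioo (-(1 / 2) : ℝ) (1 / 2) := by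
    rw [e1, abs_mul, abs_of_pos (by positivity), show 3 * a * P = 6 * a * P * (1 / 2) by ring,
      mul_lt_mul_iff_right₀ (by positivity), abs_lt]
    rfl
  simp only [Gb, PU, mem_ofPred_eq, h1]
  refine and_congr_right fun hx' => ?_
  have : 0 ≤ 1 - θ * x ^ 2 := by
    have : x ^ 2 ≤ 1 := by nlinarith [hx'.1, hx'.2]
    nlinarith [sq_nonneg x]
  rw [sq_sqrt this, e1, show 36 * a ^ 2 * (1 - θ * x ^ 2) * P ^ 2 =
    36 * a ^ 2 * P ^ 2 - θ * (6 * a * P * x) ^ 2 by ring]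
  simp [hP]

theorem measurableSet_PU_prod (θ Y a : ℝ) : MeasurableSet
    {z : ℝ × ℝ × ℝ | z.1 ∈ Ioo (-(1 / 2) : ℝ) (1 / 2) ∧ z.2 ∈ PU (√(1 - θ * z.1 ^ 2)) Y a} := by
  refine measurableSet_and (measurable_fst measurableSet_Ioo) ?_
  unfold PU
  exact measurableSet_and (measurableSet_lt (by fun_prop) (by fun_prop)) (measurableSet_and
    (measurableSet_lt (by fun_prop) (by fun_prop)) (measurableSet_lt (by fun_prop) (by fun_prop)))

theorem volume_Gb {θ Y a : ℝ} (hθ : θ ≤ 1) (ha : 0 < a) :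
    volume (Gb θ Y a) = ENNReal.ofReal (3 * a) * ∫⁻ x in Ioo (-(1 / 2) : ℝ) (1 / 2),
      (volume.prod volume) (PU (√(1 - θ * x ^ 2)) Y a) := by
  have hG := measurableSet_Gb θ Y a
  have hT := measurableSet_PU_prod θ Y a
  set T := {z : ℝ × ℝ × ℝ | z.1 ∈ Ioo (-(1 / 2) : ℝ) (1 / 2) ∧ z.2 ∈ PU (√(1 - θ * z.1 ^ 2)) Y a}
    with hTdef
  have h1 : ∫⁻ x in Ioo (-(1 / 2) : ℝ) (1 / 2), (volume.prod volume) (PU (√(1 - θ * x ^ 2)) Y a) =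
      (volume.prod (volume.prod volume)) T := by
    rw [Measure.prod_apply hT, ← lintegral_indicator measurableSet_Ioo]
    refine lintegral_congr fun x => ?_
    by_cases hx : x ∈ Ioo (-(1 / 2) : ℝ) (1 / 2)
    · rw [indicator_of_mem hx]
      congr 1
      ext w
      exact ⟨fun h => ⟨hx, h⟩, fun h => h.2⟩
    · rw [indicator_of_notMem hx]
      symm
      convert measure_empty (μ := volume.prod volume) using 2
      ext w
      simp only [mem_preimage, mem_empty_iff_false, iff_false]
      exact fun h => hx h.1
  rw [h1, Measure.volume_eq_prod, Measure.volume_eq_prod, Measure.prod_apply_symm hG,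
    Measure.prod_apply_symm hT, ← lintegral_const_mul' _ _ ofReal_ne_top]
  refine lintegral_congr fun w => ?_
  obtain ⟨P, U⟩ := w
  by_cases hP : 0 < P
  · have h2 := volume_affine_preimage (hT.preimage
      (measurable_prodMk_right : Measurable fun x : ℝ => (x, (P, U)))) (α := (3 * a)⁻¹)
        (by positivity) (-(U / (6 * a * P)))
    rw [inv_inv, abs_of_pos (by positivity)] at h2
    rw [← h2]
    congr 1
    ext b
    exact mem_Gb_iff hθ ha hP
  · have e1 : (fun x : ℝ => (x, (P, U))) ⁻¹' Gb θ Y a = ∅ := by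
      ext b
      simp only [mem_preimage, mem_empty_iff_false, iff_false]
      intro h
      have := (abs_nonneg _).trans_lt h.1
      simp only at this
      exact hP (by nlinarith)
    have e2 : (fun x : ℝ => (x, (P, U))) ⁻¹' T = ∅ := by
      ext b
      simp only [mem_preimage, mem_empty_iff_false, iff_false]
      intro h
      exact hP h.2.1
    rw [e1, e2]
    simp

theorem volume_Vb {θ Y a : ℝ} (hθ : θ ≤ 1) (hY : 0 < Y) (ha : 0 < a) :
    volume (Vb θ Y a) = ∫⁻ x in Ioo (-(1 / 2) : ℝ) (1 / 2), ∫⁻ u in Ioo (-1) 1,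
      ENNReal.ofReal (Vd (√(1 - θ * x ^ 2)) Y a u) := by
  rw [volume_Vb_eq_Gb ha, volume_Gb hθ ha, ← mul_assoc, ← ofReal_mul (by positivity),
    ← lintegral_const_mul' _ _ ofReal_ne_top]
  refine lintegral_congr fun x => ?_
  rw [volume_PU (sqrt_nonneg _) hY ha, ← mul_assoc, ← ofReal_mul (by positivity)]
  have : 1 / (81 * a ^ 3) * (3 * a) * (27 * a ^ 2) = 1 := by field_simp; norm_num
  rw [this, ofReal_one, one_mul]

theorem lintegral_volume_Vb {θ Y : ℝ} (hθ : θ ≤ 1) (hY : 0 < Y) :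
    ∫⁻ a in Ioi 0, volume (Vb θ Y a) = ∫⁻ x in Ioo (-(1 / 2) : ℝ) (1 / 2),
      ENNReal.ofReal (π / 12 * (Y / √(1 - θ * x ^ 2))) := by
  rw [setLIntegral_congr_fun measurableSet_Ioi fun a ha => volume_Vb hθ hY ha,
    lintegral_lintegral_swap]
  · refine setLIntegral_congr_fun measurableSet_Ioo fun x hx => ?_
    refine lintegral_lintegral_Vd (sqrt_pos.2 ?_) hY
    have : x ^ 2 ≤ 1 / 4 := by nlinarith [hx.1, hx.2]
    nlinarith [sq_nonneg x]
  · refine Measurable.aemeasurable ?_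
    refine Measurable.lintegral_prod_right' (f := fun z : (ℝ × ℝ) × ℝ =>
      ENNReal.ofReal (Vd (√(1 - θ * z.1.2 ^ 2)) Y z.1.1 z.2)) ?_
    unfold Vd
    fun_prop

/-- The part of the fundamental domain (`θ = 1`) or of its cusp (`θ = 0`). -/
def Va (θ Y : ℝ) : Set (ℝ × ℝ × ℝ × ℝ) :=
  {z | 0 < z.1 ∧ z.2 ∈ Vb θ Y z.1}

theorem measurableSet_Va (θ Y : ℝ) : MeasurableSet (Va θ Y) := by
  unfold Va Vb rD
  exact measurableSet_and (measurableSet_lt (by fun_prop) (by fun_prop)) (measurableSet_and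
    (measurableSet_lt (by fun_prop) (by fun_prop)) (measurableSet_and
    (measurableSet_lt (by fun_prop) (by fun_prop)) (measurableSet_lt (by fun_prop) (by fun_prop))))

theorem volume_Va (θ Y : ℝ) : volume (Va θ Y) = ∫⁻ a in Ioi 0, volume (Vb θ Y a) := by
  rw [Measure.volume_eq_prod, Measure.prod_apply (measurableSet_Va θ Y),
    ← lintegral_indicator measurableSet_Ioi]
  refine lintegral_congr fun a => ?_
  by_cases ha : 0 < a
  · rw [indicator_of_mem (show a ∈ Ioi (0 : ℝ) from ha)]
    congr 1
    ext w
    exact ⟨fun h => h.2, fun h => ⟨ha, h⟩⟩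
  · rw [indicator_of_notMem (show a ∉ Ioi (0 : ℝ) from ha)]
    convert measure_empty (μ := (volume : Measure (ℝ × ℝ × ℝ))) using 2
    ext w
    simp only [mem_preimage, mem_empty_iff_false, iff_false]
    exact fun h => ha h.1

theorem volume_Va_zero {Y : ℝ} (hY : 0 < Y) :
    volume (Va 0 Y) = ENNReal.ofReal (π / 12 * Y) := by
  rw [volume_Va, lintegral_volume_Vb zero_le_one hY]
  simp
  norm_num

theorem volume_Va_one {Y : ℝ} (hY : 0 < Y) :
    volume (Va 1 Y) = ENNReal.ofReal (π / 12 * Y * (π / 3)) := by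
  rw [volume_Va, lintegral_volume_Vb le_rfl hY]
  have h : ∀ x ∈ Ioo (-(1 / 2) : ℝ) (1 / 2),
      ENNReal.ofReal (π / 12 * (Y / √(1 - 1 * x ^ 2))) =
      ENNReal.ofReal (π / 12 * Y) * ENNReal.ofReal ((1 - x ^ 2) ^ (-(1 / 2) : ℝ)) := by
    intro x hx
    have : 0 < 1 - x ^ 2 := by nlinarith [hx.1, hx.2]
    rw [← ofReal_mul (by positivity), rpow_neg this.le, ← sqrt_eq_rpow, one_mul]
    congr 1
    ring
  have hi : IntegrableOn (fun u : ℝ => (1 - u ^ 2) ^ (-(1 / 2) : ℝ)) (Ioo (-(1 / 2)) (1 / 2)) :=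
    (integrableOn_one_sub_sq_rpow (by norm_num) (by norm_num)).mono_set
      (Ioo_subset_Ioo (by norm_num) (by norm_num))
  rw [setLIntegral_congr_fun measurableSet_Ioo h, lintegral_const_mul' _ _ ofReal_ne_top,
    ← ofReal_integral_eq_lintegral_ofReal hi, integral_one_sub_sq_rpow_neg_half (by norm_num)
    (by norm_num) (by norm_num), ← ofReal_mul (by positivity)]
  · have : Real.arcsin (1 / 2) = π / 6 := by
      rw [← Real.sin_pi_div_six, Real.arcsin_sin] <;> linarith [pi_pos]
    rw [Real.arcsin_neg, this]
    congr 1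
    ring
  · refine (ae_restrict_iff' measurableSet_Ioo).2 (Filter.Eventually.of_forall fun u hu => ?_)
    exact rpow_nonneg (by nlinarith [hu.1, hu.2]) _

/-- The part of the fundamental domain outside of its cusp. -/
def Vk (Y : ℝ) : Set (ℝ × ℝ × ℝ × ℝ) := Va 1 Y \ Va 0 Y

theorem Va_zero_subset (Y : ℝ) : Va 0 Y ⊆ Va 1 Y := by
  rintro ⟨a, b, c, d⟩ ⟨h0, h1, h2, h3⟩
  refine ⟨h0, h1, lt_of_le_of_lt ?_ h2, h3⟩
  simp only
  nlinarith [sq_nonneg (b * c - 9 * a * d)]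

theorem toReal_volume_Vk {Y : ℝ} (hY : 0 < Y) :
    volume (Vk Y) ≠ ⊤ ∧ (volume (Vk Y)).toReal = π / 12 * (π / 3 - 1) * Y := by
  have h1 := volume_Va_one hY
  have h0 := volume_Va_zero hY
  have hne : volume (Va 1 Y) ≠ ⊤ := by rw [h1]; exact ofReal_ne_top
  refine ⟨ne_top_of_le_ne_top hne (measure_mono sdiff_subset), ?_⟩
  rw [Vk, measure_sdiff (Va_zero_subset Y) (measurableSet_Va 0 Y).nullMeasurableSet
    (by rw [h0]; exact ofReal_ne_top), toReal_sub_of_le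
    (measure_mono (Va_zero_subset Y)) hne, h0, h1, toReal_ofReal (by positivity),
    toReal_ofReal (by positivity)]
  ring

end

section
open ENNReal MeasureTheory Set

theorem toReal_volume_Icc_neg {L : ℝ} (hL : 0 ≤ L) : (volume (Icc (-L) L)).toReal = 2 * L := by
  rw [Real.volume_Icc, toReal_ofReal (by linarith)]; ring

theorem abs_sum_sub_le_of_forall {ι : Type*} {s : Finset ι} {x y e : ι → ℝ} {z δ : ℝ}
    (h : ∀ i ∈ s, |x i - y i| ≤ e i) (h' : |∑ i ∈ s, y i - z| ≤ δ) :
    |∑ i ∈ s, x i - z| ≤ ∑ i ∈ s, e i + δ := by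
  have h1 : |∑ i ∈ s, (x i - y i)| ≤ ∑ i ∈ s, e i :=
    (Finset.abs_sum_le_sum_abs _ _).trans (Finset.sum_le_sum h)
  rw [Finset.sum_sub_distrib] at h1
  calc |∑ i ∈ s, x i - z| = |(∑ i ∈ s, x i - ∑ i ∈ s, y i) + (∑ i ∈ s, y i - z)| := by ring_nf
    _ ≤ _ := (abs_add_le _ _).trans (add_le_add h1 h')

open Classical in
theorem abs_sum_weight_sub_volume_le {m : ℕ} {S : Set ℝ} (h : Fr m S) {I : Finset ℤ}
    (hI : ∀ n : ℤ, (n : ℝ) ∈ S → n ∈ I) (hb : volume S ≠ ⊤) {w : ℤ → ℝ} {E : ℝ}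
    (hw : ∀ u v : ℤ, |∑ d ∈ Finset.Ico u v, (w d - 1)| ≤ E) :
    |∑ d ∈ I.filter (fun n : ℤ => (n : ℝ) ∈ S), w d - (volume S).toReal| ≤
      (2 * m + 1) * (E + 1) := by
  have h1 := h.abs_sum_le hI hw
  have h2 := h.abs_card_sub_le hI hb
  rw [Finset.sum_sub_distrib, Finset.sum_const, nsmul_eq_mul, mul_one] at h1
  rw [abs_le] at *
  constructor <;> nlinarith [h1.1, h1.2, h2.1, h2.2]

open Classical in
/-- Lattice points of a bounded region, weighted by the number of roots modulo `q₁`. -/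
theorem exists_abs_sum_region_sub_le (m : ℕ) : ∃ C : ℝ, 0 < C ∧
    ∀ (q₁ q₂ L : ℕ) (K : Set (ℝ × ℝ × ℝ × ℝ)) (J : Finset ℤ), q₁ ≠ 0 → q₂ ≠ 0 → L ≠ 0 →
    MeasurableSet K →
    (∀ a b c d : ℝ, (a, b, c, d) ∈ K → |a| ≤ L ∧ |b| ≤ L ∧ |c| ≤ L ∧ |d| ≤ L) →
    J.card ≤ L → (∀ (n : ℤ) (z : ℝ × ℝ × ℝ), ((q₂ * n : ℝ), z) ∈ K → n ∈ J) →
    (∀ b c d : ℝ, Fr m {t | (q₂ * t, b, c, d) ∈ K}) →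
    (∀ a c d : ℝ, Fr m {t | (a, t, c, d) ∈ K}) →
    (∀ a b d : ℝ, Fr m {t | (a, b, t, d) ∈ K}) →
    (∀ a b c : ℝ, Fr m {t | (a, b, c, t) ∈ K}) →
    |∑ n ∈ J, ∑ b ∈ Finset.Icc (-(L : ℤ)) L, ∑ c ∈ Finset.Icc (-(L : ℤ)) L,
      ∑ d ∈ (Finset.Icc (-(L : ℤ)) L).filter
        (fun d : ℤ => (d : ℝ) ∈ {t : ℝ | ((q₂ * n : ℝ), (b : ℝ), (c : ℝ), t) ∈ K}),
        (NRZ q₁ (q₂ * n) b c d : ℝ) - (volume K).toReal / q₂| ≤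
      C * ((L : ℝ) ^ 3 * (q₁ : ℝ) ^ (21 / 40 : ℝ) + (L : ℝ) ^ 2 * (q₁ : ℝ) ^ (61 / 40 : ℝ)) := by
  obtain ⟨C, hC, hdisc⟩ := exists_discrepancy
  refine ⟨(2 * m + 1) * (9 * C + 33), by positivity, ?_⟩
  intro q₁ q₂ L K J hq₁ hq₂ hL hK hbox hJ hJmem ha hb hc hd
  obtain ⟨Ed, hE0, hE, hEs⟩ := hdisc q₁ hq₁
  have hL1 : (1 : ℝ) ≤ L := by exact_mod_cast Nat.one_le_iff_ne_zero.2 hL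
  have hL0 : (0 : ℝ) ≤ L := by linarith
  have hq2 : (1 : ℝ) ≤ q₂ := by exact_mod_cast Nat.one_le_iff_ne_zero.2 hq₂
  have hq1 : (1 : ℝ) ≤ q₁ := by exact_mod_cast Nat.one_le_iff_ne_zero.2 hq₁
  set M : ℝ := 2 * m + 1 with hM
  have hM0 : 0 < M := by positivity
  set I := Finset.Icc (-(L : ℤ)) L with hI
  have hIcard : ((I.card : ℕ) : ℝ) = 2 * L + 1 := by
    rw [hI, Int.card_Icc, ← Int.cast_natCast (R := ℝ), Int.toNat_of_nonneg (by omega)]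
    push_cast; ring
  have hmemI : ∀ n : ℤ, |(n : ℝ)| ≤ L → n ∈ I := by
    intro n hn
    rw [abs_le] at hn
    rw [hI, Finset.mem_Icc]
    exact ⟨by exact_mod_cast hn.1, by exact_mod_cast hn.2⟩
  have mK1 : ∀ a, MeasurableSet {z : ℝ × ℝ × ℝ | (a, z) ∈ K} := fun a => measurable_prodMk_left hK
  have mK2 : ∀ a b, MeasurableSet {z : ℝ × ℝ | (a, b, z) ∈ K} := fun a b =>
    measurable_prodMk_left (mK1 a)
  have mB : MeasurableSet (Icc (-(L : ℝ)) L) := measurableSet_Icc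
  have vB := toReal_volume_Icc_neg hL0
  have tB : volume (Icc (-(L : ℝ)) L) ≠ ⊤ := by rw [Real.volume_Icc]; exact ofReal_ne_top
  have l0 : ∀ (n b c : ℤ), |∑ d ∈ I.filter
        (fun d : ℤ => (d : ℝ) ∈ {t : ℝ | ((q₂ * n : ℝ), (b : ℝ), (c : ℝ), t) ∈ K}),
        (NRZ q₁ (q₂ * n) b c d : ℝ) -
        (volume {t : ℝ | ((q₂ * n : ℝ), (b : ℝ), (c : ℝ), t) ∈ K}).toReal| ≤
      M * (Ed (q₂ * n) b c + 1) := by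
    intro n b c
    refine abs_sum_weight_sub_volume_le (hd _ _ _) (fun d h => hmemI d (hbox _ _ _ _ h).2.2.2)
      (ne_top_of_le_ne_top tB (measure_mono fun t ht => ?_)) (fun u v => hE _ _ _ u v)
    exact abs_le.1 (hbox _ _ _ _ ht).2.2.2
  have l1 : ∀ a b : ℝ, |∑ c ∈ I, (volume {t : ℝ | (a, b, (c : ℝ), t) ∈ K}).toReal -
      (volume {z : ℝ × ℝ | (a, b, z) ∈ K}).toReal| ≤ M * (2 * L) := by
    intro a b
    rw [← vB]
    refine abs_sum_measure_slice_sub_le (mK2 a b) mB tB (L := L) ?_ ?_ (fun d => hc a b d)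
    · rintro ⟨c, d⟩ h
      exact ⟨abs_le.1 (hbox _ _ _ _ h).2.2.1, abs_le.1 (hbox _ _ _ _ h).2.2.2⟩
    · intro c d h
      exact hmemI c (hbox _ _ _ _ h).2.2.1
  have v2 : (volume ((Icc (-(L : ℝ)) L) ×ˢ (Icc (-(L : ℝ)) L))).toReal = 2 * L * (2 * L) := by
    rw [Measure.volume_eq_prod, Measure.prod_prod, toReal_mul, vB]
  have v3 : (volume ((Icc (-(L : ℝ)) L) ×ˢ (Icc (-(L : ℝ)) L) ×ˢ (Icc (-(L : ℝ)) L))).toReal =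
      2 * L * (2 * L * (2 * L)) := by
    rw [Measure.volume_eq_prod, Measure.prod_prod, toReal_mul, v2, vB]
  have t2 : volume ((Icc (-(L : ℝ)) L) ×ˢ (Icc (-(L : ℝ)) L)) ≠ ⊤ := by
    rw [Measure.volume_eq_prod, Measure.prod_prod]; exact mul_ne_top tB tB
  have t3 : volume ((Icc (-(L : ℝ)) L) ×ˢ (Icc (-(L : ℝ)) L) ×ˢ (Icc (-(L : ℝ)) L)) ≠ ⊤ := by
    rw [Measure.volume_eq_prod, Measure.prod_prod]; exact mul_ne_top tB t2
  have l2 : ∀ a : ℝ, |∑ b ∈ I, (volume {z : ℝ × ℝ | (a, (b : ℝ), z) ∈ K}).toReal -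
      (volume {z : ℝ × ℝ × ℝ | (a, z) ∈ K}).toReal| ≤ M * (2 * L * (2 * L)) := by
    intro a
    rw [← v2]
    refine abs_sum_measure_slice_sub_le (mK1 a) (mB.prod mB) t2 (L := L) ?_ ?_
      (fun z => hb a z.1 z.2)
    · rintro ⟨b, c, d⟩ h
      exact ⟨abs_le.1 (hbox _ _ _ _ h).2.1, abs_le.1 (hbox _ _ _ _ h).2.2.1,
        abs_le.1 (hbox _ _ _ _ h).2.2.2⟩
    · intro b z h
      exact hmemI b (hbox _ _ _ _ h).2.1
  have l3 : |∑ n ∈ J, (volume {z : ℝ × ℝ × ℝ | ((q₂ * n : ℝ), z) ∈ K}).toReal -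
      (volume K).toReal / q₂| ≤ M * (2 * L * (2 * L * (2 * L))) := by
    have hKm : MeasurableSet {z : ℝ × ℝ × ℝ × ℝ | (q₂ * z.1, z.2) ∈ K} :=
      hK.preimage (by fun_prop : Measurable fun z : ℝ × ℝ × ℝ × ℝ => ((q₂ : ℝ) * z.1, z.2))
    have e : (volume.prod volume {z : ℝ × ℝ × ℝ × ℝ | (q₂ * z.1, z.2) ∈ K}).toReal =
        (volume K).toReal / q₂ := by
      have hvK : volume K = ∫⁻ x : ℝ, volume (Prod.mk x ⁻¹' K) := by
        rw [Measure.volume_eq_prod, Measure.prod_apply hK]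
      rw [Measure.prod_apply hKm, hvK]
      have h := lintegral_comp_affine (measurable_measure_prodMk_left (ν := volume) hK)
        (α := (q₂ : ℝ)) (by positivity) 0
      simp only [add_zero] at h
      rw [abs_of_pos (by positivity)] at h
      rw [show (∫⁻ x : ℝ, volume (Prod.mk x ⁻¹' {z : ℝ × ℝ × ℝ × ℝ | (q₂ * z.1, z.2) ∈ K})) =
        ∫⁻ x : ℝ, volume (Prod.mk ((q₂ : ℝ) * x) ⁻¹' K) from rfl, h, toReal_mul,
        toReal_ofReal (by positivity)]
      ring
    rw [← v3, ← e]
    refine abs_sum_measure_slice_sub_le hKm (mB.prod (mB.prod mB)) t3 (L := L) ?_ ?_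
      (fun z => ha z.1 z.2.1 z.2.2)
    · rintro ⟨a, b, c, d⟩ h
      have h' := hbox _ _ _ _ h
      refine ⟨abs_le.1 ?_, abs_le.1 h'.2.1, abs_le.1 h'.2.2.1, abs_le.1 h'.2.2.2⟩
      have := h'.1
      rw [abs_mul, abs_of_pos (by positivity : (0 : ℝ) < q₂)] at this
      nlinarith [abs_nonneg a]
    · intro n z h
      exact hJmem n z h
  have key := abs_sum_sub_le_of_forall (s := J) (fun n _ => abs_sum_sub_le_of_forall (s := I)
    (fun b _ => abs_sum_sub_le_of_forall (s := I) (fun c _ => l0 n b c) (l1 (q₂ * n) b))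
      (l2 (q₂ * n))) l3
  refine key.trans ?_
  set x := (q₁ : ℝ) ^ (21 / 40 : ℝ) with hx
  set y := (q₁ : ℝ) ^ (61 / 40 : ℝ) with hy
  have hx1 : 1 ≤ x := Real.one_le_rpow hq1 (by norm_num)
  have hy1 : 1 ≤ y := Real.one_le_rpow hq1 (by norm_num)
  have hxy : y = q₁ * x := by
    rw [hx, hy, ← Real.rpow_one_add' (by positivity) (by norm_num)]; norm_num
  have b0 : ∀ n b : ℤ, ∑ c ∈ I, M * (Ed (q₂ * n) b c + 1) ≤ M * (C * (3 * L * x + y) + 3 * L) := by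
    intro n b
    rw [← Finset.mul_sum, Finset.sum_add_distrib, Finset.sum_const, nsmul_eq_mul, hIcard, mul_one]
    have h := hEs (q₂ * n) b (-L) (2 * L + 1) I (fun c hc => by
      rw [hI, Finset.mem_Icc] at hc; push_cast; omega)
    have h2 : ((2 * L + 1 : ℕ) / q₁ + 1 : ℝ) * y ≤ 3 * L * x + y := by
      rw [hxy]
      push_cast
      field_simp
      nlinarith
    have h3 := mul_le_mul_of_nonneg_left h2 hC.le
    refine mul_le_mul_of_nonneg_left ?_ hM0.le
    linarith
  have b1 : ∀ n : ℤ, ∑ b ∈ I, (∑ c ∈ I, M * (Ed (q₂ * n) b c + 1) + M * (2 * L)) ≤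
      3 * L * (M * (C * (3 * L * x + y) + 3 * L) + M * (2 * L)) := by
    intro n
    refine (Finset.sum_le_sum fun b _ => add_le_add_left (b0 n b) _).trans ?_
    rw [Finset.sum_const, nsmul_eq_mul, hIcard]
    refine mul_le_mul_of_nonneg_right (by linarith) (by positivity)
  refine (add_le_add_left (Finset.sum_le_sum fun n _ => add_le_add_left (b1 n) _) _).trans ?_
  rw [Finset.sum_const, nsmul_eq_mul]
  have hJ' : ((J.card : ℕ) : ℝ) ≤ L := by exact_mod_cast hJ
  refine (add_le_add_left (mul_le_mul_of_nonneg_right hJ' (by positivity)) _).trans ?_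
  have e : (L : ℝ) * (3 * L * (M * (C * (3 * L * x + y) + 3 * L) + M * (2 * L)) +
      M * (2 * L * (2 * L))) + M * (2 * L * (2 * L * (2 * L))) =
      M * (9 * C * (L ^ 3 * x) + 3 * C * (L ^ 2 * y) + 27 * L ^ 3) := by ring
  rw [e, mul_assoc M]
  refine mul_le_mul_of_nonneg_left ?_ hM0.le
  have p1 : (L : ℝ) ^ 3 ≤ L ^ 3 * x := le_mul_of_one_le_right (by positivity) hx1
  have p2 : 0 ≤ C * ((L : ℝ) ^ 2 * y) := by positivity
  have p3 : 0 ≤ (L : ℝ) ^ 2 * y := by positivity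
  nlinarith

end

section
open Real MeasureTheory Set

theorem fr_Vk {A B C' D : Polynomial ℝ} (hA : A.natDegree ≤ 1) (hB : B.natDegree ≤ 1)
    (hC : C'.natDegree ≤ 1) (hD : D.natDegree ≤ 1) (Y : ℝ) :
    Fr 24 {t | (A.eval t, B.eval t, C'.eval t, D.eval t) ∈ Vk Y} := by
  set P := B ^ 2 - 3 * A * C' with hP
  set Q := B * C' - 9 * A * D with hQ
  set G := B ^ 2 * C' ^ 2 - 4 * A * C' ^ 3 - 4 * B ^ 3 * D - 27 * A ^ 2 * D ^ 2 +
    18 * A * B * C' * D with hG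
  have dP : P.natDegree ≤ 2 := by
    rw [hP]
    compute_degree
    refine max_le ?_ ?_ <;> omega
  have dQ : Q.natDegree ≤ 2 := by
    rw [hQ]
    compute_degree
    refine max_le ?_ ?_ <;> omega
  have dG : G.natDegree ≤ 4 := by
    rw [hG]
    compute_degree
    all_goals omega
  have f1 := (fr_poly A).mono (n := 4) (by omega)
  have f2 := (fr_poly (P - Q)).mono (n := 4) (by
    compute_degree
    exact max_le (by omega) (by omega))
  have f3 := (fr_poly (P + Q)).mono (n := 4) (by
    compute_degree
    exact max_le (by omega) (by omega))
  have f4 := (fr_poly (3 * G - 4 * P ^ 2 + Q ^ 2)).mono (n := 4) (by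
    compute_degree
    all_goals omega)
  have f5 := (fr_poly (Polynomial.C Y - G)).mono (n := 4) (by
    compute_degree
    omega)
  have f6 := ((fr_poly (3 * G - 4 * P ^ 2)).mono (n := 4) (by
    compute_degree
    exact max_le (by omega) (by omega))).compl
  have := ((((f1.inter f2).inter f3).inter f4).inter f5).inter f6
  convert this using 1
  ext t
  simp only [Vk, Va, Vb, rD, Set.mem_sdiff, mem_inter_iff, mem_compl_iff, mem_ofPred_eq, abs_lt, hP, hQ,
    hG, Polynomial.eval_sub, Polynomial.eval_add, Polynomial.eval_mul, Polynomial.eval_pow,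
    Polynomial.eval_C, Polynomial.eval_ofNat]
  constructor
  · rintro ⟨⟨h0, h1, h2, h3⟩, h4⟩
    refine ⟨⟨⟨⟨⟨h0, by linarith [h1.2]⟩, by linarith [h1.1]⟩, by linarith⟩, by linarith⟩, ?_⟩
    intro h5
    exact h4 ⟨h0, h1, by linarith, h3⟩
  · rintro ⟨⟨⟨⟨⟨h0, h1⟩, h2⟩, h3⟩, h4⟩, h5⟩
    refine ⟨⟨h0, ⟨by linarith, by linarith⟩, by linarith, by linarith⟩, ?_⟩
    rintro ⟨-, -, h6, -⟩
    exact h5 (by linarith)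

theorem abs_le_of_mem_Vk {Y L a b c d : ℝ} (hL : 0 ≤ L) (hY : 16 * Y ≤ L ^ 4)
    (h : (a, b, c, d) ∈ Vk Y) : |a| ≤ L ∧ |b| ≤ L ∧ |c| ≤ L ∧ |d| ≤ L := by
  obtain ⟨⟨h0, h1, h2, h3⟩, h4⟩ := h
  simp only [Va, Vb, mem_ofPred_eq, not_and, not_lt] at h0 h1 h2 h3 h4
  have h5 : 3 * rD a b c d ≤ 4 * (b ^ 2 - 3 * a * c) ^ 2 := by
    by_contra hc
    have := h4 h0 h1 (by linarith)
    linarith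
  have i1 : 4 * (b ^ 2 - 3 * a * c) * (c ^ 2 - 3 * b * d) - (b * c - 9 * a * d) ^ 2 =
    3 * rD a b c d := by unfold rD; ring
  have i2 : (2 * b ^ 3 + 27 * a ^ 2 * d - 9 * a * b * c) ^ 2 + 27 * a ^ 2 * rD a b c d =
    4 * (b ^ 2 - 3 * a * c) ^ 3 := by unfold rD; ring
  have i3 : (2 * c ^ 3 + 27 * d ^ 2 * a - 9 * b * c * d) ^ 2 + 27 * d ^ 2 * rD a b c d =
    4 * (c ^ 2 - 3 * b * d) ^ 3 := by unfold rD; ring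
  have i4 : (2 * (c ^ 2 - 3 * b * d) * (3 * a) - (b * c - 9 * a * d) * b) ^ 2 +
    3 * rD a b c d * b ^ 2 = 4 * (c ^ 2 - 3 * b * d) * (b ^ 2 - 3 * a * c) ^ 2 := by
    unfold rD; ring
  have i5 : (2 * (b ^ 2 - 3 * a * c) * (3 * d) - (b * c - 9 * a * d) * c) ^ 2 +
    3 * rD a b c d * c ^ 2 = 4 * (b ^ 2 - 3 * a * c) * (c ^ 2 - 3 * b * d) ^ 2 := by
    unfold rD; ring
  set P := b ^ 2 - 3 * a * c
  set Q := b * c - 9 * a * d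
  set R := c ^ 2 - 3 * b * d
  set D := rD a b c d
  have hP : 0 < P := (abs_nonneg _).trans_lt h1
  have hQ : Q ^ 2 ≤ P ^ 2 := sq_le_sq' (by linarith [neg_abs_le Q]) ((le_abs_self _).trans h1.le)
  have hPR : P < R := lt_of_mul_lt_mul_left (by linarith : P * P < P * R) hP.le
  have hRP : R ≤ 5 / 4 * P := le_of_mul_le_mul_left (by linarith : P * R ≤ P * (5 / 4 * P)) hP
  have hPP' : P * P ≤ P * R := mul_le_mul_of_nonneg_left hPR.le hP.le
  have hD : P * R ≤ D := by linarith
  have hPR0 : 0 < P * R := mul_pos hP (hP.trans hPR)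
  have hPP : P ^ 2 ≤ D := by linarith
  have hPL : P ≤ L ^ 2 / 4 := by
    have : P ^ 2 ≤ (L ^ 2 / 4) ^ 2 := by linarith
    exact le_of_sq_le_sq this (by positivity)
  have ba : 27 * a ^ 2 ≤ 4 * P := by
    have h6 := mul_le_mul_of_nonneg_left hPP (sq_nonneg a)
    have h7 := sq_nonneg (2 * b ^ 3 + 27 * a ^ 2 * d - 9 * a * b * c)
    exact le_of_mul_le_mul_right (by linarith : 27 * a ^ 2 * P ^ 2 ≤ 4 * P * P ^ 2) (by positivity)
  have bb : 3 * b ^ 2 ≤ 4 * P := by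
    have h6 := mul_le_mul_of_nonneg_left hD (sq_nonneg b)
    have h7 := sq_nonneg (2 * R * (3 * a) - Q * b)
    exact le_of_mul_le_mul_right (by linarith : 3 * b ^ 2 * (P * R) ≤ 4 * P * (P * R)) hPR0
  have bc : 3 * c ^ 2 ≤ 4 * R := by
    have h6 := mul_le_mul_of_nonneg_left hD (sq_nonneg c)
    have h7 := sq_nonneg (2 * P * (3 * d) - Q * c)
    exact le_of_mul_le_mul_right (by linarith : 3 * c ^ 2 * (P * R) ≤ 4 * R * (P * R)) hPR0
  have bd : 27 * d ^ 2 ≤ 5 * R := by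
    have h5 := mul_le_mul_of_nonneg_right hRP (sq_nonneg R)
    have h6 := mul_le_mul_of_nonneg_left hD (sq_nonneg d)
    have h7 := sq_nonneg (2 * c ^ 3 + 27 * d ^ 2 * a - 9 * b * c * d)
    exact le_of_mul_le_mul_right (by linarith : 27 * d ^ 2 * (P * R) ≤ 5 * R * (P * R)) hPR0
  refine ⟨abs_le_of_sq_le_sq ?_ hL, abs_le_of_sq_le_sq ?_ hL, abs_le_of_sq_le_sq ?_ hL,
    abs_le_of_sq_le_sq ?_ hL⟩ <;> linarith [sq_nonneg L]

/-- The coefficient vector of a form. -/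
def vec (f : BCF) : ℝ × ℝ × ℝ × ℝ := (f.a, f.b, f.c, f.d)

theorem vec_mem_Va_one {f : BCF} {Y : ℝ} :
    f.vec ∈ Va 1 Y ↔ 0 < f.a ∧ f.Inn ∧ (f.disc : ℝ) < Y := by
  have h := hessian_disc f
  have e : rD f.a f.b f.c f.d = f.disc := by unfold rD disc; push_cast; ring
  simp only [vec, Va, Vb, mem_ofPred_eq, e, Inn]
  have e1 : ((f.b : ℝ) * f.c - 9 * f.a * f.d) = (f.hQ : ℝ) := by unfold hQ; push_cast; ring
  have e2 : ((f.b : ℝ) ^ 2 - 3 * f.a * f.c) = (f.hP : ℝ) := by unfold hP; push_cast; ring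
  rw [e1, e2]
  have e3 : (4 * (f.hP : ℝ) ^ 2 - 1 * (f.hQ : ℝ) ^ 2 < 3 * f.disc) ↔
    4 * f.hP ^ 2 - f.hQ ^ 2 < 3 * f.disc := by rw [one_mul]; exact_mod_cast Iff.rfl
  rw [e3, ← h]
  constructor
  · rintro ⟨h0, h1, h2, h3⟩
    have h1' : |f.hQ| < f.hP := by exact_mod_cast h1
    refine ⟨by exact_mod_cast h0, ⟨h1', ?_⟩, h3⟩
    have hP : 0 < f.hP := (abs_nonneg _).trans_lt h1'
    exact lt_of_mul_lt_mul_left (by linarith : f.hP * f.hP < f.hP * f.hR) hP.le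
  · rintro ⟨h0, ⟨h1, h2⟩, h3⟩
    refine ⟨by exact_mod_cast h0, by exact_mod_cast h1, ?_, h3⟩
    have hP : 0 < f.hP := (abs_nonneg _).trans_lt h1
    have := mul_lt_mul_of_pos_left h2 hP
    linarith

theorem vec_mem_Va_zero {f : BCF} {Y : ℝ} : f.vec ∈ Va 0 Y ↔
    0 < f.a ∧ |f.hQ| < f.hP ∧ 4 * f.hP ^ 2 < 3 * f.disc ∧ (f.disc : ℝ) < Y := by
  have e : rD f.a f.b f.c f.d = f.disc := by unfold rD disc; push_cast; ring
  simp only [vec, Va, Vb, mem_ofPred_eq, e]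
  have e1 : ((f.b : ℝ) * f.c - 9 * f.a * f.d) = (f.hQ : ℝ) := by unfold hQ; push_cast; ring
  have e2 : ((f.b : ℝ) ^ 2 - 3 * f.a * f.c) = (f.hP : ℝ) := by unfold hP; push_cast; ring
  rw [e1, e2, zero_mul, sub_zero]
  norm_cast

theorem mem_redF_of_vec_mem {f : BCF} {Y : ℝ} (h : f.vec ∈ Va 1 Y) : f ∈ redF Y :=
  mem_redF.2 ⟨(vec_mem_Va_one.1 h).2.1.red, (vec_mem_Va_one.1 h).2.2⟩

open Classical in
/-- The weighted number of the forms in a region whose first coefficient is divisible by `q₂`. -/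
noncomputable def gS (K : Set (ℝ × ℝ × ℝ × ℝ)) (q₁ q₂ : ℕ) (Y : ℝ) : ℝ :=
  ∑ f ∈ (redF Y).filter (fun f => f.vec ∈ K ∧ (q₂ : ℤ) ∣ f.a), (NRZ q₁ f.a f.b f.c f.d : ℝ)

theorem exists_abs_gS_compact_sub_le : ∃ C : ℝ, 0 < C ∧ ∀ (q₁ q₂ : ℕ) (Y : ℝ), q₁ ≠ 0 → q₂ ≠ 0 →
    1 ≤ Y → |gS (Vk Y) q₁ q₂ Y - π / 12 * (π / 3 - 1) * Y / q₂| ≤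
      C * (Y ^ (3 / 4 : ℝ) * (q₁ : ℝ) ^ (21 / 40 : ℝ) +
        Y ^ (1 / 2 : ℝ) * (q₁ : ℝ) ^ (61 / 40 : ℝ)) := by
  classical
  obtain ⟨C, hC, hreg⟩ := exists_abs_sum_region_sub_le 24
  refine ⟨C * 27, by positivity, ?_⟩
  intro q₁ q₂ Y hq₁ hq₂ hY
  have hY0 : 0 ≤ Y := by linarith
  set l : ℝ := Y ^ (1 / 4 : ℝ) with hl
  have hl1 : 1 ≤ l := one_le_rpow hY (by norm_num)
  have hl4 : l ^ 4 = Y := by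
    rw [hl, ← rpow_natCast, ← rpow_mul hY0]; norm_num
  have hl3 : l ^ 3 = Y ^ (3 / 4 : ℝ) := by
    rw [hl, ← rpow_natCast, ← rpow_mul hY0]; norm_num
  have hl2 : l ^ 2 = Y ^ (1 / 2 : ℝ) := by
    rw [hl, ← rpow_natCast, ← rpow_mul hY0]; norm_num
  set L : ℕ := ⌈2 * l⌉₊ with hLdef
  have hL2 : 2 * l ≤ L := Nat.le_ceil _
  have hL3 : (L : ℝ) ≤ 3 * l := by
    have := Nat.ceil_lt_add_one (a := 2 * l) (by positivity)
    linarith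
  have hLne : L ≠ 0 := by
    have : (0 : ℝ) < L := by linarith
    exact_mod_cast this.ne'
  have hbox : ∀ a b c d : ℝ, (a, b, c, d) ∈ Vk Y → |a| ≤ L ∧ |b| ≤ L ∧ |c| ≤ L ∧ |d| ≤ L :=
    fun a b c d h => abs_le_of_mem_Vk (by positivity) (by
      rw [← hl4]
      calc 16 * l ^ 4 = (2 * l) ^ 4 := by ring
        _ ≤ _ := by gcongr) h
  have hq2 : (1 : ℝ) ≤ q₂ := by exact_mod_cast Nat.one_le_iff_ne_zero.2 hq₂
  have hJ : ∀ (n : ℤ) (z : ℝ × ℝ × ℝ), ((q₂ * n : ℝ), z) ∈ Vk Y → n ∈ Finset.Icc (1 : ℤ) L := by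
    rintro n ⟨b, c, d⟩ h
    have h1 : (0 : ℝ) < q₂ * n := h.1.1
    have h2 := (le_abs_self _).trans (hbox _ _ _ _ h).1
    have h3 : (0 : ℝ) < n := pos_of_mul_pos_right h1 (by positivity)
    rw [Finset.mem_Icc]
    refine ⟨by exact_mod_cast h3, ?_⟩
    have : (n : ℝ) ≤ L := by nlinarith
    exact_mod_cast this
  have mK : MeasurableSet (Vk Y) := (measurableSet_Va 1 Y).diff (measurableSet_Va 0 Y)
  have key := hreg q₁ q₂ L (Vk Y) (Finset.Icc (1 : ℤ) L) hq₁ hq₂ hLne mK hbox (by simp) hJ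
    (fun b c d => by
      have h : ∀ t : ℝ, (Polynomial.C (q₂ : ℝ) * Polynomial.X).eval t = (q₂ : ℝ) * t := fun t => by
        rw [Polynomial.eval_mul, Polynomial.eval_C, Polynomial.eval_X]
      have := fr_Vk (A := Polynomial.C (q₂ : ℝ) * Polynomial.X) (B := Polynomial.C b)
        (C' := Polynomial.C c) (D := Polynomial.C d)
        ((Polynomial.natDegree_C_mul_le _ _).trans Polynomial.natDegree_X_le) (by simp) (by simp)
        (by simp) Y
      simpa only [h, Polynomial.eval_C] using this)
    (fun a c d => by
      simpa using fr_Vk (A := Polynomial.C a) (B := Polynomial.X)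
        (C' := Polynomial.C c) (D := Polynomial.C d) (by simp) (by simp) (by simp) (by simp) Y)
    (fun a b d => by
      simpa using fr_Vk (A := Polynomial.C a) (B := Polynomial.C b)
        (C' := Polynomial.X) (D := Polynomial.C d) (by simp) (by simp) (by simp) (by simp) Y)
    (fun a b c => by
      simpa using fr_Vk (A := Polynomial.C a) (B := Polynomial.C b)
        (C' := Polynomial.C c) (D := Polynomial.X) (by simp) (by simp) (by simp) (by simp) Y)
  have hmemI : ∀ n : ℤ, |(n : ℝ)| ≤ L → n ∈ Finset.Icc (-(L : ℤ)) L := by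
    intro n hn
    rw [abs_le] at hn
    rw [Finset.mem_Icc]
    exact ⟨by exact_mod_cast hn.1, by exact_mod_cast hn.2⟩
  have hsum : gS (Vk Y) q₁ q₂ Y = ∑ n ∈ Finset.Icc (1 : ℤ) L, ∑ b ∈ Finset.Icc (-(L : ℤ)) L,
      ∑ c ∈ Finset.Icc (-(L : ℤ)) L, ∑ d ∈ (Finset.Icc (-(L : ℤ)) L).filter
        (fun d : ℤ => (d : ℝ) ∈ {t : ℝ | ((q₂ * n : ℝ), (b : ℝ), (c : ℝ), t) ∈ Vk Y}),
        (NRZ q₁ (q₂ * n) b c d : ℝ) := by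
    set I := Finset.Icc (-(L : ℤ)) L with hI
    have e : ∀ g : ℤ → ℤ → ℤ → ℤ → ℝ, (∑ n ∈ Finset.Icc (1 : ℤ) L, ∑ b ∈ I, ∑ c ∈ I,
        ∑ d ∈ I.filter (fun d : ℤ => (d : ℝ) ∈ {t : ℝ | ((q₂ * n : ℝ), (b : ℝ), (c : ℝ), t) ∈ Vk Y}),
          g n b c d) = ∑ z ∈ (Finset.Icc (1 : ℤ) L ×ˢ I ×ˢ I ×ˢ I).filter
          (fun z => ((q₂ * z.1 : ℝ), (z.2.1 : ℝ), (z.2.2.1 : ℝ), (z.2.2.2 : ℝ)) ∈ Vk Y),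
          g z.1 z.2.1 z.2.2.1 z.2.2.2 := by
      intro g
      simp only [Finset.sum_filter, Finset.sum_product, mem_ofPred_eq]
    rw [e, gS]
    have hq : (q₂ : ℤ) ≠ 0 := by exact_mod_cast hq₂
    have hvec : ∀ f : BCF, (q₂ : ℤ) ∣ f.a → f.vec =
        ((q₂ * (f.a / q₂ : ℤ) : ℝ), (f.b : ℝ), (f.c : ℝ), (f.d : ℝ)) := by
      intro f hf
      rw [vec, ← Int.cast_natCast (R := ℝ), ← Int.cast_mul, Int.mul_ediv_cancel' hf]
    refine Finset.sum_nbij' (fun f => (f.a / q₂, f.b, f.c, f.d))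
      (fun z => ⟨q₂ * z.1, z.2.1, z.2.2.1, z.2.2.2⟩) ?_ ?_ ?_ ?_ ?_
    · intro f hf
      rw [Finset.mem_filter] at hf
      have hf' := hf.2.1
      rw [hvec f hf.2.2] at hf'
      have hb := hbox _ _ _ _ hf'
      simp only [Finset.mem_filter, Finset.mem_product]
      exact ⟨⟨hJ _ _ hf', hmemI _ hb.2.1, hmemI _ hb.2.2.1, hmemI _ hb.2.2.2⟩, hf'⟩
    · rintro ⟨n, b, c, d⟩ hz
      rw [Finset.mem_filter] at hz
      have hv : (⟨q₂ * n, b, c, d⟩ : BCF).vec ∈ Vk Y := by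
        simpa [vec] using hz.2
      rw [Finset.mem_filter]
      exact ⟨mem_redF_of_vec_mem hv.1, hv, dvd_mul_right _ _⟩
    · intro f hf
      rw [Finset.mem_filter] at hf
      simp [Int.mul_ediv_cancel' hf.2.2]
    · rintro ⟨n, b, c, d⟩ -
      simp [Int.mul_ediv_cancel_left _ hq]
    · intro f hf
      rw [Finset.mem_filter] at hf
      simp [Int.mul_ediv_cancel' hf.2.2]
  rw [hsum, ← (toReal_volume_Vk (by linarith : 0 < Y)).2]
  refine key.trans ?_
  rw [mul_assoc C, ← hl3, ← hl2]
  refine mul_le_mul_of_nonneg_left ?_ hC.le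
  have p3 : (L : ℝ) ^ 3 ≤ 27 * l ^ 3 := by
    calc (L : ℝ) ^ 3 ≤ (3 * l) ^ 3 := by gcongr
      _ = _ := by ring
  have p2 : (L : ℝ) ^ 2 ≤ 27 * l ^ 2 := by
    calc (L : ℝ) ^ 2 ≤ (3 * l) ^ 2 := by gcongr
      _ ≤ _ := by nlinarith
  have x0 : (0 : ℝ) ≤ (q₁ : ℝ) ^ (21 / 40 : ℝ) := by positivity
  have y0 : (0 : ℝ) ≤ (q₁ : ℝ) ^ (61 / 40 : ℝ) := by positivity
  linarith [mul_le_mul_of_nonneg_right p3 x0, mul_le_mul_of_nonneg_right p2 y0]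

theorem bounds_of_mem_PU {Y a : ℝ} {z : ℝ × ℝ} (h : z ∈ PU 1 Y a) :
    9 * a ^ 2 < z.1 ∧ z.1 ^ 2 < Y ∧ z.2 ^ 2 < 4 * z.1 ^ 3 := by
  obtain ⟨h0, h1, h2⟩ := h
  have h3 : 0 < z.1 ^ 2 := by positivity
  rw [one_pow, mul_one] at h1
  have h4 : 9 * a ^ 2 < z.1 := by
    refine lt_of_mul_lt_mul_right (?_ : 9 * a ^ 2 * z.1 ^ 2 < z.1 * z.1 ^ 2) h3.le
    nlinarith [sq_nonneg z.2]
  have ha : 0 ≤ a ^ 2 := sq_nonneg a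
  have h6 : 36 * a ^ 2 * z.1 ^ 2 < 27 * a ^ 2 * Y := h1.trans h2
  refine ⟨h4, ?_, by nlinarith [mul_nonneg ha h3.le]⟩
  have h5 : 0 < a ^ 2 := by
    rcases ha.eq_or_lt with h | h
    · rw [← h] at h6
      simp at h6
    · exact h
  have : 36 * z.1 ^ 2 < 27 * Y := by
    refine lt_of_mul_lt_mul_left (?_ : a ^ 2 * (36 * z.1 ^ 2) < a ^ 2 * (27 * Y)) ha
    linarith
  linarith

theorem PU_eq_empty {Y a : ℝ} (h : Y ≤ a ^ 4) : PU 1 Y a = ∅ := by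
  refine Set.eq_empty_of_forall_notMem fun z hz => ?_
  obtain ⟨h1, h2, -⟩ := bounds_of_mem_PU hz
  nlinarith [sq_nonneg a, sq_nonneg (z.1 - a ^ 2)]

theorem volume_cusp_slice {Y a b : ℝ} (ha : 0 < a) :
    (volume.prod volume) {z : ℝ × ℝ | (b ^ 2 - 3 * a * z.1, z.2) ∈ PU 1 Y a} =
      ENNReal.ofReal (1 / (3 * a)) * (volume.prod volume) (PU 1 Y a) := by
  have hm := measurableSet_PU 1 Y a
  have hm' : MeasurableSet {z : ℝ × ℝ | (b ^ 2 - 3 * a * z.1, z.2) ∈ PU 1 Y a} :=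
    hm.preimage (by fun_prop : Measurable fun z : ℝ × ℝ => (b ^ 2 - 3 * a * z.1, z.2))
  rw [Measure.prod_apply hm', Measure.prod_apply hm]
  have h := lintegral_comp_affine (measurable_measure_prodMk_left (ν := volume) hm)
    (α := -(3 * a)) (neg_ne_zero.2 (by positivity)) (b ^ 2)
  rw [inv_neg, abs_neg, abs_of_pos (by positivity), ← one_div] at h
  rw [← h]
  refine lintegral_congr fun x => ?_
  rw [show -(3 * a) * x + b ^ 2 = b ^ 2 - 3 * a * x by ring]
  rfl

/-- The coefficients `d` of the forms in the cusp with given `a`, `b`, `c`. -/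
def cuspT (Y a b c : ℝ) : Set ℝ :=
  {t | (b ^ 2 - 3 * a * c, 27 * a ^ 2 * t + (2 * b ^ 3 - 9 * a * b * c)) ∈ PU 1 Y a}

theorem fr_cuspT (Y a b c : ℝ) : Fr 12 (cuspT Y a b c) := by
  set P := b ^ 2 - 3 * a * c
  set k := 27 * a ^ 2
  set e := 2 * b ^ 3 - 9 * a * b * c
  have f1 := fr_pos (g := fun _ => P) P 0 0 0 0 (fun t => by ring)
  have f2 := fr_pos (g := fun t => 4 * P ^ 3 - (k * t + e) ^ 2 - 36 * a ^ 2 * 1 ^ 2 * P ^ 2)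
    (4 * P ^ 3 - e ^ 2 - 36 * a ^ 2 * 1 ^ 2 * P ^ 2) (-2 * k * e) (-k ^ 2) 0 0 (fun t => by ring)
  have f3 := fr_pos (g := fun t => k * Y - (4 * P ^ 3 - (k * t + e) ^ 2))
    (k * Y - 4 * P ^ 3 + e ^ 2) (2 * k * e) (k ^ 2) 0 0 (fun t => by ring)
  convert (f1.inter f2).inter f3 using 1
  ext t
  simp only [cuspT, PU, mem_inter_iff, mem_ofPred_eq, sub_pos, and_assoc]
  rw [← sub_pos]

theorem abs_lt_of_mem_PU {Y a : ℝ} (hY : 0 ≤ Y) {z : ℝ × ℝ} (h : z ∈ PU 1 Y a) :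
    |z.2| ≤ 2 * Y ^ (3 / 4 : ℝ) := by
  obtain ⟨h1, h2, h3⟩ := bounds_of_mem_PU h
  set l : ℝ := Y ^ (1 / 4 : ℝ) with hl
  have hl4 : l ^ 4 = Y := by
    rw [hl, ← rpow_natCast, ← rpow_mul hY]; norm_num
  have hl3 : l ^ 3 = Y ^ (3 / 4 : ℝ) := by
    rw [hl, ← rpow_natCast, ← rpow_mul hY]; norm_num
  have hl0 : 0 ≤ l := by positivity
  rw [← hl3]
  refine abs_le_of_sq_le_sq ?_ (by positivity)
  have h0 : 0 < z.1 := lt_of_le_of_lt (by positivity) h1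
  have h4 : z.1 ≤ l ^ 2 := by
    refine le_of_sq_le_sq ?_ (by positivity)
    rw [← pow_mul, hl4]; exact h2.le
  calc z.2 ^ 2 ≤ 4 * z.1 ^ 3 := h3.le
    _ ≤ 4 * (l ^ 2) ^ 3 := by gcongr
    _ = _ := by ring

theorem volume_cuspT {Y a b c : ℝ} (ha : 0 < a) : volume (cuspT Y a b c) =
    ENNReal.ofReal (1 / (27 * a ^ 2)) * volume {u | (b ^ 2 - 3 * a * c, u) ∈ PU 1 Y a} := by
  have hm : MeasurableSet {u | (b ^ 2 - 3 * a * c, u) ∈ PU 1 Y a} :=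
    measurable_prodMk_left (measurableSet_PU 1 Y a)
  have h := volume_affine_preimage hm (α := 27 * a ^ 2) (by positivity)
    (2 * b ^ 3 - 9 * a * b * c)
  rw [abs_of_pos (by positivity), ← one_div] at h
  exact h

theorem abs_sum_volume_cuspT_sub_le {Y a b : ℝ} (hY : 0 ≤ Y) (ha : 0 < a) {I : Finset ℤ}
    (hI : ∀ (c : ℤ) (u : ℝ), (b ^ 2 - 3 * a * c, u) ∈ PU 1 Y a → c ∈ I) :
    |∑ c ∈ I, (volume (cuspT Y a b c)).toReal -
      1 / (81 * a ^ 3) * ((volume.prod volume) (PU 1 Y a)).toReal| ≤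
      4 * Y ^ (3 / 4 : ℝ) / a ^ 2 := by
  have hm := measurableSet_PU 1 Y a
  have hm' : MeasurableSet {z : ℝ × ℝ | (b ^ 2 - 3 * a * z.1, z.2) ∈ PU 1 Y a} :=
    hm.preimage (by fun_prop : Measurable fun z : ℝ × ℝ => (b ^ 2 - 3 * a * z.1, z.2))
  have hB : volume (Icc (-(2 * Y ^ (3 / 4 : ℝ))) (2 * Y ^ (3 / 4 : ℝ))) ≠ ⊤ := by
    rw [Real.volume_Icc]; exact ENNReal.ofReal_ne_top
  have key := abs_sum_measure_slice_sub_le (μ := volume) hm' (L := (b ^ 2 + √Y) / (3 * a))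
    (B := Icc (-(2 * Y ^ (3 / 4 : ℝ))) (2 * Y ^ (3 / 4 : ℝ))) measurableSet_Icc hB (by
      rintro ⟨x, u⟩ h
      replace h : (b ^ 2 - 3 * a * x, u) ∈ PU 1 Y a := h
      have hu := abs_lt_of_mem_PU hY h
      refine ⟨abs_le.1 ?_, abs_le.1 hu⟩
      obtain ⟨h1, h2, -⟩ := bounds_of_mem_PU h
      have h3 := lt_sqrt_of_sq_lt h2
      simp only at h1 h3
      have hx : 3 * a * |x| = |3 * a * x| := by rw [abs_mul, abs_of_pos (by positivity : 0 < 3 * a)]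
      rw [le_div_iff₀' (by positivity), hx, abs_le]
      constructor <;> nlinarith [sq_nonneg a, sq_nonneg b]) (I := I) hI (m := 12) (by
      intro u
      have f1 := fr_pos (g := fun x => b ^ 2 - 3 * a * x) (b ^ 2) (-3 * a) 0 0 0
        (fun t => by ring)
      have f2 := fr_pos (g := fun x => 4 * (b ^ 2 - 3 * a * x) ^ 3 - u ^ 2 -
        36 * a ^ 2 * 1 ^ 2 * (b ^ 2 - 3 * a * x) ^ 2)
        (4 * b ^ 6 - u ^ 2 - 36 * a ^ 2 * b ^ 4) (-36 * a * b ^ 4 + 216 * a ^ 3 * b ^ 2)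
        (108 * a ^ 2 * b ^ 2 - 324 * a ^ 4) (-108 * a ^ 3) 0 (fun t => by ring)
      have f3 := fr_pos (g := fun x => 27 * a ^ 2 * Y - (4 * (b ^ 2 - 3 * a * x) ^ 3 - u ^ 2))
        (27 * a ^ 2 * Y - 4 * b ^ 6 + u ^ 2) (36 * a * b ^ 4) (-108 * a ^ 2 * b ^ 2)
        (108 * a ^ 3) 0 (fun t => by ring)
      convert (f1.inter f2).inter f3 using 1
      ext t
      simp only [PU, mem_inter_iff, mem_ofPred_eq, sub_pos, and_assoc])
  rw [volume_cusp_slice ha, toReal_volume_Icc_neg (by positivity), ENNReal.toReal_mul,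
    ENNReal.toReal_ofReal (by positivity)] at key
  have e : ∀ c : ℤ, (volume (cuspT Y a b c)).toReal = 1 / (27 * a ^ 2) *
      (volume {u | ((c : ℝ), u) ∈ {z : ℝ × ℝ | (b ^ 2 - 3 * a * z.1, z.2) ∈ PU 1 Y a}}).toReal := by
    intro c
    rw [volume_cuspT ha, ENNReal.toReal_mul, ENNReal.toReal_ofReal (by positivity)]
    rfl
  simp only [e, ← Finset.mul_sum]
  have e2 : ∀ v : ℝ, 1 / (81 * a ^ 3) * v = 1 / (27 * a ^ 2) * (1 / (3 * a) * v) := by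
    intro v; field_simp; ring
  rw [e2, ← mul_sub, abs_mul, abs_of_pos (by positivity)]
  refine (mul_le_mul_of_nonneg_left key (by positivity)).trans ?_
  rw [one_div_mul_eq_div, div_le_div_iff₀ (by positivity) (by positivity)]
  push_cast
  have : 0 ≤ Y ^ (3 / 4 : ℝ) * a ^ 2 := by positivity
  linarith

theorem toReal_lintegral_Vd_eq {Y a : ℝ} (hY : 0 < Y) (ha : 0 < a) :
    (∫⁻ u in Ioo (-1) 1, ENNReal.ofReal (Vd 1 Y a u)).toReal =
      1 / (27 * a ^ 2) * ((volume.prod volume) (PU 1 Y a)).toReal := by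
  rw [volume_PU zero_le_one hY ha, ENNReal.toReal_mul, ENNReal.toReal_ofReal (by positivity)]
  field_simp

theorem cusp_coeff_bounds {Y a b : ℝ} (hY : 1 ≤ Y) (ha : 1 ≤ a) (hb0 : 0 ≤ b) (hb : b < 3 * a)
    {c u : ℝ} (h : (b ^ 2 - 3 * a * c, u) ∈ PU 1 Y a) :
    c < 0 ∧ -c ≤ √Y / (3 * a) ∧ ∀ t, u = 27 * a ^ 2 * t + (2 * b ^ 3 - 9 * a * b * c) →
      |t| ≤ 7 * Y := by
  obtain ⟨h1, h2, -⟩ := bounds_of_mem_PU h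
  have h3 := lt_sqrt_of_sq_lt h2
  have hu := abs_lt_of_mem_PU (by linarith) h
  simp only at h1 h2 h3 hu
  have hs : √Y ^ 2 = Y := sq_sqrt (by linarith)
  have hs1 : 1 ≤ √Y := one_le_sqrt.2 hY
  set s := √Y
  have hbb : b ^ 2 < 9 * a ^ 2 := by nlinarith
  have hc : c < 0 := by nlinarith
  have hbs : b ^ 2 < s := by nlinarith
  have hb1 : b ≤ s := by
    refine le_of_sq_le_sq ?_ (by linarith)
    nlinarith
  refine ⟨hc, ?_, ?_⟩
  · rw [le_div_iff₀' (by linarith)]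
    nlinarith [sq_nonneg b]
  · rintro t rfl
    have hY34 : Y ^ (3 / 4 : ℝ) ≤ Y := by
      conv_rhs => rw [← rpow_one Y]
      exact rpow_le_rpow_of_exponent_le hY (by norm_num)
    have e1 : b ^ 3 ≤ s ^ 2 := by
      calc b ^ 3 = b ^ 2 * b := by ring
        _ ≤ s * s := mul_le_mul hbs.le hb1 hb0 (by linarith)
        _ = _ := by ring
    have e2 : 3 * b * (3 * a * (-c)) ≤ 3 * s * s :=
      mul_le_mul (by linarith) (by nlinarith [sq_nonneg b]) (by nlinarith) (by linarith)
    have e3 : 0 ≤ 3 * b * (3 * a * (-c)) :=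
      mul_nonneg (by linarith) (mul_nonneg (by linarith) (by linarith))
    have e4 : 0 ≤ b ^ 3 := by positivity
    have e5 : |27 * a ^ 2 * t| ≤ 7 * Y := by
      rw [abs_le] at hu ⊢
      constructor <;> nlinarith [hu.1, hu.2]
    rw [abs_mul, abs_of_pos (by positivity)] at e5
    refine le_trans ?_ e5
    have : 1 ≤ 27 * a ^ 2 := by nlinarith
    exact le_mul_of_one_le_left (abs_nonneg t) this

open Classical in
/-- The weighted number of forms in the cusp with given first coefficient. -/
noncomputable def cuspS (q₁ : ℕ) (Y : ℝ) (a : ℤ) : ℝ :=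
  ∑ b ∈ Finset.Ico 0 (3 * a), ∑ c ∈ Finset.Ico (-(⌈√Y / (3 * a)⌉₊ : ℤ)) 0,
    ∑ d ∈ (Finset.Icc (-(⌈7 * Y⌉₊ : ℤ)) ⌈7 * Y⌉₊).filter
      (fun d : ℤ => (d : ℝ) ∈ cuspT Y a b c), (NRZ q₁ a b c d : ℝ)

theorem mem_Ico_of_cusp {Y : ℝ} {a : ℤ} {b : ℝ} (hY : 1 ≤ Y) (ha : 1 ≤ a) (hb0 : 0 ≤ b)
    (hb : b < 3 * a) {c : ℤ} {u : ℝ} (h : (b ^ 2 - 3 * a * c, u) ∈ PU 1 Y a) :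
    c ∈ Finset.Ico (-(⌈√Y / (3 * a)⌉₊ : ℤ)) 0 := by
  obtain ⟨h1, h2, -⟩ := cusp_coeff_bounds hY (by exact_mod_cast ha) hb0 hb h
  rw [Finset.mem_Ico]
  refine ⟨?_, by exact_mod_cast h1⟩
  have : -(c : ℝ) ≤ (⌈√Y / (3 * a)⌉₊ : ℝ) := h2.trans (Nat.le_ceil _)
  have h3 : -c ≤ (⌈√Y / (3 * a)⌉₊ : ℤ) := by exact_mod_cast this
  omega

theorem mem_Icc_of_cuspT {Y : ℝ} {a : ℤ} {b c : ℝ} (hY : 1 ≤ Y) (ha : 1 ≤ a) (hb0 : 0 ≤ b)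
    (hb : b < 3 * a) {d : ℤ} (h : (d : ℝ) ∈ cuspT Y a b c) :
    d ∈ Finset.Icc (-(⌈7 * Y⌉₊ : ℤ)) ⌈7 * Y⌉₊ := by
  have h1 := (cusp_coeff_bounds hY (by exact_mod_cast ha) hb0 hb h).2.2 d rfl
  have h2 := abs_le.1 (h1.trans (Nat.le_ceil _))
  rw [Finset.mem_Icc]
  exact ⟨by exact_mod_cast h2.1, by exact_mod_cast h2.2⟩

theorem exists_abs_cuspS_sub_le : ∃ C : ℝ, 0 < C ∧ ∀ (q₁ : ℕ) (Y : ℝ) (a : ℤ), q₁ ≠ 0 → 1 ≤ Y →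
    1 ≤ a → (a : ℝ) ≤ Y ^ (1 / 4 : ℝ) →
    |cuspS q₁ Y a - (∫⁻ u in Ioo (-1) 1, ENNReal.ofReal (Vd 1 Y a u)).toReal| ≤
      C * (Y ^ (1 / 2 : ℝ) * (q₁ : ℝ) ^ (21 / 40 : ℝ) +
        Y ^ (1 / 4 : ℝ) * (q₁ : ℝ) ^ (61 / 40 : ℝ)) + 12 * Y ^ (3 / 4 : ℝ) / a := by
  classical
  obtain ⟨C, hC, hdisc⟩ := exists_discrepancy
  refine ⟨100 * (C + 1), by positivity, ?_⟩
  intro q₁ Y a hq₁ hY ha haY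
  obtain ⟨Ed, hE0, hE, hEs⟩ := hdisc q₁ hq₁
  have hq1 : (1 : ℝ) ≤ q₁ := by exact_mod_cast Nat.one_le_iff_ne_zero.2 hq₁
  have ha1 : (1 : ℝ) ≤ a := by exact_mod_cast ha
  have ha0 : (0 : ℝ) < a := by linarith
  have hY0 : 0 ≤ Y := by linarith
  set l : ℝ := Y ^ (1 / 4 : ℝ) with hl
  have hl1 : 1 ≤ l := one_le_rpow hY (by norm_num)
  have hl2 : Y ^ (1 / 2 : ℝ) = l ^ 2 := by
    rw [hl, ← rpow_natCast, ← rpow_mul hY0]; norm_num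
  have hs : √Y = l ^ 2 := by rw [sqrt_eq_rpow, hl2]
  set x := (q₁ : ℝ) ^ (21 / 40 : ℝ) with hx
  set y := (q₁ : ℝ) ^ (61 / 40 : ℝ) with hy
  have hx1 : 1 ≤ x := one_le_rpow hq1 (by norm_num)
  have hy1 : 1 ≤ y := one_le_rpow hq1 (by norm_num)
  have hxy : y = q₁ * x := by
    rw [hx, hy, ← rpow_one_add' (by positivity) (by norm_num)]; norm_num
  rw [hl2]
  set nc : ℕ := ⌈√Y / (3 * a)⌉₊ with hnc
  have hnc1 : 3 * a * (nc : ℝ) ≤ 4 * l ^ 2 := by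
    have h1 := (Nat.ceil_lt_add_one (by positivity : 0 ≤ √Y / (3 * a))).le
    rw [← hnc, hs] at h1
    have h2 := mul_le_mul_of_nonneg_left h1 (by positivity : (0 : ℝ) ≤ 3 * a)
    have h3 : 3 * (a : ℝ) * (l ^ 2 / (3 * a) + 1) = l ^ 2 + 3 * a := by field_simp
    nlinarith
  set V := ((volume.prod volume) (PU 1 Y a)).toReal with hV
  set Z := 4 * Y ^ (3 / 4 : ℝ) / (a : ℝ) ^ 2 with hZ
  have hb : ∀ b ∈ Finset.Ico 0 (3 * a), |∑ c ∈ Finset.Ico (-(nc : ℤ)) 0,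
      ∑ d ∈ (Finset.Icc (-(⌈7 * Y⌉₊ : ℤ)) ⌈7 * Y⌉₊).filter
        (fun d : ℤ => (d : ℝ) ∈ cuspT Y a b c), (NRZ q₁ a b c d : ℝ) - 1 / (81 * (a : ℝ) ^ 3) * V| ≤
      25 * (C * ((nc / q₁ + 1) * y) + nc) + Z := by
    intro b hb
    rw [Finset.mem_Ico] at hb
    have hb0 : (0 : ℝ) ≤ b := by exact_mod_cast hb.1
    have hb3 : (b : ℝ) < 3 * a := by exact_mod_cast hb.2
    have l0 : ∀ c : ℤ, |∑ d ∈ (Finset.Icc (-(⌈7 * Y⌉₊ : ℤ)) ⌈7 * Y⌉₊).filter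
        (fun d : ℤ => (d : ℝ) ∈ cuspT Y a b c), (NRZ q₁ a b c d : ℝ) -
        (volume (cuspT Y a b c)).toReal| ≤ 25 * (Ed a b c + 1) := by
      intro c
      have hfin : volume (cuspT Y a b c) ≠ ⊤ := by
        refine ne_top_of_le_ne_top (?_ : volume (Icc (-(7 * Y)) (7 * Y)) ≠ ⊤)
          (measure_mono fun t ht => ?_)
        · rw [Real.volume_Icc]; exact ENNReal.ofReal_ne_top
        · exact abs_le.1 ((cusp_coeff_bounds hY ha1 hb0 hb3 ht).2.2 t rfl)
      have := abs_sum_weight_sub_volume_le (fr_cuspT Y a b c)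
        (fun d hd => mem_Icc_of_cuspT hY ha hb0 hb3 hd) hfin (fun u v => hE a b c u v)
      norm_num at this ⊢
      exact this
    have l1 := abs_sum_volume_cuspT_sub_le hY0 ha0
      (fun c u h => mem_Ico_of_cusp hY ha hb0 hb3 h)
    refine (abs_sum_sub_le_of_forall (fun c _ => l0 c) l1).trans ?_
    rw [← Finset.mul_sum, Finset.sum_add_distrib, Finset.sum_const, nsmul_eq_mul, mul_one,
      Int.card_Ico]
    have h := hEs a b (-nc) nc (Finset.Ico (-(nc : ℤ)) 0) (fun c hc => by
      rw [Finset.mem_Ico] at hc; omega)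
    have e : (((0 - -(nc : ℤ)).toNat : ℕ) : ℝ) = nc := by
      rw [zero_sub, neg_neg, Int.toNat_natCast]
    rw [← hnc, e]
    linarith
  have key := abs_sum_sub_le_of_forall (z := 3 * a * (1 / (81 * (a : ℝ) ^ 3) * V)) (δ := 0) hb (by
    rw [Finset.sum_const, nsmul_eq_mul, Int.card_Ico, sub_zero]
    have e : (((3 * a).toNat : ℕ) : ℝ) = 3 * a := by
      rw [← Int.cast_natCast (R := ℝ), Int.toNat_of_nonneg (by omega)]; push_cast; ring
    rw [e, sub_self, abs_zero])
  rw [toReal_lintegral_Vd_eq (by linarith) ha0, show 1 / (27 * (a : ℝ) ^ 2) * V =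
    3 * a * (1 / (81 * (a : ℝ) ^ 3) * V) by field_simp; ring]
  refine key.trans ?_
  rw [Finset.sum_const, nsmul_eq_mul, Int.card_Ico, sub_zero, add_zero]
  have e : (((3 * a).toNat : ℕ) : ℝ) = 3 * a := by
    rw [← Int.cast_natCast (R := ℝ), Int.toNat_of_nonneg (by omega)]; push_cast; ring
  rw [e]
  have eZ : 3 * a * Z = 12 * Y ^ (3 / 4 : ℝ) / a := by
    rw [hZ]; field_simp; ring
  have e1 : 3 * (a : ℝ) * (25 * (C * ((nc / q₁ + 1) * y) + nc) + Z) =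
      25 * (C * (3 * a * nc * x + 3 * a * y) + 3 * a * nc) + 12 * Y ^ (3 / 4 : ℝ) / a := by
    rw [mul_add, eZ, hxy]; field_simp
  rw [e1]
  have e2 : 3 * a * nc * x ≤ 4 * l ^ 2 * x := mul_le_mul_of_nonneg_right hnc1 (by linarith)
  have e3 : 3 * a * y ≤ 3 * l * y := by nlinarith
  have e4 : l ^ 2 ≤ l ^ 2 * x := le_mul_of_one_le_right (by positivity) hx1
  have e5 : 0 ≤ l * y := by positivity
  have e6 : C * (3 * a * nc * x + 3 * a * y) ≤ C * (4 * l ^ 2 * x + 4 * l * y) :=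
    mul_le_mul_of_nonneg_left (by linarith) hC.le
  linarith

theorem sum_range_inv_le (N : ℕ) {l : ℝ} (hl : 1 ≤ l) (hN : (N : ℝ) ≤ l) :
    ∑ n ∈ Finset.range N, (1 : ℝ) / (n + 1) ≤ 7 * l ^ (1 / 6 : ℝ) := by
  have h1 := harmonic_le_one_add_log N
  have h2 : ((harmonic N : ℚ) : ℝ) = ∑ n ∈ Finset.range N, (1 : ℝ) / (n + 1) := by
    simp [harmonic]
  have h3 : Real.log N ≤ Real.log l := by
    rcases Nat.eq_zero_or_pos N with h | h
    · simpa [h] using log_nonneg hl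
    · exact log_le_log (by exact_mod_cast h) hN
  have h4 := log_le_rpow_div (zero_le_one.trans hl) (ε := 1 / 6) (by norm_num)
  have h5 : 1 ≤ l ^ (1 / 6 : ℝ) := one_le_rpow hl (by norm_num)
  rw [← h2]
  linarith

/-- The main term of the cuspidal contribution. -/
noncomputable def cuspM (Y q : ℝ) : ℝ :=
  π / 12 * (Y / q) + (36 / 5 * (Y / 108) ^ (5 / 6 : ℝ) * (riemannZeta (1 / 3)).re *
    q ^ (-(1 / 3) : ℝ)) * ∫ u in Ioo (-1 : ℝ) 1, (1 - u ^ 2) ^ (-(5 / 6) : ℝ)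

theorem exists_abs_sum_cuspS_sub_le : ∃ C : ℝ, 0 < C ∧ ∀ (q₁ q₂ : ℕ) (Y : ℝ), q₁ ≠ 0 → q₂ ≠ 0 →
    1 ≤ Y → |∑ n ∈ Finset.range ⌊Y ^ (1 / 4 : ℝ) / q₂⌋₊, cuspS q₁ Y ((q₂ : ℤ) * (n + 1)) -
      cuspM Y q₂| ≤
      C * (Y ^ (19 / 24 : ℝ) * (q₁ : ℝ) ^ (21 / 40 : ℝ) +
        Y ^ (1 / 2 : ℝ) * (q₁ : ℝ) ^ (61 / 40 : ℝ)) := by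
  obtain ⟨C, hC, hcusp⟩ := exists_abs_cuspS_sub_le
  obtain ⟨C', hC', harea⟩ := exists_abs_sum_lintegral_Vd_sub_le
  refine ⟨C + C' + 84, by positivity, fun q₁ q₂ Y hq₁ hq₂ hY => ?_⟩
  have hY0 : 0 ≤ Y := by linarith
  have hY1 : 0 < Y := by linarith
  have hp1 : (1 : ℝ) ≤ q₁ := by exact_mod_cast Nat.one_le_iff_ne_zero.2 hq₁
  have hp2 : (1 : ℝ) ≤ q₂ := by exact_mod_cast Nat.one_le_iff_ne_zero.2 hq₂
  set l := Y ^ (1 / 4 : ℝ) with hl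
  have hl1 : 1 ≤ l := one_le_rpow hY (by norm_num)
  have hl4 : l ^ 4 = Y := by rw [hl, ← rpow_natCast, ← rpow_mul hY0]; norm_num
  set N := ⌊l / q₂⌋₊ with hN
  have hNl : (N : ℝ) * q₂ ≤ l := by
    rw [← le_div_iff₀ (by linarith)]; exact Nat.floor_le (by positivity)
  have hNl' : (N : ℝ) ≤ l := le_trans (le_mul_of_one_le_right (by positivity) hp2) hNl
  have hNl'' : l < q₂ * (N + 1) := by
    rw [← div_lt_iff₀' (by linarith)]; exact Nat.lt_floor_add_one _
  have hA := harea Y q₂ hY1 (by linarith) (N + 1) (by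
    rw [div_le_iff₀' (by linarith)]
    push_cast
    refine le_trans (rpow_le_rpow (by positivity) (by linarith) (by norm_num)) hNl''.le)
  rw [Finset.sum_range_succ, toReal_lintegral_Vd_eq (a := q₂ * (N + 1)) hY1 (by positivity),
    PU_eq_empty (a := q₂ * (N + 1)) (by
      rw [← hl4]; exact pow_le_pow_left₀ (by linarith) hNl''.le 4)] at hA
  simp only [measure_empty, ENNReal.toReal_zero, mul_zero, add_zero] at hA
  have key : ∀ n ∈ Finset.range N, |cuspS q₁ Y ((q₂ : ℤ) * (n + 1)) -
      (∫⁻ u in Ioo (-1) 1, ENNReal.ofReal (Vd 1 Y (q₂ * (n + 1)) u)).toReal| ≤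
      C * (Y ^ (1 / 2 : ℝ) * (q₁ : ℝ) ^ (21 / 40 : ℝ) + l * (q₁ : ℝ) ^ (61 / 40 : ℝ)) +
        12 * Y ^ (3 / 4 : ℝ) * (1 / (n + 1)) := by
    intro n hn
    have hn' : (n : ℝ) + 1 ≤ N := by exact_mod_cast Finset.mem_range.1 hn
    have h := hcusp q₁ Y ((q₂ : ℤ) * (n + 1)) hq₁ hY (by
      have : (1 : ℤ) ≤ q₂ := by exact_mod_cast Nat.one_le_iff_ne_zero.2 hq₂
      nlinarith [Int.natCast_nonneg n]) (by
      push_cast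
      refine le_trans ?_ hNl
      rw [mul_comm (N : ℝ)]
      exact mul_le_mul_of_nonneg_left hn' (by linarith))
    push_cast at h
    refine h.trans (add_le_add le_rfl ?_)
    rw [mul_one_div]
    refine div_le_div_of_nonneg_left (by positivity) (by positivity) ?_
    exact le_mul_of_one_le_left (by positivity) hp2
  have hS := Finset.abs_sum_le_sum_abs (fun n : ℕ => cuspS q₁ Y ((q₂ : ℤ) * (n + 1)) -
      (∫⁻ u in Ioo (-1) 1, ENNReal.ofReal (Vd 1 Y (q₂ * (n + 1)) u)).toReal) (Finset.range N)
  rw [Finset.sum_sub_distrib] at hS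
  have hS' := hS.trans (Finset.sum_le_sum key)
  rw [Finset.sum_add_distrib, Finset.sum_const, Finset.card_range, nsmul_eq_mul,
    ← Finset.mul_sum] at hS'
  have hinv := sum_range_inv_le N hl1 hNl'
  have e1 : l * Y ^ (1 / 2 : ℝ) ≤ Y ^ (19 / 24 : ℝ) := by
    rw [hl, ← rpow_add hY1]
    exact rpow_le_rpow_of_exponent_le hY (by norm_num)
  have e2 : l * l = Y ^ (1 / 2 : ℝ) := by
    rw [hl, ← rpow_add hY1]; norm_num
  have e3 : Y ^ (3 / 4 : ℝ) * l ^ (1 / 6 : ℝ) = Y ^ (19 / 24 : ℝ) := by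
    rw [hl, ← rpow_mul hY0, ← rpow_add hY1]; norm_num
  have hq21 : 1 ≤ (q₁ : ℝ) ^ (21 / 40 : ℝ) := one_le_rpow hp1 (by norm_num)
  have hq61 : 0 ≤ (q₁ : ℝ) ^ (61 / 40 : ℝ) := by positivity
  have hq6 : (q₂ : ℝ) ^ (-(1 / 6) : ℝ) ≤ 1 := rpow_le_one_of_one_le_of_nonpos hp2 (by norm_num)
  set A := Y ^ (19 / 24 : ℝ)
  have hA0 : 0 ≤ A := by positivity
  set p := (q₁ : ℝ) ^ (21 / 40 : ℝ)
  set r := (q₁ : ℝ) ^ (61 / 40 : ℝ)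
  set s := Y ^ (1 / 2 : ℝ)
  have hs0 : 0 ≤ s := by positivity
  have b1 : (N : ℝ) * (C * (s * p + l * r)) ≤ C * (A * p + s * r) := by
    calc (N : ℝ) * (C * (s * p + l * r)) ≤ l * (C * (s * p + l * r)) := by
          gcongr
      _ = C * ((l * s) * p + (l * l) * r) := by ring
      _ ≤ C * (A * p + s * r) := by rw [e2]; gcongr
  have b2 : 12 * Y ^ (3 / 4 : ℝ) * ∑ n ∈ Finset.range N, (1 : ℝ) / (n + 1) ≤ 84 * A := by
    calc _ ≤ 12 * Y ^ (3 / 4 : ℝ) * (7 * l ^ (1 / 6 : ℝ)) := by gcongr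
      _ = 84 * A := by rw [← e3]; ring
  have b3 : C' * (A * (q₂ : ℝ) ^ (-(1 / 6) : ℝ)) ≤ C' * A := by
    gcongr; exact mul_le_of_le_one_right hA0 hq6
  have b4 : A ≤ A * p := le_mul_of_one_le_right hA0 hq21
  have b5 : 0 ≤ s * r := by positivity
  have b6 : C' * A ≤ C' * (A * p) := by gcongr
  have b7 : 0 ≤ C' * (s * r) := by positivity
  have tri := abs_add_le (∑ n ∈ Finset.range N, cuspS q₁ Y ((q₂ : ℤ) * (n + 1)) -
    ∑ n ∈ Finset.range N,
      (∫⁻ u in Ioo (-1) 1, ENNReal.ofReal (Vd 1 Y (q₂ * (n + 1)) u)).toReal)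
    (∑ n ∈ Finset.range N,
      (∫⁻ u in Ioo (-1) 1, ENNReal.ofReal (Vd 1 Y (q₂ * (n + 1)) u)).toReal - cuspM Y q₂)
  rw [sub_add_sub_cancel] at tri
  rw [sub_sub] at hA
  have hA' : |∑ n ∈ Finset.range N,
      (∫⁻ u in Ioo (-1) 1, ENNReal.ofReal (Vd 1 Y (q₂ * (n + 1)) u)).toReal - cuspM Y q₂| ≤
      C' * (A * (q₂ : ℝ) ^ (-(1 / 6) : ℝ)) := hA
  linarith

end

section
open MeasureTheory Set

/-- The substitution `x ↦ x + n y`. -/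
def tr (f : BCF) (n : ℤ) : BCF :=
  ⟨f.a, f.b + 3 * f.a * n, f.c + 2 * f.b * n + 3 * f.a * n ^ 2,
    f.d + f.c * n + f.b * n ^ 2 + f.a * n ^ 3⟩

theorem tr_tr (f : BCF) (m n : ℤ) : (f.tr m).tr n = f.tr (m + n) := by
  ext <;> simp only [tr] <;> ring

theorem tr_zero (f : BCF) : f.tr 0 = f := by
  ext <;> simp [tr]

theorem hP_tr (f : BCF) (n : ℤ) : (f.tr n).hP = f.hP := by
  simp only [tr, hP]; ring

theorem hQ_tr (f : BCF) (n : ℤ) : (f.tr n).hQ = f.hQ + 2 * f.hP * n := by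
  simp only [tr, hQ, hP]; ring

theorem disc_tr (f : BCF) (n : ℤ) : (f.tr n).disc = f.disc := by
  simp only [tr, disc]; ring

theorem NRZ_tr (q : ℕ) [NeZero q] (f : BCF) (n : ℤ) :
    NRZ q (f.tr n).a (f.tr n).b (f.tr n).c (f.tr n).d = NRZ q f.a f.b f.c f.d := by
  rw [NRZ_eq_NR, NRZ_eq_NR]
  unfold NR
  refine Finset.card_bij' (fun r _ => r + n) (fun r _ => r - n) ?_ ?_ (by simp) (by simp)
  · intro r hr
    have h := (Finset.mem_filter.1 hr).2
    refine Finset.mem_filter.2 ⟨Finset.mem_univ _, ?_⟩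
    rw [← h]; simp only [tr]; push_cast; ring
  · intro r hr
    have h := (Finset.mem_filter.1 hr).2
    refine Finset.mem_filter.2 ⟨Finset.mem_univ _, ?_⟩
    rw [← h]; simp only [tr]; push_cast; ring

theorem tr_eq_of_hQ {f : BCF} {n : ℤ} (h1 : -f.hP < f.hQ) (h2 : f.hQ ≤ f.hP)
    (h3 : -f.hP < (f.tr n).hQ) (h4 : (f.tr n).hQ ≤ f.hP) : f.tr n = f := by
  rw [hQ_tr] at h3 h4
  have hP : 0 < f.hP := by linarith
  have h5 : n < 1 := by
    by_contra h
    nlinarith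
  have h6 : -1 < n := by
    by_contra h
    nlinarith
  rw [show n = 0 by omega, tr_zero]

theorem tr_eq_of_b {f : BCF} {n : ℤ} (h1 : 0 ≤ f.b) (h2 : f.b < 3 * f.a)
    (h3 : 0 ≤ (f.tr n).b) (h4 : (f.tr n).b < 3 * f.a) : f.tr n = f := by
  simp only [tr] at h3 h4
  have h5 : n < 1 := by
    by_contra h
    nlinarith
  have h6 : -1 < n := by
    by_contra h
    nlinarith
  rw [show n = 0 by omega, tr_zero]

theorem mem_cuspT_iff {f : BCF} (ha : 0 < f.a) {Y : ℝ} : (f.d : ℝ) ∈ cuspT Y f.a f.b f.c ↔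
    0 < f.hP ∧ 4 * f.hP ^ 2 < 3 * f.disc ∧ (f.disc : ℝ) < Y := by
  have ha' : (0 : ℝ) < (f.a : ℝ) ^ 2 := by positivity
  have e1 : (f.b : ℝ) ^ 2 - 3 * f.a * f.c = (f.hP : ℝ) := by simp [hP]
  have e2 : 4 * (f.hP : ℝ) ^ 3 - (27 * (f.a : ℝ) ^ 2 * f.d +
      (2 * (f.b : ℝ) ^ 3 - 9 * f.a * f.b * f.c)) ^ 2 = 27 * (f.a : ℝ) ^ 2 * f.disc := by
    simp only [hP, disc]; push_cast; ring
  have e3 : 4 * f.hP ^ 2 < 3 * f.disc ↔ 4 * (f.hP : ℝ) ^ 2 < 3 * f.disc := by norm_cast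
  simp only [cuspT, PU, mem_ofPred_eq, e1, e2, e3, Int.cast_pos]
  refine and_congr Iff.rfl (and_congr ?_ ?_)
  · rw [← mul_lt_mul_iff_right₀ (show (0 : ℝ) < 9 * (f.a : ℝ) ^ 2 by positivity)
      (b := 4 * (f.hP : ℝ) ^ 2)]
    constructor <;> intro h <;> linarith
  · exact mul_lt_mul_iff_right₀ (by positivity)

theorem red_of_cusp {f : BCF} (h1 : -f.hP < f.hQ) (h2 : f.hQ ≤ f.hP)
    (h3 : 4 * f.hP ^ 2 < 3 * f.disc) : f.Red ∧ f.hP < f.hR := by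
  have hP : 0 < f.hP := by linarith
  have h0 := hessian_disc f
  have : f.hP < f.hR := by
    by_contra h
    push Not at h
    nlinarith [sq_nonneg f.hQ, mul_le_mul_of_nonneg_left h hP.le]
  exact ⟨⟨hP, abs_le.2 ⟨h1.le, h2⟩, this.le⟩, this⟩

open Classical in
/-- The weighted number of the forms in the cusp, with a half-closed fundamental domain. -/
noncomputable def cuspG (q₁ q₂ : ℕ) (Y : ℝ) : ℝ :=
  ∑ f ∈ (redF Y).filter (fun f => 0 < f.a ∧ (-f.hP < f.hQ ∧ f.hQ ≤ f.hP) ∧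
    4 * f.hP ^ 2 < 3 * f.disc ∧ (q₂ : ℤ) ∣ f.a), (NRZ q₁ f.a f.b f.c f.d : ℝ)

theorem cuspG_eq {q₁ q₂ : ℕ} {Y : ℝ} (hq₁ : q₁ ≠ 0) (hq₂ : q₂ ≠ 0) (hY : 1 ≤ Y) :
    cuspG q₁ q₂ Y =
      ∑ n ∈ Finset.range ⌊Y ^ (1 / 4 : ℝ) / q₂⌋₊, cuspS q₁ Y ((q₂ : ℤ) * (n + 1)) := by
  classical
  have : NeZero q₁ := ⟨hq₁⟩
  have hq2 : (0 : ℤ) < q₂ := by exact_mod_cast Nat.pos_of_ne_zero hq₂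
  have hq2' : (0 : ℝ) < q₂ := by exact_mod_cast hq2
  simp only [cuspG, cuspS, Finset.sum_sigma']
  let i : BCF → (_ : ℕ) × (_ : ℤ) × (_ : ℤ) × ℤ := fun f =>
    let g := f.tr (-(f.b / (3 * f.a)))
    ⟨(f.a / q₂ - 1).toNat, g.b, g.c, g.d⟩
  let k : (_ : ℕ) × (_ : ℤ) × (_ : ℤ) × ℤ → BCF := fun x =>
    ⟨(q₂ : ℤ) * (x.1 + 1), x.2.1, x.2.2.1, x.2.2.2⟩
  let j : (_ : ℕ) × (_ : ℤ) × (_ : ℤ) × ℤ → BCF := fun x =>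
    (k x).tr (-(((k x).hQ + (k x).hP - 1) / (2 * (k x).hP)))
  have hki : ∀ f : BCF, 0 < f.a → (q₂ : ℤ) ∣ f.a → k (i f) = f.tr (-(f.b / (3 * f.a))) := by
    intro f hf hd
    obtain ⟨m, hm⟩ := hd
    have hm0 : 0 < m := by
      rw [hm] at hf
      exact pos_of_mul_pos_right hf hq2.le
    have : f.a / q₂ = m := by rw [hm, Int.mul_ediv_cancel_left _ hq2.ne']
    have e : ((f.a / q₂ - 1).toNat : ℤ) = m - 1 := by
      rw [this, Int.toNat_of_nonneg (by omega)]
    ext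
    · change (q₂ : ℤ) * (((f.a / q₂ - 1).toNat : ℤ) + 1) = f.a
      rw [e, hm]; ring
    · rfl
    · rfl
    · rfl
  have hka : ∀ x, 0 < (k x).a := fun x => mul_pos hq2 (by positivity)
  have hb : ∀ f : BCF, 0 < f.a → 0 ≤ (f.tr (-(f.b / (3 * f.a)))).b ∧
      (f.tr (-(f.b / (3 * f.a)))).b < 3 * f.a := by
    intro f hf
    have e : (f.tr (-(f.b / (3 * f.a)))).b = f.b % (3 * f.a) := by
      rw [Int.emod_def]; simp only [tr]; ring
    rw [e]
    exact ⟨Int.emod_nonneg _ (by omega), Int.emod_lt_of_pos _ (by omega)⟩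
  have hQ : ∀ f : BCF, 0 < f.hP → -f.hP < (f.tr (-((f.hQ + f.hP - 1) / (2 * f.hP)))).hQ ∧
      (f.tr (-((f.hQ + f.hP - 1) / (2 * f.hP)))).hQ ≤ f.hP := by
    intro f hf
    have e : (f.tr (-((f.hQ + f.hP - 1) / (2 * f.hP)))).hQ =
        (f.hQ + f.hP - 1) % (2 * f.hP) - f.hP + 1 := by
      rw [Int.emod_def, hQ_tr]; ring
    have h1 := Int.emod_nonneg (f.hQ + f.hP - 1) (b := 2 * f.hP) (by omega)
    have h2 := Int.emod_lt_of_pos (f.hQ + f.hP - 1) (b := 2 * f.hP) (by omega)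
    rw [e]
    omega
  have hk : ∀ x, (x.1 < ⌊Y ^ (1 / 4 : ℝ) / q₂⌋₊ ∧ 0 ≤ (k x).b ∧ (k x).b < 3 * (k x).a ∧
      0 < (k x).hP ∧ 4 * (k x).hP ^ 2 < 3 * (k x).disc ∧ ((k x).disc : ℝ) < Y) ↔
      x ∈ (Finset.range ⌊Y ^ (1 / 4 : ℝ) / q₂⌋₊).sigma fun n =>
        (Finset.Ico 0 (3 * ((q₂ : ℤ) * (n + 1)))).sigma fun b =>
        (Finset.Ico (-(⌈√Y / (3 * (((q₂ : ℤ) * (n + 1) : ℤ) : ℝ))⌉₊ : ℤ)) 0).sigma fun c =>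
        (Finset.Icc (-(⌈7 * Y⌉₊ : ℤ)) ⌈7 * Y⌉₊).filter
          (fun d : ℤ => (d : ℝ) ∈ cuspT Y ((q₂ : ℤ) * (n + 1) : ℤ) b c) := by
    intro x
    have hT := mem_cuspT_iff (hka x) (Y := Y)
    rw [← hT]
    simp only [Finset.mem_sigma, Finset.mem_filter, Finset.mem_range, Finset.mem_Ico]
    constructor
    · rintro ⟨h1, h2, h3, h4⟩
      have e2 : (0 : ℝ) ≤ (k x).b := by exact_mod_cast h2
      have e3 : ((k x).b : ℝ) < 3 * (k x).a := by exact_mod_cast h3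
      exact ⟨h1, ⟨h2, h3⟩, Finset.mem_Ico.1 (mem_Ico_of_cusp hY (hka x) e2 e3 h4),
        mem_Icc_of_cuspT hY (hka x) e2 e3 h4, h4⟩
    · rintro ⟨h1, ⟨h2, h3⟩, -, -, h4⟩
      exact ⟨h1, h2, h3, h4⟩
  refine Finset.sum_bij' (fun f _ => i f) (fun x _ => j x) ?_ ?_ ?_ ?_ ?_
  · intro f hf
    simp only [Finset.mem_filter, mem_redF] at hf
    obtain ⟨⟨-, hY'⟩, ha, hq, hD, hd⟩ := hf
    refine (hk _).1 ?_
    have hP : 0 < f.hP := by linarith [hq.1, hq.2]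
    rw [hki f ha hd, hP_tr, disc_tr]
    refine ⟨?_, (hb f ha).1, (hb f ha).2, hP, hD, hY'⟩
    have hT : (f.d : ℝ) ∈ cuspT Y f.a f.b f.c := (mem_cuspT_iff ha).2 ⟨hP, hD, hY'⟩
    obtain ⟨h1, h2, -⟩ := bounds_of_mem_PU hT
    simp only at h1 h2
    change (f.a / q₂ - 1).toNat < _
    obtain ⟨m, hm⟩ := hd
    have hm0 : 0 < m := by
      rw [hm] at ha
      exact pos_of_mul_pos_right ha hq2.le
    rw [hm, Int.mul_ediv_cancel_left _ hq2.ne']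
    refine lt_of_lt_of_le (b := m.toNat) (by omega) (Nat.le_floor ?_)
    have e : ((m.toNat : ℕ) : ℝ) = (m : ℝ) := by
      exact_mod_cast Int.toNat_of_nonneg hm0.le
    rw [e, le_div_iff₀' hq2']
    have e2 : (q₂ : ℝ) * m = f.a := by rw [hm]; push_cast; ring
    rw [e2]
    have ha0 : (0 : ℝ) ≤ f.a := by exact_mod_cast ha.le
    have e3 : (f.a : ℝ) ^ 4 ≤ Y := by
      have h3 : (9 * (f.a : ℝ) ^ 2) ^ 2 ≤ ((f.b : ℝ) ^ 2 - 3 * f.a * f.c) ^ 2 :=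
        pow_le_pow_left₀ (by positivity) h1.le 2
      have h4 : 0 ≤ (f.a : ℝ) ^ 4 := by positivity
      linarith
    calc (f.a : ℝ) = ((f.a : ℝ) ^ 4) ^ (1 / 4 : ℝ) := by
          rw [← Real.rpow_natCast, ← Real.rpow_mul ha0]; norm_num
      _ ≤ _ := Real.rpow_le_rpow (by positivity) e3 (by norm_num)
  · intro x hx
    obtain ⟨-, -, -, h4, h5, h6⟩ := (hk x).2 hx
    obtain ⟨h7, h8⟩ := hQ _ h4
    simp only [Finset.mem_filter, mem_redF]
    have h7' : -(j x).hP < (j x).hQ := by rwa [hP_tr]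
    have h8' : (j x).hQ ≤ (j x).hP := by rwa [hP_tr]
    have h5' : 4 * (j x).hP ^ 2 < 3 * (j x).disc := by rwa [hP_tr, disc_tr]
    refine ⟨⟨(red_of_cusp h7' h8' h5').1, by rwa [disc_tr]⟩, hka x, ⟨h7', h8'⟩, h5', ?_⟩
    exact Dvd.intro _ rfl
  · intro f hf
    simp only [Finset.mem_filter, mem_redF] at hf
    obtain ⟨-, ha, hq, hD, hd⟩ := hf
    have hP : 0 < f.hP := by linarith [hq.1, hq.2]
    change (k (i f)).tr _ = f
    have h := hQ (k (i f)) (by rwa [hki f ha hd, hP_tr])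
    revert h
    generalize -(((k (i f)).hQ + (k (i f)).hP - 1) / (2 * (k (i f)).hP)) = m
    rw [hki f ha hd, tr_tr, hP_tr]
    exact fun h => tr_eq_of_hQ hq.1 hq.2 h.1 h.2
  · intro x hx
    obtain ⟨-, h2, h3, h4, -, -⟩ := (hk x).2 hx
    have e : k (i (j x)) = k x := by
      rw [hki (j x) (hka x) (Dvd.intro _ rfl)]
      have h := hb (j x) (hka x)
      revert h
      generalize -((j x).b / (3 * (j x).a)) = m
      change 0 ≤ (((k x).tr _).tr m).b ∧ (((k x).tr _).tr m).b < _ → ((k x).tr _).tr m = k x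
      rw [tr_tr]
      exact fun h => tr_eq_of_b h2 h3 h.1 h.2
    have hinj : Function.Injective k := by
      rintro ⟨n, b, c, d⟩ ⟨n', b', c', d'⟩ h
      rw [BCF.ext_iff] at h
      obtain ⟨h1, h2, h3, h4⟩ := h
      simp only [k] at h1 h2 h3 h4
      have h5 := mul_left_cancel₀ hq2.ne' h1
      have h6 : n = n' := by omega
      subst h6 h2 h3 h4
      rfl
    exact hinj e
  · intro f hf
    simp only [Finset.mem_filter, mem_redF] at hf
    obtain ⟨-, ha, hq, hD, hd⟩ := hf
    have e := hki f ha hd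
    have := NRZ_tr q₁ f (-(f.b / (3 * f.a)))
    rw [← e] at this
    exact_mod_cast this.symm

end

section
open Real Finset

noncomputable instance : DecidableEq BCF := Classical.decEq _

/-- The positive and negative divisors of a nonzero integer. -/
def zdiv (n : ℤ) : Finset ℤ := n.natAbs.divisors.biUnion fun k => {(k : ℤ), -(k : ℤ)}

theorem mem_zdiv {m n : ℤ} (h : m ∣ n) (hn : n ≠ 0) : m ∈ zdiv n := by
  simp only [zdiv, mem_biUnion, Nat.mem_divisors, mem_insert, mem_singleton]
  exact ⟨m.natAbs, ⟨Int.natAbs_dvd_natAbs.2 h, by simpa using hn⟩, by omega⟩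

theorem card_zdiv_le (n : ℤ) : (zdiv n).card ≤ 2 * n.natAbs.divisors.card := by
  refine (card_biUnion_le_card_mul _ _ 2 fun k _ => card_le_two).trans ?_
  rw [mul_comm]

/-- The candidates for the coefficient `c` of a degenerate form, given `a, b, d` and a possible
zero `(x, y)` of the form. -/
def candC (a b d x y : ℤ) : Finset ℤ :=
  {-(a * x ^ 3 + b * x ^ 2 * y + d * y ^ 3) / (x * y ^ 2),
    (-(3 * a) + Int.sqrt (9 * a ^ 2 + 4 * (b ^ 2 + 3 * b * d))) / 2,
    (-(3 * a) - Int.sqrt (9 * a ^ 2 + 4 * (b ^ 2 + 3 * b * d))) / 2,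
    (b ^ 2 + 9 * a * d) / (b + 3 * a), (9 * a * d - b ^ 2) / (b - 3 * a)}

/-- The candidates for a degenerate form with middle coefficient `b` and another parameter `n`. -/
noncomputable def candF (n b : ℤ) : Finset BCF :=
  ((zdiv n ×ˢ zdiv n ×ˢ zdiv n).biUnion fun t =>
    (candC t.1 b (n / t.1) t.2.1 t.2.2).image fun c => ⟨t.1, b, c, n / t.1⟩) ∪
  ((zdiv n).image fun a => ⟨a, b, n / a, 0⟩) ∪ {⟨-(b / 3), b, n, b / 3⟩, ⟨b / 3, b, n, b / 3⟩}

theorem card_candF_le (n b : ℤ) :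
    (candF n b).card ≤ 5 * (zdiv n).card ^ 3 + (zdiv n).card + 2 := by
  refine (card_union_le _ _).trans (add_le_add ((card_union_le _ _).trans
    (add_le_add ?_ card_image_le)) card_le_two)
  refine (card_biUnion_le_card_mul _ _ 5 fun t _ =>
    card_image_le.trans card_le_five).trans ?_
  rw [card_product, card_product]
  exact le_of_eq (by ring)

theorem mem_candF_of_mul {f : BCF} {x y : ℤ} (hn : f.a * f.d ≠ 0) (hx : x ∣ f.a * f.d)
    (hy : y ∣ f.a * f.d) (h : f.c ∈ candC f.a f.b f.d x y) : f ∈ candF (f.a * f.d) f.b := by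
  have e : f.a * f.d / f.a = f.d := Int.mul_ediv_cancel_left _ (left_ne_zero_of_mul hn)
  refine mem_union_left _ (mem_union_left _ (mem_biUnion.2
    ⟨(f.a, x, y), ?_, ?_⟩))
  · simp only [mem_product]
    exact ⟨mem_zdiv (Dvd.intro _ rfl) hn, mem_zdiv hx hn, mem_zdiv hy hn⟩
  · simp only [e]
    exact mem_image.2 ⟨f.c, h, rfl⟩

theorem exists_coprime_zero {f : BCF} (h : ¬ f.Irr) : ∃ x y : ℤ, IsCoprime x y ∧ f.eval x y = 0 := by
  unfold Irr at h
  push Not at h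
  obtain ⟨x, y, h0, hxy⟩ := h
  have hg : 0 < Int.gcd x y := by
    rw [Int.gcd_pos_iff]
    by_contra hc
    push Not at hc
    exact hxy hc.1 hc.2
  obtain ⟨x', y', hco, e1, e2⟩ := Int.exists_gcd_one hg
  refine ⟨x', y', Int.isCoprime_iff_gcd_eq_one.2 hco, ?_⟩
  have hg' : ((Int.gcd x y : ℤ)) ^ 3 ≠ 0 := by positivity
  refine (mul_eq_zero.1 (?_ : ((Int.gcd x y : ℤ)) ^ 3 * f.eval x' y' = 0)).resolve_left hg'
  rw [← h0]
  generalize ((Int.gcd x y : ℕ) : ℤ) = g at e1 e2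
  rw [e1, e2]
  simp only [eval]; ring

theorem mem_candF_of_not_irr {f : BCF} (hn : f.a * f.d ≠ 0) (h : ¬ f.Irr) :
    f ∈ candF (f.a * f.d) f.b := by
  obtain ⟨x, y, hco, h0⟩ := exists_coprime_zero h
  have ha := left_ne_zero_of_mul hn
  have hd := right_ne_zero_of_mul hn
  have hx0 : x ≠ 0 := by
    rintro rfl
    have : y ≠ 0 := by
      rintro rfl
      exact not_isUnit_zero (isCoprime_zero_left.1 hco)
    simp [eval, hd, this] at h0
  have hy0 : y ≠ 0 := by
    rintro rfl
    simp [eval, ha, hx0] at h0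
  have hx : x ∣ f.d := by
    refine (hco.pow_right (n := 3)).dvd_of_dvd_mul_right ⟨-(f.a * x ^ 2 + f.b * x * y + f.c * y ^ 2), ?_⟩
    simp only [eval] at h0
    linear_combination h0
  have hy : y ∣ f.a := by
    refine (hco.symm.pow_right (n := 3)).dvd_of_dvd_mul_right
      ⟨-(f.b * x ^ 2 + f.c * x * y + f.d * y ^ 2), ?_⟩
    simp only [eval] at h0
    linear_combination h0
  refine mem_candF_of_mul hn (hx.mul_left _) (hy.mul_right _) ?_
  have : f.c = -(f.a * x ^ 3 + f.b * x ^ 2 * y + f.d * y ^ 3) / (x * y ^ 2) := by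
    refine (Int.ediv_eq_of_eq_mul_right (by positivity) ?_).symm
    simp only [eval] at h0
    linear_combination -h0
  exact mem_insert.2 (Or.inl this)

theorem mem_candF_of_hP_eq_hR {f : BCF} (hn : f.a * f.d ≠ 0) (h : f.hP = f.hR) :
    f ∈ candF (f.a * f.d) f.b := by
  refine mem_candF_of_mul (x := 1) (y := 1) hn (one_dvd _) (one_dvd _) ?_
  simp only [hP, hR] at h
  have e : 9 * f.a ^ 2 + 4 * (f.b ^ 2 + 3 * f.b * f.d) = (2 * f.c + 3 * f.a) * (2 * f.c + 3 * f.a) := by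
    linear_combination 4 * h
  simp only [candC, e, Int.sqrt_eq, mem_insert, mem_singleton]
  omega

theorem exists_candF_of_abs_hQ_eq {f : BCF} (hn : f.a * f.d ≠ 0) (h : |f.hQ| = f.hP) :
    f ∈ candF (f.a * f.d) f.b ∨ (f.b ≠ 0 ∧ f ∈ candF f.c f.b) := by
  have ha := left_ne_zero_of_mul hn
  have hP : f.hP = f.b ^ 2 - 3 * f.a * f.c := rfl
  have hQ : f.hQ = f.b * f.c - 9 * f.a * f.d := rfl
  have mem : ∀ c : ℤ, f.c = c → c ∈ candC f.a f.b f.d 1 1 → f ∈ candF (f.a * f.d) f.b :=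
    fun c hc h => mem_candF_of_mul hn (one_dvd _) (one_dvd _) (hc ▸ h)
  rcases abs_choice f.hQ with h' | h' <;> rw [h', hQ, hP] at h
  · by_cases hb : f.b + 3 * f.a = 0
    · right
      have hb' : f.b = -3 * f.a := by linarith
      have hd : f.d = -f.a := by
        rw [hb'] at h
        have : f.a * (f.a + f.d) = 0 := by linarith
        rcases mul_eq_zero.1 this with h1 | h1
        · exact absurd h1 ha
        · linarith
      refine ⟨by omega, mem_union_right _ (mem_insert.2 (Or.inl ?_))⟩
      ext
      · simp only; omega
      · rfl
      · rfl
      · simp only; omega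
    · left
      refine mem ((f.b ^ 2 + 9 * f.a * f.d) / (f.b + 3 * f.a))
        (Int.ediv_eq_of_eq_mul_right hb ?_).symm (by simp [candC])
      linarith
  · by_cases hb : f.b - 3 * f.a = 0
    · right
      have hb' : f.b = 3 * f.a := by linarith
      have hd : f.d = f.a := by
        rw [hb'] at h
        have : f.a * (f.a - f.d) = 0 := by linarith
        rcases mul_eq_zero.1 this with h1 | h1
        · exact absurd h1 ha
        · linarith
      refine ⟨by omega, mem_union_right _ (mem_insert.2
        (Or.inr (mem_singleton.2 ?_)))⟩
      ext
      · simp only; omega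
      · rfl
      · rfl
      · simp only; omega
    · left
      refine mem ((9 * f.a * f.d - f.b ^ 2) / (f.b - 3 * f.a))
        (Int.ediv_eq_of_eq_mul_right hb ?_).symm (by simp [candC])
      linarith

theorem exists_mem_candF {f : BCF} (hf : f.Red) (ha : f.a ≠ 0) (h : ¬ (f ∈ W ∧ f.Inn)) :
    ∃ n : ℤ, n ^ 2 ≤ 2 * f.disc ∧ f ∈ candF n f.b := by
  have hD := hf.disc_pos
  have hP := hf.hP_sq_le
  by_cases hd : f.d = 0
  · have hc : f.c ≠ 0 := by
      intro hc
      have := hf.hR_pos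
      simp [hR, hd, hc] at this
    refine ⟨f.a * f.c, ?_, mem_union_left _ (mem_union_right _
      (mem_image.2 ⟨f.a, mem_zdiv (Dvd.intro _ rfl) (mul_ne_zero ha hc), ?_⟩))⟩
    · have h1 := hf.b_sq_le
      have h2 : f.hP = f.b ^ 2 - 3 * (f.a * f.c) := by simp only [BCF.hP]; ring
      have h3 := hf.1
      have h4 : 0 ≤ f.b ^ 2 := sq_nonneg _
      have h5 : (f.a * f.c) ^ 2 ≤ f.hP ^ 2 := sq_le_sq' (by linarith) (by linarith)
      linarith
    · ext
      · rfl
      · rfl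
      · exact Int.mul_ediv_cancel_left _ ha
      · exact hd.symm
  · have hn : f.a * f.d ≠ 0 := mul_ne_zero ha hd
    have hb : (f.a * f.d) ^ 2 ≤ 2 * f.disc := by
      have := hf.ad_sq_le
      linarith [sq_nonneg (f.a * f.d)]
    by_cases h1 : f.Irr
    · have h2 : ¬ f.Inn := fun h3 => h ⟨⟨h1, hD⟩, h3⟩
      unfold Inn at h2
      by_cases h3 : f.hP = f.hR
      · exact ⟨_, hb, mem_candF_of_hP_eq_hR hn h3⟩
      · have h4 : |f.hQ| = f.hP :=
          le_antisymm hf.2.1 (not_lt.1 fun h5 => h2 ⟨h5, lt_of_le_of_ne hf.2.2 h3⟩)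
        rcases exists_candF_of_abs_hQ_eq hn h4 with h5 | ⟨h5, h6⟩
        · exact ⟨_, hb, h5⟩
        · refine ⟨_, ?_, h6⟩
          have h7 := hf.bc_sq_le
          have h8 : 1 ≤ f.b ^ 2 := by
            have : 0 < f.b ^ 2 := by positivity
            linarith
          have h9 : f.c ^ 2 ≤ (f.b * f.c) ^ 2 := by
            rw [mul_pow]; exact le_mul_of_one_le_left (sq_nonneg _) h8
          linarith
    · exact ⟨_, hb, mem_candF_of_not_irr hn h1⟩

open Classical in
/-- The reduced forms which are reducible or lie on the boundary of the fundamental domain. -/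
noncomputable def badF (Y : ℝ) : Finset BCF :=
  (redF Y).filter fun f => f.a ≠ 0 ∧ ¬ (f ∈ W ∧ f.Inn)

theorem exists_card_badF_le : ∃ C : ℝ, 0 < C ∧ ∀ Y : ℝ, 0 ≤ Y →
    ((badF Y).card : ℝ) ≤ C * Y ^ (19 / 24 : ℝ) := by
  classical
  obtain ⟨C, hC, hdiv⟩ := exists_card_divisors_le (ε := 1 / 36) (by norm_num)
  refine ⟨25 * (40 * C ^ 3 * 2 + 2 * C * 2 + 2), by positivity, fun Y hY0 => ?_⟩
  rcases lt_or_ge Y 1 with hY1 | hY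
  · have : badF Y = ∅ := by
      refine eq_empty_of_forall_notMem fun f hf => ?_
      obtain ⟨h1, h2⟩ := mem_redF.1 (mem_filter.1 hf).1
      have h3 : (1 : ℝ) ≤ f.disc := by exact_mod_cast h1.disc_pos
      linarith
    rw [this]
    simp only [card_empty, Nat.cast_zero]
    positivity
  set l := Y ^ (1 / 4 : ℝ) with hl
  have hl1 : 1 ≤ l := one_le_rpow hY (by norm_num)
  have hl4 : l ^ 4 = Y := by rw [hl, ← rpow_natCast, ← rpow_mul hY0]; norm_num
  set z := Y ^ (1 / 24 : ℝ) with hz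
  have hz1 : 1 ≤ z := one_le_rpow hY (by norm_num)
  have hlz : l ^ 3 * z = Y ^ (19 / 24 : ℝ) := by
    rw [hl, hz, ← rpow_natCast, ← rpow_mul hY0, ← rpow_add (by linarith)]; norm_num
  have hsub : badF Y ⊆ (Icc (-(⌊2 * l ^ 2⌋₊ : ℤ)) ⌊2 * l ^ 2⌋₊ ×ˢ
      Icc (-(⌊2 * l⌋₊ : ℤ)) ⌊2 * l⌋₊).biUnion fun t => candF t.1 t.2 := by
    intro f hf
    obtain ⟨hf1, ha, hf2⟩ := mem_filter.1 hf
    obtain ⟨hf0, hD⟩ := mem_redF.1 hf1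
    obtain ⟨n, hn, hmem⟩ := exists_mem_candF hf0 ha hf2
    have key : ∀ (m : ℤ) (r : ℝ), |(m : ℝ)| ≤ r → m ∈ Icc (-(⌊r⌋₊ : ℤ)) ⌊r⌋₊ := by
      intro m r h
      have h1 : m.natAbs ≤ ⌊r⌋₊ := Nat.le_floor (by rwa [Nat.cast_natAbs, Int.cast_abs])
      rw [mem_Icc]
      omega
    refine mem_biUnion.2 ⟨(n, f.b), mem_product.2 ⟨key _ _ ?_, key _ _ ?_⟩, hmem⟩
    · refine abs_le_of_sq_le_sq ?_ (by positivity)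
      have h1 : ((n : ℝ)) ^ 2 ≤ 2 * f.disc := by exact_mod_cast hn
      have h2 : (2 * l ^ 2) ^ 2 = 4 * Y := by rw [← hl4]; ring
      linarith
    · refine abs_le_of_sq_le_sq ?_ (by positivity)
      have h1 : 3 * (f.b : ℝ) ^ 2 ≤ 4 * f.hP := by exact_mod_cast hf0.b_sq_le
      have h2 : (f.hP : ℝ) ^ 2 ≤ f.disc := by exact_mod_cast hf0.hP_sq_le
      have h3 : (f.hP : ℝ) ≤ l ^ 2 := by
        refine le_of_sq_le_sq ?_ (by positivity)
        calc _ ≤ Y := by linarith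
          _ = _ := by rw [← hl4]; ring
      have : 0 ≤ l ^ 2 := by positivity
      rw [mul_pow]
      linarith
  have hc : ∀ t ∈ (Icc (-(⌊2 * l ^ 2⌋₊ : ℤ)) ⌊2 * l ^ 2⌋₊ ×ˢ
      Icc (-(⌊2 * l⌋₊ : ℤ)) ⌊2 * l⌋₊),
      ((candF t.1 t.2).card : ℝ) ≤ (40 * C ^ 3 * 2 + 2 * C * 2 + 2) * z := by
    rintro ⟨n, b⟩ ht
    have hn := (mem_product.1 ht).1
    simp only [mem_Icc] at hn
    have hnl : (n.natAbs : ℝ) ≤ 2 * l ^ 2 := by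
      refine le_trans ?_ (Nat.floor_le (by positivity : 0 ≤ 2 * l ^ 2))
      exact_mod_cast (by omega : n.natAbs ≤ ⌊2 * l ^ 2⌋₊)
    have h1 : ((zdiv n).card : ℝ) ≤ 2 * (C * (n.natAbs : ℝ) ^ (1 / 36 : ℝ)) := by
      have h0 : ((zdiv n).card : ℝ) ≤ 2 * n.natAbs.divisors.card := by
        exact_mod_cast card_zdiv_le n
      refine h0.trans ?_
      rcases eq_or_ne n.natAbs 0 with h0 | h0
      · rw [h0]; simp
      · linarith [hdiv _ h0]
    have h2 : ((n.natAbs : ℝ) ^ (1 / 36 : ℝ)) ^ 3 ≤ 2 * z := by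
      rw [← rpow_natCast, ← rpow_mul (by positivity)]
      calc (n.natAbs : ℝ) ^ ((1 / 36 : ℝ) * (3 : ℕ)) ≤ (2 * l ^ 2) ^ ((1 / 36 : ℝ) * (3 : ℕ)) :=
            rpow_le_rpow (by positivity) hnl (by positivity)
        _ = 2 ^ (1 / 12 : ℝ) * z := by
            rw [mul_rpow (by norm_num) (by positivity), hl, hz, ← rpow_natCast,
              ← rpow_mul hY0, ← rpow_mul hY0]
            norm_num
        _ ≤ 2 ^ (1 : ℝ) * z := by
            gcongr
            · norm_num
            · norm_num
        _ = 2 * z := by rw [rpow_one]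
    set w := (n.natAbs : ℝ) ^ (1 / 36 : ℝ)
    have hw : 0 ≤ w := by positivity
    have h3 : w ≤ 2 * z := by
      by_contra hcon
      push Not at hcon
      have : 1 ≤ w := by linarith
      have : w ≤ w ^ 3 := le_self_pow₀ this (by norm_num)
      linarith
    have h4 : ((zdiv n).card : ℝ) ^ 3 ≤ (2 * (C * w)) ^ 3 :=
      pow_le_pow_left₀ (by positivity) h1 3
    have h5 : ((candF n b).card : ℝ) ≤ 5 * ((zdiv n).card : ℝ) ^ 3 + (zdiv n).card + 2 := by
      exact_mod_cast card_candF_le n b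
    calc ((candF n b).card : ℝ) ≤ 5 * (2 * (C * w)) ^ 3 + 2 * (C * w) + 2 := by linarith
      _ = 40 * C ^ 3 * w ^ 3 + 2 * C * w + 2 := by ring
      _ ≤ 40 * C ^ 3 * (2 * z) + 2 * C * (2 * z) + 2 * z := by gcongr; linarith
      _ = _ := by ring
  have hle : ((badF Y).card : ℝ) ≤ ∑ t ∈ (Icc (-(⌊2 * l ^ 2⌋₊ : ℤ)) ⌊2 * l ^ 2⌋₊ ×ˢ
      Icc (-(⌊2 * l⌋₊ : ℤ)) ⌊2 * l⌋₊), ((candF t.1 t.2).card : ℝ) := by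
    exact_mod_cast (card_le_card hsub).trans card_biUnion_le
  refine hle.trans ((sum_le_sum hc).trans ?_)
  have hcard : ∀ k : ℕ, (Icc (-(k : ℤ)) k).card = 2 * k + 1 := by
    intro k; rw [Int.card_Icc]; omega
  rw [sum_const, card_product, hcard, hcard, nsmul_eq_mul]
  push_cast
  have h1 : (⌊2 * l ^ 2⌋₊ : ℝ) ≤ 2 * l ^ 2 := Nat.floor_le (by positivity)
  have h2 : (⌊2 * l⌋₊ : ℝ) ≤ 2 * l := Nat.floor_le (by positivity)
  have h3 : 1 ≤ l ^ 2 := one_le_pow₀ hl1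
  calc _ ≤ (5 * l ^ 2) * (5 * l) * ((40 * C ^ 3 * 2 + 2 * C * 2 + 2) * z) := by
        gcongr <;> linarith
    _ = _ := by rw [← hlz]; ring

theorem sum_prod_om_le {w : BCF → ℝ} (hw : ∀ f, 0 ≤ w f)
    (hs : ∀ (n : ℤ) (f : BCF), n ≠ 0 → w (f.scale n) = w f) {C α : ℝ} (hα : 1 / 4 ≤ α)
    (h : ∀ Y : ℝ, 0 ≤ Y → ∑ f ∈ redF Y, w f ≤ C * Y ^ α) (E : Finset ℕ)
    (hE : ∀ p ∈ E, p.Prime) {Y : ℝ} (hY : 0 ≤ Y) :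
    ∑ f ∈ redF Y, w f * ∏ p ∈ E, (om p f : ℝ) ≤ C * 5 ^ E.card * Y ^ α := by
  classical
  have hC : 0 ≤ C := by
    have := (sum_nonneg fun f _ => hw f).trans (h 1 zero_le_one)
    simpa using this
  induction E using Finset.induction_on generalizing Y with
  | empty => simpa using h Y hY
  | insert p E hpE ih =>
    have hp := hE p (mem_insert_self _ _)
    have hE' : ∀ q ∈ E, q.Prime := fun q hq => hE q (mem_insert_of_mem hq)
    have hp1 : (1 : ℝ) ≤ p := by exact_mod_cast hp.one_le
    have hp0 : (0 : ℝ) < p := by linarith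
    have hF : ∀ f : BCF, 0 ≤ w f * ∏ q ∈ E, (om q f : ℝ) := fun f =>
      mul_nonneg (hw f) (prod_nonneg fun _ _ => Nat.cast_nonneg _)
    have h1 : ∀ f : BCF, w f * ∏ q ∈ insert p E, (om q f : ℝ) ≤
        3 * (w f * ∏ q ∈ E, (om q f : ℝ)) +
          if f.Dv p then (p + 1) * (w f * ∏ q ∈ E, (om q f : ℝ)) else 0 := by
      intro f
      rw [prod_insert hpE, mul_left_comm]
      split_ifs with hf
      · have h2 : (om p f : ℝ) ≤ p + 1 := by exact_mod_cast om_le_of_dv f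
        linarith [mul_le_mul_of_nonneg_right h2 (hF f), hF f]
      · have h2 : (om p f : ℝ) ≤ 3 := by exact_mod_cast om_le_three hp hf
        linarith [mul_le_mul_of_nonneg_right h2 (hF f)]
    refine (sum_le_sum fun f _ => h1 f).trans ?_
    rw [sum_add_distrib, ← sum_filter, ← mul_sum]
    have h3 := sum_dv hp (fun f => (p + 1) * (w f * ∏ q ∈ E, (om q f : ℝ))) Y
    have h4 : ∑ f ∈ redF Y with f.Dv p, (p + 1) * (w f * ∏ q ∈ E, (om q f : ℝ)) =
        (p + 1) * ∑ f ∈ redF (Y / p ^ 4), w f * ∏ q ∈ E, (om q f : ℝ) := by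
      rw [mul_sum]
      refine Eq.trans ?_ (h3.trans (sum_congr rfl fun f _ => ?_))
      · congr!
      · rw [hs _ _ (by exact_mod_cast hp.ne_zero)]
        congr 2
        exact prod_congr rfl fun q hq => by
          rw [om_scale_prime hp (hE' q hq) fun e => hpE (e ▸ hq)]
    rw [h4]
    have h5 := ih hE' hY
    have h6 := ih hE' (Y := Y / p ^ 4) (by positivity)
    have h7 : (Y / p ^ 4) ^ α ≤ Y ^ α / p := by
      rw [div_rpow hY (by positivity)]
      refine div_le_div_of_nonneg_left (by positivity) hp0 ?_
      rw [← rpow_natCast, ← rpow_mul hp0.le]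
      exact self_le_rpow_of_one_le hp1 (by push_cast; linarith)
    have h8 : ((p : ℝ) + 1) * (Y ^ α / p) ≤ 2 * Y ^ α := by
      rw [mul_div_assoc', div_le_iff₀ hp0]
      linarith [mul_le_mul_of_nonneg_left hp1 (by positivity : 0 ≤ Y ^ α)]
    have h9 : 0 ≤ C * 5 ^ E.card := by positivity
    rw [card_insert_of_notMem hpE]
    calc _ ≤ 3 * (C * 5 ^ E.card * Y ^ α) + (p + 1) * (C * 5 ^ E.card * (Y ^ α / p)) := by
          gcongr
          exact h6.trans (mul_le_mul_of_nonneg_left h7 h9)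
      _ = 3 * (C * 5 ^ E.card * Y ^ α) + C * 5 ^ E.card * ((p + 1) * (Y ^ α / p)) := by ring
      _ ≤ 3 * (C * 5 ^ E.card * Y ^ α) + C * 5 ^ E.card * (2 * Y ^ α) := by gcongr
      _ = _ := by ring

theorem mem_W_Inn_scale {n : ℤ} (hn : n ≠ 0) (f : BCF) :
    (f.scale n ∈ W ∧ (f.scale n).Inn) ↔ f ∈ W ∧ f.Inn := by
  have h : 0 < n ^ 2 := by positivity
  rw [scale_mem_W_iff hn]
  simp only [Inn, hP_scale, hQ_scale, hR_scale, abs_mul, abs_of_pos h]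
  rw [mul_lt_mul_iff_right₀ h, mul_lt_mul_iff_right₀ h]

theorem exists_sum_badF_le : ∃ C : ℝ, 0 < C ∧ ∀ (E : Finset ℕ), (∀ p ∈ E, p.Prime) →
    ∀ Y : ℝ, 0 ≤ Y → ∑ f ∈ badF Y, ∏ p ∈ E, (om p f : ℝ) ≤ C * 5 ^ E.card * Y ^ (19 / 24 : ℝ) := by
  classical
  obtain ⟨C, hC, h⟩ := exists_card_badF_le
  refine ⟨C, hC, fun E hE Y hY => ?_⟩
  have := sum_prod_om_le (w := fun f => if f.a ≠ 0 ∧ ¬ (f ∈ W ∧ f.Inn) then 1 else 0)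
    (fun f => by positivity) (fun n f hn => ?_) (α := 19 / 24) (by norm_num)
    (fun Y hY => ?_) E hE hY (C := C)
  · refine le_trans (le_of_eq ?_) this
    unfold badF
    rw [sum_filter]
    refine sum_congr rfl fun f _ => ?_
    split_ifs <;> simp
  · simp only [mem_W_Inn_scale hn]
    simp [scale, hn]
  · refine le_trans (le_of_eq ?_) (h Y hY)
    rw [← sum_filter]
    simp [badF]

end

section
open Finset

theorem Inn.wr_eq {f : BCF} (hf : f ∈ W) (h : f.Inn) : f.wr = 1 / 4 := by
  have hu : ∀ u : ℤˣ, (u : ℤ) ^ 2 = 1 := fun u => by rcases Int.units_eq_one_or u with rfl | rfl <;> simp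
  let φ : ℤˣ × ℤˣ → GLZ := fun x => GLZ.mk x.1 0 0 x.2 (by
    rcases Int.units_eq_one_or x.1 with h | h <;> rcases Int.units_eq_one_or x.2 with h' | h' <;>
      simp [h, h'])
  have hφ : Function.Injective φ := by
    intro x y hxy
    have e : !![(x.1 : ℤ), 0; 0, x.2] = !![(y.1 : ℤ), 0; 0, y.2] := congrArg Units.val hxy
    have e1 := congrFun (congrFun e 0) 0
    have e2 := congrFun (congrFun e 1) 1
    simp only [Matrix.of_apply, Matrix.cons_val', Matrix.cons_val_zero, Matrix.cons_val_one,
      Matrix.cons_val_fin_one] at e1 e2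
    exact Prod.ext (Units.ext e1) (Units.ext e2)
  have hset : {γ : GLZ | (f.comp γ).Red} = φ '' Set.univ := by
    ext γ
    rw [Set.mem_ofPred_eq, Set.image_univ, Set.mem_range]
    constructor
    · intro hγ
      obtain ⟨h1, h2, h3, h4⟩ := h.eq_of_red hγ
      refine ⟨((Int.isUnit_iff.2 h1).unit, (Int.isUnit_iff.2 h2).unit), Units.ext ?_⟩
      ext i j
      fin_cases i <;> fin_cases j <;> simp [φ, h3, h4]
    · rintro ⟨⟨u, v⟩, rfl⟩
      have e1 : (f.comp (φ (u, v))).hP = f.hP := by rw [hP_comp_GLZ]; simp [φ, hv, hu]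
      have e2 : (f.comp (φ (u, v))).hR = f.hR := by rw [hR_comp_GLZ]; simp [φ, hv, hu]
      have e3 : (f.comp (φ (u, v))).hQ = f.hQ * (u * v) := by rw [hQ_comp_GLZ]; simp [φ]
      have e4 : |(u : ℤ) * v| = 1 := by
        rcases Int.units_eq_one_or u with rfl | rfl <;>
        rcases Int.units_eq_one_or v with rfl | rfl <;> simp
      unfold Red
      rw [e1, e2, e3, abs_mul, e4, mul_one]
      exact h.red
  have hcard : {γ : GLZ | (f.comp γ).Red}.ncard = 4 := by
    rw [hset, Set.ncard_image_of_injective _ hφ, Set.ncard_univ, Nat.card_prod]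
    simp
  rw [wr, wt, if_pos ⟨hf, h.red⟩, hcard]
  simp

theorem om_scale_neg (p : ℕ) (f : BCF) : om p (f.scale (-1)) = om p f :=
  cnt_scale_of_isCoprime isCoprime_one_right.neg_right p f

theorem tS_eq_two_mul (E : Finset ℕ) (Y : ℝ) : tS ∅ E Y =
    ∑ f ∈ redF Y, (if 0 < f.a then 2 * f.wr else 0) * ∏ p ∈ E, (om p f : ℝ) := by
  have hinv : ∀ f : BCF, (f.scale (-1)).scale (-1) = f := fun f => by ext <;> simp [scale]
  have h0 : ∑ f ∈ redF Y, (if 0 < f.a then f.wr else 0) * ∏ p ∈ E, (om p f : ℝ) =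
      ∑ f ∈ redF Y, (if f.a < 0 then f.wr else 0) * ∏ p ∈ E, (om p f : ℝ) := by
    refine sum_nbij' (scale (-1)) (scale (-1)) ?_ ?_ (fun f _ => hinv f)
      (fun f _ => hinv f) ?_
    · intro f hf
      rw [mem_redF] at hf ⊢
      rw [Red.scale_iff (by norm_num), disc_scale]
      simpa using hf
    · intro f hf
      rw [mem_redF] at hf ⊢
      rw [Red.scale_iff (by norm_num), disc_scale]
      simpa using hf
    · intro f _
      simp only [om_scale_neg, wr_scale (show (-1 : ℤ) ≠ 0 by norm_num)]
      simp [scale]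
  have h1 : tS ∅ E Y = ∑ f ∈ redF Y, (if 0 < f.a then f.wr else 0) * ∏ p ∈ E, (om p f : ℝ) +
      ∑ f ∈ redF Y, (if f.a < 0 then f.wr else 0) * ∏ p ∈ E, (om p f : ℝ) := by
    rw [tS, ← sum_add_distrib]
    refine sum_congr rfl fun f _ => ?_
    rw [prod_empty, one_mul, ← add_mul]
    congr 1
    rcases lt_trichotomy f.a 0 with h | h | h
    · simp [h, h.not_gt]
    · rw [wr_eq_zero fun h' => h'.1.1.a_ne h]; simp
    · simp [h, h.not_gt]
  rw [h1, ← h0, ← two_mul, mul_sum]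
  exact sum_congr rfl fun f _ => by rw [← mul_assoc, mul_ite, mul_zero]

theorem sum_powerset_filter {E : Finset ℕ} (hE : ∀ p ∈ E, p.Prime) (Y : ℝ) (R : BCF → Prop)
    [DecidablePred R] [∀ q₂ : ℕ, DecidablePred fun f : BCF => R f ∧ (q₂ : ℤ) ∣ f.a] :
    ∑ T ∈ E.powerset, ∑ f ∈ (redF Y).filter (fun f => R f ∧ ((∏ p ∈ T, p : ℕ) : ℤ) ∣ f.a),
      (NRZ (∏ p ∈ E \ T, p) f.a f.b f.c f.d : ℝ) =
    ∑ f ∈ redF Y, (if R f then 1 else 0) * ∏ p ∈ E, (om p f : ℝ) := by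
  simp only [sum_filter]
  rw [sum_comm]
  refine sum_congr rfl fun f _ => ?_
  rw [← Nat.cast_prod, prod_om_eq E hE f]
  by_cases h : R f
  · simp only [h, true_and, if_true, one_mul]
    push_cast
    rfl
  · simp [h]

theorem abs_tS_sub_le {E : Finset ℕ} (hE : ∀ p ∈ E, p.Prime) (Y : ℝ) :
    |tS ∅ E Y - 1 / 2 * ∑ T ∈ E.powerset, (gS (Vk Y) (∏ p ∈ E \ T, p) (∏ p ∈ T, p) Y +
      cuspG (∏ p ∈ E \ T, p) (∏ p ∈ T, p) Y)| ≤ 2 * ∑ f ∈ badF Y, ∏ p ∈ E, (om p f : ℝ) := by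
  classical
  have e1 := sum_powerset_filter hE Y (fun f => f.vec ∈ Vk Y)
  have e2 := sum_powerset_filter hE Y (fun f => 0 < f.a ∧ (-f.hP < f.hQ ∧ f.hQ ≤ f.hP) ∧
    4 * f.hP ^ 2 < 3 * f.disc)
  have e3 : ∀ q₁ q₂ : ℕ, cuspG q₁ q₂ Y = ∑ f ∈ (redF Y).filter (fun f => (0 < f.a ∧
      (-f.hP < f.hQ ∧ f.hQ ≤ f.hP) ∧ 4 * f.hP ^ 2 < 3 * f.disc) ∧ (q₂ : ℤ) ∣ f.a),
      (NRZ q₁ f.a f.b f.c f.d : ℝ) := fun q₁ q₂ => by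
    unfold cuspG; refine sum_congr ?_ fun _ _ => rfl; ext f; simp [and_assoc]
  have e4 : ∀ q₁ q₂ : ℕ, gS (Vk Y) q₁ q₂ Y = ∑ f ∈ (redF Y).filter (fun f => f.vec ∈ Vk Y ∧
      (q₂ : ℤ) ∣ f.a), (NRZ q₁ f.a f.b f.c f.d : ℝ) := fun q₁ q₂ => by
    unfold gS; congr!
  simp only [e3, e4]
  rw [sum_add_distrib, e1, e2, tS_eq_two_mul, ← sum_add_distrib, mul_sum,
    ← sum_sub_distrib, badF, sum_filter, mul_sum]
  refine (abs_sum_le_sum_abs _ _).trans (sum_le_sum fun f hf => ?_)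
  have hP0 : (0 : ℝ) ≤ ∏ p ∈ E, (om p f : ℝ) := prod_nonneg fun _ _ => Nat.cast_nonneg _
  rw [← add_mul, ← mul_assoc, ← sub_mul, abs_mul, abs_of_nonneg hP0]
  have key : |(if 0 < f.a then 2 * f.wr else 0) - 1 / 2 * ((if f.vec ∈ Vk Y then 1 else 0) +
      if 0 < f.a ∧ (-f.hP < f.hQ ∧ f.hQ ≤ f.hP) ∧ 4 * f.hP ^ 2 < 3 * f.disc then 1 else 0)| ≤
      if f.a ≠ 0 ∧ ¬ (f ∈ W ∧ f.Inn) then 2 else 0 := by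
    have hD := (mem_redF.1 hf).2
    have hV : f.vec ∈ Vk Y ↔ 0 < f.a ∧ f.Inn ∧ ¬ (4 * f.hP ^ 2 < 3 * f.disc) := by
      rw [Vk, Set.mem_sdiff, vec_mem_Va_one, vec_mem_Va_zero]
      constructor
      · rintro ⟨⟨h1, h2, h3⟩, h4⟩
        exact ⟨h1, h2, fun h5 => h4 ⟨h1, h2.1, h5, h3⟩⟩
      · rintro ⟨h1, h2, h3⟩
        exact ⟨⟨h1, h2, hD⟩, fun h4 => h3 h4.2.2.1⟩
    rw [hV]
    by_cases ha : 0 < f.a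
    · by_cases hg : f ∈ W ∧ f.Inn
      · have hq := abs_lt.1 hg.2.1
        by_cases h4 : 4 * f.hP ^ 2 < 3 * f.disc
        · simp [ha, hg, h4, hq.1, hq.2.le, hg.2.wr_eq hg.1]
          norm_num
        · simp [ha, hg, h4, hg.2.wr_eq hg.1]
          norm_num
      · rw [if_pos ha, if_pos (show f.a ≠ 0 ∧ ¬ (f ∈ W ∧ f.Inn) from ⟨ha.ne', hg⟩)]
        have h1 := f.wr_nonneg
        have h2 := f.wr_le_one
        rw [abs_le]
        split_ifs <;> constructor <;> linarith
    · simp only [ha, false_and, if_false]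
      split_ifs <;> simp
  refine (mul_le_mul_of_nonneg_right key hP0).trans (le_of_eq ?_)
  split_ifs <;> simp

end

section
open Real MeasureTheory Set

/-- The constant of the secondary term in the counting functions of forms. -/
noncomputable def cSec : ℝ := 18 / 5 * 108 ^ (-(5 / 6) : ℝ) * (riemannZeta (1 / 3)).re *
  ∫ u in Ioo (-1 : ℝ) 1, (1 - u ^ 2) ^ (-(5 / 6) : ℝ)

theorem mainS_eq_sum (E : Finset ℕ) {Y : ℝ} (hY : 0 ≤ Y) :
    mainS (π ^ 2 / 72) cSec ∅ E Y = 1 / 2 * ∑ T ∈ E.powerset,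
      (π / 12 * (π / 3 - 1) * Y / (∏ p ∈ T, p : ℕ) + cuspM Y (∏ p ∈ T, p : ℕ)) := by
  have h : ∀ s : ℝ, ∏ p ∈ E, (1 + (p : ℝ) ^ s) = ∑ T ∈ E.powerset, ((∏ p ∈ T, p : ℕ) : ℝ) ^ s := by
    intro s
    rw [Finset.prod_one_add]
    refine Finset.sum_congr rfl fun T _ => ?_
    rw [Nat.cast_prod, finsetProd_rpow _ _ fun _ _ => Nat.cast_nonneg _]
  rw [mainS, Finset.prod_empty, Finset.prod_empty, one_mul, one_mul, h, h, Finset.mul_sum,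
    Finset.mul_sum, Finset.mul_sum, ← Finset.sum_add_distrib]
  refine Finset.sum_congr rfl fun T _ => ?_
  rw [cuspM, cSec, rpow_neg_one, div_rpow hY (by norm_num),
    rpow_neg (by norm_num : (0 : ℝ) ≤ 108)]
  ring

theorem prod_rpow_powerset_le {E : Finset ℕ} (hE : ∀ p ∈ E, p.Prime) (T : Finset ℕ) {s : ℝ}
    (hs : 0 ≤ s) : ((∏ p ∈ E \ T, p : ℕ) : ℝ) ^ s ≤ (∏ p ∈ E, (p : ℝ)) ^ s := by
  refine rpow_le_rpow (Nat.cast_nonneg _) ?_ hs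
  rw [← Nat.cast_prod]
  exact_mod_cast Finset.prod_le_prod_of_subset_of_one_le' Finset.sdiff_subset
    fun p hp _ => (hE p hp).one_le

theorem exists_pow_card_le (k : ℕ) {ε : ℝ} (hε : 0 < ε) : ∃ C : ℝ, 0 < C ∧
    ∀ E : Finset ℕ, (∀ p ∈ E, p.Prime) → (k : ℝ) ^ E.card ≤ C * (∏ p ∈ E, (p : ℝ)) ^ ε := by
  obtain ⟨C, hC, h⟩ := exists_pow_card_primeFactors_le k hε
  refine ⟨C, hC, fun E hE => ?_⟩
  have := h (∏ p ∈ E, p) (Finset.prod_ne_zero_iff.2 fun p hp => (hE p hp).ne_zero)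
  rwa [Nat.primeFactors_prod hE, Nat.cast_prod] at this

theorem exists_abs_tS_sub_le : ∃ K : ℝ, 0 < K ∧ ∀ E : Finset ℕ, (∀ q ∈ E, q.Prime) → ∀ Y : ℝ,
    1 ≤ Y → |tS ∅ E Y - mainS (π ^ 2 / 72) cSec ∅ E Y| ≤
      K * (Y ^ (19 / 24 : ℝ) * (∏ p ∈ E, (p : ℝ)) ^ (3 / 5 : ℝ) +
        Y ^ (1 / 2 : ℝ) * (∏ p ∈ E, (p : ℝ)) ^ (31 / 20 : ℝ)) := by
  obtain ⟨C₁, hC₁, h1⟩ := exists_abs_gS_compact_sub_le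
  obtain ⟨C₂, hC₂, h2⟩ := exists_abs_sum_cuspS_sub_le
  obtain ⟨C₃, hC₃, h3⟩ := exists_sum_badF_le
  obtain ⟨C₄, hC₄, h4⟩ := exists_pow_card_le 2 (ε := 1 / 40) (by norm_num)
  obtain ⟨C₅, hC₅, h5⟩ := exists_pow_card_le 5 (ε := 3 / 5) (by norm_num)
  refine ⟨2 * C₃ * C₅ + (C₁ + C₂) * C₄, by positivity, fun E hE Y hY => ?_⟩
  have hY0 : 0 ≤ Y := by linarith
  have he : 0 < ∏ p ∈ E, (p : ℝ) :=
    Finset.prod_pos fun p hp => by exact_mod_cast (hE p hp).pos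
  have hT : ∀ T ∈ E.powerset, |gS (Vk Y) (∏ p ∈ E \ T, p) (∏ p ∈ T, p) Y +
      cuspG (∏ p ∈ E \ T, p) (∏ p ∈ T, p) Y - (π / 12 * (π / 3 - 1) * Y /
        (∏ p ∈ T, p : ℕ) + cuspM Y (∏ p ∈ T, p : ℕ))| ≤
      (C₁ + C₂) * (Y ^ (19 / 24 : ℝ) * (∏ p ∈ E, (p : ℝ)) ^ (21 / 40 : ℝ) +
        Y ^ (1 / 2 : ℝ) * (∏ p ∈ E, (p : ℝ)) ^ (61 / 40 : ℝ)) := by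
    intro T hT
    have n1 : ∏ p ∈ E \ T, p ≠ 0 :=
      Finset.prod_ne_zero_iff.2 fun p hp => (hE p (Finset.mem_sdiff.1 hp).1).ne_zero
    have n2 : ∏ p ∈ T, p ≠ 0 :=
      Finset.prod_ne_zero_iff.2 fun p hp => (hE p (Finset.mem_powerset.1 hT hp)).ne_zero
    have a1 := h1 _ _ Y n1 n2 hY
    have a2 := h2 _ _ Y n1 n2 hY
    rw [cuspG_eq n1 n2 hY, add_sub_add_comm]
    refine (abs_add_le _ _).trans ((add_le_add a1 a2).trans ?_)
    rw [add_mul]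
    have b1 := prod_rpow_powerset_le hE T (s := 21 / 40) (by norm_num)
    have b2 := prod_rpow_powerset_le hE T (s := 61 / 40) (by norm_num)
    have b3 : Y ^ (3 / 4 : ℝ) ≤ Y ^ (19 / 24 : ℝ) := rpow_le_rpow_of_exponent_le hY (by norm_num)
    gcongr
  have hsum := (Finset.abs_sum_le_sum_abs _ _).trans (Finset.sum_le_sum hT)
  rw [Finset.sum_const, Finset.card_powerset, nsmul_eq_mul, Finset.sum_sub_distrib] at hsum
  have h6 := abs_tS_sub_le hE Y
  have h7 := h3 E hE Y hY0
  rw [mainS_eq_sum E hY0]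
  refine (abs_sub_le _ (1 / 2 * ∑ T ∈ E.powerset, (gS (Vk Y) (∏ p ∈ E \ T, p) (∏ p ∈ T, p) Y +
      cuspG (∏ p ∈ E \ T, p) (∏ p ∈ T, p) Y)) _).trans ?_
  rw [← mul_sub, abs_mul, abs_of_pos (by norm_num : (0 : ℝ) < 1 / 2)]
  have h8 : C₃ * 5 ^ E.card * Y ^ (19 / 24 : ℝ) ≤
      C₃ * C₅ * (Y ^ (19 / 24 : ℝ) * (∏ p ∈ E, (p : ℝ)) ^ (3 / 5 : ℝ)) := by
    calc _ ≤ C₃ * (C₅ * (∏ p ∈ E, (p : ℝ)) ^ (3 / 5 : ℝ)) * Y ^ (19 / 24 : ℝ) := by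
          gcongr; exact_mod_cast h5 E hE
      _ = _ := by ring
  set e := ∏ p ∈ E, (p : ℝ) with hedef
  have e1 : e ^ (1 / 40 : ℝ) * e ^ (21 / 40 : ℝ) ≤ e ^ (3 / 5 : ℝ) := by
    rw [← rpow_add he]
    refine rpow_le_rpow_of_exponent_le ?_ (by norm_num)
    have : 1 ≤ ∏ p ∈ E, p := Finset.one_le_prod' fun p hp => (hE p hp).one_le
    rw [hedef, ← Nat.cast_prod]
    exact_mod_cast this
  have e2 : e ^ (1 / 40 : ℝ) * e ^ (61 / 40 : ℝ) = e ^ (31 / 20 : ℝ) := by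
    rw [← rpow_add he]; norm_num
  have h9 : ((2 ^ E.card : ℕ) : ℝ) * ((C₁ + C₂) * (Y ^ (19 / 24 : ℝ) * e ^ (21 / 40 : ℝ) +
      Y ^ (1 / 2 : ℝ) * e ^ (61 / 40 : ℝ))) ≤ (C₁ + C₂) * C₄ * (Y ^ (19 / 24 : ℝ) * e ^ (3 / 5 : ℝ) +
        Y ^ (1 / 2 : ℝ) * e ^ (31 / 20 : ℝ)) := by
    calc _ ≤ (C₄ * e ^ (1 / 40 : ℝ)) * ((C₁ + C₂) * (Y ^ (19 / 24 : ℝ) * e ^ (21 / 40 : ℝ) +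
          Y ^ (1 / 2 : ℝ) * e ^ (61 / 40 : ℝ))) := by
          gcongr; exact_mod_cast h4 E hE
      _ = (C₁ + C₂) * C₄ * (Y ^ (19 / 24 : ℝ) * (e ^ (1 / 40 : ℝ) * e ^ (21 / 40 : ℝ)) +
          Y ^ (1 / 2 : ℝ) * (e ^ (1 / 40 : ℝ) * e ^ (61 / 40 : ℝ))) := by ring
      _ ≤ _ := by rw [e2]; gcongr
  have h10 : 0 ≤ C₃ * C₅ * (Y ^ (1 / 2 : ℝ) * e ^ (31 / 20 : ℝ)) := by positivity
  have h11 := abs_nonneg (∑ T ∈ E.powerset, (gS (Vk Y) (∏ p ∈ E \ T, p) (∏ p ∈ T, p) Y +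
      cuspG (∏ p ∈ E \ T, p) (∏ p ∈ T, p) Y) - ∑ T ∈ E.powerset, (π / 12 *
        (π / 3 - 1) * Y / (∏ p ∈ T, p : ℕ) + cuspM Y (∏ p ∈ T, p : ℕ)))
  linarith

theorem exists_tS_le : ∃ K : ℝ, 0 < K ∧ ∀ E : Finset ℕ, (∀ q ∈ E, q.Prime) → ∀ Y : ℝ, 0 ≤ Y →
    tS ∅ E Y ≤ K * (Y * (∏ p ∈ E, (p : ℝ)) ^ (1 / 100 : ℝ)) := by
  obtain ⟨K, hK, h⟩ := exists_abs_tS_sub_le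
  obtain ⟨C, hC, hc⟩ := exists_pow_card_le 5 (ε := 1 / 100) (by norm_num)
  have h0 : ∀ Y : ℝ, 0 ≤ Y → ∑ f ∈ redF Y, f.wr ≤
      (π ^ 2 / 72 + |cSec| + 2 * K) * Y ^ (1 : ℝ) := by
    intro Y hY0
    rcases lt_or_ge Y 1 with hY | hY
    · rw [Finset.sum_eq_zero]
      · positivity
      · intro f hf
        obtain ⟨h1, h2⟩ := mem_redF.1 hf
        have h3 : (1 : ℝ) ≤ f.disc := by exact_mod_cast h1.disc_pos
        linarith
    · have h1 := (abs_le.1 (h ∅ (by simp) Y hY)).2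
      simp only [tS, mainS, Finset.prod_empty, one_rpow, mul_one] at h1
      have h2 : ∀ s : ℝ, s ≤ 1 → Y ^ s ≤ Y := fun s hs =>
        (rpow_le_rpow_of_exponent_le hY hs).trans (rpow_one Y).le
      have h3 : cSec * Y ^ (5 / 6 : ℝ) ≤ |cSec| * Y :=
        mul_le_mul (le_abs_self _) (h2 _ (by norm_num)) (by positivity) (abs_nonneg _)
      have h4 := mul_le_mul_of_nonneg_left (h2 (19 / 24) (by norm_num)) hK.le
      have h5 := mul_le_mul_of_nonneg_left (h2 (1 / 2) (by norm_num)) hK.le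
      rw [rpow_one]
      linarith
  refine ⟨(π ^ 2 / 72 + |cSec| + 2 * K) * C, by positivity, fun E hE Y hY => ?_⟩
  have h1 := sum_prod_om_le wr_nonneg (fun n f hn => wr_scale hn f) (by norm_num) h0 E hE hY
  simp only [tS, Finset.prod_empty, one_mul]
  refine h1.trans ?_
  rw [rpow_one]
  calc _ ≤ (π ^ 2 / 72 + |cSec| + 2 * K) * (C * (∏ p ∈ E, (p : ℝ)) ^ (1 / 100 : ℝ)) * Y := by
        gcongr; exact_mod_cast hc E hE
    _ = _ := by ring

theorem card_bndF_le (X : ℝ) : (bndF X).card ≤ (badF X).card := by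
  classical
  unfold bndF badF
  refine Finset.card_le_card fun f hf => ?_
  obtain ⟨h1, h2, h3⟩ := Finset.mem_filter.1 hf
  exact Finset.mem_filter.2 ⟨h1, h2.1.a_ne, fun h => h3 h.2⟩

theorem tendsto_countCubic_sub_nM : Tendsto (fun X : ℝ =>
    ((countCubic (fun d => 0 < (d : ℝ) ∧ (d : ℝ) < X) : ℝ) - nM X) / X ^ ((5 : ℝ) / 6))
    atTop (𝓝 0) := by
  obtain ⟨C, hC, h⟩ := exists_card_badF_le
  refine squeeze_zero_norm' (a := fun X : ℝ => C * X ^ (-(1 / 24) : ℝ)) ?_ ?_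
  · filter_upwards [eventually_gt_atTop 0] with X hX
    have h1 := (abs_countCubic_sub_nM_le X).trans
      ((Nat.cast_le.2 (card_bndF_le X)).trans (h X hX.le))
    have h2 : 0 < X ^ ((5 : ℝ) / 6) := by positivity
    rw [norm_eq_abs, abs_div, abs_of_pos h2, div_le_iff₀ h2, mul_assoc, ← rpow_add hX]
    norm_num at h1 ⊢
    exact h1
  · simpa using (tendsto_rpow_neg_atTop (show (0 : ℝ) < 1 / 24 by norm_num)).const_mul C

theorem cSec_eq : cSec = 2 * (riemannZeta (1 / 3)).re * π ^ 2 /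
    (15 * Gamma (2 / 3) ^ 3) := by
  have h : cSec = 2 / 15 * (riemannZeta (1 / 3)).re * (27 * (108 : ℝ) ^ (-(5 / 6) : ℝ) *
      ∫ u in Ioo (-1 : ℝ) 1, (1 - u ^ 2) ^ (-(5 / 6) : ℝ)) := by rw [cSec]; ring
  rw [h, beta_const]
  ring

end

end BCF

/-- The Davenport-Heilbronn theorem with the Roberts secondary term, for positive
discriminants: `N_3^+(X) = X/(12 ζ(3)) + (4 ζ(1/3)/(5 Γ(2/3)³ ζ(5/3))) X^{5/6}
+ o(X^{5/6})` as `X → ∞`. -/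
theorem secondary_term_cubic_fields_positive_disc :
    Tendsto (fun X : ℝ =>
      ((countCubic (fun d => 0 < (d : ℝ) ∧ (d : ℝ) < X) : ℝ)
        - X / (12 * (riemannZeta 3).re)
        - 4 * (riemannZeta (1/3)).re * X ^ ((5 : ℝ)/6)
            / (5 * Real.Gamma (2/3) ^ 3 * (riemannZeta (5/3)).re))
      / X ^ ((5 : ℝ)/6)) atTop (𝓝 0) := by
  obtain ⟨K₁, hK₁, h1⟩ := BCF.exists_abs_tS_sub_le
  obtain ⟨K₂, hK₂, h2⟩ := BCF.exists_tS_le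
  have hpos : ∀ E : Finset ℕ, 0 ≤ ∏ p ∈ E, (p : ℝ) := fun E =>
    Finset.prod_nonneg fun _ _ => Nat.cast_nonneg _
  have h3 := BCF.tendsto_nM (c₁ := Real.pi ^ 2 / 72) (c₂ := BCF.cSec) (K := max K₁ K₂) (by positivity)
    (fun E hE Y hY => (h1 E hE Y hY).trans (by
      have := hpos E
      gcongr
      exact le_max_left _ _))
    (fun E hE Y hY => (h2 E hE Y hY).trans (by
      have := hpos E
      gcongr
      exact le_max_right _ _))
  have h4 := h3.add BCF.tendsto_countCubic_sub_nM
  rw [add_zero] at h4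
  refine h4.congr fun X => ?_
  have hz : (riemannZeta 2).re = Real.pi ^ 2 / 6 := by
    rw [riemannZeta_two]
    norm_cast
  have e1 : Real.pi ^ 2 / 72 * X / ((riemannZeta 2).re * (riemannZeta 3).re) =
      X / (12 * (riemannZeta 3).re) := by
    rw [hz]
    field_simp
    ring
  have e2 : BCF.cSec * X ^ (5 / 6 : ℝ) / ((riemannZeta (5 / 3)).re * (riemannZeta 2).re) =
      4 * (riemannZeta (1 / 3)).re * X ^ ((5 : ℝ) / 6) /
        (5 * Real.Gamma (2 / 3) ^ 3 * (riemannZeta (5 / 3)).re) := by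
    rw [hz, BCF.cSec_eq]
    field_simp
    ring
  rw [e1, e2, ← add_div]
  congr 1
  ring
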